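/- Let l > 3 be a prime with l ≡ 3 or 5 (mod 7). Then the number of distinct monic irreducible cubic polynomials over 𝔽_l which divide Ĥ_{7,l}(x) equals h(−l) if l ≡ 1 (mod 4), and equals (3 − χ(2))·h(−l) if l ≡ 3 (mod 4), where χ denotes the Legendre symbol modulo l. -/

import Mathlib

open Polynomial

/-- The Hasse invariant polynomial `Ĥ_{7,l}(x)` of the Tate normal form `E₇`
over `𝔽_l`. -/
noncomputable def hasseH7 (l : ℕ) [Fact (Nat.Prime l)] : Polynomial (ZMod l) :=
  let r : ℕ := ((1 - legendreSym l (-3)) / 2).toNat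
  let s : ℕ := ((1 - legendreSym l (-4)) / 2).toNat
  let n : ℕ := l / 12
  let A : Polynomial (ZMod l) :=
    (X ^ 2 - X + 1) ^ 3 *
      (X ^ 6 - 11 * X ^ 5 + 30 * X ^ 4 - 15 * X ^ 3 - 10 * X ^ 2 + 5 * X + 1) ^ 3
  let Δ : Polynomial (ZMod l) := X ^ 7 * (X - 1) ^ 7 * (X ^ 3 - 8 * X ^ 2 + 5 * X + 1)
  (X ^ 2 - X + 1) ^ r *
    (X ^ 6 - 11 * X ^ 5 + 30 * X ^ 4 - 15 * X ^ 3 - 10 * X ^ 2 + 5 * X + 1) ^ r *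
    (X ^ 12 - 18 * X ^ 11 + 117 * X ^ 10 - 354 * X ^ 9 + 570 * X ^ 8 - 486 * X ^ 7
        + 273 * X ^ 6 - 222 * X ^ 5 + 174 * X ^ 4 - 46 * X ^ 3 - 15 * X ^ 2 + 6 * X + 1) ^ s *
    ∑ k ∈ Finset.range (n + 1),
      C (((2 * n + s).choose (2 * k + s) : ZMod l) * ((2 * n - 2 * k).choose (n - k) : ZMod l)
          * (-432 : ZMod l) ^ (n - k)) *
        (A - 1728 * Δ) ^ k * Δ ^ (n - k)

namespace HK

/-- exponent `r` in the definition of the Hasse polynomial -/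
noncomputable def rr (l : ℕ) [Fact (Nat.Prime l)] : ℕ := ((1 - legendreSym l (-3)) / 2).toNat
/-- exponent `s` in the definition of the Hasse polynomial -/
noncomputable def sx (l : ℕ) [Fact (Nat.Prime l)] : ℕ := ((1 - legendreSym l (-4)) / 2).toNat

lemma rs_spec (l : ℕ) [Fact (Nat.Prime l)] (hl : 3 < l) :
    l / 2 = 3 * (2 * (l / 12) + sx l) + 2 * rr l ∧ rr l ≤ 1 ∧ sx l ≤ 1 := by
  have hp : l.Prime := Fact.out
  have h2 : ¬ 2 ∣ l := fun h => by
    have := (Nat.prime_dvd_prime_iff_eq Nat.prime_two hp).1 h; omega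
  have h3 : ¬ 3 ∣ l := fun h => by
    have := (Nat.prime_dvd_prime_iff_eq Nat.prime_three hp).1 h; omega
  have hs : legendreSym l (-4) = if l % 4 = 1 then 1 else -1 := by
    have : ((-4 : ℤ)) = (-1) * 2 ^ 2 := by norm_num
    rw [this, legendreSym.mul, legendreSym.sq_one' l (by
      intro h
      rw [show ((2 : ℤ) : ZMod l) = ((2 : ℕ) : ZMod l) by norm_num,
        ZMod.natCast_eq_zero_iff] at h
      exact absurd (Nat.le_of_dvd (by norm_num) h) (by omega)), mul_one,
      legendreSym.at_neg_one (by omega)]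
    rw [ZMod.χ₄_nat_eq_if_mod_four]
    split_ifs <;> omega
  have hr : legendreSym l (-3) = if l % 3 = 1 then 1 else -1 := by
    have : ((-3 : ℤ)) = (-1) * ((3 : ℕ) : ℤ) := by norm_num
    have f3 : Fact (Nat.Prime 3) := ⟨Nat.prime_three⟩
    rw [this, legendreSym.mul, legendreSym.quadratic_reciprocity' (by omega) (by omega),
      legendreSym.at_neg_one (by omega), ZMod.χ₄_eq_neg_one_pow (by omega), ← mul_assoc, ← pow_add]
    rw [Even.neg_one_pow ⟨l / 2, by omega⟩, one_mul, legendreSym.mod]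
    have : (l : ℤ) % 3 = 1 ∨ (l : ℤ) % 3 = 2 := by omega
    push_cast
    rcases this with h | h
    · rw [h, if_pos (by omega)]; exact (by decide : @legendreSym 3 ⟨Nat.prime_three⟩ 1 = 1)
    · rw [h, if_neg (by omega)]; exact (by decide : @legendreSym 3 ⟨Nat.prime_three⟩ 2 = -1)
  unfold sx rr
  rw [hs, hr]
  split_ifs <;> norm_num <;> omega

section legendre
variable {R : Type*} [CommRing R]

lemma leg_coeff1 (n s : ℕ) (hs : s ≤ 1) (w z : R) :
    ((X ^ 2 + C w * X + C z : R[X]) ^ (2 * n + s)).coeff (2 * n + s) =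
      ∑ k ∈ Finset.range (n + 1), (((2 * n + s).choose (2 * k + s) : ℕ) : R) *
        (((2 * n - 2 * k).choose (n - k) : ℕ) : R) * w ^ (2 * k + s) * z ^ (n - k) := by
  have e : (X ^ 2 + C w * X + C z : R[X]) = C w * X + (X ^ 2 + C z) := by ring
  have key : ∀ i ∈ Finset.range (2 * n + s + 1),
      ((C w * X) ^ i * (X ^ 2 + C z) ^ (2 * n + s - i) *
        (((2 * n + s).choose i : ℕ) : R[X])).coeff (2 * n + s) =
      if Even (2 * n + s - i) then (((2 * n + s).choose i : ℕ) : R) *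
        ((2 * n + s - i).choose ((2 * n + s - i) / 2) : ℕ) * w ^ i * z ^ ((2 * n + s - i) / 2)
      else 0 := by
    intro i hi
    have hi' : i ≤ 2 * n + s := by simpa [Nat.lt_succ_iff] using hi
    obtain ⟨t, ht⟩ := Nat.exists_eq_add_of_le hi'
    rw [ht, Nat.add_sub_cancel_left]
    rw [mul_pow, ← C_pow, show (C (w ^ i) * X ^ i * (X ^ 2 + C z) ^ t *
      (((i + t).choose i : ℕ) : R[X])) = C (w ^ i * ((i + t).choose i : ℕ)) * ((X ^ 2 + C z) ^ t * X ^ i) by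
        simp; ring]
    rw [coeff_C_mul, add_comm i t, coeff_mul_X_pow]
    have : ((X ^ 2 + C z : R[X]) ^ t).coeff t =
        if Even t then ((t.choose (t / 2) : ℕ) : R) * z ^ (t / 2) else 0 := by
      rw [add_pow, finsetSum_coeff]
      have : ∀ b ∈ Finset.range (t + 1), (((X : R[X]) ^ 2) ^ b * C z ^ (t - b) *
          ((t.choose b : ℕ) : R[X])).coeff t = if t = 2 * b then z ^ (t - b) * (t.choose b : ℕ) else 0 := by
        intro b hb
        rw [← pow_mul, ← C_pow, mul_assoc, ← C_eq_natCast, ← C_mul, coeff_mul_C, coeff_X_pow]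
        simp
      rw [Finset.sum_congr rfl this]
      by_cases h : Even t
      · obtain ⟨b, rfl⟩ := h
        rw [Finset.sum_eq_single b]
        · rw [if_pos (by ring), if_pos ⟨b, rfl⟩]
          rw [show b + b - b = b by omega, show (b + b) / 2 = b by omega]; ring
        · intro c _ hc; rw [if_neg (by omega)]
        · intro hb; simp at hb
      · rw [if_neg h]
        apply Finset.sum_eq_zero
        intro b _
        rw [if_neg]
        rintro rfl; exact h ⟨b, by ring⟩
    rw [this]
    split_ifs
    · ring
    · ring
  rw [e, add_pow, finsetSum_coeff, Finset.sum_congr rfl key, ← Finset.sum_filter]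
  symm
  apply Finset.sum_bij (fun k _ => 2 * k + s)
  · intro k hk
    simp at hk ⊢
    refine ⟨by omega, n - k, by omega⟩
  · intro a _ b _ h; omega
  · intro b hb
    simp only [Finset.mem_filter, Finset.mem_range] at hb
    obtain ⟨hb, c, hc⟩ := hb
    exact ⟨n - c, by simp, by omega⟩
  · intro k hk
    have hk : k ≤ n := by simpa [Nat.lt_succ_iff] using hk
    rw [show 2 * n + s - (2 * k + s) = 2 * n - 2 * k by omega,
      show (2 * n - 2 * k) / 2 = n - k by omega]

lemma leg_coeff2 (N : ℕ) (u V : R) :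
    (((X + C u) * (X + C u + C V) : R[X]) ^ N).coeff N =
      ∑ k ∈ Finset.range (N + 1), ((N.choose k : ℕ) : R) * (((N + k).choose k : ℕ) : R) *
        u ^ k * V ^ (N - k) := by
  rw [mul_pow, add_pow (X + C u) (C V), Finset.mul_sum, finsetSum_coeff]
  apply Finset.sum_congr rfl
  intro k hk
  rw [show (X + C u) ^ N * ((X + C u) ^ k * C V ^ (N - k) * ((N.choose k : ℕ) : R[X])) =
    C (V ^ (N - k) * (N.choose k : ℕ)) * (X + C u) ^ (N + k) by rw [pow_add]; simp; ring]
  rw [coeff_C_mul, coeff_X_add_C_pow]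
  rw [Nat.add_sub_cancel_left, ← Nat.choose_symm_of_eq_add (show N + k = N + k by rfl)]
  ring

lemma leg_id (n s : ℕ) (hs : s ≤ 1) (u V : R) :
    ∑ k ∈ Finset.range (n + 1), (((2 * n + s).choose (2 * k + s) : ℕ) : R) *
        (((2 * n - 2 * k).choose (n - k) : ℕ) : R) * (2 * u + V) ^ (2 * k + s) *
          (u * (u + V)) ^ (n - k) =
    ∑ k ∈ Finset.range (2 * n + s + 1), (((2 * n + s).choose k : ℕ) : R) *
      (((2 * n + s + k).choose k : ℕ) : R) * u ^ k * V ^ (2 * n + s - k) := by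
  rw [← leg_coeff1 n s hs, ← leg_coeff2]
  congr 2
  simp only [C_add, C_mul, map_ofNat]
  ring

end legendre

lemma binom_mod (l : ℕ) [Fact (Nat.Prime l)] (hl : 3 < l) (k : ℕ) :
    ((((l / 2).choose k * (l / 2 - k).choose (2 * k) * 4 ^ k : ℕ)) : ZMod l) =
      ((27 ^ k * (2 * (l / 12) + sx l).choose k * (2 * (l / 12) + sx l + k).choose k : ℕ) : ZMod l) := by
  obtain ⟨h1, h2, h3⟩ := rs_spec l hl
  have hp : l.Prime := Fact.out
  have hodd : ¬ 2 ∣ l := fun h => by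
    have := (Nat.prime_dvd_prime_iff_eq Nat.prime_two hp).1 h; omega
  set m := l / 2 with hm
  set N := 2 * (l / 12) + sx l with hN
  set r := rr l
  have hlm : l = 2 * m + 1 := by omega
  induction k with
  | zero => simp
  | succ k ih =>
    by_cases hk : N ≤ k
    · rw [Nat.choose_eq_zero_of_lt (show m - (k + 1) < 2 * (k + 1) by omega),
        Nat.choose_eq_zero_of_lt (show N < k + 1 by omega)]
      simp
    push Not at hk
    obtain ⟨e, he⟩ := Nat.exists_eq_add_of_lt hk
    have hkm : 3 * k + 3 ≤ m := by omega
    obtain ⟨c, hc⟩ := Nat.exists_eq_add_of_le hkm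
    -- exact recurrences over ℕ
    have e1 : (m.choose (k + 1) * (m - (k + 1)).choose (2 * (k + 1))) * ((k + 1) * (2 * k + 1) * (2 * k + 2)) =
        (m.choose k * (m - k).choose (2 * k)) * ((m - 3 * k) * (m - 3 * k - 1) * (m - 3 * k - 2)) := by
      have f1 : m.choose (k + 1) * (k + 1) = m.choose k * (m - k) := Nat.choose_succ_right_eq m k
      obtain ⟨q, hq⟩ : ∃ q, m - k = q + 1 := ⟨m - k - 1, by omega⟩
      have hq2 : m - (k + 1) = q := by omega
      rw [hq] at f1
      rw [hq2, hq]
      have f2 : q.choose (2 * k + 1) * (2 * k + 1) = q.choose (2 * k) * (q - 2 * k) := Nat.choose_succ_right_eq q _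
      have f3 : q.choose (2 * k + 1 + 1) * (2 * k + 1 + 1) = q.choose (2 * k + 1) * (q - (2 * k + 1)) := Nat.choose_succ_right_eq q _
      have f4 : q.succ * q.choose (2 * k) = q.succ.choose (2 * k) * (q.succ - 2 * k) :=
        Nat.add_one_mul_choose_eq q (2 * k) |>.trans (by
          have := Nat.choose_succ_right_eq q.succ (2 * k); simpa [Nat.succ_eq_add_one] using this)
      rw [show 2 * (k + 1) = 2 * k + 1 + 1 by ring]
      have g1 : m - 3 * k = q.succ - 2 * k := by omega
      have g2 : m - 3 * k - 1 = q - 2 * k := by omega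
      have g3 : m - 3 * k - 2 = q - (2 * k + 1) := by omega
      rw [g3, g2, g1]
      calc _ = (m.choose (k + 1) * (k + 1)) * (q.choose (2 * k + 1 + 1) * (2 * k + 1 + 1)) * (2 * k + 1) := by ring
        _ = m.choose k * (q + 1) * (q.choose (2 * k + 1) * (2 * k + 1)) * (q - (2 * k + 1)) := by rw [f1, f3]; ring
        _ = m.choose k * (q.succ * q.choose (2 * k)) * (q - 2 * k) * (q - (2 * k + 1)) := by rw [f2]; simp only [Nat.succ_eq_add_one]; ring
        _ = _ := by rw [f4]; simp only [Nat.succ_eq_add_one]; ring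
    have e2 : (N.choose (k + 1) * (N + (k + 1)).choose (k + 1)) * ((k + 1) * (k + 1)) =
        (N.choose k * (N + k).choose k) * ((N - k) * (N + k + 1)) := by
      have f1 : N.choose (k + 1) * (k + 1) = N.choose k * (N - k) := Nat.choose_succ_right_eq N k
      have f2 : (N + k + 1) * (N + k).choose k = (N + k + 1).choose (k + 1) * (k + 1) := Nat.add_one_mul_choose_eq _ _
      calc _ = (N.choose (k + 1) * (k + 1)) * ((N + k + 1).choose (k + 1) * (k + 1)) := by rw [← add_assoc]; ring
        _ = _ := by rw [f1, ← f2]; ring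
    have hl0 : (2 * (m : ZMod l) + 1) = 0 := by
      have : ((2 * m + 1 : ℕ) : ZMod l) = 0 := by rw [← hlm]; exact ZMod.natCast_self l
      simpa using this
    have nz : ∀ a : ℕ, 0 < a → a < l → ((a : ℕ) : ZMod l) ≠ 0 := by
      intro a h1 h2 h
      rw [ZMod.natCast_eq_zero_iff] at h
      exact absurd (Nat.le_of_dvd h1 h) (by omega)
    have hu1 : ((((k + 1) * (2 * k + 1) * (2 * k + 2) * (k + 1) : ℕ)) : ZMod l) ≠ 0 := by
      push_cast
      have a1 := nz (k + 1) (by omega) (by omega)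
      have a2 := nz (2 * k + 1) (by omega) (by omega)
      have a3 := nz (2 * k + 2) (by omega) (by omega)
      push_cast at a1 a2 a3
      exact mul_ne_zero (mul_ne_zero (mul_ne_zero a1 a2) a3) a1
    apply mul_right_cancel₀ hu1
    have E1 := congrArg (Nat.cast : ℕ → ZMod l) e1
    have E2 := congrArg (Nat.cast : ℕ → ZMod l) e2
    have hm3 : ((m - 3 * k : ℕ) : ZMod l) = (m : ZMod l) - 3 * k := by
      rw [Nat.cast_sub (by omega)]; push_cast; ring
    have hm31 : ((m - 3 * k - 1 : ℕ) : ZMod l) = (m : ZMod l) - 3 * k - 1 := by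
      rw [Nat.cast_sub (by omega), hm3]; push_cast; ring
    have hm32 : ((m - 3 * k - 2 : ℕ) : ZMod l) = (m : ZMod l) - 3 * k - 2 := by
      rw [Nat.cast_sub (by omega), hm3]; push_cast; ring
    have hNk : ((N - k : ℕ) : ZMod l) = (N : ZMod l) - k := by
      rw [Nat.cast_sub (by omega)]
    have hNm : (m : ZMod l) = 3 * N + 2 * r := by exact_mod_cast congrArg (Nat.cast : ℕ → ZMod l) h1
    have hrr : (r : ZMod l) * (r - 1) = 0 := by
      have : r = 0 ∨ r = 1 := by omega
      rcases this with h | h <;> rw [h] <;> simp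
    push_cast [hm3, hm31, hm32, hNk] at E1 E2 ih ⊢
    generalize ((m.choose (k + 1) : ℕ) : ZMod l) = A1 at *
    generalize (((m - (k + 1)).choose (2 * (k + 1)) : ℕ) : ZMod l) = A2 at *
    generalize ((m.choose k : ℕ) : ZMod l) = A3 at *
    generalize (((m - k).choose (2 * k) : ℕ) : ZMod l) = A4 at *
    generalize ((N.choose (k + 1) : ℕ) : ZMod l) = B1 at *
    generalize (((N + (k + 1)).choose (k + 1) : ℕ) : ZMod l) = B2 at *
    generalize ((N.choose k : ℕ) : ZMod l) = B3 at *
    generalize (((N + k).choose k : ℕ) : ZMod l) = B4 at *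
    generalize (m : ZMod l) = M at *
    generalize (N : ZMod l) = n' at *
    generalize (k : ZMod l) = x at *
    generalize (r : ZMod l) = ρ at *
    subst hNm
    have L : A1 * A2 * 4 ^ (k + 1) * ((x + 1) * (2 * x + 1) * (2 * x + 2) * (x + 1)) =
      (A3 * A4 * 4 ^ k) * (4 * (x + 1) * ((3 * n' + 2 * ρ - 3 * x) * (3 * n' + 2 * ρ - 3 * x - 1) * (3 * n' + 2 * ρ - 3 * x - 2))) := by
      linear_combination (4 ^ (k + 1) * (x + 1)) * E1
    have Rr : 27 ^ (k + 1) * B1 * B2 * ((x + 1) * (2 * x + 1) * (2 * x + 2) * (x + 1)) =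
      (27 ^ k * B3 * B4) * (27 * (2 * x + 1) * (2 * x + 2) * ((n' - x) * (n' + x + 1))) := by
      linear_combination (27 ^ (k + 1) * (2 * x + 1) * (2 * x + 2)) * E2
    rw [L, Rr, ih]
    congr 1
    have h8 : (2 : ZMod l) ≠ 0 := by have := nz 2 (by omega) (by omega); exact_mod_cast this
    have hρ : n' = (-(1:ZMod l) - 4 * ρ) / 6 := by
      have h6 : (6 : ZMod l) ≠ 0 := by
        have h3' := nz 3 (by omega) (by omega)
        push_cast at h3'
        rw [show (6 : ZMod l) = 2 * 3 by norm_num]; exact mul_ne_zero h8 h3'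
      field_simp
      linear_combination hl0
    have hM : 3 * n' + 2 * ρ = -1 / 2 := by field_simp; linear_combination hl0
    rw [hM]
    have h36 : (12 : ZMod l) * 3 ≠ 0 := by
        have h3' := nz 3 (by omega) (by omega)
        push_cast at h3'
        rw [show (12 : ZMod l) * 3= 2 * 2 * (3 * 3) by norm_num]
        exact mul_ne_zero (mul_ne_zero h8 h8) (mul_ne_zero h3' h3')
    apply mul_left_cancel₀ h36
    have hnn : 36 * ((n' - x) * (n' + x + 1)) = -(6 * x + 1) * (6 * x + 5) := by
      linear_combination (6 * n' + 5 - 4 * ρ) * hl0 + 16 * hrr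
    have hmm : (-1 / 2 - 3 * x) * (-1 / 2 - 3 * x - 1) * (-1 / 2 - 3 * x - 2) * 8 =
      -(6 * x + 1) * (6 * x + 3) * (6 * x + 5) := by
      field_simp; ring
    linear_combination 18 * (x + 1) * hmm - 27 * (2 * x + 1) * (2 * x + 2) * hnn

end HK

namespace HK

lemma sum_pow_zmod (l : ℕ) [Fact (Nat.Prime l)] (hl : 3 < l) (i : ℕ) (hi : i < 2 * (l - 1)) :
    ∑ x : ZMod l, x ^ i = if i = l - 1 then -1 else 0 := by
  by_cases h : i < l - 1
  · rw [if_neg (by omega)]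
    exact FiniteField.sum_pow_lt_card_sub_one _ i (by rwa [ZMod.card])
  have h0 : i ≠ 0 := by omega
  have : ∑ x : ZMod l, x ^ i = ∑ x : (ZMod l)ˣ, (x : ZMod l) ^ i := by
    rw [← Finset.sum_erase (a := (0 : ZMod l)) Finset.univ (by simp [h0])]
    symm
    apply Finset.sum_bij (fun (x : (ZMod l)ˣ) _ => (x : ZMod l))
    · intro a _; simp
    · intro a _ b _ hab; exact Units.ext hab
    · intro b hb
      simp at hb
      exact ⟨Units.mk0 b hb, by simp, by simp⟩
    · intro a _; rfl
  rw [this, FiniteField.sum_pow_units, ZMod.card]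
  congr 1
  refine propext ⟨fun hd => ?_, fun hd => hd ▸ dvd_rfl⟩
  obtain ⟨c, rfl⟩ := hd
  have hc : c < 2 := by
    by_contra hc
    push Not at hc
    have : (l - 1) * 2 ≤ (l - 1) * c := Nat.mul_le_mul_left _ hc
    omega
  interval_cases c
  · simp at h0
  · simp

lemma sum_poly_zmod (l : ℕ) [Fact (Nat.Prime l)] (hl : 3 < l) (g : (ZMod l)[X])
    (hg : g.natDegree < 2 * (l - 1)) : ∑ x : ZMod l, g.eval x = - g.coeff (l - 1) := by
  simp_rw [eval_eq_sum_range]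
  rw [Finset.sum_comm]
  simp_rw [← Finset.mul_sum]
  have : ∀ i ∈ Finset.range (g.natDegree + 1), g.coeff i * ∑ x : ZMod l, x ^ i =
      if i = l - 1 then - g.coeff (l - 1) else 0 := by
    intro i hi
    rw [sum_pow_zmod l hl i (by simp at hi; omega)]
    split_ifs with h
    · rw [h]; ring
    · simp
  rw [Finset.sum_congr rfl this, Finset.sum_ite_eq']
  split_ifs with h
  · rfl
  · rw [coeff_eq_zero_of_natDegree_lt]; · simp
    simp at h; omega

lemma shift_coeff (l : ℕ) [Fact (Nat.Prime l)] {F : Type*} [Field F] [CharP F l] (g : F[X])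
    (hg : g.natDegree < 2 * l - 1) (a : F) :
    (g.comp (X + C a)).coeff (l - 1) = g.coeff (l - 1) := by
  have hp : l.Prime := Fact.out
  have hl := hp.two_le
  rw [comp, eval₂_eq_sum_range, finsetSum_coeff]
  have : ∀ i ∈ Finset.range (g.natDegree + 1), (C (g.coeff i) * (X + C a) ^ i).coeff (l - 1) =
      if i = l - 1 then g.coeff (l - 1) else 0 := by
    intro i hi
    rw [coeff_C_mul, coeff_X_add_C_pow]
    simp at hi
    split_ifs with h
    · rw [h]; simp
    · by_cases h1 : i < l - 1
      · rw [Nat.choose_eq_zero_of_lt h1]; simp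
      · have : ((i.choose (l - 1) : ℕ) : F) = 0 := by
          rw [CharP.cast_eq_zero_iff F l]
          obtain ⟨j, rfl⟩ : ∃ j, i = l + j := ⟨i - l, by omega⟩
          have hj : j < l - 1 := by omega
          rw [← Nat.modEq_zero_iff_dvd]
          have := Choose.choose_modEq_choose_mod_mul_choose_div_nat (n := l + j) (k := l - 1) (p := l)
          refine this.trans ?_
          rw [Nat.add_mod_left, Nat.mod_eq_of_lt (show j < l by omega),
            Nat.mod_eq_of_lt (show l - 1 < l by omega), Nat.choose_eq_zero_of_lt hj]
          simp [Nat.ModEq]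
        rw [this]; simp
  rw [Finset.sum_congr rfl this, Finset.sum_ite_eq']
  split_ifs with h
  · rfl
  · rw [coeff_eq_zero_of_natDegree_lt]
    simp at h; omega

lemma natDegree_cubic_pow {F : Type*} [Field F] (a b : F) (m : ℕ) :
    ((X ^ 3 - C a * X + C b : F[X]) ^ m).natDegree ≤ 3 * m := by
  refine (natDegree_pow_le).trans ?_
  rw [mul_comm]
  apply Nat.mul_le_mul_right
  compute_degree

lemma hasse_coeff (l : ℕ) [Fact (Nat.Prime l)] (hl : 3 < l) {F : Type*} [Field F] [CharP F l]
    (v w : F) :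
    ((X ^ 3 - C (3 * v ^ 2) * X + C (2 * w) : F[X]) ^ (l / 2)).coeff (l - 1) =
      3 ^ (l / 2) * (v ^ (2 * rr l) * ∑ k ∈ Finset.range (l / 12 + 1),
        (((2 * (l / 12) + sx l).choose (2 * k + sx l) : ℕ) : F) *
        (((2 * (l / 12) - 2 * k).choose (l / 12 - k) : ℕ) : F) * w ^ (2 * k + sx l) *
          ((w ^ 2 - v ^ 6) / 4) ^ (l / 12 - k)) := by
  obtain ⟨h1, h2, h3⟩ := rs_spec l hl
  have hp : l.Prime := Fact.out
  have hodd : ¬ 2 ∣ l := fun h => by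
    have := (Nat.prime_dvd_prime_iff_eq Nat.prime_two hp).1 h; omega
  have hb := fun k => congrArg (ZMod.castHom (dvd_refl l) F) (binom_mod l hl k)
  simp only [map_natCast] at hb
  set m := l / 2 with hm
  set N := 2 * (l / 12) + sx l with hN
  set r := rr l
  have hlm : l - 1 = 2 * m := by omega
  have nz : ∀ a : ℕ, 0 < a → a < l → ((a : ℕ) : F) ≠ 0 := by
    intro a h1 h2 h
    rw [CharP.cast_eq_zero_iff F l] at h
    exact absurd (Nat.le_of_dvd h1 h) (by omega)
  have n2 : (2 : F) ≠ 0 := by exact_mod_cast nz 2 (by omega) (by omega)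
  have n3 : (3 : F) ≠ 0 := by exact_mod_cast nz 3 (by omega) (by omega)
  have hleg := leg_id (R := F) (l / 12) (sx l) h3 ((w - v ^ 3) / 2) (v ^ 3)
  have ew : 2 * ((w - v ^ 3) / 2) + v ^ 3 = w := by field_simp; ring
  have ez : (w - v ^ 3) / 2 * ((w - v ^ 3) / 2 + v ^ 3) = (w ^ 2 - v ^ 6) / 4 := by
    have : (4 : F) = 2 * 2 := by norm_num
    rw [this]; field_simp; ring
  rw [ew, ez] at hleg
  rw [hleg]
  rw [← shift_coeff l _ (lt_of_le_of_lt (natDegree_cubic_pow _ _ _) (by omega)) v, pow_comp]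
  have e : (X ^ 3 - C (3 * v ^ 2) * X + C (2 * w) : F[X]).comp (X + C v) =
      C (2 * (w - v ^ 3)) + X ^ 2 * (X + C (3 * v)) := by
    simp only [add_comp, sub_comp, mul_comp, pow_comp, X_comp, C_comp]
    simp only [C_mul, C_pow, map_ofNat, C_sub]
    ring
  rw [e, add_pow, finsetSum_coeff, hlm]
  have key : ∀ k ∈ Finset.range (m + 1), (C (2 * (w - v ^ 3)) ^ k * (X ^ 2 * (X + C (3 * v))) ^ (m - k) *
      ((m.choose k : ℕ) : F[X])).coeff (2 * m) =
      (2 * (w - v ^ 3)) ^ k * (m.choose k : ℕ) * ((3 * v) ^ (m - k - 2 * k) * ((m - k).choose (2 * k) : ℕ)) := by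
    intro k hk
    have hk : k ≤ m := by simpa [Nat.lt_succ_iff] using hk
    rw [mul_pow, ← pow_mul, show (C (2 * (w - v ^ 3)) ^ k * (X ^ (2 * (m - k)) * (X + C (3 * v)) ^ (m - k)) *
      ((m.choose k : ℕ) : F[X])) = C ((2 * (w - v ^ 3)) ^ k * (m.choose k : ℕ)) *
       ((X + C (3 * v)) ^ (m - k) * X ^ (2 * (m - k))) by
         simp only [C_mul, C_pow, C_eq_natCast]; ring]
    rw [coeff_C_mul, show 2 * m = 2 * k + 2 * (m - k) by omega, coeff_mul_X_pow, coeff_X_add_C_pow]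
  rw [Finset.sum_congr rfl key]
  rw [← Finset.sum_subset (Finset.range_subset_range.2 (show N + 1 ≤ m + 1 by omega)), Finset.mul_sum,
    Finset.mul_sum]
  · apply Finset.sum_congr rfl
    intro k hk
    have hk : k ≤ N := by simpa [Nat.lt_succ_iff] using hk
    have hbk := hb k
    push_cast at hbk
    have e1 : m - k - 2 * k = 3 * (N - k) + 2 * r := by omega
    have e2 : m = 3 * (N - k) + 2 * r + 3 * k := by omega
    have e3 : (3 : F) ^ m = 3 ^ (3 * (N - k) + 2 * r) * 27 ^ k := by
      conv_lhs => rw [e2]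
      rw [pow_add _ _ (3 * k), pow_mul _ 3 k]; norm_num
    rw [e1, e3, mul_pow 3 v, ← pow_mul v 3, div_pow, mul_pow 2, pow_add v]
    have h4 : (4 : F) ^ k = 2 ^ k * 2 ^ k := by rw [← mul_pow]; norm_num
    rw [h4] at hbk
    field_simp
    linear_combination (v^(3*(N-k)) * v^(2*r) * (w - v^3)^k) * hbk
  · intro k hk hk2
    have : m - k < 2 * k := by
      simp at hk hk2; omega
    rw [Nat.choose_eq_zero_of_lt this]; simp

/-- vanishing of the Hasse invariant kills the character sum -/
lemma char_sum_zero (l : ℕ) [Fact (Nat.Prime l)] (hl : 3 < l) (c4 c6 z : ZMod l)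
    (hz : 4 * z = c6 ^ 2 - c4 ^ 3)
    (h : c4 ^ rr l * ∑ k ∈ Finset.range (l / 12 + 1),
        (((2 * (l / 12) + sx l).choose (2 * k + sx l) : ℕ) : ZMod l) *
        (((2 * (l / 12) - 2 * k).choose (l / 12 - k) : ℕ) : ZMod l) * c6 ^ (2 * k + sx l) *
          z ^ (l / 12 - k) = 0) :
    ∑ x : ZMod l, (x ^ 3 - 27 * c4 * x - 54 * c6) ^ (l / 2) = 0 := by
  have hp : l.Prime := Fact.out
  have hodd : ¬ 2 ∣ l := fun h => by
    have := (Nat.prime_dvd_prime_iff_eq Nat.prime_two hp).1 h; omega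
  have e : ∀ x : ZMod l, (x ^ 3 - 27 * c4 * x - 54 * c6) ^ (l / 2) =
      ((X ^ 3 - C (27 * c4) * X + C (-54 * c6) : (ZMod l)[X]) ^ (l / 2)).eval x := by
    intro x; simp [sub_eq_add_neg]
  simp_rw [e]
  rw [sum_poly_zmod l hl _ (lt_of_le_of_lt (natDegree_cubic_pow _ _ _) (by omega)), neg_eq_zero]
  obtain ⟨F, i1, i2, i3⟩ : ∃ (F : Type) (_ : Field F) (_ : Algebra (ZMod l) F), IsAlgClosed F :=
    ⟨AlgebraicClosure (ZMod l), inferInstance, inferInstance, inferInstance⟩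
  have : CharP F l := charP_of_injective_algebraMap (algebraMap (ZMod l) F).injective l
  obtain ⟨v, hv⟩ := IsAlgClosed.exists_pow_nat_eq (algebraMap (ZMod l) F c4) (n := 2) (by norm_num)
  apply (algebraMap (ZMod l) F).injective
  rw [map_zero, ← coeff_map]
  have := hasse_coeff l hl (3 * v) (-27 * algebraMap (ZMod l) F c6)
  have e2 : Polynomial.map (algebraMap (ZMod l) F) ((X ^ 3 - C (27 * c4) * X + C (-54 * c6)) ^ (l / 2)) =
    (X ^ 3 - C (3 * (3 * v) ^ 2) * X + C (2 * (-27 * algebraMap (ZMod l) F c6))) ^ (l / 2) := by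
    rw [Polynomial.map_pow]
    congr 1
    simp only [Polynomial.map_add, Polynomial.map_sub, Polynomial.map_mul, Polynomial.map_pow, map_X, map_C]
    congr 3
    · rw [map_mul, ← hv, map_ofNat]; ring
    · rw [map_mul, map_neg, map_ofNat]; ring
  rw [e2, this]
  apply mul_eq_zero_of_right
  have h' := congrArg (algebraMap (ZMod l) F) h
  simp only [map_mul, map_zero, map_sum, map_pow, map_natCast] at h'
  rw [← hv] at h'
  have nz : ∀ a : ℕ, 0 < a → a < l → ((a : ℕ) : F) ≠ 0 := by
    intro a h1 h2 h
    rw [CharP.cast_eq_zero_iff F l] at h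
    exact absurd (Nat.le_of_dvd h1 h) (by omega)
  have n2 : (4 : F) ≠ 0 := by exact_mod_cast nz 4 (by omega) (by omega)
  have ez : ((-27 * algebraMap (ZMod l) F c6) ^ 2 - (3 * v) ^ 6) / 4 = 729 * algebraMap (ZMod l) F z := by
    have := congrArg (algebraMap (ZMod l) F) hz
    simp only [map_mul, map_sub, map_pow, map_ofNat] at this
    rw [div_eq_iff n2]
    rw [← hv] at this
    linear_combination -729 * this
  rw [ez]
  have : ∀ k ∈ Finset.range (l / 12 + 1), (((2 * (l / 12) + sx l).choose (2 * k + sx l) : ℕ) : F) *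
        (((2 * (l / 12) - 2 * k).choose (l / 12 - k) : ℕ) : F) * (-27 * algebraMap (ZMod l) F c6) ^ (2 * k + sx l) *
          (729 * algebraMap (ZMod l) F z) ^ (l / 12 - k) = (729 ^ (l / 12) * (-27) ^ sx l) * ((((2 * (l / 12) + sx l).choose (2 * k + sx l) : ℕ) : F) *
        (((2 * (l / 12) - 2 * k).choose (l / 12 - k) : ℕ) : F) * (algebraMap (ZMod l) F c6) ^ (2 * k + sx l) *
          (algebraMap (ZMod l) F z) ^ (l / 12 - k)) := by
    intro k hk
    have hk : k ≤ l / 12 := by simpa [Nat.lt_succ_iff] using hk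
    have : (729 : F) ^ (l / 12) = 729 ^ k * 729 ^ (l / 12 - k) := by rw [← pow_add]; congr 1; omega
    rw [this, mul_pow, mul_pow, pow_add (-27 : F), pow_mul (-27 : F)]
    norm_num
    ring
  rw [Finset.sum_congr rfl this, ← Finset.mul_sum]
  rw [mul_pow, pow_mul v 2]
  linear_combination (3 ^ (2 * rr l) * (729 ^ (l / 12) * (-27) ^ sx l)) * h'

end HK

namespace HK

/-- The Tate normal form with a point of order 7. -/
def tate7 {F : Type*} [Field F] (d : F) : WeierstrassCurve F :=
  ⟨1 - (d ^ 2 - d), -(d ^ 3 - d ^ 2), -(d ^ 3 - d ^ 2), 0, 0⟩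

lemma tate7_Δ {F : Type*} [Field F] (d : F) : (tate7 d).Δ =
    d ^ 7 * (d - 1) ^ 7 * (d ^ 3 - 8 * d ^ 2 + 5 * d + 1) := by
  simp only [tate7, WeierstrassCurve.Δ, WeierstrassCurve.b₂, WeierstrassCurve.b₄,
    WeierstrassCurve.b₆, WeierstrassCurve.b₈]
  ring

lemma tate7_c4 {F : Type*} [Field F] (d : F) : (tate7 d).c₄ =
    (d ^ 2 - d + 1) * (d ^ 6 - 11 * d ^ 5 + 30 * d ^ 4 - 15 * d ^ 3 - 10 * d ^ 2 + 5 * d + 1) := by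
  simp only [tate7, WeierstrassCurve.c₄, WeierstrassCurve.b₂, WeierstrassCurve.b₄]
  ring

lemma tate7_c6 {F : Type*} [Field F] (d : F) : (tate7 d).c₆ =
    -(d ^ 12 - 18 * d ^ 11 + 117 * d ^ 10 - 354 * d ^ 9 + 570 * d ^ 8 - 486 * d ^ 7
        + 273 * d ^ 6 - 222 * d ^ 5 + 174 * d ^ 4 - 46 * d ^ 3 - 15 * d ^ 2 + 6 * d + 1) := by
  simp only [tate7, WeierstrassCurve.c₆, WeierstrassCurve.b₂, WeierstrassCurve.b₄,
    WeierstrassCurve.b₆]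
  ring

lemma pt_add {F : Type*} [Field F] [DecidableEq F] {W : WeierstrassCurve.Affine F}
    {x₁ y₁ x₂ y₂ x₃ y₃ : F}
    (h₁ : W.Nonsingular x₁ y₁) (h₂ : W.Nonsingular x₂ y₂) (h₃ : W.Nonsingular x₃ y₃) (m : F)
    (hxy : ¬(x₁ = x₂ ∧ y₁ = W.negY x₂ y₂)) (hm : W.slope x₁ x₂ y₁ y₂ = m)
    (hx : W.addX x₁ x₂ m = x₃) (hy : W.addY x₁ x₂ y₁ m = y₃) :
    WeierstrassCurve.Affine.Point.some _ _ h₁ + WeierstrassCurve.Affine.Point.some _ _ h₂ =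
      WeierstrassCurve.Affine.Point.some _ _ h₃ := by
  rw [WeierstrassCurve.Affine.Point.add_some hxy]
  subst hm hx hy
  rfl

lemma seven_dvd_card {F : Type} [Field F] [DecidableEq F] [Finite F] (d : F) (h : (tate7 d).Δ ≠ 0) :
    7 ∣ Nat.card (WeierstrassCurve.Affine.Point (tate7 d)) := by
  have hd := h
  rw [tate7_Δ] at hd
  have h0 : d ≠ 0 := by rintro rfl; simp at hd
  have h1 : d - 1 ≠ 0 := by intro h; simp [h] at hd
  set b := d ^ 3 - d ^ 2 with hb
  set c := d ^ 2 - d with hc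
  have hb0 : b ≠ 0 := by rw [hb, show d ^ 3 - d ^ 2 = d ^ 2 * (d - 1) by ring]; positivity
  have hc0 : c ≠ 0 := by rw [hc, show d ^ 2 - d = d * (d - 1) by ring]; positivity
  have hns : ∀ x y, y ^ 2 + (1 - c) * x * y - b * y = x ^ 3 - b * x ^ 2 →
      (WeierstrassCurve.Affine.Nonsingular (tate7 d)) x y := by
    intro x y hxy
    rw [← WeierstrassCurve.Affine.equation_iff_nonsingular_of_Δ_ne_zero h,
      WeierstrassCurve.Affine.equation_iff]
    simp only [tate7]
    linear_combination hxy
  have n1 := hns 0 0 (by ring)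
  have n2 := hns b (b * c) (by ring)
  have n3 := hns c (b - c) (by rw [hb, hc]; ring)
  have n4 := hns c (c ^ 2) (by rw [hb, hc]; ring)
  have e2 := pt_add n1 n1 n2 0 (by simp [WeierstrassCurve.Affine.negY, tate7]; exact fun h => hb0 h.symm)
    (by rw [WeierstrassCurve.Affine.slope_of_Y_ne rfl (by simp [WeierstrassCurve.Affine.negY, tate7]; exact fun h => hb0 h.symm)]
        simp [tate7])
    (by simp [WeierstrassCurve.Affine.addX, tate7, hb])
    (by simp [WeierstrassCurve.Affine.addX, WeierstrassCurve.Affine.addY, WeierstrassCurve.Affine.negAddY,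
          WeierstrassCurve.Affine.negY, tate7, hb, hc]; ring)
  have e3 := pt_add n1 n2 n3 c (by rintro ⟨h, -⟩; exact hb0 h.symm)
    (by rw [WeierstrassCurve.Affine.slope_of_X_ne (fun h => hb0 h.symm), div_eq_iff (by simpa using hb0)]; ring)
    (by simp [WeierstrassCurve.Affine.addX, tate7, hb, hc]; ring)
    (by simp [WeierstrassCurve.Affine.addX, WeierstrassCurve.Affine.addY, WeierstrassCurve.Affine.negAddY,
          WeierstrassCurve.Affine.negY, tate7, hb, hc]; ring)
  have e4 := pt_add n1 n3 n4 (d - 1) (by rintro ⟨h, -⟩; exact hc0 h.symm)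
    (by rw [WeierstrassCurve.Affine.slope_of_X_ne (fun h => hc0 h.symm), div_eq_iff (by simpa using hc0)]
        rw [hb, hc]; ring)
    (by simp [WeierstrassCurve.Affine.addX, tate7, hb, hc]; ring)
    (by simp [WeierstrassCurve.Affine.addX, WeierstrassCurve.Affine.addY, WeierstrassCurve.Affine.negAddY,
          WeierstrassCurve.Affine.negY, tate7, hb, hc]; ring)
  have e7 : WeierstrassCurve.Affine.Point.some _ _ n4 = - WeierstrassCurve.Affine.Point.some _ _ n3 := by
    rw [WeierstrassCurve.Affine.Point.neg_some]
    congr 1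
    simp [WeierstrassCurve.Affine.negY, tate7, hb, hc]; ring
  set P := WeierstrassCurve.Affine.Point.some _ _ n1 with hP
  have h7 : (7 : ℕ) • P = 0 := by
    have : (7 : ℕ) • P = (P + (P + (P + P))) + (P + (P + P)) := by abel
    rw [this, e2, e3, e4, e7]; abel
  have hP0 : P ≠ 0 := WeierstrassCurve.Affine.Point.some_ne_zero _
  have ho : addOrderOf P = 7 := by
    have := (Nat.dvd_prime (by norm_num : Nat.Prime 7)).1 (addOrderOf_dvd_of_nsmul_eq_zero h7)
    rcases this with h | h
    · rw [AddMonoid.addOrderOf_eq_one_iff] at h; exact absurd h hP0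
    · exact h
  rw [← ho]
  exact addOrderOf_dvd_natCard P

lemma card_point (l : ℕ) [Fact (Nat.Prime l)] (hl : 3 < l) (W : WeierstrassCurve (ZMod l))
    (hW : W.Δ ≠ 0) : (Nat.card (WeierstrassCurve.Affine.Point W) : ℤ) = 1 + (l : ℤ) +
      ∑ x : ZMod l, quadraticChar (ZMod l) (4 * x ^ 3 + W.b₂ * x ^ 2 + 2 * W.b₄ * x + W.b₆) := by
  classical
  have hch : ringChar (ZMod l) ≠ 2 := by rw [ZMod.ringChar_zmod_n]; omega
  have h2 : (2 : ZMod l) ≠ 0 := by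
    intro h
    have : ((2 : ℕ) : ZMod l) = 0 := by exact_mod_cast h
    rw [CharP.cast_eq_zero_iff (ZMod l) l] at this
    exact absurd (Nat.le_of_dvd (by norm_num) this) (by omega)
  rw [Nat.card_congr (WeierstrassCurve.Affine.nonsingularPointEquiv W)]
  have : Nat.card (WithZero {xy : ZMod l × ZMod l // WeierstrassCurve.Affine.Nonsingular W xy.fst xy.snd}) =
      Nat.card {xy : ZMod l × ZMod l // WeierstrassCurve.Affine.Nonsingular W xy.fst xy.snd} + 1 :=
    Finite.card_option
  rw [this]
  have e : {xy : ZMod l × ZMod l // WeierstrassCurve.Affine.Nonsingular W xy.fst xy.snd} ≃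
      Σ x : ZMod l, {z : ZMod l // z ^ 2 = 4 * x ^ 3 + W.b₂ * x ^ 2 + 2 * W.b₄ * x + W.b₆} :=
    { toFun := fun p => ⟨p.1.1, 2 * p.1.2 + W.a₁ * p.1.1 + W.a₃, by
        have := p.2
        rw [← WeierstrassCurve.Affine.equation_iff_nonsingular_of_Δ_ne_zero hW,
          WeierstrassCurve.Affine.equation_iff] at this
        simp only [WeierstrassCurve.b₂, WeierstrassCurve.b₄, WeierstrassCurve.b₆]
        linear_combination 4 * this⟩
      invFun := fun p => ⟨(p.1, (p.2.1 - W.a₁ * p.1 - W.a₃) / 2), by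
        have := p.2.2
        simp only [WeierstrassCurve.b₂, WeierstrassCurve.b₄, WeierstrassCurve.b₆] at this
        rw [← WeierstrassCurve.Affine.equation_iff_nonsingular_of_Δ_ne_zero hW,
          WeierstrassCurve.Affine.equation_iff]
        have h4 : (4 : ZMod l) ≠ 0 := by
          rw [show (4 : ZMod l) = 2 * 2 by norm_num]; exact mul_ne_zero h2 h2
        apply mul_left_cancel₀ h4
        field_simp
        linear_combination this⟩
      left_inv := by
        rintro ⟨⟨x, y⟩, h⟩
        simp only [Subtype.mk.injEq, Prod.mk.injEq, true_and]
        field_simp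
        ring
      right_inv := by
        rintro ⟨x, z, h⟩
        simp only [Sigma.mk.injEq, heq_eq_eq, Subtype.mk.injEq, true_and]
        field_simp
        ring }
  rw [Nat.card_congr e, Nat.card_sigma]
  push_cast
  have : ∀ x : ZMod l, (Nat.card {z : ZMod l // z ^ 2 = 4 * x ^ 3 + W.b₂ * x ^ 2 + 2 * W.b₄ * x + W.b₆} : ℤ) =
      quadraticChar (ZMod l) (4 * x ^ 3 + W.b₂ * x ^ 2 + 2 * W.b₄ * x + W.b₆) + 1 := by
    intro x
    rw [← quadraticChar_card_sqrts hch, Nat.card_eq_fintype_card, Set.toFinset_card]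
    rfl
  rw [Finset.sum_congr rfl (fun x _ => this x), Finset.sum_add_distrib]
  simp [ZMod.card]
  ring

lemma not_all_squares (l : ℕ) [Fact (Nat.Prime l)] (hl : 3 < l) (f : (ZMod l)[X])
    (hf : f.natDegree = 3) (h : ∀ x, f.eval x ^ (l / 2) = 1) : False := by
  have hp : l.Prime := Fact.out
  have hodd : ¬ 2 ∣ l := fun h => by
    have := (Nat.prime_dvd_prime_iff_eq Nat.prime_two hp).1 h; omega
  have nz : ∀ a : ℕ, 0 < a → a < l → ((a : ℕ) : ZMod l) ≠ 0 := by
    intro a h1 h2 h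
    rw [CharP.cast_eq_zero_iff (ZMod l) l] at h
    exact absurd (Nat.le_of_dvd h1 h) (by omega)
  set m := l / 2 with hm
  have hX : (X ^ l - X : (ZMod l)[X]).natDegree = l := FiniteField.X_pow_card_sub_X_natDegree_eq _ hp.one_lt
  have hX0 : (X ^ l - X : (ZMod l)[X]) ≠ 0 := FiniteField.X_pow_card_sub_X_ne_zero _ hp.one_lt
  have hdvd : (X ^ l - X : (ZMod l)[X]) ∣ f ^ m - 1 := by
    have h1 : (X ^ l - X : (ZMod l)[X]) = ∏ a : ZMod l, (X - C a) := by
      have hr := FiniteField.roots_X_pow_card_sub_X (ZMod l)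
      rw [ZMod.card] at hr
      have := prod_multiset_X_sub_C_of_monic_of_roots_card_eq (p := (X ^ l - X : (ZMod l)[X]))
        (monic_X_pow_sub (by rw [degree_X]; exact_mod_cast hp.one_lt))
        (by rw [hr, hX]; simp [ZMod.card])
      rw [← this, hr]; rfl
    rw [h1]
    apply Finset.prod_dvd_of_coprime
    · intro a _ b _ hab
      exact pairwise_coprime_X_sub_C Function.injective_id hab
    · intro a _
      rw [dvd_iff_isRoot]
      simp [h a]
  obtain ⟨g, hg⟩ := hdvd
  have hf0 : f ≠ 0 := by rintro rfl; simp at hf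
  have hgdeg : g ≠ 0 → f.natDegree + g.natDegree < l := by
    intro hg0
    have h1 : (f ^ m - 1).natDegree ≤ 3 * m := by
      refine (natDegree_sub_le _ _).trans ?_
      simp [hf, mul_comm]
    rw [hg, natDegree_mul hX0 hg0, hX] at h1
    omega
  have hder := congrArg derivative hg
  simp only [derivative_mul, derivative_sub, derivative_pow, derivative_X, derivative_one] at hder
  have hl0 : (C (l : ZMod l)) = 0 := by simp
  have key : C (m : ZMod l) * derivative f + f * g =
      (X ^ l - X) * (f * derivative g - C (m : ZMod l) * derivative f * g) := by
    have hfm : f ^ (m - 1) * f = f ^ m := by rw [← pow_succ]; congr 1; omega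
    have hfm2 : f ^ m = (X ^ l - X) * g + 1 := by rw [← hg]; ring
    rw [hl0] at hder
    linear_combination f * hder - C (m : ZMod l) * derivative f * hfm - C (m : ZMod l) * derivative f * hfm2
  have hdf : (derivative f).natDegree ≤ 2 := by
    have := natDegree_derivative_le f; omega
  have hlow : (C (m : ZMod l) * derivative f + f * g).natDegree < l := by
    refine lt_of_le_of_lt (natDegree_add_le _ _) (max_lt ?_ ?_)
    · refine lt_of_le_of_lt (natDegree_C_mul_le _ _) (by omega)
    · by_cases hg0 : g = 0
      · simp [hg0]; omega
      · exact lt_of_le_of_lt natDegree_mul_le (hgdeg hg0)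
  have hz : C (m : ZMod l) * derivative f + f * g = 0 := by
    by_contra hne
    rw [key] at hne hlow
    rw [natDegree_mul hX0 (right_ne_zero_of_mul hne), hX] at hlow
    omega
  have hdf0 : C (m : ZMod l) * derivative f ≠ 0 := by
    refine mul_ne_zero (C_ne_zero.2 (nz m (by omega) (by omega))) ?_
    intro h0
    have := congrArg (fun p => coeff p 2) h0
    simp only [coeff_derivative, coeff_zero] at this
    have h3 : f.coeff 3 ≠ 0 := by rw [← hf]; exact leadingCoeff_ne_zero.2 hf0
    have := (mul_eq_zero.1 this).resolve_left h3
    apply nz 3 (by omega) (by omega)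
    push_cast at this ⊢
    linear_combination this
  have hg0 : g ≠ 0 := by rintro rfl; simp at hz; rcases hz with h | h <;> simp [h] at hdf0
  have h5 : (f * g).natDegree ≤ 2 := by
    rw [show f * g = -(C (m : ZMod l) * derivative f) by linear_combination hz, natDegree_neg]
    exact (natDegree_C_mul_le _ _).trans hdf
  rw [natDegree_mul hf0 hg0, hf] at h5
  omega

lemma no_ss_curve (l : ℕ) [Fact (Nat.Prime l)] (hl : 3 < l) (hmod7 : l % 7 = 3 ∨ l % 7 = 5)
    (W : WeierstrassCurve (ZMod l)) (hW : W.Δ ≠ 0)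
    (h7 : 7 ∣ Nat.card (WeierstrassCurve.Affine.Point W))
    (h : ∑ x : ZMod l, (x ^ 3 - 27 * W.c₄ * x - 54 * W.c₆) ^ (l / 2) = 0) : False := by
  have hp : l.Prime := Fact.out
  have hch : ringChar (ZMod l) ≠ 2 := by rw [ZMod.ringChar_zmod_n]; omega
  have nz : ∀ a : ℕ, 0 < a → a < l → ((a : ℕ) : ZMod l) ≠ 0 := by
    intro a h1 h2 h
    rw [CharP.cast_eq_zero_iff (ZMod l) l] at h
    exact absurd (Nat.le_of_dvd h1 h) (by omega)
  have n2 : (2 : ZMod l) ≠ 0 := by exact_mod_cast nz 2 (by omega) (by omega)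
  have n3 : (3 : ZMod l) ≠ 0 := by exact_mod_cast nz 3 (by omega) (by omega)
  have n36 : (36 : ZMod l) ≠ 0 := by
    rw [show (36 : ZMod l) = 2 ^ 2 * 3 ^ 2 by norm_num]; positivity
  have n108 : (108 : ZMod l) ≠ 0 := by
    rw [show (108 : ZMod l) = 2 ^ 2 * 3 ^ 3 by norm_num]; positivity
  have hodd : ¬ 2 ∣ l := fun h => by
    have := (Nat.prime_dvd_prime_iff_eq Nat.prime_two hp).1 h; omega
  set f : (ZMod l)[X] := C 4 * X ^ 3 + C W.b₂ * X ^ 2 + C (2 * W.b₄) * X + C W.b₆ with hf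
  have hfe : ∀ x, f.eval x = 4 * x ^ 3 + W.b₂ * x ^ 2 + 2 * W.b₄ * x + W.b₆ := by
    intro x; simp [hf]
  have hfd : f.natDegree = 3 := by
    rw [hf]; exact natDegree_cubic (by rw [show (4 : ZMod l) = 2 ^ 2 by norm_num]; positivity)
  have hcard := card_point l hl W hW
  simp_rw [← hfe] at hcard
  set S := ∑ x : ZMod l, quadraticChar (ZMod l) (f.eval x) with hS
  have hSl : (l : ℤ) ∣ S := by
    rw [← ZMod.intCast_zmod_eq_zero_iff_dvd, hS]
    push_cast
    simp_rw [quadraticChar_eq_pow_of_char_ne_two' hch, ZMod.card]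
    rw [← h]
    let e : ZMod l ≃ ZMod l :=
      { toFun := fun x => 36 * x + 3 * W.b₂
        invFun := fun x => (x - 3 * W.b₂) / 36
        left_inv := fun x => by field_simp; ring
        right_inv := fun x => by field_simp; ring }
    rw [← Equiv.sum_comp e (fun x => (x ^ 3 - 27 * W.c₄ * x - 54 * W.c₆) ^ (l / 2))]
    apply Finset.sum_congr rfl
    intro x _
    have : (e x) ^ 3 - 27 * W.c₄ * (e x) - 54 * W.c₆ = 108 ^ 2 * f.eval x := by
      rw [hfe]; simp only [e, Equiv.coe_fn_mk, WeierstrassCurve.c₄, WeierstrassCurve.c₆]; ring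
    rw [this, mul_pow, ← pow_mul, show 2 * (l / 2) = l - 1 by omega, ZMod.pow_card_sub_one_eq_one n108, one_mul]
  have hb : ∀ x : ZMod l, |quadraticChar (ZMod l) (f.eval x)| ≤ 1 := by
    intro x
    rcases quadraticChar_isQuadratic (ZMod l) (f.eval x) with h | h | h <;> rw [h] <;> simp
  have hSb : |S| ≤ l := by
    refine (Finset.abs_sum_le_sum_abs _ _).trans ((Finset.sum_le_sum (fun x _ => hb x)).trans ?_)
    simp [ZMod.card]
  obtain ⟨k, hk⟩ := hSl
  have hk1 : |k| ≤ 1 := by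
    rw [hk, abs_mul, Nat.abs_cast] at hSb
    have : (0 : ℤ) < l := by exact_mod_cast hp.pos
    nlinarith [abs_nonneg k]
  rw [abs_le] at hk1
  have h7' : (7 : ℤ) ∣ 1 + l + S := by rw [← hcard]; exact_mod_cast h7
  have hkl : S ≠ l := by
    intro hSl
    apply not_all_squares l hl f hfd
    intro x
    have hall : quadraticChar (ZMod l) (f.eval x) = 1 := by
      by_contra hne
      have hlt : S < ∑ x : ZMod l, 1 := by
        apply Finset.sum_lt_sum (fun x _ => (abs_le.1 (hb x)).2)
        exact ⟨x, Finset.mem_univ _, lt_of_le_of_ne (abs_le.1 (hb x)).2 hne⟩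
      simp [ZMod.card] at hlt
      omega
    have := quadraticChar_eq_pow_of_char_ne_two' hch (f.eval x)
    rw [hall, ZMod.card] at this
    rw [← this]; simp
  obtain ⟨hk1, hk2⟩ := hk1
  interval_cases k <;> simp at hk <;> omega

end HK

open Polynomial

namespace HK

/-- coefficients of the supersingular polynomial -/
noncomputable def cc (l : ℕ) [Fact (Nat.Prime l)] (k : ℕ) : ℤ :=
  ((2 * (l / 12) + sx l).choose (2 * k + sx l) : ℕ) * ((2 * (l / 12) - 2 * k).choose (l / 12 - k) : ℕ) *
    (-432) ^ (l / 12 - k)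

/-- `E₄³ = W a(y)` -/
def aP {R : Type*} [CommRing R] (y : R) : R := (49 * y ^ 2 + 13 * y + 1) * (2401 * y ^ 2 + 245 * y + 1) ^ 3
/-- `E₆² = W q(y)²` -/
def qP {R : Type*} [CommRing R] (y : R) : R :=
  823543 * y ^ 4 + 235298 * y ^ 3 + 21609 * y ^ 2 + 490 * y - 1

/-- the supersingular polynomial in terms of the Hauptmodul `y`. -/
noncomputable def SSv (l : ℕ) [Fact (Nat.Prime l)] {R : Type*} [CommRing R] (y : R) : R :=
  aP y ^ rr l * qP y ^ sx l *
    ∑ k ∈ Finset.range (l / 12 + 1), (cc l k : R) * (qP y ^ 2) ^ k * y ^ (l / 12 - k)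

lemma aP_sub {R : Type*} [CommRing R] (y : R) : aP y - 1728 * y = qP y ^ 2 := by
  simp only [aP, qP]; ring

def dD {R : Type*} [CommRing R] (d : R) : R := d ^ 2 - d
def dC {R : Type*} [CommRing R] (d : R) : R := d ^ 3 - 8 * d ^ 2 + 5 * d + 1
def dQ1 {R : Type*} [CommRing R] (d : R) : R := d ^ 2 - d + 1
def dQ2 {R : Type*} [CommRing R] (d : R) : R :=
  d ^ 6 - 11 * d ^ 5 + 30 * d ^ 4 - 15 * d ^ 3 - 10 * d ^ 2 + 5 * d + 1
def dS {R : Type*} [CommRing R] (d : R) : R :=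
  d ^ 12 - 18 * d ^ 11 + 117 * d ^ 10 - 354 * d ^ 9 + 570 * d ^ 8 - 486 * d ^ 7
        + 273 * d ^ 6 - 222 * d ^ 5 + 174 * d ^ 4 - 46 * d ^ 3 - 15 * d ^ 2 + 6 * d + 1

lemma dS_sq {R : Type*} [CommRing R] (d : R) :
    dQ1 d ^ 3 * dQ2 d ^ 3 - 1728 * (d ^ 7 * (d - 1) ^ 7 * dC d) = dS d ^ 2 := by
  simp only [dQ1, dQ2, dS, dC]; ring

lemma aeval_hasse (l : ℕ) [Fact (Nat.Prime l)] {F : Type*} [Field F] [Algebra (ZMod l) F] (d : F) :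
    aeval d (hasseH7 l) = (dQ1 d * dQ2 d) ^ rr l * dS d ^ sx l *
      ∑ k ∈ Finset.range (l / 12 + 1), (cc l k : F) * (dS d ^ 2) ^ k *
        (d ^ 7 * (d - 1) ^ 7 * dC d) ^ (l / 12 - k) := by
  have : ∀ k, (algebraMap (ZMod l) F) (((2 * (l / 12) + sx l).choose (2 * k + sx l) : ZMod l) *
      ((2 * (l / 12) - 2 * k).choose (l / 12 - k) : ZMod l)
          * (-432 : ZMod l) ^ (l / 12 - k)) = (cc l k : F) := by
    intro k
    simp only [cc, map_mul, map_natCast, map_pow, map_neg, map_ofNat]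
    push_cast
    ring
  simp_rw [← dS_sq, ← this]
  rw [hasseH7]
  simp only [map_mul, map_pow, map_sum, map_sub, map_add, aeval_X, aeval_C, map_one, map_ofNat]
  rw [mul_pow]
  simp only [rr, sx, dQ1, dQ2, dC, dS, map_natCast, map_neg, map_ofNat]

section
variable (l : ℕ) [Fact (Nat.Prime l)] (hl : 3 < l) (hl7 : l ≠ 7)

lemma ne49 (hl7 : l ≠ 7) {F : Type*} [Field F] [Algebra (ZMod l) F] : (7 : F) ≠ 0 := by
  have : CharP F l := charP_of_injective_algebraMap (algebraMap (ZMod l) F).injective l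
  intro h
  have h' : ((7 : ℕ) : F) = 0 := by exact_mod_cast h
  rw [CharP.cast_eq_zero_iff F l] at h'
  exact hl7 ((Nat.prime_dvd_prime_iff_eq Fact.out (by norm_num)).1 h')

lemma hasse_iff (hl7 : l ≠ 7) {F : Type*} [Field F] [Algebra (ZMod l) F] (d : F)
    (hD : dD d ≠ 0) :
    aeval d (hasseH7 l) = 0 ↔ SSv l (dC d / (49 * dD d)) = 0 := by
  have h7 : (7 : F) ≠ 0 := ne49 l hl7
  have h49 : (49 : F) ≠ 0 := by rw [show (49 : F) = 7 ^ 2 by norm_num]; positivity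
  set y := dC d / (49 * dD d) with hy
  have hyC : dC d = 49 * dD d * y := by rw [hy]; field_simp
  have eS : dS d = 7 * dD d ^ 4 * qP y := by
    have : dS d = dC d ^ 4 + 14 * dC d ^ 3 * dD d + 63 * dC d ^ 2 * dD d ^ 2 + 70 * dC d * dD d ^ 3
        - 7 * dD d ^ 4 := by simp only [dS, dC, dD]; ring
    rw [this, hyC]; simp only [qP]; ring
  have eQ : (dQ1 d * dQ2 d) ^ 3 = 49 * dD d ^ 8 * aP y := by
    have h1 : dQ1 d ^ 3 = dC d ^ 2 + 13 * dC d * dD d + 49 * dD d ^ 2 := by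
      simp only [dQ1, dC, dD]; ring
    have h2 : dQ2 d = dC d ^ 2 + 5 * dC d * dD d + dD d ^ 2 := by
      simp only [dQ2, dC, dD]; ring
    rw [mul_pow, h1, h2, hyC]; simp only [aP]; ring
  have eD : d ^ 7 * (d - 1) ^ 7 * dC d = 49 * dD d ^ 8 * y := by
    have : d ^ 7 * (d - 1) ^ 7 = dD d ^ 7 := by simp only [dD]; ring
    rw [this, hyC]; ring
  rw [aeval_hasse, SSv, eD, eS]
  have es : ∀ k ∈ Finset.range (l / 12 + 1), (cc l k : F) * ((7 * dD d ^ 4 * qP y) ^ 2) ^ k *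
        (49 * dD d ^ 8 * y) ^ (l / 12 - k) = (49 * dD d ^ 8) ^ (l / 12) *
        ((cc l k : F) * (qP y ^ 2) ^ k * y ^ (l / 12 - k)) := by
    intro k hk
    have hk : k ≤ l / 12 := by simpa [Nat.lt_succ_iff] using hk
    have : (49 * dD d ^ 8) ^ (l / 12) = (49 * dD d ^ 8) ^ k * (49 * dD d ^ 8) ^ (l / 12 - k) := by
      rw [← pow_add]; congr 1; omega
    rw [this, show (7 * dD d ^ 4 * qP y) ^ 2 = (49 * dD d ^ 8) * qP y ^ 2 by ring, mul_pow, mul_pow _ y]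
    ring
  rw [Finset.sum_congr rfl es, ← Finset.mul_sum]
  have hA : dQ1 d * dQ2 d = 0 ↔ aP y = 0 := by
    rw [← pow_eq_zero_iff (n := 3) (by norm_num), eQ]
    simp [h49, hD]
  simp only [mul_eq_zero, pow_eq_zero_iff', hA]
  simp [h49, hD, h7]

lemma cc_top : cc l (l / 12) = 1 := by
  simp [cc]

lemma SSv_zero {F : Type*} [Field F] : SSv l (0 : F) ≠ 0 := by
  simp only [SSv]
  refine mul_ne_zero (mul_ne_zero ?_ ?_) ?_
  · simp [aP]
  · simp [qP]
  · rw [Finset.sum_eq_single (l / 12)]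
    · simp [cc_top, qP]
    · intro k hk hk2
      have : l / 12 - k ≠ 0 := by
        simp at hk; omega
      simp [this]
    · simp

lemma no_ss_d (hl : 3 < l) (hmod7 : l % 7 = 3 ∨ l % 7 = 5) (d : ZMod l) (hD : dD d ≠ 0)
    (h : aeval d (hasseH7 l) = 0) : False := by
  by_cases hC : dC d = 0
  · rw [hasse_iff l (by rintro rfl; omega) d hD, hC, zero_div] at h
    exact SSv_zero l h
  have hΔ : (tate7 d).Δ = d ^ 7 * (d - 1) ^ 7 * dC d := by rw [tate7_Δ]; rfl
  have hΔ0 : (tate7 d).Δ ≠ 0 := by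
    rw [hΔ]
    have : d ^ 7 * (d - 1) ^ 7 = dD d ^ 7 := by simp only [dD]; ring
    rw [this]; exact mul_ne_zero (pow_ne_zero _ hD) hC
  have e4 : (tate7 d).c₄ = dQ1 d * dQ2 d := tate7_c4 d
  have e6 : (tate7 d).c₆ = -dS d := tate7_c6 d
  have hrel := dS_sq d
  rw [← hΔ] at hrel
  refine no_ss_curve l hl hmod7 (tate7 d) hΔ0 (seven_dvd_card d hΔ0)
    (char_sum_zero l hl _ _ (-432 * (tate7 d).Δ) ?_ ?_)
  · rw [e4, e6, neg_sq, ← hrel]; ring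
  · rw [aeval_hasse, ← hΔ] at h
    rw [e4, e6]
    have : ∀ k ∈ Finset.range (l / 12 + 1), (((2 * (l / 12) + sx l).choose (2 * k + sx l) : ℕ) : ZMod l) *
        (((2 * (l / 12) - 2 * k).choose (l / 12 - k) : ℕ) : ZMod l) * (-dS d) ^ (2 * k + sx l) *
          (-432 * (tate7 d).Δ) ^ (l / 12 - k) = (-dS d) ^ sx l * ((cc l k : ZMod l) * (dS d ^ 2) ^ k *
        (tate7 d).Δ ^ (l / 12 - k)) := by
      intro k _
      simp only [cc]
      push_cast
      rw [pow_add, pow_mul, neg_sq, mul_pow]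
      ring
    rw [Finset.sum_congr rfl this, ← Finset.mul_sum, neg_pow (dS d)]
    linear_combination (-1) ^ sx l * h

/-- the cubic attached to `h` -/
noncomputable def ph (h : ZMod l) : (ZMod l)[X] := C 1 * X ^ 3 + C (-8 - h) * X ^ 2 + C (5 + h) * X + C 1

lemma ph_aeval {F : Type*} [Field F] [Algebra (ZMod l) F] (h : ZMod l) (d : F) :
    aeval d (ph l h) = dC d - algebraMap _ F h * dD d := by
  simp only [ph, map_add, map_mul, map_pow, aeval_X, aeval_C, map_one, map_sub, map_neg, map_ofNat, dC, dD]
  ring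

lemma ph_natDegree (h : ZMod l) : (ph l h).natDegree = 3 := natDegree_cubic one_ne_zero

lemma ph_monic (h : ZMod l) : (ph l h).Monic := by
  rw [Monic, ph, leadingCoeff_cubic one_ne_zero]

lemma ph_inj : Function.Injective (ph l) := by
  intro a b hab
  have := congrArg (fun p => coeff p 1) hab
  simp only [ph, coeff_add, coeff_C_mul, coeff_X_pow, coeff_X, coeff_C] at this
  simpa using this

lemma dD_ne_of_ph {F : Type*} [Field F] [Algebra (ZMod l) F] (h : ZMod l) (d : F)
    (hd : aeval d (ph l h) = 0) : dD d ≠ 0 := by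
  intro hD
  rw [ph_aeval, hD, mul_zero, sub_zero] at hd
  have : d * (d - 1) = 0 := by rw [← hD, dD]; ring
  rcases mul_eq_zero.1 this with h | h
  · rw [h] at hd; simp [dC] at hd
  · rw [sub_eq_zero.1 h] at hd
    simp only [dC] at hd
    norm_num at hd

theorem partI (hl : 3 < l) (hmod7 : l % 7 = 3 ∨ l % 7 = 5)
    (hIIa : ∀ (F : Type) [Field F] [Algebra (ZMod l) F] (y : F), SSv l y = 0 → y ^ (l ^ 2) = y) :
    {p : Polynomial (ZMod l) | p.Monic ∧ Irreducible p ∧ p.natDegree = 3 ∧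
        p ∣ hasseH7 l}.ncard = {y : ZMod l | SSv l y = 0}.ncard := by
  have hl7 : l ≠ 7 := by rintro rfl; omega
  have hp : l.Prime := Fact.out
  have h49 : (49 : ZMod l) ≠ 0 := by
    rw [show (49 : ZMod l) = 7 ^ 2 by norm_num]; exact pow_ne_zero _ (ne49 l hl7)
  have hinj : Function.Injective (fun y : ZMod l => ph l (49 * y)) :=
    (ph_inj l).comp (mul_right_injective₀ h49)
  rw [← Set.ncard_image_of_injective _ hinj]
  congr 1
  ext p
  simp only [Set.mem_setOf_eq, Set.mem_image]
  constructor
  · rintro ⟨hm, hirr, hdeg, hdvd⟩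
    haveI : Fact (Irreducible p) := ⟨hirr⟩
    set d : AdjoinRoot p := AdjoinRoot.root p with hd
    have hpd : ∀ q : (ZMod l)[X], aeval d q = 0 ↔ p ∣ q := by
      intro q
      rw [hd, AdjoinRoot.aeval_eq, AdjoinRoot.mk_eq_zero]
    have hD : dD d ≠ 0 := by
      intro h
      have : aeval d (X * (X - C 1) : (ZMod l)[X]) = 0 := by
        rw [← h]; simp [dD]; ring
      rw [hpd] at this
      rcases hirr.prime.dvd_or_dvd this with h | h
      · have := natDegree_le_of_dvd h X_ne_zero
        simp [hdeg] at this
      · have := natDegree_le_of_dvd h (X_sub_C_ne_zero 1)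
        rw [natDegree_X_sub_C, hdeg] at this; omega
    have hss : SSv l (dC d / (49 * dD d)) = 0 := by
      rw [← hasse_iff l hl7 d hD, hpd]; exact hdvd
    set y := dC d / (49 * dD d) with hy
    have h2 := hIIa _ y hss
    have hfr : y ^ (l ^ 3) = y := by
      haveI : Module.Finite (ZMod l) (AdjoinRoot p) := hm.finite_adjoinRoot
      haveI : Finite (AdjoinRoot p) := Module.finite_of_finite (ZMod l)
      haveI := Fintype.ofFinite (AdjoinRoot p)
      have hc : Fintype.card (AdjoinRoot p) = l ^ 3 := by
        rw [Module.card_eq_pow_finrank (K := ZMod l), ZMod.card, PowerBasis.finrank (AdjoinRoot.powerBasis hm.ne_zero)]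
        simp [hdeg]
      rw [← hc]; exact FiniteField.pow_card y
    have h1 : y ^ l = y := by
      rw [pow_succ, pow_mul, h2] at hfr; exact hfr
    have hmem : ∃ y0 : ZMod l, algebraMap (ZMod l) (AdjoinRoot p) y0 = y := by
      have hr := FiniteField.roots_X_pow_card_sub_X (ZMod l)
      rw [ZMod.card] at hr
      have hX : (X ^ l - X : (ZMod l)[X]).natDegree = l :=
        FiniteField.X_pow_card_sub_X_natDegree_eq _ hp.one_lt
      have := prod_multiset_X_sub_C_of_monic_of_roots_card_eq (p := (X ^ l - X : (ZMod l)[X]))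
        (monic_X_pow_sub (by rw [degree_X]; exact_mod_cast hp.one_lt))
        (by rw [hr, hX]; simp [ZMod.card])
      rw [hr] at this
      have h3 := congrArg (aeval y) this
      have h4 : aeval y (X ^ l - X : (ZMod l)[X]) = 0 := by simp [h1]
      rw [h4] at h3
      change aeval y (∏ a : ZMod l, (X - C a)) = 0 at h3
      rw [map_prod, Finset.prod_eq_zero_iff] at h3
      obtain ⟨a, -, ha⟩ := h3
      refine ⟨a, ?_⟩
      simp only [map_sub, aeval_X, aeval_C] at ha
      exact (sub_eq_zero.1 ha).symm
    obtain ⟨y0, hy0⟩ := hmem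
    refine ⟨y0, ?_, ?_⟩
    · have : algebraMap (ZMod l) (AdjoinRoot p) (SSv l y0) = SSv l y := by
        rw [← hy0]
        simp only [SSv, aP, qP, map_mul, map_pow, map_sum, map_add, map_sub, map_one, map_ofNat, map_intCast]
      rw [hss] at this
      exact (map_eq_zero _).1 this
    · have hdiv : p ∣ ph l (49 * y0) := by
        rw [← hpd, ph_aeval, map_mul, hy0, hy, map_ofNat]
        have h49' : (49 : AdjoinRoot p) ≠ 0 := by
          rw [show (49 : AdjoinRoot p) = 7 ^ 2 by norm_num]; exact pow_ne_zero _ (ne49 l hl7)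
        field_simp
        ring
      exact (eq_of_monic_of_dvd_of_natDegree_le hm (ph_monic l _) hdiv (by rw [ph_natDegree, hdeg])).symm ▸ rfl
  · rintro ⟨y, hy, rfl⟩
    have hback : ∀ (F : Type) [Field F] [Algebra (ZMod l) F] (d : F), aeval d (ph l (49 * y)) = 0 →
        dD d ≠ 0 ∧ aeval d (hasseH7 l) = 0 := by
      intro F _ _ d hd
      have hD := dD_ne_of_ph l _ d hd
      refine ⟨hD, ?_⟩
      rw [hasse_iff l hl7 d hD]
      rw [ph_aeval, map_mul, map_ofNat] at hd
      have h49' : (49 : F) ≠ 0 := by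
        rw [show (49 : F) = 7 ^ 2 by norm_num]; exact pow_ne_zero _ (ne49 l hl7)
      have : dC d / (49 * dD d) = algebraMap (ZMod l) F y := by
        rw [div_eq_iff (mul_ne_zero h49' hD)]; linear_combination hd
      rw [this]
      have : algebraMap (ZMod l) F (SSv l y) = SSv l (algebraMap (ZMod l) F y) := by
        simp only [SSv, aP, qP, map_mul, map_pow, map_sum, map_add, map_sub, map_one, map_ofNat, map_intCast]
      rw [← this, hy, map_zero]
    have hirr : Irreducible (ph l (49 * y)) := by
      rw [irreducible_iff_roots_eq_zero_of_degree_le_three (by rw [ph_natDegree]; norm_num) (by rw [ph_natDegree])]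
      apply Multiset.eq_zero_of_forall_notMem
      intro d hd
      rw [mem_roots (ph_monic l _).ne_zero, IsRoot, ← coe_aeval_eq_eval] at hd
      obtain ⟨h1, h2⟩ := hback (ZMod l) d hd
      exact no_ss_d l hl hmod7 d h1 h2
    refine ⟨ph_monic l _, hirr, ph_natDegree l _, ?_⟩
    haveI : Fact (Irreducible (ph l (49 * y))) := ⟨hirr⟩
    have := (hback (AdjoinRoot (ph l (49 * y))) (AdjoinRoot.root _)
      (by rw [AdjoinRoot.aeval_eq, AdjoinRoot.mk_self])).2
    rwa [AdjoinRoot.aeval_eq, AdjoinRoot.mk_eq_zero] at this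

end
end HK

namespace HK
open UpperHalfPlane
open scoped MatrixGroups

/-- membership in the lattice `ℤ + ℤ t`. -/
def inL (t x : ℂ) : Prop := ∃ m n : ℤ, x = m + n * t

lemma inL_lin {t x y : ℂ} (hx : inL t x) (hy : inL t y) (m n : ℤ) : inL t (m * x + n * y) := by
  obtain ⟨a, b, rfl⟩ := hx
  obtain ⟨c, d, rfl⟩ := hy
  exact ⟨m * a + n * c, m * b + n * d, by push_cast; ring⟩

lemma inL_add {t x y : ℂ} (hx : inL t x) (hy : inL t y) : inL t (x + y) := by
  simpa using inL_lin hx hy 1 1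

lemma inL_sub {t x y : ℂ} (hx : inL t x) (hy : inL t y) : inL t (x - y) := by
  simpa [sub_eq_add_neg] using inL_lin hx hy 1 (-1)

lemma inL_one (t : ℂ) : inL t 1 := ⟨1, 0, by simp⟩
lemma inL_self (t : ℂ) : inL t t := ⟨0, 1, by simp⟩
lemma inL_int (t : ℂ) (n : ℤ) : inL t n := ⟨n, 0, by simp⟩

/-- linear independence of `1, τ` -/
lemma lin_indep {t : ℂ} (ht : t.im ≠ 0) {a b c d : ℝ} (h : (a : ℂ) + b * t = c + d * t) :
    a = c ∧ b = d := by
  have h1 := congrArg Complex.im h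
  have h2 := congrArg Complex.re h
  simp at h1 h2
  rcases h1 with h1 | h1
  · subst h1; exact ⟨by linarith, rfl⟩
  · exact absurd h1 ht

lemma lin_indepZ {t : ℂ} (ht : t.im ≠ 0) {a b c d : ℤ} (h : (a : ℂ) + b * t = c + d * t) :
    a = c ∧ b = d := by
  have := lin_indep ht (a := a) (b := b) (c := c) (d := d) (by simpa using h)
  exact_mod_cast this

lemma hne (τ : ℍ) : (τ : ℂ).im ≠ 0 := τ.im_pos.ne'

lemma smul_eq (γ : SL(2, ℤ)) (τ : ℍ) :
    (((γ • τ : ℍ) : ℂ)) * (γ 1 0 * τ + γ 1 1) = γ 0 0 * τ + γ 0 1 := by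
  have h := UpperHalfPlane.coe_specialLinearGroup_apply γ τ
  have hd := UpperHalfPlane.denom_ne_zero (γ : GL (Fin 2) ℝ) τ
  rw [ModularGroup.denom_apply] at hd
  rw [h]
  simp at hd ⊢
  exact div_mul_cancel₀ _ hd

lemma den_ne (γ : SL(2, ℤ)) (τ : ℍ) : ((γ 1 0 : ℂ) * τ + γ 1 1) ≠ 0 := by
  have hd := UpperHalfPlane.denom_ne_zero (γ : GL (Fin 2) ℝ) τ
  rwa [ModularGroup.denom_apply] at hd

lemma smul_eq_of {γ : SL(2, ℤ)} {τ τ' : ℍ}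
    (h : (τ' : ℂ) * (γ 1 0 * τ + γ 1 1) = γ 0 0 * τ + γ 0 1) : γ • τ = τ' := by
  ext
  have := smul_eq γ τ
  rw [← h] at this
  exact mul_right_cancel₀ (den_ne γ τ) this

/-- a real matrix moving an upper half plane point to an upper half plane point has positive
determinant -/
lemma det_pos_of {a b c d : ℝ} {t t' : ℂ} (ht : 0 < t.im) (ht' : 0 < t'.im)
    (h : t' * (c * t + d) = a * t + b) (h0 : (c : ℂ) * t + d ≠ 0) : 0 < a * d - b * c := by
  have key : t'.im * Complex.normSq (c * t + d) = (a * d - b * c) * t.im := by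
    have h1 : t' * (Complex.normSq (c * t + d) : ℂ)
        = (a * t + b) * (starRingEnd ℂ) (c * t + d) := by
      rw [← h, ← Complex.mul_conj]; ring
    have := congrArg Complex.im h1
    simp at this
    rw [this]; ring
  have h2 : 0 < Complex.normSq (c * t + d) := Complex.normSq_pos.2 h0
  have : 0 < (a * d - b * c) * t.im := by rw [← key]; positivity
  exact (pos_iff_pos_of_mul_pos this).2 ht

theorem homothety {τ τ' : ℍ} {lam : ℂ} (h0 : lam ≠ 0) (h1 : inL τ lam) (h2 : inL τ (lam * τ'))
    (h3 : inL τ' lam⁻¹) (h4 : inL τ' (lam⁻¹ * τ)) :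
    ∃ γ : SL(2, ℤ), γ • τ = τ' ∧ lam = γ 1 0 * τ + γ 1 1 := by
  obtain ⟨d, c, hd⟩ := h1
  obtain ⟨b, a, hb⟩ := h2
  obtain ⟨d', c', hd'⟩ := h3
  obtain ⟨b', a', hb'⟩ := h4
  have e1 : ((1 : ℤ) : ℂ) + (0 : ℤ) * τ = ((d' * d + c' * b : ℤ) : ℂ) + ((d' * c + c' * a : ℤ) : ℂ) * τ := by
    have : (1 : ℂ) = d' * lam + c' * (lam * τ') := by
      calc (1 : ℂ) = lam * lam⁻¹ := (mul_inv_cancel₀ h0).symm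
        _ = _ := by rw [hd']; ring
    rw [hb, hd] at this
    push_cast
    linear_combination this
  have e2 : ((0 : ℤ) : ℂ) + (1 : ℤ) * τ = ((b' * d + a' * b : ℤ) : ℂ) + ((b' * c + a' * a : ℤ) : ℂ) * τ := by
    have : (τ : ℂ) = b' * lam + a' * (lam * τ') := by
      calc (τ : ℂ) = lam * (lam⁻¹ * τ) := by field_simp
        _ = _ := by rw [hb']; ring
    rw [hb, hd] at this
    push_cast
    linear_combination this
  obtain ⟨f1, f2⟩ := lin_indepZ (hne τ) e1
  obtain ⟨f3, f4⟩ := lin_indepZ (hne τ) e2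
  have hdet : (a * d - b * c) * (a' * d' - b' * c') = 1 := by
    have : (a * d - b * c) * (a' * d' - b' * c') = (d' * d + c' * b) * (b' * c + a' * a) -
      (d' * c + c' * a) * (b' * d + a' * b) := by ring
    rw [this, ← f1, ← f2, ← f3, ← f4]; norm_num
  have hpos : (0:ℝ) < (a : ℝ) * d - b * c := by
    apply det_pos_of (t := τ) (t' := τ') τ.im_pos τ'.im_pos
    · push_cast
      have : (c : ℂ) * τ + d = lam := by rw [hd]; ring
      rw [this]; linear_combination hb
    · have : (c : ℂ) * τ + d = lam := by rw [hd]; ring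
      simpa [this] using h0
  have hpos' : 0 < a * d - b * c := by exact_mod_cast hpos
  have hone : a * d - b * c = 1 := by
    rcases Int.eq_one_or_neg_one_of_mul_eq_one hdet with h | h
    · exact h
    · omega
  refine ⟨⟨!![a, b; c, d], by rw [Matrix.det_fin_two_of]; linarith⟩, ?_, ?_⟩
  · apply smul_eq_of
    simp
    have : (c : ℂ) * τ + d = lam := by rw [hd]; ring
    rw [this]; linear_combination hb
  · simp; rw [hd]; ring

lemma homothety_conv (γ : SL(2, ℤ)) (τ : ℍ) :
    let lam : ℂ := γ 1 0 * τ + γ 1 1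
    lam ≠ 0 ∧ inL τ lam ∧ inL τ (lam * (γ • τ : ℍ)) ∧ inL (γ • τ : ℍ) lam⁻¹ ∧
      inL (γ • τ : ℍ) (lam⁻¹ * τ) := by
  intro lam
  have h0 : lam ≠ 0 := den_ne γ τ
  have h := smul_eq γ τ
  have hdet : (γ 0 0 : ℂ) * γ 1 1 - γ 0 1 * γ 1 0 = 1 := by
    have := γ.det_coe
    rw [Matrix.det_fin_two] at this
    exact_mod_cast this
  refine ⟨h0, ⟨γ 1 1, γ 1 0, by simp only [lam]; ring⟩, ⟨γ 0 1, γ 0 0, by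
    simp only [lam]; linear_combination h⟩, ⟨γ 0 0, - γ 1 0, ?_⟩, ⟨- γ 0 1, γ 1 1, ?_⟩⟩
  · rw [inv_eq_iff_eq_inv, eq_comm, inv_eq_iff_eq_inv, eq_comm, ← one_div, div_eq_iff h0]
    push_cast
    linear_combination (norm := (simp only [lam]; ring)) -hdet + (γ 1 0 : ℂ) * h
  · rw [inv_mul_eq_iff_eq_mul₀ h0]
    push_cast
    linear_combination (norm := (simp only [lam]; ring)) -(γ 1 1 : ℂ) * h - (τ : ℂ) * hdet

/-- class modulo `SL(2,ℤ)` -/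
noncomputable def jq (τ : ℍ) : MulAction.orbitRel.Quotient SL(2, ℤ) ℍ := Quotient.mk'' τ

lemma jq_eq {τ τ' : ℍ} : jq τ = jq τ' ↔ ∃ γ : SL(2, ℤ), γ • τ = τ' := by
  unfold jq
  rw [eq_comm, Quotient.eq'', MulAction.orbitRel_apply, MulAction.mem_orbit_iff]

/-- homothety criterion with sets -/
theorem jq_eq_iff {τ τ' : ℍ} : jq τ = jq τ' ↔ ∃ lam : ℂ, lam ≠ 0 ∧ ∀ x, inL τ' x ↔ inL τ (lam * x) := by
  rw [jq_eq]
  constructor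
  · rintro ⟨γ, rfl⟩
    obtain ⟨h0, h1, h2, h3, h4⟩ := homothety_conv γ τ
    refine ⟨_, h0, fun x => ⟨?_, ?_⟩⟩
    · rintro ⟨m, n, rfl⟩
      convert inL_lin h1 h2 m n using 1; ring
    · rintro ⟨m, n, hx⟩
      convert inL_lin h3 h4 m n using 1
      rw [← mul_right_inj' h0, hx]
      linear_combination (-(m : ℂ) - n * τ) * mul_inv_cancel₀ h0
  · rintro ⟨lam, h0, h⟩
    obtain ⟨γ, h, -⟩ := homothety (lam := lam) h0 (by simpa using (h 1).1 (inL_one _)) ((h τ').1 (inL_self _))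
      ((h _).2 (by simpa [h0] using inL_one _)) ((h _).2 (by rw [← mul_assoc, mul_inv_cancel₀ h0, one_mul]; exact inL_self _))
    exact ⟨γ, h⟩

end HK

namespace HK
open UpperHalfPlane
open scoped MatrixGroups

/-- `i √l` -/
noncomputable def sq (l : ℕ) : ℂ := Complex.I * (Real.sqrt l : ℂ)

lemma sq_sq (l : ℕ) : sq l ^ 2 = -(l : ℂ) := by
  unfold sq
  rw [mul_pow, Complex.I_sq, ← Complex.ofReal_pow, Real.sq_sqrt (by positivity)]; simp

lemma sq_im (l : ℕ) : (sq l).im = Real.sqrt l := by simp [sq]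
lemma sq_re (l : ℕ) : (sq l).re = 0 := by simp [sq]
lemma sq_im_ne {l : ℕ} (hl : 0 < l) : (sq l).im ≠ 0 := by
  rw [sq_im]; positivity

/-- generator of the maximal order -/
noncomputable def om (l : ℕ) : ℂ := if l % 4 = 1 then sq l else (1 + sq l) / 2

def Hom (l : ℕ) : Set ℍ := {τ | inL τ (om l) ∧ inL τ (om l * τ)}

lemma om_im_ne {l : ℕ} (hl : 0 < l) : (om l).im ≠ 0 := by
  unfold om
  split_ifs
  · exact sq_im_ne hl
  · have := sq_im_ne hl
    simp only [Complex.div_ofNat_im, Complex.add_im, Complex.one_im, zero_add]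
    positivity

lemma exists_phi (l : ℕ) (K : Type) [Field K] [NumberField K] (α : K) (hα : α ^ 2 = -(l : K)) :
    ∃ φ : K →+* ℂ, φ α = sq l := by
  obtain ⟨φ⟩ : Nonempty (K →+* ℂ) := inferInstance
  have h : φ α ^ 2 = sq l ^ 2 := by
    rw [← map_pow, hα, sq_sq]; simp
  rcases sq_eq_sq_iff_eq_or_eq_neg.1 h with h | h
  · exact ⟨φ, h⟩
  · refine ⟨(starRingEnd ℂ).comp φ, ?_⟩
    simp [h, sq]

lemma exists_pq (l : ℕ) (hl : 0 < l) (K : Type) [Field K] [NumberField K]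
    (hdeg : Module.finrank ℚ K = 2) (α : K) (φ : K →+* ℂ) (hφ : φ α = sq l)
    (x : K) : ∃ p q : ℚ, x = p + q * α := by
  have hli : LinearIndependent ℚ ![(1:K), α] := by
    rw [LinearIndependent.pair_iff]
    intro s t h
    have := congrArg φ h
    simp only [map_add, map_zero, Algebra.smul_def, map_mul, hφ, map_one, mul_one] at this
    have := lin_indep (t := sq l) (sq_im_ne hl) (a := s) (b := t) (c := 0) (d := 0)
      (by simpa using this)
    exact_mod_cast this
  have hsp := hli.span_eq_top_of_card_eq_finrank' (by simp [hdeg])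
  have hx : x ∈ Submodule.span ℚ (Set.range ![(1:K), α]) := by rw [hsp]; trivial
  simp only [Matrix.range_cons, Matrix.range_empty, Set.union_empty] at hx
  rw [Set.singleton_union, Submodule.mem_span_pair] at hx
  obtain ⟨a, b, h⟩ := hx
  exact ⟨a, b, by rw [← h]; simp [Algebra.smul_def]⟩

lemma rat_int_of_integral {p : ℚ} (h : IsIntegral ℤ (p : ℂ)) : ∃ n : ℤ, p = n := by
  have h1 : IsIntegral ℤ p := by
    have : (p : ℂ) = algebraMap ℚ ℂ p := by simp
    rw [this] at h
    exact (isIntegral_algebraMap_iff (algebraMap ℚ ℂ).injective).1 h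
  obtain ⟨n, hn⟩ := IsIntegrallyClosed.isIntegral_iff.1 h1
  exact ⟨n, by simpa using hn.symm⟩

lemma integral_form (l : ℕ) (hp : l.Prime) (h3 : 3 < l) (p q : ℚ)
    (h : IsIntegral ℤ ((p : ℂ) + q * sq l)) : ∃ m n : ℤ, (p : ℂ) + q * sq l = m + n * om l := by
  have hc : IsIntegral ℤ ((p : ℂ) - q * sq l) := by
    have := h.map ((starRingEnd ℂ).toIntAlgHom)
    have e : (starRingEnd ℂ).toIntAlgHom ((p : ℂ) + q * sq l) = (p : ℂ) - q * sq l := by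
      simp [sq]; ring
    rwa [e] at this
  obtain ⟨P, hP⟩ := rat_int_of_integral (p := 2 * p) (by
    have e : ((2 * p : ℚ) : ℂ) = ((p : ℂ) + q * sq l) + (p - q * sq l) := by push_cast; ring
    rw [e]; exact h.add hc)
  obtain ⟨N, hN⟩ := rat_int_of_integral (p := p ^ 2 + l * q ^ 2) (by
    have e : ((p ^ 2 + l * q ^ 2 : ℚ) : ℂ) = ((p : ℂ) + q * sq l) * (p - q * sq l) := by
      push_cast; linear_combination ((q:ℂ)^2) * sq_sq l
    rw [e]; exact h.mul hc)
  have hl0 : (l : ℚ) ≠ 0 := by exact_mod_cast hp.ne_zero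
  -- l (2q)^2 = 4N - P^2
  have h4 : (l : ℚ) * (2 * q) ^ 2 = ((4 * N - P ^ 2 : ℤ) : ℚ) := by
    push_cast; rw [← hN, ← hP]; ring
  obtain ⟨R, hR⟩ : ∃ R : ℤ, l * (2 * q) = R := by
    apply rat_int_of_integral
    apply IsIntegral.of_pow (n := 2) (by norm_num)
    have : (((l : ℚ) * (2 * q) : ℚ) : ℂ) ^ 2 = ((l * (4 * N - P ^ 2) : ℤ) : ℂ) := by
      have : ((l : ℚ) * (2 * q)) ^ 2 = ((l * (4 * N - P ^ 2) : ℤ) : ℚ) := by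
        push_cast at h4 ⊢; rw [← h4]; ring
      exact_mod_cast congrArg (fun x : ℚ => (x : ℂ)) this
    rw [this]
    exact isIntegral_algebraMap (R := ℤ) (x := (l * (4 * N - P ^ 2) : ℤ))
  have hR2 : R ^ 2 = l * (4 * N - P ^ 2) := by
    have : (R : ℚ) ^ 2 = l * (4 * N - P ^ 2) := by
      rw [← hR]; push_cast at h4; rw [← h4]; ring
    exact_mod_cast this
  have hdvd : (l : ℤ) ∣ R := by
    have : (l : ℤ) ∣ R ^ 2 := ⟨_, hR2⟩
    exact (Nat.prime_iff_prime_int.1 hp).dvd_of_dvd_pow this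
  obtain ⟨Q, rfl⟩ := hdvd
  have hQ : 2 * q = Q := by
    have : (l : ℚ) * (2 * q) = l * Q := by rw [hR]; push_cast; ring
    exact mul_left_cancel₀ hl0 this
  have hPQ : (l : ℤ) * Q ^ 2 = 4 * N - P ^ 2 := by
    rw [hQ] at h4; exact_mod_cast h4
  have hodd : l % 2 = 1 := (hp.eq_two_or_odd).resolve_left (by omega)
  have hpc : (p : ℂ) = P / 2 := by
    have : p = P / 2 := by rw [← hP]; ring
    rw [this]; push_cast; ring
  have hqc : (q : ℂ) = Q / 2 := by
    have : q = Q / 2 := by rw [← hQ]; ring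
    rw [this]; push_cast; ring
  rcases Int.even_or_odd' P with ⟨P', hP' | hP'⟩ <;> rcases Int.even_or_odd' Q with ⟨Q', hQ' | hQ'⟩
  · -- both even
    unfold om
    split_ifs
    · exact ⟨P', Q', by rw [hpc, hqc, hP', hQ']; push_cast; ring⟩
    · exact ⟨P' - Q', 2 * Q', by rw [hpc, hqc, hP', hQ']; push_cast; ring⟩
  · exfalso
    have : (l : ℤ) = 4 * (N - P' ^ 2 - l * (Q' ^ 2 + Q')) := by rw [hP', hQ'] at hPQ; linarith
    omega
  · exfalso
    have : (1 : ℤ) = 4 * (N - l * Q' ^ 2 - P' ^ 2 - P') := by rw [hP', hQ'] at hPQ; linarith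
    omega
  · have : (l : ℤ) + 1 = 4 * (N - P' ^ 2 - P' - l * (Q' ^ 2 + Q')) := by
      rw [hP', hQ'] at hPQ; linarith
    unfold om
    rw [if_neg (by omega)]
    exact ⟨P' - Q', 2 * Q' + 1, by rw [hpc, hqc, hP', hQ']; push_cast; ring⟩

lemma om_integral (l : ℕ) (hp : l.Prime) (h3 : 3 < l) : IsIntegral ℤ (om l) := by
  have hodd : l % 2 = 1 := (hp.eq_two_or_odd).resolve_left (by omega)
  have hs : IsIntegral ℤ (sq l) := by
    apply IsIntegral.of_pow (n := 2) (by norm_num)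
    rw [sq_sq]
    have := isIntegral_algebraMap (R := ℤ) (A := ℂ) (x := -(l : ℤ))
    simpa using this
  unfold om
  split_ifs with h
  · exact hs
  · obtain ⟨k, hk⟩ : ∃ k : ℕ, l + 1 = 4 * k := ⟨(l + 1) / 4, by omega⟩
    have hk' : (l : ℂ) = 4 * k - 1 := by
      have : ((l : ℂ) + 1) = 4 * k := by exact_mod_cast hk
      rw [← this]; ring
    refine ⟨X ^ 2 - X + C (k : ℤ), ?_, ?_⟩
    · monicity!
    · simp only [eval₂_add, eval₂_sub, eval₂_X, eval₂_pow, eval₂_C]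
      have := sq_sq l
      rw [hk'] at this
      simp
      linear_combination this / 4

lemma om_mem_range (l : ℕ) (K : Type) [Field K] (α : K) [CharZero K]
    (φ : K →+* ℂ) (hφ : φ α = sq l) : ∃ w : K, φ w = om l := by
  unfold om
  split_ifs
  · exact ⟨α, hφ⟩
  · exact ⟨(1 + α) / 2, by simp [hφ, map_ofNat φ 2]⟩

/-- `(1, om)` is a basis of the ring of integers. -/
theorem ringOfIntegers_eq (l : ℕ) (hp : l.Prime) (h3 : 3 < l) (K : Type) [Field K] [NumberField K]
    (hdeg : Module.finrank ℚ K = 2) (α : K) (φ : K →+* ℂ) (hφ : φ α = sq l) :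
    ∃ w : NumberField.RingOfIntegers K, φ w = om l ∧
      ∀ x : NumberField.RingOfIntegers K, ∃ m n : ℤ, x = m + n * w := by
  obtain ⟨w, hw⟩ := om_mem_range l K α φ hφ
  have hwi : IsIntegral ℤ w := by
    have := om_integral l hp h3
    rw [← hw] at this
    exact (isIntegral_algHom_iff φ.toIntAlgHom φ.injective).1 this
  obtain ⟨w, rfl⟩ : ∃ w' : NumberField.RingOfIntegers K, (w' : K) = w := ⟨⟨w, hwi⟩, rfl⟩
  refine ⟨w, hw, fun x => ?_⟩
  obtain ⟨p, q, hx⟩ := exists_pq l hp.pos K hdeg α φ hφ x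
  have hxi : IsIntegral ℤ (φ (x : K)) := x.2.map φ.toIntAlgHom
  have e : φ (x : K) = p + q * sq l := by rw [hx]; simp [hφ]
  rw [e] at hxi
  obtain ⟨m, n, hmn⟩ := integral_form l hp h3 p q hxi
  refine ⟨m, n, ?_⟩
  apply NumberField.RingOfIntegers.coe_injective
  apply φ.injective
  simp
  rw [e, hmn, hw]

end HK

namespace HK
open UpperHalfPlane
open scoped MatrixGroups nonZeroDivisors

section
variable {K : Type} [Field K] [NumberField K]

local notation "OK" => NumberField.RingOfIntegers K

/-- the ideal `J` is homothetic to the lattice of `τ` -/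
def PJ (φ : K →+* ℂ) (J : Ideal (NumberField.RingOfIntegers K)) (τ : ℍ) : Prop :=
  ∃ u : ℂ, u ≠ 0 ∧ ∀ x : ℂ, inL τ x ↔ ∃ a ∈ J, φ a = u * x

lemma PJ_mem_Hom {l : ℕ} {φ : K →+* ℂ} {w : OK} (hw : φ w = om l) {J : Ideal OK} {τ : ℍ}
    (h : PJ φ J τ) : τ ∈ Hom l := by
  obtain ⟨u, hu, h⟩ := h
  have key : ∀ x, inL τ x → inL τ (om l * x) := by
    intro x hx
    obtain ⟨a, ha, e⟩ := (h x).1 hx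
    refine (h _).2 ⟨w * a, J.mul_mem_left _ ha, ?_⟩
    simp [hw, e]; ring
  exact ⟨by simpa using key 1 (inL_one _), key _ (inL_self _)⟩

lemma PJ_exists {l : ℕ} (hp : l.Prime)
    (hdeg : Module.finrank ℚ K = 2) (α : K) (φ : K →+* ℂ) (hφ : φ α = sq l)
    (J : Ideal OK) (hJ : J ≠ ⊥) : ∃ τ : ℍ, PJ φ J τ := by
  have hr : Module.finrank ℤ OK = 2 := by rw [NumberField.RingOfIntegers.rank, hdeg]
  let b := Module.finBasisOfFinrankEq ℤ OK hr
  let e := Ideal.selfBasis b J hJ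
  have hspan : ∀ a : OK, a ∈ J ↔ ∃ m n : ℤ, a = m * (e 0 : OK) + n * (e 1 : OK) := by
    intro a
    constructor
    · intro ha
      have := e.sum_repr ⟨a, ha⟩
      rw [Fin.sum_univ_two] at this
      refine ⟨e.repr ⟨a, ha⟩ 0, e.repr ⟨a, ha⟩ 1, ?_⟩
      have := congrArg Subtype.val this
      simp at this
      exact this.symm
    · rintro ⟨m, n, rfl⟩
      exact J.add_mem (J.mul_mem_left _ (e 0).2) (J.mul_mem_left _ (e 1).2)
  have hli : ∀ m n : ℤ, (m : OK) * (e 0 : OK) + n * (e 1 : OK) = 0 → m = 0 ∧ n = 0 := by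
    intro m n h
    have := e.linearIndependent
    rw [Fintype.linearIndependent_iff] at this
    have := this ![m, n] (by
      rw [Fin.sum_univ_two]
      apply Subtype.ext
      simp
      exact h)
    exact ⟨this 0, this 1⟩
  obtain ⟨e0, e1, hspan, hli⟩ : ∃ e0 e1 : OK, (∀ a : OK, a ∈ J ↔ ∃ m n : ℤ, a = m * e0 + n * e1) ∧
    ∀ m n : ℤ, (m : OK) * e0 + n * e1 = 0 → m = 0 ∧ n = 0 := ⟨_, _, hspan, hli⟩
  have h0 : e0 ≠ 0 := by
    intro h; have := hli 1 0 (by simp [h]); simp at this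
  have h0' : φ e0 ≠ 0 := by
    rw [_root_.map_ne_zero]; exact NumberField.RingOfIntegers.coe_ne_zero_iff.2 h0
  set t : ℂ := φ e1 / φ e0 with ht
  have htim : t.im ≠ 0 := by
    intro him
    obtain ⟨p, q, hpq⟩ := exists_pq l hp.pos K hdeg α φ hφ ((e1 : K) / e0)
    have hq : q = 0 := by
      have : t = p + q * sq l := by rw [ht, ← map_div₀, hpq]; simp [hφ]
      have := congrArg Complex.im this
      rw [him] at this
      simp [sq_im] at this
      rcases this with h | h
      · exact h
      · have := hp.pos; omega
    rw [hq] at hpq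
    have h0K : (e0 : K) ≠ 0 := NumberField.RingOfIntegers.coe_ne_zero_iff.2 h0
    rw [div_eq_iff h0K] at hpq
    have h1 := hli p.num (-p.den) (by
      apply NumberField.RingOfIntegers.coe_injective
      have hpq : algebraMap OK K e1 = (p + (0 : ℚ) * α) * algebraMap OK K e0 := hpq
      simp
      rw [hpq]
      have : (p : K) * p.den = p.num := by
        have := Rat.mul_den_eq_num p
        exact_mod_cast congrArg (fun x : ℚ => (x : K)) this
      simp
      linear_combination (-(algebraMap OK K e0)) * this)
    have := p.den_pos
    omega
  have main : ∀ (s : ℤ) (hs : s * s = 1) (hpos : 0 < ((s : ℂ) * t).im), PJ φ J ⟨(s : ℂ) * t, hpos⟩ := by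
    intro s hs hpos
    have hs' : (s : ℂ) * s = 1 := by exact_mod_cast hs
    refine ⟨φ e0, h0', fun x => ⟨?_, ?_⟩⟩
    · rintro ⟨m, n, rfl⟩
      refine ⟨m * e0 + (n * s : ℤ) * e1, (hspan _).2 ⟨m, n * s, rfl⟩, ?_⟩
      simp [ht]
      field_simp
    · rintro ⟨a, ha, hx⟩
      obtain ⟨m, n, rfl⟩ := (hspan a).1 ha
      refine ⟨m, n * s, ?_⟩
      apply mul_left_cancel₀ h0'
      rw [← hx]
      simp [ht]
      field_simp
      linear_combination (-(n : ℂ)) * φ e1 * hs'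
  rcases lt_or_gt_of_ne htim with h | h
  · exact ⟨_, main (-1) (by norm_num) (by simpa using h)⟩
  · exact ⟨_, main 1 (by norm_num) (by simpa using h)⟩

lemma PJ_iff {φ : K →+* ℂ} {J J' : Ideal OK} (hJ : J ∈ (Ideal OK)⁰) (hJ' : J' ∈ (Ideal OK)⁰) {τ τ' : ℍ}
    (h : PJ φ J τ) (h' : PJ φ J' τ') :
    ClassGroup.mk0 (⟨J, hJ⟩ : (Ideal OK)⁰) = ClassGroup.mk0 ⟨J', hJ'⟩ ↔ jq τ = jq τ' := by
  obtain ⟨u, hu, h⟩ := h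
  obtain ⟨u', hu', h'⟩ := h'
  have inj : ∀ a b : OK, φ a = φ b → a = b := fun a b hab =>
    NumberField.RingOfIntegers.coe_injective (φ.injective hab)
  have nz : ∀ a : OK, a ≠ 0 → φ a ≠ 0 := fun a ha => by
    rw [_root_.map_ne_zero]; exact NumberField.RingOfIntegers.coe_ne_zero_iff.2 ha
  rw [ClassGroup.mk0_eq_mk0_iff, jq_eq_iff]
  constructor
  · rintro ⟨x, y, hx, hy, hxy⟩
    -- x J = y J'
    simp only at hxy
    have k1 : ∀ a ∈ J, ∃ b ∈ J', x * a = y * b := by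
      intro a ha
      have : x * a ∈ Ideal.span {y} * J' := by
        rw [← hxy]; exact Ideal.mul_mem_mul (Ideal.mem_span_singleton_self x) ha
      rw [Ideal.mem_span_singleton_mul] at this
      obtain ⟨b, hb, e⟩ := this
      exact ⟨b, hb, e.symm⟩
    have k2 : ∀ b ∈ J', ∃ a ∈ J, x * a = y * b := by
      intro b hb
      have : y * b ∈ Ideal.span {x} * J := by
        rw [hxy]; exact Ideal.mul_mem_mul (Ideal.mem_span_singleton_self y) hb
      rw [Ideal.mem_span_singleton_mul] at this
      obtain ⟨a, ha, e⟩ := this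
      exact ⟨a, ha, e⟩
    have hx' := nz x hx
    have hy' := nz y hy
    refine ⟨φ y * u' / (φ x * u), by positivity, fun z => ?_⟩
    rw [h, h']
    constructor
    · rintro ⟨b, hb, e⟩
      obtain ⟨a, ha, e2⟩ := k2 b hb
      refine ⟨a, ha, ?_⟩
      have : φ (x : K) * φ a = φ y * φ b := by simpa using congrArg (fun t : OK => φ t) e2
      field_simp
      linear_combination this + φ y * e
    · rintro ⟨a, ha, e⟩
      obtain ⟨b, hb, e2⟩ := k1 a ha
      refine ⟨b, hb, ?_⟩
      have : φ (x : K) * φ a = φ y * φ b := by simpa using congrArg (fun t : OK => φ t) e2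
      field_simp at e
      apply mul_left_cancel₀ hy'
      rw [← this]; linear_combination e
  · rintro ⟨lam, h0, hl⟩
    obtain ⟨a, ha, ea⟩ := (h' 1).1 (inL_one _)
    have ha0 : a ≠ 0 := by
      rintro rfl; simp at ea; exact hu' ea.symm
    obtain ⟨b, hb, eb⟩ := (h lam).1 (by simpa using (hl 1).1 (inL_one _))
    have hb0 : b ≠ 0 := by
      rintro rfl; simp at eb; rcases eb with eb | eb
      · exact hu eb
      · exact h0 eb
    -- φ b / φ a = u lam / u'
    rw [mul_one] at ea
    refine ⟨a, b, ha0, hb0, ?_⟩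
    simp only
    ext z
    rw [Ideal.mem_span_singleton_mul, Ideal.mem_span_singleton_mul]
    constructor
    · rintro ⟨c, hc, rfl⟩
      -- φ c = u x , x in L_tau; x = lam x'
      have hc' : inL τ' (φ c / (u * lam)) := by
        rw [hl, h]
        exact ⟨c, hc, by field_simp⟩
      obtain ⟨d, hd, ed⟩ := (h' _).1 hc'
      refine ⟨d, hd, inj _ _ ?_⟩
      simp
      rw [ea, eb, ed]; field_simp
    · rintro ⟨d, hd, rfl⟩
      have hd' : inL τ (lam * (φ d / u')) := by
        rw [← hl, h']
        exact ⟨d, hd, by field_simp⟩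
      obtain ⟨c, hc, ec⟩ := (h _).1 hd'
      refine ⟨c, hc, inj _ _ ?_⟩
      simp
      rw [ea, eb, ec]; field_simp

lemma PJ_of_Hom {l : ℕ} (hp : l.Prime) (φ : K →+* ℂ) {w : OK} (hw : φ w = om l)
    (hw2 : ∀ x : OK, ∃ m n : ℤ, x = m + n * w) {τ : ℍ}
    (h : τ ∈ Hom l) : ∃ J : Ideal OK, J ≠ ⊥ ∧ PJ φ J τ := by
  obtain ⟨⟨d, c, h1⟩, h2⟩ := h
  have hc : c ≠ 0 := by
    rintro rfl
    have := congrArg Complex.im h1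
    simp at this
    exact om_im_ne hp.pos this
  have hcC : (c : ℂ) ≠ 0 := by exact_mod_cast hc
  have stab : ∀ x, inL τ x → inL τ (om l * x) := by
    rintro x ⟨m, n, rfl⟩
    have := inL_lin (⟨d, c, h1⟩ : inL τ (om l)) h2 m n
    convert this using 1; ring
  let J : Ideal OK :=
    { carrier := {a | inL τ (φ a / c)}
      add_mem' := by
        intro a b ha hb
        simp only [Set.mem_ofPred_eq, map_add] at *
        rw [add_div]; exact inL_add ha hb
      zero_mem' := by simpa using inL_int τ 0
      smul_mem' := by
        intro x a ha
        obtain ⟨m, n, rfl⟩ := hw2 x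
        simp only [Set.mem_ofPred_eq, smul_eq_mul, map_mul, map_add, map_intCast] at *
        rw [hw]
        have := inL_lin ha (stab _ ha) m n
        convert this using 1
        ring }
  have hJ : ∀ a, a ∈ J ↔ inL τ (φ a / c) := fun a => Iff.rfl
  refine ⟨J, ?_, c, hcC, fun x => ⟨?_, ?_⟩⟩
  · intro hbot
    have : (c : OK) ∈ J := by
      rw [hJ]; simp [hcC]; exact inL_one _
    rw [hbot] at this
    simp at this
    exact hc this
  · rintro ⟨m, n, rfl⟩
    have e : φ ((m * c + n * (w - d) : OK) : K) = c * (m + n * τ) := by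
      simp [hw]; rw [h1]; ring
    refine ⟨m * c + n * (w - d), ?_, e⟩
    rw [hJ, e]
    exact ⟨m, n, by field_simp⟩
  · rintro ⟨a, ha, e⟩
    rw [hJ, e] at ha
    convert ha using 1
    field_simp

end

theorem card_Hom (l : ℕ) (hp : l.Prime) (h3 : 3 < l) (K : Type) [Field K] [NumberField K]
    (hdeg : Module.finrank ℚ K = 2) (α : K) (hα : α ^ 2 = -(l : K)) :
    (jq '' Hom l).ncard = NumberField.classNumber K := by
  obtain ⟨φ, hφ⟩ := exists_phi l K α hα
  obtain ⟨w, hw, hw2⟩ := ringOfIntegers_eq l hp h3 K hdeg α φ hφ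
  have hrep : ∀ c : ClassGroup (NumberField.RingOfIntegers K), ∃ τ : ℍ, ∃ J, ∃ hJ,
      ClassGroup.mk0 (⟨J, hJ⟩ : (Ideal (NumberField.RingOfIntegers K))⁰) = c ∧ PJ φ J τ := by
    intro c
    obtain ⟨⟨J, hJ⟩, rfl⟩ := ClassGroup.mk0_surjective c
    obtain ⟨τ, hτ⟩ := PJ_exists hp hdeg α φ hφ J (nonZeroDivisors.ne_zero hJ)
    exact ⟨τ, J, hJ, rfl, hτ⟩
  choose T J hJ hc hP using hrep
  have hrange : jq '' Hom l = Set.range (fun c => jq (T c)) := by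
    ext q
    constructor
    · rintro ⟨τ, hτ, rfl⟩
      obtain ⟨J', hJ', hPJ⟩ := PJ_of_Hom hp φ hw hw2 hτ
      refine ⟨ClassGroup.mk0 ⟨J', mem_nonZeroDivisors_of_ne_zero hJ'⟩, ?_⟩
      exact (PJ_iff (hJ _) (mem_nonZeroDivisors_of_ne_zero hJ') (hP _) hPJ).1 (hc _)
    · rintro ⟨c, rfl⟩
      exact ⟨T c, PJ_mem_Hom hw (hP c), rfl⟩
  have hinj : Function.Injective (fun c => jq (T c)) := by
    intro c c' h
    have := (PJ_iff (hJ c) (hJ c') (hP c) (hP c')).2 h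
    rwa [hc, hc] at this
  rw [hrange, ← Set.image_univ, Set.ncard_image_of_injective _ hinj, Set.ncard_univ,
    Nat.card_eq_fintype_card]
  rfl

end HK

namespace HK
open UpperHalfPlane
open scoped MatrixGroups

def Hl (l : ℕ) : Set ℍ := {τ | inL τ (sq l) ∧ inL τ (sq l * τ)}

lemma Hl_iff {l : ℕ} (hl : 0 < l) (τ : ℍ) : τ ∈ Hl l ↔
    ∃ A B C : ℤ, 0 < A ∧ A * C - B ^ 2 = l ∧ sq l = A * τ + B ∧ sq l * τ = -B * τ - C := by
  constructor
  · rintro ⟨⟨B, A, h1⟩, ⟨D, E, h2⟩⟩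
    have hA : 0 < A := by
      have := congrArg Complex.im h1
      rw [sq_im] at this
      simp at this
      have h3 : 0 < Real.sqrt l := by positivity
      rw [this] at h3
      have := (pos_iff_pos_of_mul_pos h3).2 τ.im_pos
      exact_mod_cast this
    have h3 : (((-l : ℤ) : ℂ)) + (0 : ℤ) * τ = ((A * D + B * B : ℤ) : ℂ) + ((A * E + B * A : ℤ) : ℂ) * τ := by
      have h4 : sq l * sq l = B * sq l + A * (sq l * τ) := by
        nth_rewrite 2 [h1]; ring
      rw [h2] at h4
      nth_rewrite 3 [h1] at h4
      push_cast
      linear_combination h4 - sq_sq l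
    obtain ⟨h5, h6⟩ := lin_indepZ (hne τ) h3
    have hE : E = -B := by
      have : A * (E + B) = 0 := by linarith
      rcases mul_eq_zero.1 this with h | h <;> omega
    refine ⟨A, B, -D, hA, by linarith, by rw [h1]; ring, by rw [h2, hE]; push_cast; ring⟩
  · rintro ⟨A, B, C, _, _, h1, h2⟩
    exact ⟨⟨B, A, by rw [h1]; ring⟩, ⟨-C, -B, by rw [h2]; push_cast; ring⟩⟩

/-- converse: a quadratic equation suffices -/
lemma Hl_of_form {l : ℕ} (hl : 0 < l) (τ : ℍ) {A B C : ℤ} (hA : 0 < A) (hd : A * C - B ^ 2 = l)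
    (h : (A : ℂ) * τ ^ 2 + 2 * B * τ + C = 0) : sq l = A * τ + B ∧ sq l * τ = -B * τ - C := by
  have h1 : (A * τ + B : ℂ) ^ 2 = sq l ^ 2 := by
    rw [sq_sq]
    have : (A : ℂ) * C - B ^ 2 = l := by exact_mod_cast hd
    linear_combination A * h - this
  have h2 : sq l = A * τ + B := by
    rcases sq_eq_sq_iff_eq_or_eq_neg.1 h1 with h2 | h2
    · exact h2.symm
    · exfalso
      have := congrArg Complex.im h2
      rw [Complex.neg_im, sq_im] at this
      simp at this
      have h3 : 0 < Real.sqrt l := by positivity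
      have h4 : (0 : ℝ) < A := by exact_mod_cast hA
      have := mul_pos h4 τ.im_pos
      linarith
  exact ⟨h2, by rw [h2]; linear_combination h⟩

lemma Hl_form {l : ℕ} (τ : ℍ) {A B C : ℤ}
    (h1 : sq l = A * τ + B) (h2 : sq l * τ = -B * τ - C) : (A : ℂ) * τ ^ 2 + 2 * B * τ + C = 0 := by
  rw [h1] at h2; linear_combination h2

lemma Hom_of_lin {l : ℕ} {τ : ℍ} (h : τ ∈ Hom l) : ∀ x, inL τ x → inL τ (om l * x) := by
  rintro x ⟨m, n, rfl⟩
  convert inL_lin h.1 h.2 m n using 1; ring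

lemma Hl_of_lin {l : ℕ} {τ : ℍ} (h : τ ∈ Hl l) : ∀ x, inL τ x → inL τ (sq l * x) := by
  rintro x ⟨m, n, rfl⟩
  convert inL_lin h.1 h.2 m n using 1; ring

lemma Hom_jq {l : ℕ} {τ τ' : ℍ} (h : jq τ = jq τ') (hτ : τ ∈ Hom l) : τ' ∈ Hom l := by
  obtain ⟨lam, h0, hx⟩ := jq_eq_iff.1 h
  have : ∀ x, inL τ' x → inL τ' (om l * x) := by
    intro x h
    rw [hx] at h ⊢
    convert Hom_of_lin hτ _ h using 1; ring
  exact ⟨by simpa using this 1 (inL_one _), this _ (inL_self _)⟩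

lemma Hl_jq {l : ℕ} {τ τ' : ℍ} (h : jq τ = jq τ') (hτ : τ ∈ Hl l) : τ' ∈ Hl l := by
  obtain ⟨lam, h0, hx⟩ := jq_eq_iff.1 h
  have : ∀ x, inL τ' x → inL τ' (sq l * x) := by
    intro x h
    rw [hx] at h ⊢
    convert Hl_of_lin hτ _ h using 1; ring
  exact ⟨by simpa using this 1 (inL_one _), this _ (inL_self _)⟩

lemma Hom_sub_Hl {l : ℕ} : Hom l ⊆ Hl l := by
  intro τ hτ
  have e : ∃ a b : ℤ, sq l = a * om l + b := by
    unfold om; split_ifs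
    · exact ⟨1, 0, by simp⟩
    · exact ⟨2, -1, by push_cast; ring⟩
  obtain ⟨a, b, e⟩ := e
  constructor
  · rw [e]; convert inL_lin hτ.1 (inL_one _) a b using 1; ring
  · rw [e]; convert inL_lin hτ.2 (inL_self _) a b using 1; ring

lemma sq_mul_eq {l : ℕ} (hp : l.Prime) {m x y : ℤ} (hm : ¬ (l : ℤ) ∣ m) (hm0 : m ≠ 0)
    (h : l * x ^ 2 = m * y ^ 2) : x = 0 := by
  by_contra hx
  have : Fact l.Prime := ⟨hp⟩
  have hy : y ≠ 0 := by
    rintro rfl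
    simp at h
    rcases h with h | h
    · exact hp.ne_zero h
    · exact hx h
  have h1 := congrArg (padicValInt l) h
  rw [padicValInt.mul (by exact_mod_cast hp.ne_zero) (pow_ne_zero _ hx),
    padicValInt.mul hm0 (pow_ne_zero _ hy), pow_two, pow_two, padicValInt.mul hx hx, padicValInt.mul hy hy,
    padicValInt.eq_zero_of_not_dvd hm] at h1
  have : padicValInt l (l : ℤ) = 1 := by
    rw [padicValInt.of_nat]; exact padicValNat.self hp.one_lt
  omega

/-- stabilizer of a point of `Hl` -/
theorem stab_Hl {l : ℕ} (hp : l.Prime) (h3 : 3 < l) {τ : ℍ} (hτ : τ ∈ Hl l) {γ : SL(2, ℤ)}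
    (h : γ • τ = τ) : γ 1 0 = 0 ∧ γ 0 1 = 0 ∧ γ 0 0 = γ 1 1 ∧ (γ 1 1 = 1 ∨ γ 1 1 = -1) := by
  obtain ⟨A, B, C, hA, hd, h1, h2⟩ := (Hl_iff hp.pos τ).1 hτ
  have hq := Hl_form τ h1 h2
  have hs := smul_eq γ τ
  rw [h] at hs
  have hdet : γ 0 0 * γ 1 1 - γ 0 1 * γ 1 0 = 1 := by
    have := γ.det_coe
    rwa [Matrix.det_fin_two] at this
  generalize γ 0 0 = a at *
  generalize γ 0 1 = b at *
  generalize γ 1 0 = c at *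
  generalize γ 1 1 = d at *
  -- A (d-a) = 2 B c , -A b = C c
  have h4 : (((-A * b : ℤ)) : ℂ) + ((A * (d - a) : ℤ) : ℂ) * τ = ((c * C : ℤ) : ℂ) + ((2 * B * c : ℤ) : ℂ) * τ := by
    push_cast
    linear_combination A * hs - c * hq
  obtain ⟨h5, h6⟩ := lin_indepZ (hne τ) h4
  have h7 : l * (2 * c) ^ 2 = (4 - (a + d) ^ 2) * A ^ 2 := by
    rw [← hd]
    have : (a + d) ^ 2 = (d - a) ^ 2 + 4 * (1 + b * c) := by rw [← hdet]; ring
    rw [this]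
    linear_combination -4 * c * A * h5 + (A * (d - a) + 2 * B * c) * h6
  have h5l : 5 ≤ l := by
    by_contra h
    have : l = 4 := by omega
    subst this; norm_num at hp
  have hc : c = 0 := by
    by_contra hc
    have hpos : 0 < l * (2 * c) ^ 2 := by
      have : 0 < c ^ 2 := by positivity
      have : (0 : ℤ) < l := by exact_mod_cast hp.pos
      positivity
    rw [h7] at hpos
    have ht : 0 < 4 - (a + d) ^ 2 := (pos_iff_pos_of_mul_pos hpos).2 (by positivity)
    have hle : 4 - (a + d) ^ 2 ≤ 4 := by nlinarith [sq_nonneg (a + d)]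
    have := sq_mul_eq hp (m := 4 - (a + d) ^ 2) (x := 2 * c) (y := A) (fun hdvd => by
      have := Int.le_of_dvd ht hdvd
      omega) (by omega) h7
    omega
  subst hc
  have hb : b = 0 := by
    have : A * b = 0 := by linarith
    rcases mul_eq_zero.1 this with h | h
    · omega
    · exact h
  have had : a = d := by
    have : A * (d - a) = 0 := by linarith
    rcases mul_eq_zero.1 this with h | h
    · omega
    · omega
  subst hb had
  refine ⟨rfl, rfl, rfl, ?_⟩
  exact Int.eq_one_or_neg_one_of_mul_eq_one (by linarith : a * a = 1)

/-- the parity form attached to index `i` -/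
def ef (i : Fin 3) (m n : ℤ) : ℤ := if i = 0 then n else if i = 1 then m else m + n

def Lam (i : Fin 3) (t x : ℂ) : Prop := ∃ m n : ℤ, x = m + n * t ∧ 2 ∣ ef i m n

lemma Lam_iff {i : Fin 3} {t : ℂ} (ht : t.im ≠ 0) {m n : ℤ} : Lam i t (m + n * t) ↔ 2 ∣ ef i m n := by
  constructor
  · rintro ⟨m', n', h, hd⟩
    obtain ⟨rfl, rfl⟩ := lin_indepZ ht h
    exact hd
  · intro h; exact ⟨m, n, rfl, h⟩

noncomputable def sp (i : Fin 3) (τ : ℍ) : ℍ :=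
  if i = 0 then ⟨2 * τ, by simpa using τ.im_pos⟩
  else if i = 1 then ⟨τ / 2, by simpa using τ.im_pos⟩
  else ⟨(τ + 1) / 2, by simpa using τ.im_pos⟩

lemma sp_iff (i : Fin 3) (τ : ℍ) : ∃ k : ℂ, k ≠ 0 ∧ ∀ x, inL (sp i τ) x ↔ Lam i τ (k * x) := by
  fin_cases i
  · refine ⟨1, one_ne_zero, fun x => ⟨?_, ?_⟩⟩
    · rintro ⟨m, n, rfl⟩
      exact ⟨m, 2 * n, by simp [sp]; ring, by simp [ef]⟩
    · rintro ⟨m, n, h, hd⟩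
      obtain ⟨n', rfl⟩ : 2 ∣ n := by simpa [ef] using hd
      exact ⟨m, n', by simp [sp] at h ⊢; rw [h]; ring⟩
  · refine ⟨2, two_ne_zero, fun x => ⟨?_, ?_⟩⟩
    · rintro ⟨m, n, rfl⟩
      exact ⟨2 * m, n, by simp [sp]; ring, by simp [ef]⟩
    · rintro ⟨m, n, h, hd⟩
      obtain ⟨n', rfl⟩ : 2 ∣ m := by simpa [ef] using hd
      exact ⟨n', n, by simp [sp] at h ⊢; linear_combination h / 2⟩
  · refine ⟨2, two_ne_zero, fun x => ⟨?_, ?_⟩⟩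
    · rintro ⟨m, n, rfl⟩
      exact ⟨2 * m + n, n, by simp [sp]; ring, by simp [ef]; omega⟩
    · rintro ⟨m, n, h, hd⟩
      obtain ⟨k, hk⟩ : 2 ∣ m + n := by simpa [ef] using hd
      obtain rfl : m = 2 * k - n := by omega
      exact ⟨k - n, n, by simp [sp] at h ⊢; linear_combination h / 2⟩

lemma sp_jq {i i' : Fin 3} {τ τ' : ℍ} : jq (sp i τ) = jq (sp i' τ') ↔
    ∃ lam : ℂ, lam ≠ 0 ∧ ∀ x, Lam i' τ' x ↔ Lam i τ (lam * x) := by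
  obtain ⟨k, hk, h⟩ := sp_iff i τ
  obtain ⟨k', hk', h'⟩ := sp_iff i' τ'
  rw [jq_eq_iff]
  constructor
  · rintro ⟨lam, h0, hx⟩
    refine ⟨k * lam / k', by positivity, fun x => ?_⟩
    have := hx (x / k')
    rw [h, h'] at this
    convert this using 2 <;> field_simp
  · rintro ⟨lam, h0, hx⟩
    refine ⟨k' * lam / k, by positivity, fun x => ?_⟩
    rw [h, h', hx]
    convert Iff.rfl using 2 <;> field_simp

end HK

namespace HK
open UpperHalfPlane
open scoped MatrixGroups

lemma Lam_sub {i : Fin 3} {t x : ℂ} (h : Lam i t x) : inL t x := by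
  obtain ⟨m, n, h, -⟩ := h; exact ⟨m, n, h⟩

lemma Lam_lin {i : Fin 3} {t x y : ℂ} (hx : Lam i t x) (hy : Lam i t y) (m n : ℤ) :
    Lam i t (m * x + n * y) := by
  obtain ⟨a, b, rfl, h1⟩ := hx
  obtain ⟨c, d, rfl, h2⟩ := hy
  refine ⟨m * a + n * c, m * b + n * d, by push_cast; ring, ?_⟩
  have : ef i (m * a + n * c) (m * b + n * d) = m * ef i a b + n * ef i c d := by
    unfold ef; split_ifs <;> ring
  rw [this]
  exact dvd_add (dvd_mul_of_dvd_right h1 _) (dvd_mul_of_dvd_right h2 _)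

lemma Lam_two {i : Fin 3} {t x : ℂ} (h : inL t x) : Lam i t (2 * x) := by
  obtain ⟨m, n, rfl⟩ := h
  refine ⟨2 * m, 2 * n, by push_cast; ring, ?_⟩
  unfold ef; split_ifs
  · simp
  · simp
  · omega

/-- two elements outside the sublattice differ by an element of the sublattice -/
lemma Lam_diff {i : Fin 3} {t x y : ℂ} (hx : inL t x) (hy : inL t y) (h1 : ¬ Lam i t x)
    (h2 : ¬ Lam i t y) : Lam i t (x - y) := by
  obtain ⟨a, b, rfl⟩ := hx
  obtain ⟨c, d, rfl⟩ := hy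
  refine ⟨a - c, b - d, by push_cast; ring, ?_⟩
  have h1' : ¬ 2 ∣ ef i a b := fun h => h1 ⟨a, b, rfl, h⟩
  have h2' : ¬ 2 ∣ ef i c d := fun h => h2 ⟨c, d, rfl, h⟩
  unfold ef at *; split_ifs at * <;> omega

lemma om_sq {l : ℕ} (h : l % 4 = 3) : om l ^ 2 = om l - ((l + 1) / 4 : ℕ) ∧ sq l = 2 * om l - 1 := by
  have h1 : om l = (1 + sq l) / 2 := by unfold om; rw [if_neg (by omega)]
  obtain ⟨k, hk⟩ : ∃ k : ℕ, l + 1 = 4 * k := ⟨(l + 1) / 4, by omega⟩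
  have hk2 : (l + 1) / 4 = k := by omega
  have hk' : (l : ℂ) = 4 * k - 1 := by
    have : ((l : ℂ) + 1) = 4 * k := by exact_mod_cast hk
    rw [← this]; ring
  constructor
  · rw [h1, hk2]
    have := sq_sq l
    rw [hk'] at this
    linear_combination this / 4
  · rw [h1]; ring

lemma Lam_stable_iff {l : ℕ} {i : Fin 3} {τ : ℍ} : sp i τ ∈ Hom l ↔ ∀ x, Lam i τ x → Lam i τ (om l * x) := by
  obtain ⟨k, hk, h⟩ := sp_iff i τ
  constructor
  · intro hs x hx
    have := (h (x / k)).2 (by rwa [mul_div_cancel₀ _ hk])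
    have := (h _).1 (Hom_of_lin hs _ this)
    convert this using 1; field_simp
  · intro hs
    have : ∀ x, inL (sp i τ) x → inL (sp i τ) (om l * x) := by
      intro x hx
      rw [h] at hx ⊢
      convert hs _ hx using 1; ring
    exact ⟨by simpa using this 1 (inL_one _), this _ (inL_self _)⟩

lemma sp_mem_Hl {l : ℕ} (hl : l % 4 = 3) (i : Fin 3) {τ : ℍ} (hτ : τ ∈ Hom l) : sp i τ ∈ Hl l := by
  obtain ⟨k, hk, h⟩ := sp_iff i τ
  have : ∀ x, inL (sp i τ) x → inL (sp i τ) (sq l * x) := by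
    intro x hx
    rw [h] at hx ⊢
    rw [(om_sq hl).2]
    have h2 := Lam_two (i := i) (Hom_of_lin hτ _ (Lam_sub hx))
    convert Lam_lin h2 hx 1 (-1) using 1; push_cast; ring
  exact ⟨by simpa using this 1 (inL_one _), this _ (inL_self _)⟩

/-- which sublattices are stable -/
lemma stable_parity {l : ℕ} (hp : l.Prime) (hl : l % 4 = 3) {τ : ℍ} (hτ : τ ∈ Hom l) :
    ∃ b c : ℤ, (2 ∣ b * c ↔ 2 ∣ (l + 1) / 4) ∧ (sp 0 τ ∈ Hom l ↔ 2 ∣ c) ∧ (sp 1 τ ∈ Hom l ↔ 2 ∣ b) ∧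
      (sp 2 τ ∈ Hom l ↔ ¬ 2 ∣ b + c) := by
  have hτ' := hτ
  obtain ⟨⟨d, c, h1⟩, ⟨b, a, h2⟩⟩ := hτ
  obtain ⟨h3, -⟩ := om_sq hl
  set N := (l + 1) / 4
  have h4 : (((a * d - b * c - N : ℤ)) : ℂ) + ((1 - a - d : ℤ) : ℂ) * om l
      = ((0 : ℤ) : ℂ) + ((0 : ℤ) : ℂ) * om l := by
    push_cast
    have e : (om l - a) * (om l - d) = b * c := by
      have : om l - d = c * τ := by rw [h1]; ring
      rw [this]
      linear_combination c * h2
    linear_combination e - h3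
  obtain ⟨h5, h6⟩ := lin_indepZ (om_im_ne hp.pos) h4
  have hev : ∃ k, a * d = 2 * k := by
    obtain rfl : d = 1 - a := by omega
    rcases Int.even_or_odd' a with ⟨k, hk | hk⟩
    · exact ⟨k * (1 - a), by rw [hk]; ring⟩
    · exact ⟨-a * k, by rw [hk]; ring⟩
  obtain ⟨k, hk⟩ := hev
  refine ⟨b, c, by omega, ?_, ?_, ?_⟩
  · rw [Lam_stable_iff]
    constructor
    · intro h
      have := h 1 ⟨1, 0, by simp, by simp [ef]⟩
      rw [mul_one, h1, Lam_iff (hne τ)] at this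
      simpa [ef] using this
    · rintro ⟨c', rfl⟩ x ⟨m, n, rfl, hd⟩
      obtain ⟨n', rfl⟩ : 2 ∣ n := by simpa [ef] using hd
      have k1 : Lam 0 τ (om l) := ⟨d, 2 * c', h1, by simp [ef]⟩
      have k2 : Lam 0 τ (2 * (om l * τ)) := Lam_two hτ'.2
      convert Lam_lin k1 k2 m n' using 1
      push_cast; ring
  · rw [Lam_stable_iff]
    constructor
    · intro h
      have := h τ ⟨0, 1, by simp, by simp [ef]⟩
      rw [h2, Lam_iff (hne τ)] at this
      simpa [ef] using this
    · rintro ⟨c', rfl⟩ x ⟨m, n, rfl, hd⟩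
      obtain ⟨m', rfl⟩ : 2 ∣ m := by simpa [ef] using hd
      have k1 : Lam 1 τ (om l * τ) := ⟨2 * c', a, h2, by simp [ef]⟩
      have k2 : Lam 1 τ (2 * (om l)) := Lam_two hτ'.1
      convert Lam_lin k1 k2 n m' using 1
      push_cast; ring
  · rw [Lam_stable_iff]
    have e : om l * (1 + τ) = ((d + b : ℤ) : ℂ) + ((c + a : ℤ) : ℂ) * τ := by
      push_cast; linear_combination h1 + h2
    constructor
    · intro h
      have := h (1 + τ) ⟨1, 1, by simp, by simp [ef]⟩
      rw [e, Lam_iff (hne τ)] at this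
      simp [ef] at this
      omega
    · rintro hodd x ⟨m, n, rfl, hd⟩
      obtain ⟨k, hk⟩ : 2 ∣ m + n := by simpa [ef] using hd
      obtain rfl : m = 2 * k - n := by omega
      have k1 : Lam 2 τ (om l * (1 + τ)) := ⟨d + b, c + a, e, by simp [ef]; omega⟩
      have k2 : Lam 2 τ (2 * (om l)) := Lam_two hτ'.1
      have k3 : Lam 2 τ (2 * (om l)) := Lam_two hτ'.1
      convert Lam_lin (Lam_lin k1 k2 n k) k3 1 (-n) using 1
      push_cast; ring

/-- every non-maximal point comes from a maximal one -/
lemma exists_parent {l : ℕ} (hp : l.Prime) (hl : l % 4 = 3) {σ : ℍ} (h : σ ∈ Hl l) (hn : σ ∉ Hom l) :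
    ∃ τ ∈ Hom l, ∃ i, jq σ = jq (sp i τ) := by
  obtain ⟨A, B, C, hA, hd, h1, h2⟩ := (Hl_iff hp.pos σ).1 h
  have hom : om l = (1 + sq l) / 2 := by unfold om; rw [if_neg (by omega)]
  have hmod4 : (A * C - B ^ 2) % 4 = 3 := by rw [hd]; omega
  have jrefl : ∀ {x y : ℍ}, x = y → jq x = jq y := fun h => by rw [h]
  have h2C : (2 : ℂ) ≠ 0 := two_ne_zero
  rcases Int.even_or_odd' B with ⟨B', hB | hB⟩
  · -- B even, A C odd
    have hAo : A % 2 = 1 ∧ C % 2 = 1 := by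
      rcases Int.even_or_odd' A with ⟨A', hA' | hA'⟩
      · exfalso
        have : A * C - B ^ 2 = 2 * (A' * C - 2 * B' ^ 2) := by rw [hA', hB]; ring
        omega
      · rcases Int.even_or_odd' C with ⟨C', hC' | hC'⟩
        · exfalso
          have : A * C - B ^ 2 = 2 * (A * C' - 2 * B' ^ 2) := by rw [hC', hB]; ring
          omega
        · omega
    obtain ⟨A', hA'⟩ : ∃ A', A = 2 * A' + 1 := ⟨A / 2, by omega⟩
    obtain ⟨C', hC'⟩ : ∃ C', C = 2 * C' + 1 := ⟨C / 2, by omega⟩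
    -- tau = (1+σ)/2 ; sq = 2Aτ - A + B
    have hAC : (A - 2 * B + C) % 4 = 0 := by
      have : A * C - B ^ 2 = 4 * (A' * C' - B' ^ 2) + 2 * A' + 2 * C' + 1 := by rw [hA', hB, hC']; ring
      omega
    obtain ⟨D, hD⟩ : ∃ D, A - 2 * B + C = 4 * D := ⟨(A - 2 * B + C) / 4, by omega⟩
    have hpos : 0 < (((σ : ℂ) + 1) / 2).im := by simpa using σ.im_pos
    refine ⟨⟨((σ : ℂ) + 1) / 2, hpos⟩, ⟨⟨(B' - A'), A, ?_⟩, ⟨-D, (A' + 1 - B'), ?_⟩⟩, 0, ?_⟩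
    · simp only
      rw [hom, h1, hB]
      have : (A : ℂ) = 2 * A' + 1 := by exact_mod_cast hA'
      push_cast
      rw [this]; ring
    · simp only
      have e1 : (A : ℂ) = 2 * A' + 1 := by exact_mod_cast hA'
      have e2 : (A : ℂ) - 2 * B + C = 4 * D := by exact_mod_cast hD
      have e3 : (B : ℂ) = 2 * B' := by exact_mod_cast hB
      have e4 : om l * (((σ : ℂ) + 1) / 2) = (1 + σ + sq l * σ + sq l) / 4 := by rw [hom]; ring
      rw [e4, h2, h1]
      push_cast
      linear_combination e1 * (1/4 * σ + 1/4) - e2 / 4 - e3 * (1 / 4 * σ + 1 / 4)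
    · rw [jq_eq_iff]
      refine ⟨1, one_ne_zero, fun x => ⟨?_, ?_⟩⟩
      · rintro ⟨m, n, rfl⟩
        exact ⟨m + n, n, by simp [sp]; ring⟩
      · rintro ⟨m, n, h⟩
        exact ⟨m - n, n, by simp [sp] at h ⊢; rw [h]; ring⟩
  · have hAC4 : (A * C) % 4 = 0 := by
      have : A * C - B ^ 2 = A * C - 4 * (B' ^ 2 + B') - 1 := by rw [hB]; ring
      omega
    have e3 : (B : ℂ) = 2 * B' + 1 := by exact_mod_cast hB
    by_cases hAe : 2 ∣ A
    · by_cases hCe : 2 ∣ C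
      · exfalso
        obtain ⟨A', hA'⟩ := hAe
        obtain ⟨C', hC'⟩ := hCe
        have e1 : (A : ℂ) = 2 * A' := by exact_mod_cast hA'
        have e2 : (C : ℂ) = 2 * C' := by exact_mod_cast hC'
        apply hn
        refine ⟨⟨B' + 1, A', ?_⟩, ⟨-C', -B', ?_⟩⟩
        · rw [hom, h1, e1, e3]; push_cast; ring
        · have : om l * σ = (σ + sq l * σ) / 2 := by rw [hom]; ring
          rw [this, h2, e2, e3]; push_cast; ring
      · -- 4 | A
        have h4A : 4 ∣ A := by
          have hcop : IsCoprime (4 : ℤ) C := by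
            rw [show (4 : ℤ) = 2 ^ 2 by norm_num]
            exact IsCoprime.pow_left ((Int.prime_two.coprime_iff_not_dvd).2 hCe)
          exact hcop.dvd_of_dvd_mul_right (Int.dvd_of_emod_eq_zero hAC4)
        obtain ⟨A', hA'⟩ := h4A
        have e1 : (A : ℂ) = 4 * A' := by exact_mod_cast hA'
        have hpos : 0 < (2 * (σ : ℂ)).im := by simpa using σ.im_pos
        refine ⟨⟨2 * (σ : ℂ), hpos⟩, ⟨⟨B' + 1, A', ?_⟩, ⟨-C, -B', ?_⟩⟩, 1, ?_⟩
        · simp only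
          rw [hom, h1, e1, e3]; push_cast; ring
        · simp only
          have : om l * (2 * σ) = (σ + sq l * σ) := by rw [hom]; ring
          rw [this, h2, e3]; push_cast; ring
        · apply jrefl
          ext
          simp [sp]
    · have h4C : 4 ∣ C := by
        have hcop : IsCoprime (4 : ℤ) A := by
          rw [show (4 : ℤ) = 2 ^ 2 by norm_num]
          exact IsCoprime.pow_left ((Int.prime_two.coprime_iff_not_dvd).2 hAe)
        exact hcop.dvd_of_dvd_mul_left (Int.dvd_of_emod_eq_zero hAC4)
      obtain ⟨C', hC'⟩ := h4C
      have e2 : (C : ℂ) = 4 * C' := by exact_mod_cast hC'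
      have hpos : 0 < ((σ : ℂ) / 2).im := by simpa using σ.im_pos
      refine ⟨⟨(σ : ℂ) / 2, hpos⟩, ⟨⟨B' + 1, A, ?_⟩, ⟨-C', -B', ?_⟩⟩, 0, ?_⟩
      · simp only
        rw [hom, h1, e3]; push_cast; ring
      · simp only
        have : om l * (σ / 2) = (σ + sq l * σ) / 4 := by rw [hom]; ring
        rw [this, h2, e2, e3]; push_cast; ring
      · apply jrefl
        ext
        simp [sp]
        field_simp

end HK

namespace HK
open UpperHalfPlane
open scoped MatrixGroups

lemma sp_transfer {τ τ' : ℍ} (h : jq τ = jq τ') (i : Fin 3) : ∃ i', jq (sp i τ) = jq (sp i' τ') := by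
  obtain ⟨lam, h0, hx⟩ := jq_eq_iff.1 h
  obtain ⟨m0, n0, h1⟩ := (hx 1).1 (inL_one _)
  obtain ⟨m1, n1, h2⟩ := (hx τ').1 (inL_self _)
  rw [mul_one] at h1
  have key : ∀ m n : ℤ, Lam i τ (lam * (m + n * τ')) ↔ 2 ∣ m * ef i m0 n0 + n * ef i m1 n1 := by
    intro m n
    have e : lam * (m + n * τ') = ((m * m0 + n * m1 : ℤ) : ℂ) + ((m * n0 + n * n1 : ℤ) : ℂ) * τ := by
      push_cast; linear_combination m * h1 + n * h2
    rw [e, Lam_iff (hne τ)]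
    have : ef i (m * m0 + n * m1) (m * n0 + n * n1) = m * ef i m0 n0 + n * ef i m1 n1 := by
      unfold ef; split_ifs <;> ring
    rw [this]
  have hnot : ¬ (2 ∣ ef i m0 n0 ∧ 2 ∣ ef i m1 n1) := by
    rintro ⟨ha, hb⟩
    have all : ∀ x, inL τ x → Lam i τ x := by
      intro x hxx
      have : inL τ' (x / lam) := by rw [hx]; rwa [mul_div_cancel₀ _ h0]
      obtain ⟨m, n, e⟩ := this
      have := (key m n).2 (dvd_add (dvd_mul_of_dvd_right ha _) (dvd_mul_of_dvd_right hb _))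
      rw [← e, mul_div_cancel₀ _ h0] at this
      exact this
    have k1 := all (((1 : ℤ) : ℂ) + (0 : ℤ) * τ) ⟨_, _, rfl⟩
    have k2 := all (((0 : ℤ) : ℂ) + (1 : ℤ) * τ) ⟨_, _, rfl⟩
    rw [Lam_iff (hne τ)] at k1 k2
    fin_cases i <;> simp [ef] at k1 k2
  have fin : ∀ i' : Fin 3, (∀ m n : ℤ, 2 ∣ ef i' m n ↔ 2 ∣ m * ef i m0 n0 + n * ef i m1 n1) →
      jq (sp i τ) = jq (sp i' τ') := by
    intro i' hi
    rw [sp_jq]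
    refine ⟨lam, h0, fun x => ⟨?_, ?_⟩⟩
    · rintro ⟨m, n, rfl, hd⟩
      exact (key m n).2 ((hi m n).1 hd)
    · intro hL
      have : inL τ' x := (hx x).2 (Lam_sub hL)
      obtain ⟨m, n, rfl⟩ := this
      exact ⟨m, n, rfl, (hi m n).2 ((key m n).1 hL)⟩
  generalize ef i m0 n0 = p at *
  generalize ef i m1 n1 = q at *
  rcases Int.even_or_odd' p with ⟨p', hp | hp⟩ <;> rcases Int.even_or_odd' q with ⟨q', hq | hq⟩
  · exact absurd ⟨⟨p', hp⟩, ⟨q', hq⟩⟩ hnot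
  · refine ⟨0, fin 0 fun m n => ?_⟩
    have : m * p + n * q = n + 2 * (m * p' + n * q') := by rw [hp, hq]; ring
    rw [this]; simp [ef]
  · refine ⟨1, fin 1 fun m n => ?_⟩
    have : m * p + n * q = m + 2 * (m * p' + n * q') := by rw [hp, hq]; ring
    rw [this]; simp [ef]
  · refine ⟨2, fin 2 fun m n => ?_⟩
    have : m * p + n * q = m + n + 2 * (m * p' + n * q') := by rw [hp, hq]; ring
    rw [this]; simp [ef]

lemma hull {l : ℕ} {τ : ℍ} (hτ : τ ∈ Hom l) {i : Fin 3} (hn : sp i τ ∉ Hom l) (x : ℂ) :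
    inL τ x ↔ ∃ u v, Lam i τ u ∧ Lam i τ v ∧ x = u + om l * v := by
  constructor
  · intro hx
    rw [Lam_stable_iff] at hn
    push Not at hn
    obtain ⟨v, hv, hv2⟩ := hn
    by_cases hL : Lam i τ x
    · exact ⟨x, 0, hL, ⟨0, 0, by simp, by unfold ef; simp⟩, by simp⟩
    · exact ⟨x - om l * v, v, Lam_diff hx (Hom_of_lin hτ _ (Lam_sub hv)) hL hv2, hv, by ring⟩
  · rintro ⟨u, v, hu, hv, rfl⟩
    exact inL_add (Lam_sub hu) (Hom_of_lin hτ _ (Lam_sub hv))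

lemma sp_inj1 {l : ℕ} {τ τ' : ℍ} (hτ : τ ∈ Hom l) (hτ' : τ' ∈ Hom l) {i i' : Fin 3}
    (hn : sp i τ ∉ Hom l) (hn' : sp i' τ' ∉ Hom l) {lam : ℂ} (h0 : lam ≠ 0)
    (h : ∀ x, Lam i' τ' x ↔ Lam i τ (lam * x)) : ∀ x, inL τ' x ↔ inL τ (lam * x) := by
  intro x
  rw [hull hτ hn, hull hτ' hn']
  constructor
  · rintro ⟨u, v, hu, hv, rfl⟩
    exact ⟨lam * u, lam * v, (h _).1 hu, (h _).1 hv, by ring⟩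
  · rintro ⟨u, v, hu, hv, e⟩
    refine ⟨u / lam, v / lam, (h _).2 (by rwa [mul_div_cancel₀ _ h0]),
      (h _).2 (by rwa [mul_div_cancel₀ _ h0]), ?_⟩
    field_simp
    linear_combination e

lemma sp_inj {l : ℕ} (hp : l.Prime) (h3 : 3 < l) {τ τ' : ℍ} (hτ : τ ∈ Hom l) (hτ' : τ' ∈ Hom l)
    {i i' : Fin 3} (hn : sp i τ ∉ Hom l) (hn' : sp i' τ' ∉ Hom l)
    (h : jq (sp i τ) = jq (sp i' τ')) : jq τ = jq τ' ∧ (τ = τ' → i = i') := by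
  obtain ⟨lam, h0, hx⟩ := sp_jq.1 h
  have hh := sp_inj1 hτ hτ' hn hn' h0 hx
  refine ⟨jq_eq_iff.2 ⟨lam, h0, hh⟩, ?_⟩
  rintro rfl
  obtain ⟨γ, hγ, hlam⟩ := homothety (τ := τ) (τ' := τ) h0 (by simpa using (hh 1).1 (inL_one _))
      ((hh _).1 (inL_self _))
      ((hh _).2 (by simpa [h0] using inL_one _))
      ((hh _).2 (by rw [← mul_assoc, mul_inv_cancel₀ h0, one_mul]; exact inL_self _))
  obtain ⟨g1, g2, g3, g4⟩ := stab_Hl hp h3 (Hom_sub_Hl hτ) hγ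
  have key : ∀ x, Lam i' τ x ↔ Lam i τ x := by
    intro x
    rw [hx, hlam, g1]
    rcases g4 with g4 | g4
    · rw [g4]; simp
    · rw [g4]
      constructor
      · intro k; convert Lam_lin k k (-1) 0 using 1; push_cast; ring
      · intro k; convert Lam_lin k k (-1) 0 using 1; push_cast; ring
  have k1 := key (((1 : ℤ) : ℂ) + (0 : ℤ) * τ)
  have k2 := key (((0 : ℤ) : ℂ) + (1 : ℤ) * τ)
  rw [Lam_iff (hne τ), Lam_iff (hne τ)] at k1 k2
  fin_cases i <;> fin_cases i' <;> simp [ef] at k1 k2 ⊢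

/-- the number of classes -/
noncomputable def hcount (l : ℕ) (h : ℕ) : ℕ :=
  if l % 4 = 1 then h else if l % 8 = 7 then 2 * h else 4 * h

theorem card_Hl (l : ℕ) (hp : l.Prime) (h3 : 3 < l) (h : ℕ) (hh : 0 < h)
    (hcl : (jq '' Hom l).ncard = h) : (jq '' Hl l).ncard = hcount l h := by
  have hodd : l % 2 = 1 := (hp.eq_two_or_odd).resolve_left (by omega)
  have hfin : (jq '' Hom l).Finite := Set.finite_of_ncard_pos (by omega)
  unfold hcount
  split_ifs with h4 h8
  · rw [← hcl]
    congr 2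
    unfold Hl Hom om
    rw [if_pos h4]
  all_goals
    have hl3 : l % 4 = 3 := by omega
    have hrep : ∀ q : MulAction.orbitRel.Quotient SL(2, ℤ) ℍ, ∃ τ, jq τ = q := fun q =>
      Quotient.inductionOn' q fun τ => ⟨τ, rfl⟩
    choose T hT using hrep
    have hTH : ∀ q ∈ jq '' Hom l, T q ∈ Hom l := by
      rintro _ ⟨τ, hτ, rfl⟩
      exact Hom_jq (hT (jq τ)).symm hτ
    set N : Set ℍ := {τ ∈ Hl l | τ ∉ Hom l} with hN
    have hunion : jq '' Hl l = jq '' Hom l ∪ jq '' N := by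
      rw [← Set.image_union]
      congr 1
      ext τ
      by_cases hτ : τ ∈ Hom l
      · simp [hτ, hN, Hom_sub_Hl hτ]
      · simp [hτ, hN]
    have hdisj : Disjoint (jq '' Hom l) (jq '' N) := by
      rw [Set.disjoint_left]
      rintro _ ⟨τ, hτ, rfl⟩ ⟨σ, hσ, e⟩
      exact hσ.2 (Hom_jq e.symm hτ)
    have hNimg : jq '' N = (fun p : _ × Fin 3 => jq (sp p.2 (T p.1))) ''
        {p | p.1 ∈ jq '' Hom l ∧ sp p.2 (T p.1) ∉ Hom l} := by
      ext q
      constructor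
      · rintro ⟨σ, hσ, rfl⟩
        obtain ⟨τ, hτ, i, hi⟩ := exists_parent hp hl3 hσ.1 hσ.2
        obtain ⟨i', hi'⟩ := sp_transfer (hT (jq τ)).symm i
        refine ⟨(jq τ, i'), ⟨⟨τ, hτ, rfl⟩, ?_⟩, ?_⟩
        · intro hbad
          exact hσ.2 (Hom_jq (hi.trans hi').symm hbad)
        · exact (hi.trans hi').symm
      · rintro ⟨⟨q', i⟩, ⟨h1, h2⟩, rfl⟩
        exact ⟨_, ⟨sp_mem_Hl hl3 i (hTH _ h1), h2⟩, rfl⟩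
    have hinj : Set.InjOn (fun p : _ × Fin 3 => jq (sp p.2 (T p.1)))
        {p | p.1 ∈ jq '' Hom l ∧ sp p.2 (T p.1) ∉ Hom l} := by
      rintro ⟨q, i⟩ ⟨h1, h2⟩ ⟨q', i'⟩ ⟨h1', h2'⟩ e
      obtain ⟨e1, e2⟩ := sp_inj hp h3 (hTH _ h1) (hTH _ h1') h2 h2' e
      simp only [hT] at e1
      subst e1
      exact Prod.ext rfl (e2 rfl)
    have hfinN : {p : MulAction.orbitRel.Quotient SL(2, ℤ) ℍ × Fin 3 | p.1 ∈ jq '' Hom l ∧ sp p.2 (T p.1) ∉ Hom l}.Finite :=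
      (hfin.prod (Set.finite_univ (α := Fin 3))).subset fun p hp => ⟨hp.1, trivial⟩
    have hNc := Set.InjOn.ncard_image hinj
    rw [← hNimg] at hNc
    have hNf : (jq '' N).Finite := by rw [hNimg]; exact hfinN.image _
    rw [hunion, Set.ncard_union_eq hdisj hfin hNf, hNc, hcl]
  · -- exactly one
    have hev : 2 ∣ (l + 1) / 4 := by omega
    have hex : ∀ q, ∃ i : Fin 3, q ∈ jq '' Hom l → ∀ j, (sp j (T q) ∉ Hom l ↔ j = i) := by
      intro q
      by_cases hq : q ∈ jq '' Hom l
      · obtain ⟨b, c, h0, s0, s1, s2⟩ := stable_parity hp hl3 (hTH q hq)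
        have hbc := h0.2 hev
        rw [Int.prime_two.dvd_mul] at hbc
        have mk : ∀ i : Fin 3, (∀ j, (sp j (T q) ∉ Hom l ↔ j = i)) → ∃ i : Fin 3, q ∈ jq '' Hom l → ∀ j, (sp j (T q) ∉ Hom l ↔ j = i) :=
          fun i hi => ⟨i, fun _ => hi⟩
        by_cases hb : 2 ∣ b
        · by_cases hc : 2 ∣ c
          · apply mk 2
            intro j; fin_cases j <;> simp [s0, s1, s2, hb, hc]; omega
          · apply mk 0
            intro j; fin_cases j <;> simp [s0, s1, s2, hb, hc]; omega
        · have hc : 2 ∣ c := by tauto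
          apply mk 1
          intro j; fin_cases j <;> simp [s0, s1, s2, hb, hc]; omega
      · exact ⟨0, fun h => absurd h hq⟩
    choose f hf using hex
    have : {p : MulAction.orbitRel.Quotient SL(2, ℤ) ℍ × Fin 3 | p.1 ∈ jq '' Hom l ∧ sp p.2 (T p.1) ∉ Hom l}
        = (fun q => (q, f q)) '' (jq '' Hom l) := by
      ext ⟨q, i⟩
      constructor
      · rintro ⟨h1, h2⟩
        exact ⟨q, h1, by rw [(hf q h1 i).1 h2]⟩
      · rintro ⟨q', h1, e⟩
        simp only [Prod.mk.injEq] at e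
        obtain ⟨rfl, rfl⟩ := e
        exact ⟨h1, (hf q' h1 _).2 rfl⟩
    rw [this, Set.ncard_image_of_injective _ (fun a b e => (Prod.mk.inj e).1), hcl]
    ring
  · have hev : ¬ 2 ∣ (l + 1) / 4 := by omega
    have : {p : MulAction.orbitRel.Quotient SL(2, ℤ) ℍ × Fin 3 | p.1 ∈ jq '' Hom l ∧ sp p.2 (T p.1) ∉ Hom l}
        = (jq '' Hom l) ×ˢ (Set.univ : Set (Fin 3)) := by
      ext ⟨q, i⟩
      simp only [Set.mem_ofPred_eq, Set.mem_prod, Set.mem_univ, and_true, and_iff_left_iff_imp]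
      intro hq
      obtain ⟨b, c, h0, s0, s1, s2⟩ := stable_parity hp hl3 (hTH q hq)
      have hbc := mt h0.1 hev
      rw [Int.prime_two.dvd_mul] at hbc
      fin_cases i
      · simp [s0]; omega
      · simp [s1]; omega
      · simp [s2]; omega
    rw [this, Set.ncard_prod, hcl, Set.ncard_univ]
    simp; ring

end HK

namespace HK
open UpperHalfPlane
open scoped MatrixGroups

def S7 (l : ℕ) : Set ℍ := {τ | ∃ A B C : ℤ, 0 < A ∧ 7 ∣ A ∧ A * C - B ^ 2 = l ∧
  (A : ℂ) * τ ^ 2 + 2 * B * τ + C = 0}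

lemma form_unique {l : ℕ} {τ : ℍ} {A B A' B' : ℤ} (h : sq l = A * τ + B) (h' : sq l = A' * τ + B') :
    A = A' ∧ B = B' := by
  have := lin_indepZ (hne τ) (a := B) (b := A) (c := B') (d := A') (by rw [h] at h'; linear_combination h')
  exact ⟨this.2, this.1⟩

/-- transformation of the form under `γ` -/
lemma form_trans {l : ℕ} {τ τ' : ℍ} {γ : SL(2, ℤ)} (hγ : γ • τ = τ') {A B C A' B' : ℤ}
    (h1 : sq l = A * τ + B) (h2 : sq l * τ = -B * τ - C) (h' : sq l = A' * τ' + B') :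
    A' = A * γ 1 1 ^ 2 - 2 * B * γ 1 0 * γ 1 1 + C * γ 1 0 ^ 2 ∧
    B' = - A * γ 0 1 * γ 1 1 + B * (γ 0 0 * γ 1 1 + γ 0 1 * γ 1 0) - C * γ 0 0 * γ 1 0 := by
  have hs := smul_eq γ τ
  have h0 := den_ne γ τ
  rw [hγ] at hs
  have hdet : (γ 0 0 : ℂ) * γ 1 1 - γ 0 1 * γ 1 0 = 1 := by
    have := γ.det_coe
    rw [Matrix.det_fin_two] at this
    exact_mod_cast this
  refine form_unique (l := l) (τ := τ') h' ?_
  push_cast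
  generalize (γ 0 0 : ℂ) = a at *
  generalize (γ 0 1 : ℂ) = b at *
  generalize (γ 1 0 : ℂ) = c at *
  generalize (γ 1 1 : ℂ) = d at *
  apply mul_right_cancel₀ h0
  have e : sq l * (c * τ + d) = c * (-B * τ - C) + d * (A * τ + B) := by
    rw [← h2, ← h1]; ring
  rw [e]
  linear_combination (-(A * d ^ 2 - 2 * B * c * d + C * c ^ 2)) * hs - (c * (-B * τ - C) + d * (A * τ + B)) * hdet

lemma zmod7 {A : ℤ} : (A : ZMod 7) = 0 ↔ 7 ∣ A := by
  have := ZMod.intCast_zmod_eq_zero_iff_dvd A 7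
  simpa using this

instance : Fact (Nat.Prime 7) := ⟨by norm_num⟩

lemma ncard_eq_of_ker {α β δ : Type*} (S : Set α) (f : α → β) (g : α → δ)
    (h : ∀ a ∈ S, ∀ b ∈ S, (f a = f b ↔ g a = g b)) : (f '' S).ncard = (g '' S).ncard := by
  by_cases hS : S.Nonempty
  · obtain ⟨s0, hs0⟩ := hS
    classical
    have : Nonempty α := ⟨s0⟩
    have e : g '' S = (fun b => g (Function.invFunOn f S b)) '' (f '' S) := by
      ext x
      constructor
      · rintro ⟨a, ha, rfl⟩
        have h1 := Function.invFunOn_mem ⟨a, ha, rfl⟩ (f := f) (s := S) (b := f a)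
        have h2 := Function.invFunOn_eq ⟨a, ha, rfl⟩ (f := f) (s := S) (b := f a)
        exact ⟨f a, ⟨a, ha, rfl⟩, (h _ h1 _ ha).1 h2⟩
      · rintro ⟨_, ⟨a, ha, rfl⟩, rfl⟩
        exact ⟨_, Function.invFunOn_mem ⟨a, ha, rfl⟩ (f := f) (s := S) (b := f a), rfl⟩
    rw [e]; symm; apply Set.InjOn.ncard_image
    rintro _ ⟨a, ha, rfl⟩ _ ⟨b, hb, rfl⟩ hab
    have h1 := Function.invFunOn_mem ⟨a, ha, rfl⟩ (f := f) (s := S) (b := f a)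
    have h2 := Function.invFunOn_eq ⟨a, ha, rfl⟩ (f := f) (s := S) (b := f a)
    have h1' := Function.invFunOn_mem ⟨b, hb, rfl⟩ (f := f) (s := S) (b := f b)
    have h2' := Function.invFunOn_eq ⟨b, hb, rfl⟩ (f := f) (s := S) (b := f b)
    have := (h _ h1 _ h1').2 hab
    rwa [h2, h2'] at this
  · rw [Set.not_nonempty_iff_eq_empty] at hS
    simp [hS]

theorem card_S7 (l : ℕ) (hp : l.Prime) (hmod7 : l % 7 = 3 ∨ l % 7 = 5)
    (y : ℍ → ℂ) (hy : ∀ τ τ', y τ = y τ' ↔ ∃ γ : SL(2, ℤ), 7 ∣ γ 1 0 ∧ γ • τ = τ') :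
    (y '' S7 l).ncard = 2 * (jq '' Hl l).ncard := by
  classical
  obtain ⟨s, hs, hs0⟩ : ∃ s : ZMod 7, s ^ 2 = -(l : ZMod 7) ∧ s ≠ 0 := by
    rw [← ZMod.natCast_mod l 7]
    rcases hmod7 with h | h <;> rw [h] <;> decide
  have hex : ∀ τ : ℍ, ∃ A B C : ℤ, τ ∈ Hl l → 0 < A ∧ A * C - B ^ 2 = l ∧ sq l = A * τ + B ∧ sq l * τ = -B * τ - C := by
    intro τ
    by_cases h : τ ∈ Hl l
    · obtain ⟨A, B, C, h⟩ := (Hl_iff hp.pos τ).1 h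
      exact ⟨A, B, C, fun _ => h⟩
    · exact ⟨0, 0, 0, fun h' => absurd h' h⟩
  choose A B C hABC using hex
  have hS7 : ∀ τ, τ ∈ S7 l ↔ τ ∈ Hl l ∧ (A τ : ZMod 7) = 0 := by
    intro τ
    constructor
    · rintro ⟨a, b, c, h1, h2, h3, h4⟩
      obtain ⟨h5, h6⟩ := Hl_of_form hp.pos τ h1 h3 h4
      have hm : τ ∈ Hl l := (Hl_iff hp.pos τ).2 ⟨a, b, c, h1, h3, h5, h6⟩
      refine ⟨hm, ?_⟩
      obtain ⟨e, -⟩ := form_unique (hABC τ hm).2.2.1 h5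
      rw [e, zmod7]; exact h2
    · rintro ⟨h1, h2⟩
      obtain ⟨h3, h4, h5, h6⟩ := hABC τ h1
      exact ⟨A τ, B τ, C τ, h3, zmod7.1 h2, h4, Hl_form τ h5 h6⟩
  have hdisc : ∀ τ ∈ Hl l, (A τ : ZMod 7) * C τ - (B τ : ZMod 7) ^ 2 = - s ^ 2 := by
    intro τ h
    rw [hs]
    have := congrArg (fun z : ℤ => (z : ZMod 7)) (hABC τ h).2.1
    push_cast at this
    rw [this]; ring
  have hBs : ∀ τ ∈ S7 l, (B τ : ZMod 7) = s ∨ (B τ : ZMod 7) = -s := by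
    intro τ h
    obtain ⟨h1, h2⟩ := (hS7 τ).1 h
    have := hdisc τ h1
    rw [h2] at this
    have : (B τ : ZMod 7) ^ 2 = s ^ 2 := by linear_combination -this
    exact sq_eq_sq_iff_eq_or_eq_neg.1 this
  have h2ne : (2 : ZMod 7) ≠ 0 := by decide
  have hsne : s ≠ -s := by
    intro h
    have : 2 * s = 0 := by linear_combination h
    rcases mul_eq_zero.1 this with h | h
    · exact h2ne h
    · exact hs0 h
  let F : ℍ → _ × Bool := fun τ => (jq τ, decide ((B τ : ZMod 7) = s))
  have hker : ∀ a ∈ S7 l, ∀ b ∈ S7 l, (y a = y b ↔ F a = F b) := by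
    intro τ hτ τ' hτ'
    obtain ⟨h1, h2⟩ := (hS7 τ).1 hτ
    obtain ⟨h1', h2'⟩ := (hS7 τ').1 hτ'
    have tr : ∀ γ : SL(2, ℤ), γ • τ = τ' → ((B τ' : ZMod 7) = B τ ↔ 7 ∣ γ 1 0) := by
      intro γ hγ
      obtain ⟨e1, e2⟩ := form_trans hγ (hABC τ h1).2.2.1 (hABC τ h1).2.2.2 (hABC τ' h1').2.2.1
      have e1 := congrArg (fun z : ℤ => (z : ZMod 7)) e1
      have e2 := congrArg (fun z : ℤ => (z : ZMod 7)) e2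
      have hdet : (γ 0 0 : ZMod 7) * γ 1 1 - γ 0 1 * γ 1 0 = 1 := by
        have := γ.det_coe
        rw [Matrix.det_fin_two] at this
        exact_mod_cast congrArg (fun z : ℤ => (z : ZMod 7)) this
      push_cast at e1 e2
      rw [h2'] at e1
      rw [h2] at e1 e2
      rw [← zmod7]
      have hB0 : (B τ : ZMod 7) ≠ 0 := by
        rcases hBs τ hτ with h | h <;> rw [h]
        · exact hs0
        · exact neg_ne_zero.2 hs0
      constructor
      · intro hBB
        by_contra hc
        have e3 : (C τ : ZMod 7) * γ 1 0 = 2 * B τ * γ 1 1 := by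
          apply mul_right_cancel₀ hc
          linear_combination -e1
        rw [hBB] at e2
        have : 2 * (B τ : ZMod 7) = 0 := by
          linear_combination e2 - (γ 0 0 : ZMod 7) * e3 - (B τ : ZMod 7) * hdet
        rcases mul_eq_zero.1 this with h | h
        · exact h2ne h
        · exact hB0 h
      · intro hc
        rw [hc] at e2 hdet
        rw [e2]
        linear_combination (B τ : ZMod 7) * hdet
    rw [hy]
    simp only [F, Prod.mk.injEq, jq_eq]
    constructor
    · rintro ⟨γ, h7, hγ⟩
      refine ⟨⟨γ, hγ⟩, ?_⟩
      rw [(tr γ hγ).2 h7]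
    · rintro ⟨⟨γ, hγ⟩, hd⟩
      refine ⟨γ, (tr γ hγ).1 ?_, hγ⟩
      rw [decide_eq_decide] at hd
      rcases hBs τ hτ with h | h <;> rcases hBs τ' hτ' with h' | h'
      · rw [h, h']
      · exact absurd (hd.1 h) (by rw [h']; exact hsne.symm)
      · exact absurd (hd.2 h') (by rw [h]; exact hsne.symm)
      · rw [h, h']
  have himg : F '' S7 l = (jq '' Hl l) ×ˢ (Set.univ : Set Bool) := by
    ext ⟨q, ε⟩
    constructor
    · rintro ⟨τ, hτ, e⟩
      simp only [F, Prod.mk.injEq] at e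
      exact ⟨⟨τ, ((hS7 τ).1 hτ).1, e.1⟩, trivial⟩
    · rintro ⟨⟨τ, hτ, rfl⟩, -⟩
      -- target value for B
      have main : ∀ s' : ZMod 7, s' ≠ 0 → s' ^ 2 = s ^ 2 →
          ∃ τ' ∈ S7 l, jq τ = jq τ' ∧ (B τ' : ZMod 7) = s' := by
        intro s' hs0' hs'
        have hd := hdisc τ hτ
        have mk : ∀ d : ℤ, (A τ : ZMod 7) * d ^ 2 - 2 * B τ * d + C τ = 0 → (A τ : ZMod 7) * d - B τ = s' →
            ∃ τ' ∈ S7 l, jq τ = jq τ' ∧ (B τ' : ZMod 7) = s' := by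
          intro d hd1 hd2
          let γ : SL(2, ℤ) := ⟨!![0, -1; 1, d], by simp [Matrix.det_fin_two]⟩
          have hj : jq τ = jq (γ • τ) := jq_eq.2 ⟨γ, rfl⟩
          have hm : γ • τ ∈ Hl l := Hl_jq hj hτ
          obtain ⟨e1, e2⟩ := form_trans (γ := γ) rfl (hABC τ hτ).2.2.1 (hABC τ hτ).2.2.2 (hABC _ hm).2.2.1
          simp [γ] at e1 e2
          have e1 := congrArg (fun z : ℤ => (z : ZMod 7)) e1
          have e2 := congrArg (fun z : ℤ => (z : ZMod 7)) e2
          push_cast at e1 e2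
          refine ⟨γ • τ, (hS7 _).2 ⟨hm, ?_⟩, hj, ?_⟩
          · exact e1.trans hd1
          · refine e2.trans ?_
            rw [← hd2]; ring
        by_cases hA : (A τ : ZMod 7) = 0
        · rw [hA] at hd
          have h2 : (B τ : ZMod 7) ^ 2 = s' ^ 2 := by rw [hs']; linear_combination -hd
          rcases sq_eq_sq_iff_eq_or_eq_neg.1 h2 with h | h
          · exact ⟨τ, (hS7 τ).2 ⟨hτ, hA⟩, rfl, h⟩
          · obtain ⟨d, hd⟩ := ZMod.intCast_surjective (((C τ : ℤ) : ZMod 7) / (2 * ((B τ : ℤ) : ZMod 7)))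
            have hB0 : (B τ : ZMod 7) ≠ 0 := by rw [h]; exact neg_ne_zero.2 hs0'
            refine mk d ?_ ?_
            · rw [hA, hd]; field_simp; ring
            · rw [hA, h]; ring
        · obtain ⟨d, hd'⟩ := ZMod.intCast_surjective ((((B τ : ℤ) : ZMod 7) + s') / ((A τ : ℤ) : ZMod 7))
          have e : (A τ : ZMod 7) * d = B τ + s' := by rw [hd']; field_simp
          refine mk d ?_ (by rw [e]; ring)
          apply mul_left_cancel₀ hA
          linear_combination hd + hs' + (A τ * d - B τ + s' : ZMod 7) * e
      cases ε
      · obtain ⟨τ', h1, h2, h3⟩ := main (-s) (neg_ne_zero.2 hs0) (by ring)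
        refine ⟨τ', h1, ?_⟩
        simp only [F, Prod.mk.injEq, decide_eq_false_iff_not]
        exact ⟨h2.symm, by rw [h3]; exact hsne.symm⟩
      · obtain ⟨τ', h1, h2, h3⟩ := main s hs0 rfl
        refine ⟨τ', h1, ?_⟩
        simp only [F, Prod.mk.injEq, decide_eq_true_eq]
        exact ⟨h2.symm, h3⟩
  rw [ncard_eq_of_ker (S7 l) y F hker, himg, Set.ncard_prod, Set.ncard_univ]
  simp; ring

end HK

namespace HK
open PowerSeries (coeff)

/-- The power series `F` converges on the open unit disc with sum `f`. -/
def Rep (F : PowerSeries ℂ) (f : ℂ → ℂ) : Prop :=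
  ∀ q : ℂ, ‖q‖ < 1 → HasSum (fun n => coeff n F * q ^ n) (f q)

lemma Rep.congr {F : PowerSeries ℂ} {f g : ℂ → ℂ} (h : Rep F f)
    (e : ∀ q : ℂ, ‖q‖ < 1 → f q = g q) : Rep F g := fun q hq => e q hq ▸ h q hq

lemma Rep.add {F G : PowerSeries ℂ} {f g : ℂ → ℂ} (hf : Rep F f) (hg : Rep G g) :
    Rep (F + G) (fun q => f q + g q) := fun q hq => by
  simpa [add_mul] using (hf q hq).add (hg q hq)

lemma Rep.neg {F : PowerSeries ℂ} {f : ℂ → ℂ} (hf : Rep F f) :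
    Rep (-F) (fun q => - f q) := fun q hq => by
  simpa using (hf q hq).neg

lemma Rep.sub {F G : PowerSeries ℂ} {f g : ℂ → ℂ} (hf : Rep F f) (hg : Rep G g) :
    Rep (F - G) (fun q => f q - g q) := fun q hq => by
  simpa [sub_mul] using (hf q hq).sub (hg q hq)

lemma Rep.mul {F G : PowerSeries ℂ} {f g : ℂ → ℂ} (hf : Rep F f) (hg : Rep G g) :
    Rep (F * G) (fun q => f q * g q) := fun q hq => by
  have h1 := (hf q hq)
  have h2 := (hg q hq)
  have s1 := h1.summable.norm
  have s2 := h2.summable.norm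
  have := summable_norm_sum_mul_antidiagonal_of_summable_norm s1 s2
  have e := tsum_mul_tsum_eq_tsum_sum_antidiagonal_of_summable_norm s1 s2
  rw [h1.tsum_eq, h2.tsum_eq] at e
  show HasSum _ (f q * g q)
  rw [e]
  have h3 := this.of_norm.hasSum
  refine (congrArg (fun u : ℕ → ℂ => HasSum u _) (funext fun n => ?_)).mpr h3
  rw [PowerSeries.coeff_mul, Finset.sum_mul]
  refine Finset.sum_congr rfl fun x hx => ?_
  rw [← Finset.HasAntidiagonal.mem_antidiagonal.1 hx, pow_add]; ring

lemma Rep.const (c : ℂ) : Rep (PowerSeries.C c) (fun _ => c) := fun q hq => by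
  convert hasSum_ite_eq (0 : ℕ) c using 2 with n
  rw [PowerSeries.coeff_C]; split_ifs with h <;> simp [h]

lemma Rep.one : Rep 1 (fun _ => 1) := by simpa using Rep.const 1

lemma Rep.X : Rep PowerSeries.X (fun q => q) := fun q hq => by
  convert hasSum_ite_eq (1 : ℕ) q using 2 with n
  rw [PowerSeries.coeff_X]; split_ifs with h <;> simp [h]

lemma Rep.pow {F : PowerSeries ℂ} {f : ℂ → ℂ} (hf : Rep F f) (n : ℕ) :
    Rep (F ^ n) (fun q => f q ^ n) := by
  induction n with
  | zero => simpa using Rep.one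
  | succ n ih => simpa [pow_succ] using ih.mul hf

lemma Rep.sum {ι : Type*} (s : Finset ι) {F : ι → PowerSeries ℂ} {f : ι → ℂ → ℂ}
    (hf : ∀ i ∈ s, Rep (F i) (f i)) :
    Rep (∑ i ∈ s, F i) (fun q => ∑ i ∈ s, f i q) := by
  classical
  induction s using Finset.induction_on with
  | empty => simpa using Rep.const 0
  | insert a s ha ih =>
    simp only [Finset.sum_insert ha]
    exact (hf a (by simp)).add (ih fun i hi => hf i (by simp [hi]))

lemma Rep.hasFPower {F : PowerSeries ℂ} {f : ℂ → ℂ} (hf : Rep F f) :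
    HasFPowerSeriesOnBall f (FormalMultilinearSeries.ofScalars ℂ (fun n => coeff n F)) 0 1 := by
  refine ⟨?_, one_pos, ?_⟩
  · refine ENNReal.le_of_forall_nnreal_lt fun r hr => ?_
    apply FormalMultilinearSeries.le_radius_of_summable_norm
    have h := (hf (r : ℂ) (by simpa using hr)).summable.norm
    refine h.congr fun n => ?_
    simp
  · intro y hy
    have hy' : ‖y‖ < 1 := by
      have h : ‖y‖₊ < 1 := by simpa [enorm_eq_nnnorm] using hy
      exact_mod_cast h
    have := hf y hy'
    simpa [FormalMultilinearSeries.ofScalars_apply_eq, smul_eq_mul, mul_comm] using this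

lemma Rep.differentiableOn {F : PowerSeries ℂ} {f : ℂ → ℂ} (hf : Rep F f) :
    DifferentiableOn ℂ f (Metric.ball 0 1) := by
  have := hf.hasFPower.differentiableOn
  have e : Metric.eball (0 : ℂ) 1 = Metric.ball 0 1 := by
    ext z
    have : ‖z‖₊ < 1 ↔ ‖z‖ < 1 := by rw [← NNReal.coe_lt_coe]; simp
    simp [enorm_eq_nnnorm, this]
  rwa [e] at this

lemma exists_rep {f : ℂ → ℂ} (hf : DifferentiableOn ℂ f (Metric.ball 0 1)) :
    ∃ F, Rep F f := by
  refine ⟨PowerSeries.mk fun n => (n.factorial : ℂ)⁻¹ * iteratedDeriv n f 0, fun q hq => ?_⟩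
  have := Complex.hasSum_taylorSeries_on_ball (r := 1) (c := 0) hf (z := q) (by simpa using hq)
  simpa [mul_assoc, mul_comm, mul_left_comm] using this

lemma Rep.coeff_eq {F : PowerSeries ℂ} {f : ℂ → ℂ} (hf : Rep F f) (n : ℕ) :
    coeff n F = (n.factorial : ℂ)⁻¹ * iteratedDeriv n f 0 := by
  have h1 := hf.hasFPower.hasFPowerSeriesAt
  have h2 := (hf.differentiableOn.analyticAt (Metric.ball_mem_nhds 0 one_pos)).hasFPowerSeriesAt
  have := h1.eq_formalMultilinearSeries h2
  have e := congrArg (fun p => FormalMultilinearSeries.coeff p n) this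
  simp [FormalMultilinearSeries.coeff_ofScalars] at e
  rw [e]; field_simp

lemma Rep.unique {F G : PowerSeries ℂ} {f : ℂ → ℂ} (hf : Rep F f) (hg : Rep G f) : F = G := by
  ext n; rw [hf.coeff_eq, hg.coeff_eq]

lemma Rep.coeff_zero {F : PowerSeries ℂ} {f : ℂ → ℂ} (hf : Rep F f) :
    coeff 0 F = f 0 := by
  have := hf.coeff_eq 0
  simpa using this

lemma Rep.eq_zero {F G : PowerSeries ℂ} {f g : ℂ → ℂ} (hf : Rep F f) (hg : Rep G g)
    (e : ∀ q : ℂ, ‖q‖ < 1 → q ≠ 0 → f q = g q) : f 0 = g 0 := by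
  have c1 : ContinuousAt f 0 :=
    (hf.differentiableOn.differentiableAt (Metric.ball_mem_nhds 0 one_pos)).continuousAt
  have c2 : ContinuousAt g 0 :=
    (hg.differentiableOn.differentiableAt (Metric.ball_mem_nhds 0 one_pos)).continuousAt
  have t1 := c1.tendsto.mono_left (nhdsWithin_le_nhds (s := {0}ᶜ))
  have t2 := c2.tendsto.mono_left (nhdsWithin_le_nhds (s := {0}ᶜ))
  refine tendsto_nhds_unique t1 (t2.congr' ?_)
  have hb : Metric.ball (0:ℂ) 1 ∈ nhdsWithin (0:ℂ) {0}ᶜ :=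
    nhdsWithin_le_nhds (Metric.ball_mem_nhds 0 one_pos)
  filter_upwards [hb, self_mem_nhdsWithin] with q h1 h2
  exact (e q (by simpa using h1) (by simpa using h2)).symm

/-- Uniqueness when values agree away from `0`. -/
lemma Rep.unique' {F G : PowerSeries ℂ} {f g : ℂ → ℂ} (hf : Rep F f) (hg : Rep G g)
    (e : ∀ q : ℂ, ‖q‖ < 1 → q ≠ 0 → f q = g q) : F = G := by
  refine hf.unique (hg.congr fun q hq => ?_)
  by_cases h : q = 0
  · subst h; exact (hf.eq_zero hg e).symm
  · exact (e q hq h).symm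

lemma Rep.inv {F : PowerSeries ℂ} {f : ℂ → ℂ} (hf : Rep F f)
    (h0 : ∀ q : ℂ, ‖q‖ < 1 → f q ≠ 0) : ∃ G, F * G = 1 ∧ Rep G (fun q => (f q)⁻¹) := by
  obtain ⟨G, hG⟩ := exists_rep (f := fun q => (f q)⁻¹)
    (hf.differentiableOn.fun_inv fun x hx => h0 x (by simpa using hx))
  refine ⟨G, ?_, hG⟩
  refine (hf.mul hG).unique (Rep.one.congr fun q hq => ?_)
  rw [mul_inv_cancel₀ (h0 q hq)]

/-- the inverse of a series with `F * G = 1`. -/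
lemma Rep.inv' {F G : PowerSeries ℂ} {f : ℂ → ℂ} (hf : Rep F f)
    (h0 : ∀ q : ℂ, ‖q‖ < 1 → f q ≠ 0) (hFG : F * G = 1) : Rep G (fun q => (f q)⁻¹) := by
  obtain ⟨H, h1, h2⟩ := hf.inv h0
  have : G = H := by
    calc G = (F * H) * G := by rw [h1, one_mul]
      _ = (F * G) * H := by ring
      _ = H := by rw [hFG, one_mul]
  rwa [this]

lemma Rep.expand {F : PowerSeries ℂ} {f : ℂ → ℂ} (hf : Rep F f) (p : ℕ) (hp : p ≠ 0) :
    Rep (PowerSeries.expand p hp F) (fun q => f (q ^ p)) := fun q hq => by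
  have h := hf (q ^ p) (by rw [norm_pow]; exact pow_lt_one₀ (norm_nonneg _) hq hp)
  have hinj : Function.Injective (fun m : ℕ => p * m) :=
    fun a b h => Nat.eq_of_mul_eq_mul_left (Nat.pos_of_ne_zero hp) h
  rw [← hinj.hasSum_iff]
  · convert h using 2 with m
    simp [PowerSeries.coeff_expand_mul, pow_mul]
  · intro n hn
    rw [PowerSeries.coeff_expand_of_not_dvd, zero_mul]
    rintro ⟨m, rfl⟩
    exact hn ⟨m, rfl⟩

lemma Rep.shift {G : PowerSeries ℂ} {g : ℂ → ℂ} (h : Rep (PowerSeries.X * G) g) :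
    Rep G (fun q => ∑' n, coeff n G * q ^ n) := fun q hq => by
  apply Summable.hasSum
  by_cases h0 : q = 0
  · subst h0
    refine summable_of_ne_finset_zero (s := {0}) fun b hb => ?_
    simp at hb; simp [hb]
  · have := (h q hq).summable
    rw [← summable_nat_add_iff 1] at this
    have := this.mul_right q⁻¹
    refine this.congr fun n => ?_
    rw [PowerSeries.coeff_succ_X_mul, pow_succ]; field_simp

lemma Rep.shift_val {G : PowerSeries ℂ} {g : ℂ → ℂ} (h : Rep (PowerSeries.X * G) g)
    (q : ℂ) (hq : ‖q‖ < 1) : q * (∑' n, coeff n G * q ^ n) = g q :=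
  ((Rep.X.mul h.shift) q hq).unique (h q hq)

/-- integer power series as complex ones -/
noncomputable def toC : PowerSeries ℤ →+* PowerSeries ℂ := PowerSeries.map (Int.castRingHom ℂ)

lemma toC_inj : Function.Injective toC :=
  PowerSeries.map_injective _ Int.cast_injective

@[simp] lemma coeff_toC (n : ℕ) (F : PowerSeries ℤ) : coeff n (toC F) = (coeff n F : ℤ) := by
  simp [toC]

lemma toC_X : toC PowerSeries.X = PowerSeries.X := by simp [toC]
lemma toC_C (a : ℤ) : toC (PowerSeries.C a) = PowerSeries.C (a : ℂ) := by simp [toC]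

lemma toC_expand (F : PowerSeries ℤ) (p : ℕ) (hp : p ≠ 0) :
    toC (PowerSeries.expand p hp F) = PowerSeries.expand p hp (toC F) := by
  simp [toC]

lemma exists_inv_int (F : PowerSeries ℤ) (h : coeff 0 F = 1) : ∃ G, F * G = 1 ∧ coeff 0 G = 1 := by
  refine ⟨PowerSeries.invOfUnit F 1, PowerSeries.mul_invOfUnit F 1 (by simpa using h), by simp⟩

end HK

namespace HK
open UpperHalfPlane hiding I
open ModularForm Complex
open scoped MatrixGroups Real

/-- the sixth-root character exponent -/
def psi (a b c d : ZMod 6) : ZMod 6 :=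
  (1 - c ^ 2) * (b * d + 3 * (c - 1) * d + c + 3) + c * (a + d - 3)

set_option maxRecDepth 100000 in
set_option maxHeartbeats 4000000 in
lemma psi_T : ∀ a b c d : ZMod 6, a * d - b * c = 1 →
    psi a (a + b) c (c + d) = psi a b c d + 1 := by
  decide +kernel

set_option maxRecDepth 100000 in
set_option maxHeartbeats 4000000 in
lemma psi_S : ∀ a b c d : ZMod 6, a * d - b * c = 1 →
    psi b (-a) d (-c) = psi a b c d + 3 := by
  decide +kernel

/-- sixth roots of unity -/
noncomputable def zt (x : ZMod 6) : ℂ := exp (2 * π * I / 6) ^ x.val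

lemma zt_base : exp (2 * π * I / 6) ^ 6 = 1 := by
  rw [← exp_nat_mul, show ((6 : ℕ) : ℂ) * (2 * π * I / 6) = 2 * π * I by push_cast; ring, exp_two_pi_mul_I]

lemma zt_cast (n : ℕ) : zt (n : ZMod 6) = exp (2 * π * I / 6) ^ n := by
  rw [zt, ZMod.val_natCast, ← Nat.mod_add_div n 6, pow_add, pow_mul, zt_base]; simp

lemma zt_add (x y : ZMod 6) : zt (x + y) = zt x * zt y := by
  rw [← ZMod.natCast_zmod_val x, ← ZMod.natCast_zmod_val y, ← Nat.cast_add, zt_cast, zt_cast,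
    zt_cast, pow_add]

lemma zt_ne (x : ZMod 6) : zt x ≠ 0 := pow_ne_zero _ (exp_ne_zero _)
lemma zt_zero : zt 0 = 1 := by simpa using zt_cast 0
lemma zt_one : zt 1 = exp (2 * π * I / 6) := by simpa using zt_cast 1
lemma zt_three : zt 3 = -1 := by
  have := zt_cast 3
  rw [← exp_nat_mul, show ((3 : ℕ) : ℂ) * (2 * π * I / 6) = π * I by push_cast; ring, exp_pi_mul_I] at this
  exact_mod_cast this

noncomputable def qq (z : ℂ) : ℂ := exp (2 * π * I * z)

noncomputable def ep (q : ℂ) : ℂ := ∏' n : ℕ, (1 - q ^ (n + 1))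

noncomputable def e4 (z : ℂ) : ℂ := ModularForm.eta z ^ 4

lemma qq_ne (z : ℂ) : qq z ≠ 0 := exp_ne_zero _

lemma qq_norm (z : ℂ) : ‖qq z‖ = Real.exp (-(2 * π * z.im)) := by
  rw [qq, norm_exp]; simp

lemma qq_norm_lt {z : ℂ} (hz : 0 < z.im) : ‖qq z‖ < 1 := by
  rw [qq_norm, Real.exp_lt_one_iff]
  have := Real.pi_pos
  have : 0 < 2 * π * z.im := by positivity
  linarith

lemma qq_add (z w : ℂ) : qq (z + w) = qq z * qq w := by
  rw [qq, mul_add, exp_add]; rfl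

lemma qq_int (n : ℤ) : qq n = 1 := by
  rw [qq, mul_comm, exp_int_mul_two_pi_mul_I]

lemma qq_nat_mul (n : ℕ) (z : ℂ) : qq (n * z) = qq z ^ n := by
  rw [qq, qq, ← exp_nat_mul]; ring_nf

lemma eta_eq (z : ℂ) : ModularForm.eta z = exp (2 * π * I * z / 24) * ep (qq z) := by
  rw [ModularForm.eta, ep, Function.Periodic.qParam]
  simp only [eta_q_eq_pow]
  rfl

lemma e4_eq (z : ℂ) : e4 z = exp (2 * π * I * z / 6) * ep (qq z) ^ 4 := by
  rw [e4, eta_eq, mul_pow, ← exp_nat_mul]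
  congr 2; push_cast; ring

lemma e4_T (z : ℂ) : e4 (z + 1) = zt 1 * e4 z := by
  rw [e4_eq, e4_eq, zt_one, qq_add, show qq 1 = 1 by simpa using qq_int 1, mul_one, ← mul_assoc,
    ← exp_add]
  congr 2; ring

lemma e4_S {z : ℂ} (hz : 0 < z.im) : e4 (-1 / z) = zt 3 * z ^ 2 * e4 z := by
  have hz0 : z ≠ 0 := by rintro rfl; simp at hz
  have h := eta_comp_eq_csqrt_I_inv (show z ∈ upperHalfPlaneSet from hz)
  simp only [Function.comp, Pi.smul_apply, Pi.mul_apply, smul_eq_mul] at h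
  have hs : ∀ w : ℂ, w ≠ 0 → sqrt w ^ 4 = w ^ 2 := by
    intro w hw
    rw [sqrt_eq_exp hw, ← exp_nat_mul]
    ring_nf
    rw [show (log w * 2) = (2 : ℕ) * log w by push_cast; ring, exp_nat_mul, exp_log hw]
  rw [e4, h, mul_pow, mul_pow, inv_pow, hs _ I_ne_zero, hs _ hz0, zt_three, e4]
  simp

lemma e4_ne {z : ℂ} (hz : 0 < z.im) : e4 z ≠ 0 := pow_ne_zero _ (eta_ne_zero hz)

def PG (γ : SL(2, ℤ)) : Prop :=
  ∀ τ : ℍ, e4 ((γ • τ : ℍ) : ℂ) = zt (psi (γ 0 0 : ℤ) (γ 0 1 : ℤ) (γ 1 0 : ℤ) (γ 1 1 : ℤ)) *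
    ((γ 1 0 : ℤ) * τ + (γ 1 1 : ℤ)) ^ 2 * e4 τ

lemma det6 (γ : SL(2, ℤ)) : ((γ 0 0 : ℤ) : ZMod 6) * (γ 1 1 : ℤ) - (γ 0 1 : ℤ) * (γ 1 0 : ℤ) = 1 := by
  have := γ.det_coe
  rw [Matrix.det_fin_two] at this
  exact_mod_cast congrArg (Int.cast : ℤ → ZMod 6) this

lemma PG_T {γ : SL(2, ℤ)} (h : PG γ) : PG (γ * ModularGroup.T) := by
  intro τ
  have h1 := h (ModularGroup.T • τ)
  rw [mul_smul, h1, modular_T_smul]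
  have e : ((1 : ℝ) +ᵥ τ : ℍ) = (τ : ℂ) + 1 := by simp [add_comm]
  have e00 : (γ * ModularGroup.T) 0 0 = γ 0 0 := by simp [Matrix.SpecialLinearGroup.coe_mul, ModularGroup.coe_T, Matrix.mul_apply, Fin.sum_univ_two]
  have e01 : (γ * ModularGroup.T) 0 1 = γ 0 0 + γ 0 1 := by simp [Matrix.SpecialLinearGroup.coe_mul, ModularGroup.coe_T, Matrix.mul_apply, Fin.sum_univ_two]
  have e10 : (γ * ModularGroup.T) 1 0 = γ 1 0 := by simp [Matrix.SpecialLinearGroup.coe_mul, ModularGroup.coe_T, Matrix.mul_apply, Fin.sum_univ_two]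
  have e11 : (γ * ModularGroup.T) 1 1 = γ 1 0 + γ 1 1 := by simp [Matrix.SpecialLinearGroup.coe_mul, ModularGroup.coe_T, Matrix.mul_apply, Fin.sum_univ_two]
  rw [e, e4_T, e00, e01, e10, e11]
  have := psi_T _ _ _ _ (det6 γ)
  push_cast
  rw [this, zt_add]; ring

lemma PG_T' {γ : SL(2, ℤ)} (h : PG (γ * ModularGroup.T)) : PG γ := by
  intro τ
  have h1 := h (ModularGroup.T⁻¹ • τ)
  rw [← mul_smul, mul_assoc, mul_inv_cancel, mul_one] at h1
  have e : (τ : ℂ) = ((ModularGroup.T⁻¹ • τ : ℍ) : ℂ) + 1 := by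
    have : τ = ModularGroup.T • (ModularGroup.T⁻¹ • τ) := by rw [smul_inv_smul]
    rw [modular_T_smul] at this
    conv_lhs => rw [this]
    simp [add_comm]
  have e00 : (γ * ModularGroup.T) 0 0 = γ 0 0 := by simp [Matrix.SpecialLinearGroup.coe_mul, ModularGroup.coe_T, Matrix.mul_apply, Fin.sum_univ_two]
  have e01 : (γ * ModularGroup.T) 0 1 = γ 0 0 + γ 0 1 := by simp [Matrix.SpecialLinearGroup.coe_mul, ModularGroup.coe_T, Matrix.mul_apply, Fin.sum_univ_two]
  have e10 : (γ * ModularGroup.T) 1 0 = γ 1 0 := by simp [Matrix.SpecialLinearGroup.coe_mul, ModularGroup.coe_T, Matrix.mul_apply, Fin.sum_univ_two]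
  have e11 : (γ * ModularGroup.T) 1 1 = γ 1 0 + γ 1 1 := by simp [Matrix.SpecialLinearGroup.coe_mul, ModularGroup.coe_T, Matrix.mul_apply, Fin.sum_univ_two]
  rw [h1, e00, e01, e10, e11, e, e4_T]
  have := psi_T _ _ _ _ (det6 γ)
  push_cast
  rw [this, zt_add]; ring

lemma PG_S {γ : SL(2, ℤ)} (h : PG γ) : PG (γ * ModularGroup.S) := by
  intro τ
  have h1 := h (ModularGroup.S • τ)
  have e : ((ModularGroup.S • τ : ℍ) : ℂ) = -1 / (τ : ℂ) := by
    rw [modular_S_smul]; simp [neg_div]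
  have hτ : (τ : ℂ) ≠ 0 := ne_zero τ
  have e00 : (γ * ModularGroup.S) 0 0 = γ 0 1 := by simp [Matrix.SpecialLinearGroup.coe_mul, ModularGroup.coe_S, Matrix.mul_apply, Fin.sum_univ_two]
  have e01 : (γ * ModularGroup.S) 0 1 = - γ 0 0 := by simp [Matrix.SpecialLinearGroup.coe_mul, ModularGroup.coe_S, Matrix.mul_apply, Fin.sum_univ_two]
  have e10 : (γ * ModularGroup.S) 1 0 = γ 1 1 := by simp [Matrix.SpecialLinearGroup.coe_mul, ModularGroup.coe_S, Matrix.mul_apply, Fin.sum_univ_two]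
  have e11 : (γ * ModularGroup.S) 1 1 = - γ 1 0 := by simp [Matrix.SpecialLinearGroup.coe_mul, ModularGroup.coe_S, Matrix.mul_apply, Fin.sum_univ_two]
  rw [mul_smul, h1, e, e4_S τ.2, e00, e01, e10, e11]
  have := psi_S _ _ _ _ (det6 γ)
  push_cast
  rw [this, zt_add]; field_simp; ring

lemma PG_all (γ : SL(2, ℤ)) : PG γ := by
  have h1 : PG 1 := by
    intro τ; simp [psi, zt_zero]
  have hm : γ ∈ Subgroup.closure {ModularGroup.S, ModularGroup.T} := by
    rw [_root_.SpecialLinearGroup.SL2Z_generators]; trivial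
  induction hm using Subgroup.closure_induction_right with
  | one => exact h1
  | mul_right x hx y hy ih =>
    rcases hy with rfl | rfl
    · exact PG_S ih
    · exact PG_T ih
  | mul_inv_cancel x hx y hy ih =>
    rcases hy with rfl | rfl
    · have : ModularGroup.S⁻¹ = ModularGroup.S * ModularGroup.S * ModularGroup.S := by
        rw [inv_eq_iff_mul_eq_one]; decide
      rw [this, ← mul_assoc, ← mul_assoc]
      exact PG_S (PG_S (PG_S ih))
    · apply PG_T'
      rwa [mul_assoc, inv_mul_cancel, mul_one]

/-- transformation law of `η⁴`. -/
lemma e4_trans (a b c d : ℤ) (hdet : a * d - b * c = 1) {z : ℂ} (hz : 0 < z.im) :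
    e4 ((a * z + b) / (c * z + d)) = zt (psi a b c d) * (c * z + d) ^ 2 * e4 z := by
  let γ : SL(2, ℤ) := ⟨!![a, b; c, d], by rw [Matrix.det_fin_two]; simpa using hdet⟩
  have h := PG_all γ ⟨z, hz⟩
  have e : ((γ • (⟨z, hz⟩ : ℍ) : ℍ) : ℂ) = (a * z + b) / (c * z + d) := by
    rw [specialLinearGroup_apply]; simp [γ]
  rw [e] at h
  simpa [γ] using h

end HK

open Polynomial
open PowerSeries (coeff)
namespace HK
open UpperHalfPlane hiding I
open ModularForm Complex Filter
open scoped MatrixGroups Real Topology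

lemma tlu_iter {ι : Type*} {φ : Filter ι} [φ.NeBot] {U : Set ℂ} (hU : IsOpen U) {F : ι → ℂ → ℂ} {f : ℂ → ℂ}
    (hf : TendstoLocallyUniformlyOn F f φ U) (hF : ∀ i, Differentiable ℂ (F i)) (n : ℕ) :
    TendstoLocallyUniformlyOn (fun i => iteratedDeriv n (F i)) (iteratedDeriv n f) φ U := by
  induction n with
  | zero => simpa [iteratedDeriv_zero] using hf
  | succ n ih =>
    have := ih.deriv (Eventually.of_forall fun i => ?_) hU
    · refine (this.congr ?_).congr_right ?_
      · intro i x hx; simp [iteratedDeriv_succ]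
      · intro x hx; simp [iteratedDeriv_succ]
    · have h1 : ContDiff ℂ (n + 1 : ℕ) (F i) := (hF i).contDiff
      exact (h1.differentiable_iteratedDeriv n (by exact_mod_cast Nat.lt_succ_self n)).differentiableOn

lemma Rep.prod {ι : Type*} (s : Finset ι) {F : ι → PowerSeries ℂ} {f : ι → ℂ → ℂ}
    (h : ∀ i ∈ s, Rep (F i) (f i)) : Rep (∏ i ∈ s, F i) (fun q => ∏ i ∈ s, f i q) := by
  classical
  induction s using Finset.induction_on with
  | empty => simpa using Rep.one
  | insert a s ha ih =>
    simp only [Finset.prod_insert ha]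
    exact (h a (by simp)).mul (ih fun i hi => h i (by simp [hi]))

/-- the Euler product power series -/
noncomputable def E0 : PowerSeries ℤ := PowerSeries.pentagonalSeries ℤ

lemma ep_rep : Rep (toC E0) ep := by
  obtain ⟨F, hF⟩ := exists_rep (f := ep) (by
    exact ModularForm.differentiableOn_tprod_one_sub_pow)
  suffices F = toC E0 by rwa [← this]
  ext n
  rw [hF.coeff_eq]
  have h1 := ModularForm.multipliableLocallyUniformlyOn_one_sub_pow.hasProdLocallyUniformlyOn
  have h2 : TendstoLocallyUniformlyOn (fun (s : Finset ℕ) (q : ℂ) => ∏ i ∈ s, (1 - q ^ (i + 1))) ep atTop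
      (Metric.ball 0 1) := h1
  have h3 := tlu_iter Metric.isOpen_ball h2 (fun s => by fun_prop) n
  have h4 := h3.tendsto_at (a := 0) (by simp)
  have h5 : ∀ s : Finset ℕ, iteratedDeriv n (fun q : ℂ => ∏ i ∈ s, (1 - q ^ (i + 1))) 0 =
      (n.factorial : ℂ) * coeff n (∏ i ∈ s, (1 - PowerSeries.X ^ (i + 1)) : PowerSeries ℂ) := by
    intro s
    have : Rep (∏ i ∈ s, (1 - PowerSeries.X ^ (i + 1)) : PowerSeries ℂ)
      (fun q => ∏ i ∈ s, (1 - q ^ (i + 1))) := Rep.prod s fun i _ => Rep.one.sub (Rep.X.pow _)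
    rw [this.coeff_eq, mul_inv_cancel_left₀ (by exact_mod_cast n.factorial_ne_zero)]
  have h6 := PowerSeries.coeff_prod_one_sub_X_pow_eventually_eq ℤ n
  have h7 : Tendsto (fun s : Finset ℕ => iteratedDeriv n (fun q : ℂ => ∏ i ∈ s, (1 - q ^ (i + 1))) 0) atTop
      (𝓝 ((n.factorial : ℂ) * coeff n (toC E0))) := by
    apply tendsto_nhds_of_eventually_eq
    filter_upwards [h6] with s hs
    rw [h5, coeff_toC, E0, ← hs, ← coeff_toC]
    simp [toC_X]
  rw [tendsto_nhds_unique h4 h7, inv_mul_cancel_left₀ (by exact_mod_cast n.factorial_ne_zero)]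

lemma ep_ne {q : ℂ} (hq : ‖q‖ < 1) : ep q ≠ 0 := by
  refine tprod_one_add_ne_zero_of_summable (f := fun n => - q ^ (n + 1)) ?_ ?_
  · intro i h
    have h1 : q ^ (i + 1) = 1 := by linear_combination -h
    have : ‖q‖ ^ (i + 1) = 1 := by rw [← norm_pow, h1, norm_one]
    have := pow_lt_one₀ (norm_nonneg q) hq (Nat.succ_ne_zero i)
    simp only [Nat.succ_eq_add_one] at this; linarith
  · simpa using (summable_nat_add_iff 1).mpr (summable_geometric_of_lt_one (norm_nonneg _) hq)

lemma E0_zero : coeff 0 E0 = 1 := by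
  have := PowerSeries.coeff_pentagonalSeries_pentagonal ℤ 0
  simpa [E0, pentagonal] using this

lemma E0_trunc : ∃ R : PowerSeries ℤ, E0 = (1 - PowerSeries.X - PowerSeries.X ^ 2 + PowerSeries.X ^ 5 + PowerSeries.X ^ 7) +
    PowerSeries.X ^ 9 * R := by
  have h : (PowerSeries.X ^ 9 : PowerSeries ℤ) ∣ E0 - (1 - PowerSeries.X - PowerSeries.X ^ 2 + PowerSeries.X ^ 5 + PowerSeries.X ^ 7) := by
    rw [PowerSeries.X_pow_dvd_iff]
    have hz : ∀ n, n < 9 → (n ≠ 0 ∧ n ≠ 1 ∧ n ≠ 2 ∧ n ≠ 5 ∧ n ≠ 7) → coeff n E0 = 0 := by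
      intro n hn hh
      apply PowerSeries.coeff_pentagonalSeries_eq_zero
      rintro ⟨k, rfl⟩
      have e := two_mul_natCast_pentagonal k
      have h1 : k * (3 * k - 1) < 18 := by rw [← e]; exact_mod_cast (by omega)
      have h2 : -3 < k := by nlinarith
      have h3 : k < 3 := by nlinarith
      interval_cases k <;> revert hh <;> simp [pentagonal]
    have e1 : coeff 1 E0 = -1 := by
      have := PowerSeries.coeff_pentagonalSeries_pentagonal ℤ 1
      simpa [E0, pentagonal] using this
    have e2 : coeff 2 E0 = -1 := by
      have := PowerSeries.coeff_pentagonalSeries_pentagonal ℤ (-1)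
      simpa [E0, pentagonal] using this
    have e5 : coeff 5 E0 = 1 := by
      have := PowerSeries.coeff_pentagonalSeries_pentagonal ℤ 2
      simpa [E0, pentagonal] using this
    have e7 : coeff 7 E0 = 1 := by
      have := PowerSeries.coeff_pentagonalSeries_pentagonal ℤ (-2)
      simpa [E0, pentagonal] using this
    intro m hm
    have h0 := E0_zero
    interval_cases m <;> simp [PowerSeries.coeff_X_pow, PowerSeries.coeff_X, PowerSeries.coeff_one, -PowerSeries.coeff_zero_eq_constantCoeff, h0, e1, e2, e5, e7, hz]
  obtain ⟨R, hR⟩ := h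
  exact ⟨R, by rw [← hR]; ring⟩

end HK

namespace HK
open PowerSeries (coeff)
open UpperHalfPlane hiding I
open ModularForm Complex Filter
open scoped MatrixGroups Real Topology

/-- integer two by two matrices -/
abbrev M2 := Matrix (Fin 2) (Fin 2) ℤ

/-- positively oriented pairs -/
def Pos (u v : ℂ) : Prop := 0 < (u * (starRingEnd ℂ) v).im

noncomputable def p1 (N : M2) (u v : ℂ) : ℂ := N 0 0 * u + N 0 1 * v
noncomputable def p2 (N : M2) (u v : ℂ) : ℂ := N 1 0 * u + N 1 1 * v

lemma p1_mul (M N : M2) (u v : ℂ) : p1 (M * N) u v = p1 M (p1 N u v) (p2 N u v) := by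
  simp [p1, p2, Matrix.mul_apply, Fin.sum_univ_two]; ring
lemma p2_mul (M N : M2) (u v : ℂ) : p2 (M * N) u v = p2 M (p1 N u v) (p2 N u v) := by
  simp [p1, p2, Matrix.mul_apply, Fin.sum_univ_two]; ring

lemma p1_smul (N : M2) (c u v : ℂ) : p1 N (c * u) (c * v) = c * p1 N u v := by simp [p1]; ring
lemma p2_smul (N : M2) (c u v : ℂ) : p2 N (c * u) (c * v) = c * p2 N u v := by simp [p2]; ring

lemma Pos.act {u v : ℂ} (h : Pos u v) {N : M2} (hN : 0 < N.det) : Pos (p1 N u v) (p2 N u v) := by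
  have e : (p1 N u v * (starRingEnd ℂ) (p2 N u v)).im = N.det * (u * (starRingEnd ℂ) v).im := by
    rw [Matrix.det_fin_two]; simp [p1, p2]; ring
  have : (0 : ℝ) < N.det := by exact_mod_cast hN
  have h' := h
  rw [Pos] at *
  rw [e]; positivity

lemma Pos.ne {u v : ℂ} (h : Pos u v) : v ≠ 0 := by
  rintro rfl; simp [Pos] at h
lemma Pos.ne' {u v : ℂ} (h : Pos u v) : u ≠ 0 := by
  rintro rfl; simp [Pos] at h

lemma Pos.im {u v : ℂ} (h : Pos u v) : 0 < (u / v).im := by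
  have hv := h.ne
  have e : (u / v).im = (u * (starRingEnd ℂ) v).im / normSq v := by
    rw [div_eq_mul_inv, inv_def, ← mul_assoc, im_mul_ofReal]; rfl
  rw [e]; exact div_pos h (normSq_pos.2 hv)

lemma Pos.of_im {z : ℂ} (h : 0 < z.im) : Pos z 1 := by simpa [Pos] using h

lemma Pos.smul {u v : ℂ} (h : Pos u v) {c : ℂ} (hc : c ≠ 0) : Pos (c * u) (c * v) := by
  have : (c * u * (starRingEnd ℂ) (c * v)) = ((normSq c : ℝ) : ℂ) * (u * (starRingEnd ℂ) v) := by
    rw [normSq_eq_conj_mul_self, map_mul]; ring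
  rw [Pos, this, im_ofReal_mul]
  exact mul_pos (normSq_pos.2 hc) h

lemma Pos.seven {u v : ℂ} (h : Pos u v) : Pos (7 * u) v := by
  have := h.act (N := !![7, 0; 0, 1]) (by simp)
  simpa [p1, p2] using this

lemma Pos.fricke {u v : ℂ} (h : Pos u v) : Pos (-v) (7 * u) := by
  have := h.act (N := !![0, -1; 7, 0]) (by simp)
  simpa [p1, p2] using this

/-- homogeneous form of `η⁴` -/
noncomputable def eh (u v : ℂ) : ℂ := e4 (u / v) / v ^ 2

lemma eh_ne {u v : ℂ} (h : Pos u v) : eh u v ≠ 0 :=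
  div_ne_zero (e4_ne h.im) (pow_ne_zero _ h.ne)

lemma eh_smul {c u v : ℂ} (hc : c ≠ 0) : eh (c * u) (c * v) = (c ^ 2)⁻¹ * eh u v := by
  rw [eh, eh, mul_div_mul_left _ _ hc]; field_simp

lemma eh_trans {γ : M2} (hγ : γ.det = 1) {u v : ℂ} (h : Pos u v) :
    eh (p1 γ u v) (p2 γ u v) = zt (psi (γ 0 0) (γ 0 1) (γ 1 0) (γ 1 1)) * eh u v := by
  have hp := (h.act (N := γ) (by omega)).ne
  have hv := h.ne
  rw [Matrix.det_fin_two] at hγ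
  have := e4_trans _ _ _ _ hγ h.im
  have e1 : ((γ 1 0 : ℤ) : ℂ) * (u / v) + (γ 1 1 : ℤ) = p2 γ u v / v := by
    rw [p2]; field_simp
  have e2 : ((γ 0 0 : ℤ) : ℂ) * (u / v) + (γ 0 1 : ℤ) = p1 γ u v / v := by
    rw [p1]; field_simp
  rw [e1, e2, div_div_div_cancel_right₀ hv] at this
  rw [eh, eh, this]; field_simp

lemma zt_pow_six (x : ZMod 6) : zt x ^ 6 = 1 := by
  rw [zt, ← pow_mul, mul_comm x.val, pow_mul, zt_base, one_pow]

/-- matrices of given determinant with lower left entry divisible by 7 -/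
def D7 (d : ℤ) (N : M2) : Prop := N.det = d ∧ 7 ∣ N 1 0

lemma D7.mul {d e : ℤ} {M N : M2} (hM : D7 d M) (hN : D7 e N) : D7 (d * e) (M * N) := by
  refine ⟨by rw [Matrix.det_mul, hM.1, hN.1], ?_⟩
  simp only [Matrix.mul_apply, Fin.sum_univ_two]
  exact dvd_add (hM.2.mul_right _) (hN.2.mul_left _)

noncomputable def yh (u v : ℂ) : ℂ := eh (7 * u) v / eh u v
noncomputable def wh (u v : ℂ) : ℂ := eh u v ^ 7 / eh (7 * u) v

lemma eh7_trans {γ : M2} (hγ : D7 1 γ) {u v : ℂ} (h : Pos u v) :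
    eh (7 * p1 γ u v) (p2 γ u v) = zt (psi (γ 0 0) (γ 0 1) (γ 1 0) (γ 1 1)) * eh (7 * u) v := by
  obtain ⟨hd, c, hc⟩ := hγ
  have := eh_trans (γ := !![γ 0 0, 7 * γ 0 1; c, γ 1 1]) (by
    rw [Matrix.det_fin_two] at hd ⊢; simp; rw [hc] at hd; linarith) h.seven
  have e1 : p1 !![γ 0 0, 7 * γ 0 1; c, γ 1 1] (7 * u) v = 7 * p1 γ u v := by simp [p1]; ring
  have e2 : p2 !![γ 0 0, 7 * γ 0 1; c, γ 1 1] (7 * u) v = p2 γ u v := by simp [p2, hc]; ring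
  rw [e1, e2] at this
  rw [this]
  have h7 : (7 : ZMod 6) = 1 := by decide
  simp [hc, h7]

lemma yh_inv {γ : M2} (hγ : D7 1 γ) {u v : ℂ} (h : Pos u v) : yh (p1 γ u v) (p2 γ u v) = yh u v := by
  rw [yh, eh7_trans hγ h, eh_trans hγ.1 h, mul_div_mul_left _ _ (zt_ne _)]; rfl

lemma wh_inv {γ : M2} (hγ : D7 1 γ) {u v : ℂ} (h : Pos u v) : wh (p1 γ u v) (p2 γ u v) = wh u v := by
  rw [wh, eh7_trans hγ h, eh_trans hγ.1 h, mul_pow, pow_succ (zt _) 6, zt_pow_six, one_mul,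
    mul_div_mul_left _ _ (zt_ne _)]; rfl

lemma yh_ne {u v : ℂ} (h : Pos u v) : yh u v ≠ 0 := div_ne_zero (eh_ne h.seven) (eh_ne h)
lemma wh_ne {u v : ℂ} (h : Pos u v) : wh u v ≠ 0 := div_ne_zero (pow_ne_zero _ (eh_ne h)) (eh_ne h.seven)

lemma yh_smul {c u v : ℂ} (hc : c ≠ 0) : yh (c * u) (c * v) = yh u v := by
  rw [yh, show 7 * (c * u) = c * (7 * u) by ring, eh_smul hc, eh_smul hc, mul_div_mul_left _ _ (by positivity)]; rfl

lemma wh_smul {c u v : ℂ} (hc : c ≠ 0) : wh (c * u) (c * v) = (c ^ 12)⁻¹ * wh u v := by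
  rw [wh, wh, show 7 * (c * u) = c * (7 * u) by ring, eh_smul hc, eh_smul hc]; field_simp

lemma eh_S {u v : ℂ} (h : Pos u v) : eh (-v) u = - eh u v := by
  have := e4_S h.im
  rw [show -1 / (u / v) = -v / u by rw [div_div_eq_mul_div]; ring, zt_three] at this
  have := h.ne; have := h.ne'
  rw [eh, eh, ‹e4 _ = _›]; field_simp

lemma yh_fricke {u v : ℂ} (h : Pos u v) : yh (-v) (7 * u) = 1 / (49 * yh u v) := by
  have e := eh_S h.seven
  have e2 := eh_S h
  have h1 := eh_ne h; have h2 := eh_ne h.seven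
  rw [yh, yh, show 7 * -v = 7 * (-v) by ring, eh_smul (by norm_num), e, e2]
  field_simp; norm_num

lemma wh_fricke {u v : ℂ} (h : Pos u v) : wh (-v) (7 * u) = 49 * wh u v * yh u v ^ 8 := by
  have e := eh_S h.seven
  have e2 := eh_S h
  have h1 := eh_ne h; have h2 := eh_ne h.seven
  rw [yh, wh, wh, show 7 * -v = 7 * (-v) by ring, eh_smul (by norm_num), e, e2]
  field_simp; norm_num

/-- one-variable versions -/
noncomputable def yy (z : ℂ) : ℂ := yh z 1
noncomputable def ww (z : ℂ) : ℂ := wh z 1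

lemma yh_eq {u v : ℂ} (hv : v ≠ 0) : yh u v = yy (u / v) := by
  rw [yy, ← yh_smul (u := u / v) (v := 1) hv, mul_one, mul_div_cancel₀ _ hv]

lemma wh_eq {u v : ℂ} (hv : v ≠ 0) : wh u v = (v ^ 12)⁻¹ * ww (u / v) := by
  rw [ww, ← wh_smul (u := u / v) (v := 1) hv, mul_one, mul_div_cancel₀ _ hv]

/-- inverse of the Euler series -/
noncomputable def D0s : PowerSeries ℤ := (exists_inv_int E0 E0_zero).choose
lemma E0_D0s : E0 * D0s = 1 := (exists_inv_int E0 E0_zero).choose_spec.1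
lemma D0s_zero : coeff 0 D0s = 1 := (exists_inv_int E0 E0_zero).choose_spec.2

noncomputable def Y1 : PowerSeries ℤ := (PowerSeries.expand 7 (by norm_num) E0) ^ 4 * D0s ^ 4
noncomputable def Y1i : PowerSeries ℤ := (PowerSeries.expand 7 (by norm_num) D0s) ^ 4 * E0 ^ 4
noncomputable def Y0 : PowerSeries ℤ := PowerSeries.X * Y1
noncomputable def W0 : PowerSeries ℤ := E0 ^ 28 * (PowerSeries.expand 7 (by norm_num) D0s) ^ 4
noncomputable def W0i : PowerSeries ℤ := D0s ^ 28 * (PowerSeries.expand 7 (by norm_num) E0) ^ 4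

lemma ED7 : PowerSeries.expand 7 (by norm_num) E0 * PowerSeries.expand 7 (by norm_num) D0s = 1 := by
  rw [← map_mul, E0_D0s, map_one]

lemma Y1_inv : Y1 * Y1i = 1 := by
  calc Y1 * Y1i = (PowerSeries.expand 7 (by norm_num) E0 * PowerSeries.expand 7 (by norm_num) D0s) ^ 4 * (E0 * D0s) ^ 4 := by
        rw [Y1, Y1i]; ring
    _ = 1 := by rw [ED7, E0_D0s]; simp
lemma W0_inv : W0 * W0i = 1 := by
  calc W0 * W0i = (PowerSeries.expand 7 (by norm_num) E0 * PowerSeries.expand 7 (by norm_num) D0s) ^ 4 * (E0 * D0s) ^ 28 := by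
        rw [W0, W0i]; ring
    _ = 1 := by rw [ED7, E0_D0s]; simp

lemma Y1_zero : coeff 0 Y1 = 1 := by
  have h1 := E0_zero
  have h2 := D0s_zero
  simp at h1 h2
  simp [Y1, h1, h2]
lemma W0_zero : coeff 0 W0 = 1 := by
  have h1 := E0_zero
  have h2 := D0s_zero
  simp at h1 h2
  simp [W0, h1, h2]

/-- functions of `q` -/
noncomputable def y1f (q : ℂ) : ℂ := ep (q ^ 7) ^ 4 * (ep q)⁻¹ ^ 4
noncomputable def yf (q : ℂ) : ℂ := q * y1f q
noncomputable def wf (q : ℂ) : ℂ := ep q ^ 28 * (ep (q ^ 7))⁻¹ ^ 4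

lemma pow_lt {q : ℂ} (hq : ‖q‖ < 1) {n : ℕ} (hn : n ≠ 0) : ‖q ^ n‖ < 1 := by
  rw [norm_pow]; exact pow_lt_one₀ (norm_nonneg _) hq hn

lemma D0s_rep : Rep (toC D0s) (fun q => (ep q)⁻¹) :=
  ep_rep.inv' (fun _ h => ep_ne h) (by rw [← map_mul, E0_D0s, map_one])

lemma y1f_rep : Rep (toC Y1) y1f := by
  have := ((ep_rep.expand 7 (by norm_num)).pow 4).mul (D0s_rep.pow 4)
  rw [← toC_expand, ← map_pow toC, ← map_pow toC, ← map_mul toC] at this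
  exact this
lemma yf_rep : Rep (toC Y0) yf := by
  rw [Y0, map_mul, toC_X]; exact Rep.X.mul y1f_rep
lemma wf_rep : Rep (toC W0) wf := by
  have := (ep_rep.pow 28).mul ((D0s_rep.expand 7 (by norm_num)).pow 4)
  rw [← toC_expand, ← map_pow toC, ← map_pow toC, ← map_mul toC] at this
  exact this

lemma y1f_ne {q : ℂ} (hq : ‖q‖ < 1) : y1f q ≠ 0 :=
  mul_ne_zero (pow_ne_zero _ (ep_ne (pow_lt hq (by norm_num)))) (pow_ne_zero _ (inv_ne_zero (ep_ne hq)))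
lemma wf_ne {q : ℂ} (hq : ‖q‖ < 1) : wf q ≠ 0 :=
  mul_ne_zero (pow_ne_zero _ (ep_ne hq)) (pow_ne_zero _ (inv_ne_zero (ep_ne (pow_lt hq (by norm_num)))))

lemma eh_one (z : ℂ) : eh z 1 = exp (2 * π * I * z / 6) * ep (qq z) ^ 4 := by
  rw [eh]; simp [e4_eq]
lemma eh_seven (z : ℂ) : eh (7 * z) 1 = exp (2 * π * I * z / 6) ^ 7 * ep (qq z ^ 7) ^ 4 := by
  rw [eh_one, ← exp_nat_mul, show (7 : ℂ) * z = (7 : ℕ) * z by norm_num, qq_nat_mul]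
  congr 2; push_cast; ring

lemma yy_eq {z : ℂ} (hz : 0 < z.im) : yy z = yf (qq z) := by
  have h1 := ep_ne (qq_norm_lt hz)
  have h3 := exp_ne_zero (2 * π * I * z / 6)
  rw [yy, yh, eh_seven, eh_one, yf, y1f]
  rw [show qq z = exp (2 * π * I * z / 6) ^ 6 by
    rw [← exp_nat_mul, qq]; congr 1; push_cast; ring] at *
  field_simp

lemma ww_eq {z : ℂ} (hz : 0 < z.im) : ww z = wf (qq z) := by
  have h1 := ep_ne (pow_lt (qq_norm_lt hz) (show 7 ≠ 0 by norm_num))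
  have h3 := exp_ne_zero (2 * π * I * z / 6)
  rw [ww, wh, eh_seven, eh_one, wf]
  field_simp

end HK

namespace HK
open PowerSeries (coeff)
open UpperHalfPlane hiding I
open ModularForm Complex Filter
open scoped MatrixGroups Real Topology Manifold

/-- invariance under `Γ₀(7)` -/
def Inv7 (f : ℂ → ℂ) : Prop :=
  ∀ γ : M2, D7 1 γ → ∀ z : ℂ, 0 < z.im → f (p1 γ z 1 / p2 γ z 1) = f z

/-- growth at the cusp 0 -/
def GrW (f : ℂ → ℂ) (K : ℕ) : Prop :=
  ∃ C A : ℝ, ∀ z : ℂ, A ≤ z.im → 0 < z.im → ‖f (-1 / (7 * z))‖ ≤ C * Real.exp (2 * π * z.im) ^ K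

lemma smul_coe (g : SL(2, ℤ)) (τ : ℍ) : ((g • τ : ℍ) : ℂ) = p1 g.1 τ 1 / p2 g.1 τ 1 := by
  rw [specialLinearGroup_apply]; simp [p1, p2]

lemma slash_zero (f : ℍ → ℂ) (g : SL(2, ℤ)) : f ∣[(0:ℤ)] g = fun τ => f (g • τ) := by
  ext τ
  rw [ModularForm.SL_slash_apply]
  simp

theorem const_of_bdd {f : ℂ → ℂ} (hd : DifferentiableOn ℂ f {z | 0 < z.im}) (hi : Inv7 f)
    (hb : ∃ C A : ℝ, ∀ z : ℂ, A ≤ z.im → 0 < z.im → ‖f z‖ ≤ C) (hw : GrW f 0) :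
    ∃ c, ∀ z : ℂ, 0 < z.im → f z = c := by
  have hinv : ∀ g : SL(2, ℤ), 7 ∣ g 1 0 → ∀ τ : ℍ, f ((g • τ : ℍ) : ℂ) = f τ := by
    intro g hg τ
    rw [smul_coe]
    exact hi g.1 ⟨g.2, hg⟩ τ τ.2
  have hfi : (CongruenceSubgroup.Gamma0 7).FiniteIndex :=
    (CongruenceSubgroup.Gamma0_is_congruence 7).finiteIndex
  let F : ModularForm (CongruenceSubgroup.Gamma0 7 : Subgroup (GL (Fin 2) ℝ)) 0 :=
    { toFun := fun τ => f τ
      slash_action_eq' := by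
        rintro _ ⟨g, hg, rfl⟩
        have : 7 ∣ g 1 0 := by
          have := CongruenceSubgroup.Gamma0_mem.1 hg
          exact (ZMod.intCast_zmod_eq_zero_iff_dvd _ 7).1 (by exact_mod_cast this)
        have e := slash_zero (fun τ => f τ) g
        refine Eq.trans e ?_
        ext τ
        exact hinv g this τ
      holo' := by
        rw [UpperHalfPlane.mdifferentiable_iff]
        refine hd.congr fun z hz => ?_
        simp [ofComplex_apply_of_im_pos hz]
      bdd_at_cusps' := by
        intro c hc
        rw [Subgroup.IsArithmetic.isCusp_iff_isCusp_SL2Z] at hc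
        rw [OnePoint.isBoundedAt_iff_forall_SL2Z hc]
        intro γ _
        rw [isBoundedAtImInfty_iff]
        show ∃ M A, ∀ z : ℍ, A ≤ z.im → ‖((fun τ : ℍ => f τ) ∣[(0:ℤ)] γ) z‖ ≤ M
        rw [slash_zero]
        by_cases h7 : 7 ∣ γ 1 0
        · obtain ⟨C, A, h⟩ := hb
          refine ⟨C, A, fun z hz => ?_⟩
          show ‖f ((γ • z : ℍ) : ℂ)‖ ≤ C
          rw [hinv γ h7]
          exact h z hz z.2
        · obtain ⟨C, A, h⟩ := hw
          refine ⟨C, 7 * A, fun z hz => ?_⟩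
          show ‖f ((γ • z : ℍ) : ℂ)‖ ≤ C
          have hdet : γ 0 0 * γ 1 1 - γ 0 1 * γ 1 0 = 1 := by
            have := γ.det_coe; rwa [Matrix.det_fin_two] at this
          obtain ⟨j, hj⟩ : ∃ j : ℤ, 7 ∣ γ 1 1 - j * γ 1 0 := by
            have hc : IsCoprime (7 : ℤ) (γ 1 0) := by
              rw [Int.isCoprime_iff_gcd_eq_one]
              have := (Nat.coprime_or_dvd_of_prime (show Nat.Prime 7 by norm_num) (γ 1 0).natAbs)
              rcases this with h | h
              · exact h
              · exact absurd (Int.natCast_dvd.2 h) h7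
            obtain ⟨a, b, hab⟩ := hc
            exact ⟨b * γ 1 1, a * γ 1 1, by linear_combination (-γ 1 1) * hab⟩
          let w : ℂ := ((z : ℂ) + j) / 7
          have hw0 : w.im = (z : ℂ).im / 7 := by simp [w]
          have hwp : 0 < w.im := by rw [hw0]; have := z.2; positivity
          have hz' : (z : ℂ).im = z.im := rfl
          have hww := h w (by rw [hw0, hz']; linarith) hwp
          have hg := hi !![-(γ 0 1 - j * γ 0 0), γ 0 0; -(γ 1 1 - j * γ 1 0), γ 1 0]
            ⟨by rw [Matrix.det_fin_two]; simp; linear_combination hdet, by simpa using (dvd_sub_comm.1 hj)⟩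
            (-1 / (7 * w)) (by
              have := (Pos.of_im hwp).fricke.im
              rwa [mul_comm, mul_comm] at this)
          have hne : (z : ℂ) + j ≠ 0 := by
            have := z.2
            intro h0
            have := congrArg Complex.im h0
            simp at this
            exact z.2.ne' this
          have e : ((γ • z : ℍ) : ℂ) = p1 !![-(γ 0 1 - j * γ 0 0), γ 0 0; -(γ 1 1 - j * γ 1 0), γ 1 0] (-1 / (7 * w)) 1 /
            p2 !![-(γ 0 1 - j * γ 0 0), γ 0 0; -(γ 1 1 - j * γ 1 0), γ 1 0] (-1 / (7 * w)) 1 := by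
            rw [smul_coe]
            have e1 : (-1 / (7 * w)) = -1 / (z + j) := by simp [w]; field_simp
            rw [e1]
            have : p1 !![-(γ 0 1 - j * γ 0 0), γ 0 0; -(γ 1 1 - j * γ 1 0), γ 1 0] (-1 / (z + j)) 1 = p1 γ.1 z 1 / (z + j) := by
              simp [p1]; field_simp; ring
            rw [this]
            have : p2 !![-(γ 0 1 - j * γ 0 0), γ 0 0; -(γ 1 1 - j * γ 1 0), γ 1 0] (-1 / (z + j)) 1 = p2 γ.1 z 1 / (z + j) := by
              simp [p2]; field_simp; ring
            rw [this, div_div_div_cancel_right₀ hne]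
          rw [e, hg]
          simpa using hww }
  obtain ⟨c, hc⟩ := ModularForm.eq_const_of_weight_zero F
  refine ⟨c, fun z hz => ?_⟩
  exact congrFun hc (⟨z, hz⟩ : ℍ)

end HK

namespace HK
open PowerSeries (coeff)
open UpperHalfPlane hiding I
open ModularForm Complex Filter
open scoped MatrixGroups Real Topology Manifold

lemma Rep.bdd {G : PowerSeries ℂ} {g : ℂ → ℂ} (h : Rep G g) :
    ∃ C : ℝ, 0 ≤ C ∧ ∀ z : ℂ, 1 ≤ z.im → ‖g (qq z)‖ ≤ C := by
  have hr : Real.exp (-(2 * π)) < 1 := by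
    rw [Real.exp_lt_one_iff]; have := Real.pi_pos; linarith
  have hc : ContinuousOn g (Metric.closedBall 0 (Real.exp (-(2 * π)))) :=
    h.differentiableOn.continuousOn.mono (Metric.closedBall_subset_ball hr)
  obtain ⟨C, hC⟩ := (isCompact_closedBall (0 : ℂ) (Real.exp (-(2 * π)))).exists_bound_of_continuousOn hc
  refine ⟨|C|, abs_nonneg _, fun z hz => (hC _ ?_).trans (le_abs_self _)⟩
  rw [mem_closedBall_zero_iff, qq_norm, Real.exp_le_exp]
  have := Real.pi_pos; nlinarith

lemma Rep.holo {G : PowerSeries ℂ} {g : ℂ → ℂ} (h : Rep G g) :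
    DifferentiableOn ℂ (fun z => g (qq z)) {z : ℂ | 0 < z.im} := by
  refine h.differentiableOn.comp (t := Metric.ball 0 1) ?_ ?_
  · intro z _
    unfold qq
    fun_prop
  · intro z hz
    simpa using qq_norm_lt hz

lemma Rep.lim {G : PowerSeries ℂ} {g : ℂ → ℂ} (h : Rep G g) :
    Tendsto (fun t : ℝ => g (qq (t * I))) atTop (𝓝 (coeff 0 G)) := by
  rw [h.coeff_zero]
  have c1 : ContinuousAt g 0 :=
    (h.differentiableOn.differentiableAt (Metric.ball_mem_nhds 0 one_pos)).continuousAt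
  refine c1.tendsto.comp ?_
  rw [tendsto_zero_iff_norm_tendsto_zero]
  have : (fun t : ℝ => ‖qq (t * I)‖) = fun t : ℝ => Real.exp (-(2 * π * t)) := by
    ext t; rw [qq_norm]; simp
  rw [this]
  exact Real.tendsto_exp_neg_atTop_nhds_zero.comp (tendsto_id.const_mul_atTop (by have := Real.pi_pos; positivity))

lemma Rep.const_of_eq {G : PowerSeries ℂ} {g : ℂ → ℂ} (h : Rep G g) {c : ℂ}
    (hc : ∀ z : ℂ, 0 < z.im → g (qq z) = c) : coeff 0 G = c := by
  refine tendsto_nhds_unique h.lim (tendsto_const_nhds.congr' ?_)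
  filter_upwards [eventually_gt_atTop 0] with t ht
  rw [hc]; simpa using ht

lemma neg_inv_im {z : ℂ} (hz : 0 < z.im) : 0 < (-1 / (7 * z)).im := by
  simpa using (Pos.of_im hz).fricke.im

lemma yy_fricke {z : ℂ} (hz : 0 < z.im) : yy (-1 / (7 * z)) = 1 / (49 * yy z) := by
  have h := (Pos.of_im hz).fricke
  rw [← yh_eq h.ne, yh_fricke (Pos.of_im hz)]; rfl

lemma yy_ne {z : ℂ} (hz : 0 < z.im) : yy z ≠ 0 := yh_ne (Pos.of_im hz)

lemma yy_inv : Inv7 yy := by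
  intro γ hγ z hz
  have hp := (Pos.of_im hz).act (N := γ) (by rw [hγ.1]; norm_num)
  rw [← yh_eq hp.ne, yh_inv hγ (Pos.of_im hz)]; rfl

lemma act_im {γ : M2} {d : ℤ} (hd : 0 < d) (hγ : γ.det = d) {z : ℂ} (hz : 0 < z.im) : 0 < (p1 γ z 1 / p2 γ z 1).im :=
  ((Pos.of_im hz).act (N := γ) (by rw [hγ]; exact hd)).im

lemma yy_bound : ∃ C : ℝ, 0 ≤ C ∧ ∀ z : ℂ, 1 ≤ z.im → ‖yy z‖ * Real.exp (2 * π * z.im) ≤ C := by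
  obtain ⟨C, h0, hC⟩ := y1f_rep.bdd
  refine ⟨C, h0, fun z hz => ?_⟩
  rw [yy_eq (by linarith), yf, norm_mul, qq_norm, mul_right_comm, ← Real.exp_add]
  simpa using hC z hz

/-- the structure theorem -/
theorem struct {R : Type*} [CommRing R] (φ : R →+* ℂ) (K : ℕ) :
    ∀ (F : PowerSeries R) (f g : ℂ → ℂ), (∀ z : ℂ, 0 < z.im → f z = g (qq z)) →
      Rep (PowerSeries.map φ F) g → Inv7 f → GrW f K →
      ∃ P : R[X], P.natDegree ≤ K ∧ ∀ z : ℂ, 0 < z.im → f z = P.eval₂ φ (yy z) := by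
  induction K with
  | zero =>
    intro F f g hfg hF hi hw
    obtain ⟨c, hc⟩ := const_of_bdd (hF.holo.congr fun z hz => hfg z hz) hi (by
      obtain ⟨C, _, hC⟩ := hF.bdd
      refine ⟨C, 1, fun z hz hz' => ?_⟩
      rw [hfg z hz']; exact hC z hz) hw
    have := hF.const_of_eq fun z hz => by rw [← hfg z hz, hc z hz]
    refine ⟨Polynomial.C (coeff 0 F), by simp, fun z hz => ?_⟩
    rw [hc z hz, ← this]; simp
  | succ K ih =>
    intro F f g hfg hF hi hw
    let F1 : PowerSeries R := PowerSeries.mk fun n => coeff (n + 1) F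
    have hF1 : F = PowerSeries.C (coeff 0 F) + PowerSeries.X * F1 := by
      have := PowerSeries.eq_X_mul_shift_add_const F
      rw [add_comm]; simpa using this
    have hF1r : Rep (PowerSeries.X * PowerSeries.map φ F1) (fun q => g q - φ (coeff 0 F)) := by
      have := hF.sub (Rep.const (φ (coeff 0 F)))
      convert this using 1
      conv_rhs => rw [hF1]
      simp
    have hr := hF1r.shift
    have hv := hF1r.shift_val
    set g1 : ℂ → ℂ := fun q => ∑' n, coeff n (PowerSeries.map φ F1) * q ^ n with hg1
    have hY : Rep (PowerSeries.map φ (PowerSeries.map (Int.castRingHom R) Y1i)) (fun q => (y1f q)⁻¹) := by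
      have : PowerSeries.map φ (PowerSeries.map (Int.castRingHom R) Y1i) = toC Y1i := by
        rw [toC]; ext n; simp
      rw [this]
      exact y1f_rep.inv' (fun _ h => y1f_ne h) (by rw [← map_mul toC, Y1_inv, map_one])
    obtain ⟨P, hP, hPe⟩ := ih (F1 * PowerSeries.map (Int.castRingHom R) Y1i)
      (fun z => (f z - φ (coeff 0 F)) / yy z) (fun q => g1 q * (y1f q)⁻¹) (by
        intro z hz
        have hq := qq_norm_lt hz
        have := hv (qq z) hq
        have h1 := y1f_ne hq
        have h2 := qq_ne z
        show (f z - φ (coeff 0 F)) / yy z = g1 (qq z) * (y1f (qq z))⁻¹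
        rw [yy_eq hz, yf, hfg z hz, ← this]
        field_simp; rfl) (by rw [map_mul]; exact hr.mul hY) (by
        intro γ hγ z hz
        show (f _ - _) / yy _ = _
        rw [hi γ hγ z hz, yy_inv γ hγ z hz]) (by
        obtain ⟨C, A, hC⟩ := hw
        obtain ⟨C', h0, hC'⟩ := yy_bound
        refine ⟨49 * (C * C' + ‖φ (coeff 0 F)‖ * C'), max A 1, fun z hz hz' => ?_⟩
        have hA : A ≤ z.im := (le_max_left _ _).trans hz
        have h1 : 1 ≤ z.im := (le_max_right _ _).trans hz
        show ‖(f (-1 / (7 * z)) - _) / yy (-1 / (7 * z))‖ ≤ _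
        rw [yy_fricke hz', norm_div, norm_div, norm_mul, norm_one, div_div_eq_mul_div, div_one]
        have hE : 1 ≤ Real.exp (2 * π * z.im) := by
          rw [Real.one_le_exp_iff]; have := Real.pi_pos; positivity
        have hE0 : 0 < Real.exp (2 * π * z.im) := Real.exp_pos _
        have hy := hC' z h1
        have hf := hC z hA hz'
        set E := Real.exp (2 * π * z.im) with hEd
        have hn : ‖(49:ℂ)‖ = 49 := by simp
        rw [hn]
        have h3 := norm_sub_le (f (-1 / (7 * z))) (φ (coeff 0 F))
        have hEK : 1 ≤ E ^ K := one_le_pow₀ hE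
        have hCn : 0 ≤ C * E ^ (K+1) := (norm_nonneg _).trans hf
        calc ‖f (-1 / (7 * z)) - φ (coeff 0 F)‖ * (49 * ‖yy z‖)
            ≤ (C * E ^ (K+1) + ‖φ (coeff 0 F)‖ * E ^ (K+1)) * (49 * ‖yy z‖) := by
              gcongr
              refine h3.trans (add_le_add hf ?_)
              exact le_mul_of_one_le_right (norm_nonneg _) (one_le_pow₀ hE)
          _ = 49 * (C + ‖φ (coeff 0 F)‖) * E ^ K * (‖yy z‖ * E) := by ring
          _ ≤ 49 * (C + ‖φ (coeff 0 F)‖) * E ^ K * C' := by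
              have : 0 ≤ C := by
                by_contra hcon
                push Not at hcon
                have : C * E ^ (K+1) < 0 := mul_neg_of_neg_of_pos hcon (by positivity)
                linarith
              gcongr
          _ = _ := by ring)
    refine ⟨Polynomial.C (coeff 0 F) + Polynomial.X * P, ?_, fun z hz => ?_⟩
    · refine (natDegree_add_le _ _).trans (max_le (by simp) ?_)
      refine natDegree_mul_le.trans ?_
      have := natDegree_X_le (R := R)
      omega
    · have := hPe z hz
      have h2 := yy_ne hz
      rw [div_eq_iff h2] at this
      simp only [eval₂_add, eval₂_mul, eval₂_C, eval₂_X]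
      linear_combination this

lemma yy_holo : DifferentiableOn ℂ yy {z : ℂ | 0 < z.im} :=
  yf_rep.holo.congr fun z hz => yy_eq hz

lemma yf_zero : yf 0 = 0 := by simp [yf]

lemma yy_lim_bd (c : ℂ) (hc : c ≠ 0) : ∃ A : ℝ, 1 ≤ A ∧ ∀ z : ℂ, A ≤ z.im → ‖yy z‖ ≤ ‖c‖ / 2 := by
  obtain ⟨C, h0, hC⟩ := yy_bound
  have hcp : 0 < ‖c‖ := norm_pos_iff.2 hc
  have ht : Tendsto (fun t : ℝ => Real.exp (2 * π * t)) atTop atTop :=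
    Real.tendsto_exp_atTop.comp (tendsto_id.const_mul_atTop (by have := Real.pi_pos; positivity))
  obtain ⟨A, hA⟩ := (ht.eventually_ge_atTop (2 * C / ‖c‖)).exists_forall_of_atTop
  refine ⟨max A 1, le_max_right _ _, fun z hz => ?_⟩
  have h1 := hA z.im ((le_max_left _ _).trans hz)
  have h2 := hC z ((le_max_right _ _).trans hz)
  rw [div_le_iff₀ hcp] at h1
  have hE := Real.exp_pos (2 * π * z.im)
  set E := Real.exp (2 * π * z.im)
  rw [le_div_iff₀ (by norm_num)]
  have : ‖yy z‖ * 2 * E ≤ ‖c‖ * E := by nlinarith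
  exact le_of_mul_le_mul_right this hE

theorem yy_surj {c : ℂ} (hc : c ≠ 0) : ∃ z : ℂ, 0 < z.im ∧ yy z = c := by
  by_contra hcon
  push Not at hcon
  have hcp : 0 < ‖c‖ := norm_pos_iff.2 hc
  obtain ⟨d, hd⟩ := const_of_bdd (f := fun z => (yy z - c)⁻¹)
    (by
      refine (yy_holo.sub_const c).fun_inv fun z hz => sub_ne_zero.2 (hcon z hz))
    (by intro γ hγ z hz; show (yy _ - c)⁻¹ = _; rw [yy_inv γ hγ z hz]) (by
      obtain ⟨A, h1, hA⟩ := yy_lim_bd c hc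
      refine ⟨2 / ‖c‖, A, fun z hz hz' => ?_⟩
      rw [norm_inv, inv_le_comm₀ (norm_pos_iff.2 (sub_ne_zero.2 (hcon z hz'))) (by positivity), inv_div]
      have := hA z hz
      have h3 := norm_sub_norm_le c (yy z)
      rw [norm_sub_rev] at h3
      linarith) (by
      obtain ⟨A, h1, hA⟩ := yy_lim_bd ((49 * c)⁻¹) (inv_ne_zero (mul_ne_zero (by norm_num) hc))
      refine ⟨1 / ‖c‖, A, fun z hz hz' => ?_⟩
      have := hA z hz
      have hne := hcon _ (neg_inv_im hz')
      have hy := yy_ne hz'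
      rw [norm_inv, inv_le_comm₀ (norm_pos_iff.2 (sub_ne_zero.2 hne)) (by positivity)]
      rw [yy_fricke hz']
      have h3 := norm_sub_norm_le (1 / (49 * yy z)) c
      have h4 : 2 * ‖c‖ ≤ ‖1 / (49 * yy z)‖ := by
        rw [norm_div, norm_mul, norm_one]
        rw [norm_inv, norm_mul] at this
        have hn : ‖(49:ℂ)‖ = 49 := by simp
        rw [hn] at this ⊢
        have hyp : 0 < ‖yy z‖ := norm_pos_iff.2 hy
        rw [le_div_iff₀ (by positivity)]
        have e : (49 * ‖c‖) * ((49 * ‖c‖)⁻¹ / 2) = 1 / 2 := by field_simp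
        have h5 := mul_le_mul_of_nonneg_left this (show 0 ≤ 49 * ‖c‖ by positivity)
        rw [e] at h5
        linarith
      simp only [pow_zero, mul_one, one_div, inv_inv] at h4 h3 ⊢
      linarith)
  -- constant reciprocal: yy constant, so yy → 0 gives contradiction
  have h0 : ∀ z : ℂ, 0 < z.im → yf (qq z) = c + d⁻¹ := by
    intro z hz
    have := hd z hz
    rw [← yy_eq hz, ← this, inv_inv]; ring
  have h1 := yf_rep.const_of_eq h0
  rw [yf_rep.coeff_zero, yf_zero] at h1
  have := h0 I (by simp)
  rw [← h1, ← yy_eq (by simp)] at this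
  exact yy_ne (by simp) this

end HK

namespace HK
open PowerSeries (coeff)
open UpperHalfPlane hiding I
open ModularForm Complex Filter
open scoped MatrixGroups Real Topology Manifold

/-- Hecke representatives -/
def Mi (l : ℕ) : Option (Fin l) → M2
  | none => !![(l : ℤ), 0; 0, 1]
  | some k => !![1, (k : ℤ); 0, (l : ℤ)]

lemma Mi_D7 (l : ℕ) (i : Option (Fin l)) : D7 l (Mi l i) := by
  cases i <;> simp [Mi, D7, Matrix.det_fin_two]

lemma exists_k (l : ℕ) (hp : l.Prime) {a b : ℤ} (ha : ¬ (l : ℤ) ∣ a) :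
    ∃ k : Fin l, (l : ℤ) ∣ b - k * a := by
  have : Fact l.Prime := ⟨hp⟩
  have ha' : (a : ZMod l) ≠ 0 := by rwa [Ne, ZMod.intCast_zmod_eq_zero_iff_dvd]
  refine ⟨⟨((b : ZMod l) / a).val, ZMod.val_lt _⟩, ?_⟩
  rw [← ZMod.intCast_zmod_eq_zero_iff_dvd]
  push_cast
  rw [ZMod.natCast_zmod_val]
  field_simp
  simp

lemma hecke_ex (l : ℕ) (hp : l.Prime) (h7 : l ≠ 7) {N : M2} (hN : D7 l N) :
    ∃ i γ, D7 1 γ ∧ N = γ * Mi l i := by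
  obtain ⟨hd, h10⟩ := hN
  rw [Matrix.det_fin_two] at hd
  have hl0 : (l : ℤ) ≠ 0 := by exact_mod_cast hp.ne_zero
  have hlp : Prime (l : ℤ) := Nat.prime_iff_prime_int.1 hp
  have key : ∀ k : Fin l, (l : ℤ) ∣ N 0 1 - k * N 0 0 → (l : ℤ) ∣ N 1 1 - k * N 1 0 →
      ∃ i γ, D7 1 γ ∧ N = γ * Mi l i := by
    rintro k ⟨x, hx⟩ ⟨y, hy⟩
    refine ⟨some k, !![N 0 0, x; N 1 0, y], ⟨?_, by simpa using h10⟩, ?_⟩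
    · rw [Matrix.det_fin_two]
      simp
      apply mul_left_cancel₀ hl0
      linear_combination hd - N 0 0 * hy + N 1 0 * hx
    · ext i j
      fin_cases i <;> fin_cases j <;> simp [Mi, Matrix.mul_apply, Fin.sum_univ_two]
      · linear_combination hx
      · linear_combination hy
  by_cases ha : (l : ℤ) ∣ N 0 0
  · by_cases hc : (l : ℤ) ∣ N 1 0
    · obtain ⟨x, hx⟩ := ha
      obtain ⟨y, hy⟩ := hc
      refine ⟨none, !![x, N 0 1; y, N 1 1], ⟨?_, ?_⟩, ?_⟩
      · rw [Matrix.det_fin_two]; simp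
        apply mul_left_cancel₀ hl0
        linear_combination hd - N 1 1 * hx + N 0 1 * hy
      · have : (7 : ℤ) ∣ y := by
          rw [hy] at h10
          refine (Int.Prime.dvd_mul' (p := 7) (by norm_num) h10).resolve_left fun h => h7 ?_
          have : 7 ∣ l := by exact_mod_cast h
          exact ((Nat.prime_dvd_prime_iff_eq (by norm_num) hp).1 this).symm
        simpa using this
      · ext i j
        fin_cases i <;> fin_cases j <;> simp [Mi, Matrix.mul_apply, Fin.sum_univ_two, hx, hy, mul_comm]
    · obtain ⟨k, hk⟩ := exists_k l hp (b := N 1 1) hc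
      refine key k ?_ hk
      have : (l : ℤ) ∣ N 1 0 * (N 0 1 - k * N 0 0) := by
        obtain ⟨x, hx⟩ := hk
        exact ⟨N 0 0 * x - 1, by linear_combination N 0 0 * hx - hd⟩
      exact (hlp.dvd_or_dvd this).resolve_left hc
  · obtain ⟨k, hk⟩ := exists_k l hp (b := N 0 1) ha
    refine key k hk ?_
    have : (l : ℤ) ∣ N 0 0 * (N 1 1 - k * N 1 0) := by
      obtain ⟨x, hx⟩ := hk
      exact ⟨N 1 0 * x + 1, by linear_combination N 1 0 * hx + hd⟩
    exact (hlp.dvd_or_dvd this).resolve_left ha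

lemma hecke_uni (l : ℕ) (hp : l.Prime) {i j : Option (Fin l)} {γ : M2} (hγ : γ.det = 1)
    (h : γ * Mi l i = Mi l j) : i = j := by
  have hl : 1 < (l : ℤ) := by exact_mod_cast hp.one_lt
  rw [Matrix.det_fin_two] at hγ
  have e := fun a b => congrFun (congrFun h a) b
  have e00 := e 0 0
  have e01 := e 0 1
  have e10 := e 1 0
  have e11 := e 1 1
  have hu : ∀ x : ℤ, x * l = 1 → False := fun x hx => by
    have := Int.isUnit_iff.1 (IsUnit.of_mul_eq_one_right x hx)
    omega
  cases i <;> cases j <;> simp [Mi, Matrix.mul_apply, Fin.sum_univ_two] at e00 e01 e10 e11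
  · rfl
  · exact (hu _ e00).elim
  · rw [e00, e10] at hγ
    simp at hγ
    exact (hu (γ 1 1) (by linarith)).elim
  · rename_i k k'
    rw [e00] at e01
    have : (k : ℤ) ≡ k' [ZMOD l] := by
      rw [Int.modEq_iff_dvd]; exact ⟨γ 0 1, by linarith⟩
    have := (Int.natCast_modEq_iff.1 this)
    rw [Nat.ModEq, Nat.mod_eq_of_lt k.2, Nat.mod_eq_of_lt k'.2] at this
    rw [Fin.ext this]

lemma adj_D7 {γ : M2} (h : D7 1 γ) : D7 1 γ.adjugate := by
  refine ⟨by rw [Matrix.det_adjugate, h.1]; simp, ?_⟩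
  rw [Matrix.adjugate_fin_two]
  simpa using h.2

lemma hecke_perm (l : ℕ) (hp : l.Prime) (h7 : l ≠ 7) {γ : M2} (hγ : D7 1 γ) :
    ∃ σ : Equiv.Perm (Option (Fin l)), ∀ i, ∃ γ', D7 1 γ' ∧ Mi l i * γ = γ' * Mi l (σ i) := by
  have : ∀ i, ∃ j γ', D7 1 γ' ∧ Mi l i * γ = γ' * Mi l j := fun i =>
    hecke_ex l hp h7 (by simpa using (Mi_D7 l i).mul hγ)
  choose σ γ' h1 h2 using this
  have hinj : Function.Injective σ := by
    intro i j hij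
    have e : ∀ i, (γ' i).adjugate * Mi l i = Mi l (σ i) * γ.adjugate := by
      intro i
      have a1 : (γ' i).adjugate * γ' i = 1 := by rw [Matrix.adjugate_mul, (h1 i).1, one_smul]
      have a2 : γ * γ.adjugate = 1 := by rw [Matrix.mul_adjugate, hγ.1, one_smul]
      calc (γ' i).adjugate * Mi l i = (γ' i).adjugate * Mi l i * (γ * γ.adjugate) := by rw [a2, mul_one]
        _ = (γ' i).adjugate * (Mi l i * γ) * γ.adjugate := by simp only [mul_assoc]
        _ = ((γ' i).adjugate * γ' i) * Mi l (σ i) * γ.adjugate := by rw [h2]; simp only [mul_assoc]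
        _ = _ := by rw [a1, one_mul]
    have := e i
    rw [hij, ← e j] at this
    refine hecke_uni l hp (γ := γ' j * (γ' i).adjugate) ?_ ?_
    · rw [Matrix.det_mul, (h1 j).1, (adj_D7 (h1 i)).1, one_mul]
    · rw [mul_assoc, this, ← mul_assoc, Matrix.mul_adjugate, (h1 j).1, one_smul, one_mul]
  exact ⟨Equiv.ofBijective σ (Finite.injective_iff_bijective.1 hinj), fun i => ⟨γ' i, h1 i, h2 i⟩⟩

/-- growth at infinity -/
def Gr (f : ℂ → ℂ) (K : ℕ) : Prop :=
  ∃ C A : ℝ, 0 ≤ C ∧ ∀ z : ℂ, A ≤ z.im → 0 < z.im → ‖f z‖ ≤ C * Real.exp (2 * π * z.im) ^ K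

lemma one_le_exp {z : ℂ} (hz : 0 < z.im) : 1 ≤ Real.exp (2 * π * z.im) := by
  rw [Real.one_le_exp_iff]; have := Real.pi_pos; positivity

lemma Gr.mono {f : ℂ → ℂ} {K L : ℕ} (h : Gr f K) (hKL : K ≤ L) : Gr f L := by
  obtain ⟨C, A, h0, h⟩ := h
  exact ⟨C, A, h0, fun z h1 h2 => (h z h1 h2).trans
    (mul_le_mul_of_nonneg_left (pow_le_pow_right₀ (one_le_exp h2) hKL) h0)⟩

lemma Gr.congr {f g : ℂ → ℂ} {K : ℕ} (h : Gr f K) (e : ∀ z : ℂ, 0 < z.im → f z = g z) : Gr g K := by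
  obtain ⟨C, A, h0, h⟩ := h
  exact ⟨C, A, h0, fun z h1 h2 => by rw [← e z h2]; exact h z h1 h2⟩

lemma Gr.add {f g : ℂ → ℂ} {K : ℕ} (hf : Gr f K) (hg : Gr g K) : Gr (fun z => f z + g z) K := by
  obtain ⟨C, A, h0, h⟩ := hf
  obtain ⟨C', A', h0', h'⟩ := hg
  refine ⟨C + C', max A A', by positivity, fun z h1 h2 => ?_⟩
  have a := h z ((le_max_left _ _).trans h1) h2
  have b := h' z ((le_max_right _ _).trans h1) h2
  rw [add_mul]
  exact (norm_add_le _ _).trans (add_le_add a b)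

lemma Gr.mul {f g : ℂ → ℂ} {K L : ℕ} (hf : Gr f K) (hg : Gr g L) : Gr (fun z => f z * g z) (K + L) := by
  obtain ⟨C, A, h0, h⟩ := hf
  obtain ⟨C', A', h0', h'⟩ := hg
  refine ⟨C * C', max A A', by positivity, fun z h1 h2 => ?_⟩
  have a := h z ((le_max_left _ _).trans h1) h2
  have b := h' z ((le_max_right _ _).trans h1) h2
  rw [norm_mul]
  refine (mul_le_mul a b (norm_nonneg _) (by positivity)).trans (le_of_eq ?_)
  rw [pow_add]; ring

lemma Gr.const (c : ℂ) : Gr (fun _ => c) 0 := ⟨‖c‖, 0, norm_nonneg _, fun z _ _ => by simp⟩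

lemma Gr.neg {f : ℂ → ℂ} {K : ℕ} (hf : Gr f K) : Gr (fun z => - f z) K := by
  simpa using (Gr.const (-1)).mul hf

lemma Gr.sub {f g : ℂ → ℂ} {K : ℕ} (hf : Gr f K) (hg : Gr g K) : Gr (fun z => f z - g z) K := by
  simpa [sub_eq_add_neg] using hf.add hg.neg

lemma Gr.pow {f : ℂ → ℂ} {K : ℕ} (hf : Gr f K) (n : ℕ) : Gr (fun z => f z ^ n) (n * K) := by
  induction n with
  | zero => simpa using Gr.const 1
  | succ n ih => simpa [pow_succ, add_mul] using ih.mul hf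

lemma Gr.prod {ι : Type*} (s : Finset ι) {f : ι → ℂ → ℂ} {K : ι → ℕ} (h : ∀ i ∈ s, Gr (f i) (K i)) :
    Gr (fun z => ∏ i ∈ s, f i z) (∑ i ∈ s, K i) := by
  classical
  induction s using Finset.induction_on with
  | empty => simpa using Gr.const 1
  | insert a s ha ih =>
    simp only [Finset.prod_insert ha, Finset.sum_insert ha]
    exact (h a (Finset.mem_insert_self _ _)).mul (ih fun i hi => h i (Finset.mem_insert_of_mem hi))

lemma Gr.sum {ι : Type*} (s : Finset ι) {f : ι → ℂ → ℂ} {K : ℕ} (h : ∀ i ∈ s, Gr (f i) K) :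
    Gr (fun z => ∑ i ∈ s, f i z) K := by
  classical
  induction s using Finset.induction_on with
  | empty => simpa using (Gr.const 0).mono (Nat.zero_le K)
  | insert a s ha ih =>
    simp only [Finset.sum_insert ha]
    exact (h a (Finset.mem_insert_self _ _)).add (ih fun i hi => h i (Finset.mem_insert_of_mem hi))

lemma GrW_of_Gr {f : ℂ → ℂ} {K : ℕ} (h : Gr (fun z => f (-1 / (7 * z))) K) : GrW f K := by
  obtain ⟨C, A, _, h⟩ := h; exact ⟨C, A, h⟩

/-- coefficientwise growth for polynomials -/
def PGr (p : ℂ → ℂ[X]) : Prop := ∃ K, ∀ j, Gr (fun z => (p z).coeff j) K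

lemma PGr.mul {p q : ℂ → ℂ[X]} (hp : PGr p) (hq : PGr q) : PGr (fun z => p z * q z) := by
  obtain ⟨K, h⟩ := hp
  obtain ⟨L, h'⟩ := hq
  refine ⟨K + L, fun j => ?_⟩
  simp only [Polynomial.coeff_mul]
  exact Gr.sum _ fun i _ => (h _).mul (h' _)

lemma PGr.lin {f : ℂ → ℂ} {K : ℕ} (hf : Gr f K) : PGr (fun z => X - C (f z)) := by
  refine ⟨K, fun j => ?_⟩
  simp only [coeff_sub, coeff_C]
  refine Gr.sub ((Gr.const _).mono (Nat.zero_le _)) ?_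
  split_ifs
  · exact hf
  · exact (Gr.const 0).mono (Nat.zero_le _)

lemma PGr.prod {ι : Type*} (s : Finset ι) {p : ι → ℂ → ℂ[X]} (h : ∀ i ∈ s, PGr (p i)) :
    PGr (fun z => ∏ i ∈ s, p i z) := by
  classical
  induction s using Finset.induction_on with
  | empty => exact ⟨0, fun j => by simpa using Gr.const _⟩
  | insert a s ha ih =>
    simp only [Finset.prod_insert ha]
    exact (h a (Finset.mem_insert_self _ _)).mul (ih fun i hi => h i (Finset.mem_insert_of_mem hi))

end HK

namespace HK
open PowerSeries (coeff)
open UpperHalfPlane hiding I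
open ModularForm Complex Filter
open scoped MatrixGroups Real Topology Manifold

variable {R : Type*} [CommRing R]

def RepP (φ : R →+* ℂ) (Q : (PowerSeries R)[X]) (p : ℂ → ℂ[X]) : Prop :=
  ∀ j, Rep (PowerSeries.map φ (Q.coeff j)) (fun t => (p t).coeff j)

lemma RepP.mul {φ : R →+* ℂ} {Q S : (PowerSeries R)[X]} {p q : ℂ → ℂ[X]} (h : RepP φ Q p)
    (h' : RepP φ S q) : RepP φ (Q * S) (fun t => p t * q t) := by
  intro j
  simp only [Polynomial.coeff_mul, map_sum, map_mul]
  exact Rep.sum _ fun i _ => (h _).mul (h' _)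

lemma RepP.lin {φ : R →+* ℂ} {G : PowerSeries R} {g : ℂ → ℂ} (h : Rep (PowerSeries.map φ G) g) :
    RepP φ (X - C G) (fun t => X - C (g t)) := by
  intro j
  simp only [coeff_sub, coeff_C, map_sub, Polynomial.coeff_X]
  refine Rep.sub ?_ ?_
  · split_ifs
    · simpa using Rep.one
    · simpa using Rep.const 0
  · split_ifs
    · exact h
    · simpa using Rep.const 0

lemma RepP.prod {φ : R →+* ℂ} {ι : Type*} (s : Finset ι) {Q : ι → (PowerSeries R)[X]}
    {p : ι → ℂ → ℂ[X]} (h : ∀ i ∈ s, RepP φ (Q i) (p i)) :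
    RepP φ (∏ i ∈ s, Q i) (fun z => ∏ i ∈ s, p i z) := by
  classical
  induction s using Finset.induction_on with
  | empty =>
    intro j
    simp only [Finset.prod_empty, coeff_one]
    split_ifs
    · simpa using Rep.one
    · simpa using Rep.const 0
  | insert a s ha ih =>
    simp only [Finset.prod_insert ha]
    exact (h a (Finset.mem_insert_self _ _)).mul (ih fun i hi => h i (Finset.mem_insert_of_mem hi))

lemma Rep.rescale {φ : R →+* ℂ} {G : PowerSeries R} {g : ℂ → ℂ} (h : Rep (PowerSeries.map φ G) g)
    (b : R) (hb : ‖φ b‖ ≤ 1) :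
    Rep (PowerSeries.map φ (PowerSeries.rescale b G)) (fun t => g (φ b * t)) := by
  intro q hq
  have := h (φ b * q) (by
    rw [norm_mul]; nlinarith [norm_nonneg q])
  convert this using 2 with n
  rw [PowerSeries.coeff_map, PowerSeries.coeff_rescale, PowerSeries.coeff_map, map_mul, map_pow]; ring

lemma Rep.of_expand {D : PowerSeries ℂ} {h : ℂ → ℂ} (p : ℕ) (hp : p ≠ 0)
    (hD : Rep (PowerSeries.expand p hp D) h) :
    ∃ g, Rep D g ∧ ∀ t : ℂ, ‖t‖ < 1 → g (t ^ p) = h t := by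
  have key : ∀ t : ℂ, ‖t‖ < 1 → HasSum (fun n => coeff n D * (t ^ p) ^ n) (h t) := by
    intro t ht
    have h1 := hD t ht
    have hinj : Function.Injective (fun m : ℕ => p * m) :=
      fun a b hab => Nat.eq_of_mul_eq_mul_left (Nat.pos_of_ne_zero hp) hab
    rw [← hinj.hasSum_iff] at h1
    · convert h1 using 2 with n
      simp only [Function.comp]
      rw [PowerSeries.coeff_expand_mul, pow_mul]
    · intro n hn
      rw [PowerSeries.coeff_expand_of_not_dvd, zero_mul]
      rintro ⟨m, rfl⟩
      exact hn ⟨m, rfl⟩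
  refine ⟨fun q => ∑' n, coeff n D * q ^ n, fun q hq => ?_, fun t ht => (key t ht).tsum_eq⟩
  obtain ⟨t, rfl⟩ := IsAlgClosed.exists_pow_nat_eq q (Nat.pos_of_ne_zero hp)
  have ht : ‖t‖ < 1 := by
    by_contra hcon
    push Not at hcon
    rw [norm_pow] at hq
    exact absurd (one_le_pow₀ hcon) (not_le.2 hq)
  exact (key t ht).summable.hasSum

lemma qq_surj {q : ℂ} (h0 : q ≠ 0) (h1 : ‖q‖ < 1) : ∃ z : ℂ, 0 < z.im ∧ qq z = q := by
  have e : qq (log q / (2 * π * I)) = q := by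
    rw [qq, mul_div_cancel₀ _ two_pi_I_ne_zero, exp_log h0]
  refine ⟨log q / (2 * π * I), ?_, e⟩
  rw [← e, qq_norm, Real.exp_lt_one_iff] at h1
  have := Real.pi_pos
  by_contra hcon
  push Not at hcon
  nlinarith

lemma Rep.evalPoly {φ : R →+* ℂ} {Y : PowerSeries R} {yf : ℂ → ℂ} (h : Rep (PowerSeries.map φ Y) yf)
    (P : R[X]) : Rep (PowerSeries.map φ (P.eval₂ (PowerSeries.C) Y)) (fun q => P.eval₂ φ (yf q)) := by
  induction P using Polynomial.induction_on' with
  | add p q hp hq => simpa using hp.add hq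
  | monomial n a =>
    simpa using (Rep.const (φ a)).mul (h.pow n)

/-- integral `q`-expansion of `y` over `R` -/
noncomputable def YR (R : Type*) [CommRing R] : PowerSeries R := PowerSeries.map (Int.castRingHom R) Y0

lemma map_YR {S : Type*} [CommRing S] (φ : R →+* S) : PowerSeries.map φ (YR R) = YR S := by
  ext n; simp [YR]

lemma YR_C : YR ℂ = toC Y0 := rfl

/-- the substitution `Y ↦ y(q)` -/
noncomputable def evY (R : Type*) [CommRing R] : R[X] →+* PowerSeries R :=
  eval₂RingHom PowerSeries.C (YR R)

lemma evY_map {S : Type*} [CommRing S] (φ : R →+* S) (P : R[X]) :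
    PowerSeries.map φ (evY R P) = evY S (P.map φ) := by
  simp only [evY, coe_eval₂RingHom, hom_eval₂, eval₂_map, map_YR]
  congr 1
  ext a; simp

lemma evY_inj (R : Type*) [CommRing R] [IsDomain R] : Function.Injective (evY R) := by
  rw [injective_iff_map_eq_zero]
  intro P hP
  by_contra h0
  obtain ⟨Q, hQ⟩ := Polynomial.X_pow_dvd_iff.2 (fun d (hd : d < P.natTrailingDegree) => coeff_eq_zero_of_lt_natTrailingDegree hd)
  have hY : YR R ≠ 0 := by
    intro h
    have := congrArg (PowerSeries.coeff 1) h
    rw [YR, Y0, PowerSeries.coeff_map, show 1 = 0 + 1 from rfl, PowerSeries.coeff_succ_X_mul, Y1_zero] at this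
    simp at this
  rw [hQ, map_mul, map_pow] at hP
  have hX : evY R X = YR R := by simp [evY]
  rw [hX] at hP
  have := (mul_eq_zero.1 hP).resolve_left (pow_ne_zero _ hY)
  have h2 : coeff 0 (evY R Q) = Q.coeff 0 := by
    rw [PowerSeries.coeff_zero_eq_constantCoeff_apply, evY, coe_eval₂RingHom, hom_eval₂]
    have : PowerSeries.constantCoeff (YR R) = 0 := by
      rw [← PowerSeries.coeff_zero_eq_constantCoeff_apply, YR, PowerSeries.coeff_map, Y0]; simp
    rw [this, eval₂_at_zero]; simp
  rw [this] at h2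
  have h3 : P.coeff P.natTrailingDegree = 0 := by
    have := Polynomial.coeff_X_pow_mul Q P.natTrailingDegree 0
    rw [zero_add, ← hQ] at this
    rw [this]; simpa using h2.symm
  have : P.trailingCoeff = 0 := h3
  rw [trailingCoeff_eq_zero] at this
  exact h0 this

/-- functions attached to Hecke cosets -/
structure Fam (l : ℕ) (f : M2 → ℂ → ℂ) : Prop where
  left : ∀ γ N, D7 1 γ → D7 l N → ∀ z : ℂ, 0 < z.im → f (γ * N) z = f N z
  right : ∀ γ N, D7 1 γ → D7 l N → ∀ z : ℂ, 0 < z.im → f N (p1 γ z 1 / p2 γ z 1) = f (N * γ) z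

lemma Fam.prod_inv {l : ℕ} (hp : l.Prime) (h7 : l ≠ 7) {f : M2 → ℂ → ℂ} (hf : Fam l f)
    {β : Type*} [CommMonoid β] (F : ℂ → β) {γ : M2} (hγ : D7 1 γ) {z : ℂ} (hz : 0 < z.im) :
    ∏ i, F (f (Mi l i) (p1 γ z 1 / p2 γ z 1)) = ∏ i, F (f (Mi l i) z) := by
  obtain ⟨σ, hσ⟩ := hecke_perm l hp h7 hγ
  rw [← Equiv.prod_comp σ (fun i => F (f (Mi l i) z))]
  refine Finset.prod_congr rfl fun i _ => ?_
  obtain ⟨γ', h1, h2⟩ := hσ i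
  rw [hf.right γ _ hγ (Mi_D7 l i) z hz, h2, hf.left γ' _ h1 (Mi_D7 l _) z hz]

theorem family [IsDomain R] (φ : R →+* ℂ) (hφ : Function.Injective φ) (l : ℕ) (hp : l.Prime)
    (h7 : l ≠ 7) (ζ : R) (hζ : φ ζ = qq (1 / l)) (f : M2 → ℂ → ℂ) (hf : Fam l f)
    (hg : ∀ i, ∃ K, Gr (fun z => f (Mi l i) (-1 / (7 * z))) K)
    (G0 G : PowerSeries R) (g0 g : ℂ → ℂ) (hG0 : Rep (PowerSeries.map φ G0) g0)
    (hG : Rep (PowerSeries.map φ G) g)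
    (f0 : ∀ z : ℂ, 0 < z.im → f (Mi l none) z = g0 (qq z))
    (f1 : ∀ k : Fin l, ∀ z : ℂ, 0 < z.im → f (Mi l (some k)) z = g (qq ((z + (k : ℕ)) / l))) :
    ∃ P : R[X][X], (∀ z : ℂ, 0 < z.im →
        P.map (eval₂RingHom φ (yy z)) = ∏ i, (X - C (f (Mi l i) z))) ∧
      P.map (((PowerSeries.expand l hp.ne_zero : PowerSeries R →ₐ[R] PowerSeries R) : PowerSeries R →+* PowerSeries R).comp (evY R)) =
        (X - C (PowerSeries.expand l hp.ne_zero G0)) *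
          ∏ k : Fin l, (X - C (PowerSeries.rescale (ζ ^ (k : ℕ)) G)) := by
  have hl0 : (l : ℂ) ≠ 0 := by exact_mod_cast hp.ne_zero
  have hprim : IsPrimitiveRoot ζ l := by
    refine IsPrimitiveRoot.of_map_of_injective (f := φ) ?_ hφ
    rw [hζ, qq]
    convert Complex.isPrimitiveRoot_exp l hp.ne_zero using 2
    ring
  have hn1 : ∀ k : ℕ, ‖φ (ζ ^ k)‖ ≤ 1 := by
    intro k
    rw [map_pow, norm_pow, hζ, qq_norm]
    simp
  set Q : (PowerSeries R)[X] := (X - C (PowerSeries.expand l hp.ne_zero G0)) *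
          ∏ k : Fin l, (X - C (PowerSeries.rescale (ζ ^ (k : ℕ)) G)) with hQ
  let p : ℂ → ℂ[X] := fun t => (X - C (g0 (t ^ l))) * ∏ k : Fin l, (X - C (g (φ (ζ ^ (k : ℕ)) * t)))
  have hRP : RepP φ Q p := by
    refine RepP.mul (RepP.lin ?_) (RepP.prod _ fun k _ => RepP.lin (hG.rescale _ (hn1 _)))
    rw [PowerSeries.map_expand]
    exact hG0.expand l hp.ne_zero
  have hpz : ∀ z : ℂ, 0 < z.im → p (qq (z / l)) = ∏ i, (X - C (f (Mi l i) z)) := by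
    intro z hz
    rw [Fintype.prod_option]
    simp only [p]
    congr 1
    · rw [f0 z hz, ← qq_nat_mul, mul_div_cancel₀ _ hl0]
    · refine Finset.prod_congr rfl fun k _ => ?_
      rw [f1 k z hz, map_pow, hζ, ← qq_nat_mul, ← qq_add]
      congr 4
      field_simp
      ring
  have hinv : Q.map (PowerSeries.rescale ζ) = Q := by
    rw [hQ, Polynomial.map_mul, Polynomial.map_prod]
    congr 1
    · simp only [Polynomial.map_sub, map_X, map_C]
      congr 2
      ext n
      rw [PowerSeries.coeff_rescale]
      by_cases hd : l ∣ n
      · rw [(hprim.pow_eq_one_iff_dvd n).2 hd, one_mul]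
      · rw [PowerSeries.coeff_expand_of_not_dvd _ _ _ hd, mul_zero]
    · have e : ∀ k : Fin l, Polynomial.map (PowerSeries.rescale ζ) (X - C (PowerSeries.rescale (ζ ^ (k : ℕ)) G))
          = X - C (PowerSeries.rescale (ζ ^ ((k : ℕ) + 1)) G) := by
        intro k
        simp only [Polynomial.map_sub, map_X, map_C, PowerSeries.rescale_rescale]
        rw [pow_succ]
      simp only [e]
      rw [Fin.prod_univ_eq_prod_range (fun k => (X - C (PowerSeries.rescale (ζ ^ (k + 1)) G))),
        Fin.prod_univ_eq_prod_range (fun k => (X - C (PowerSeries.rescale (ζ ^ k) G)))]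
      have h1 := Finset.prod_range_succ' (fun k => (X - C (PowerSeries.rescale (ζ ^ k) G))) l
      have h2 := Finset.prod_range_succ (fun k => (X - C (PowerSeries.rescale (ζ ^ k) G))) l
      rw [h1, hprim.pow_eq_one, ← pow_zero ζ] at h2
      exact mul_right_cancel₀ (X_sub_C_ne_zero _) h2
  have hdiv : ∀ j n, ¬ l ∣ n → coeff n (Q.coeff j) = 0 := by
    intro j n hn
    have := congrArg (fun S => PowerSeries.coeff n (Polynomial.coeff S j)) hinv
    simp only [coeff_map, PowerSeries.coeff_rescale] at this
    have h2 : (ζ ^ n - 1) * coeff n (Q.coeff j) = 0 := by rw [sub_mul, this]; ring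
    refine (mul_eq_zero.1 h2).resolve_left fun h => hn ((hprim.pow_eq_one_iff_dvd n).1 (sub_eq_zero.1 h))
  let D : ℕ → PowerSeries R := fun j => PowerSeries.mk fun n => coeff (l * n) (Q.coeff j)
  have hD : ∀ j, PowerSeries.expand l hp.ne_zero (D j) = Q.coeff j := by
    intro j
    ext n
    by_cases hd : l ∣ n
    · obtain ⟨m, rfl⟩ := hd
      rw [PowerSeries.coeff_expand_mul]; simp [D]
    · rw [PowerSeries.coeff_expand_of_not_dvd _ _ _ hd, hdiv j n hd]
  have hDr : ∀ j, ∃ h, Rep (PowerSeries.map φ (D j)) h ∧ ∀ t : ℂ, ‖t‖ < 1 → h (t ^ l) = (p t).coeff j := by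
    intro j
    have := hRP j
    rw [← hD j, PowerSeries.map_expand] at this
    exact this.of_expand
  choose h hr hh using hDr
  have hfz : ∀ j, ∀ z : ℂ, 0 < z.im → (∏ i, (X - C (f (Mi l i) z))).coeff j = h j (qq z) := by
    intro j z hz
    rw [← hpz z hz, ← hh j (qq (z / l)), ← qq_nat_mul, mul_div_cancel₀ _ hl0]
    refine qq_norm_lt ?_
    have : (z / (l : ℂ)).im = z.im / l := by simp
    rw [this]
    exact div_pos hz (by exact_mod_cast hp.pos)
  have hgr : ∃ K, ∀ j, GrW (fun z => (∏ i, (X - C (f (Mi l i) z))).coeff j) K := by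
    obtain ⟨K, hK⟩ := PGr.prod Finset.univ (p := fun i z => X - C (f (Mi l i) (-1 / (7 * z))))
      fun i _ => by obtain ⟨K, hK⟩ := hg i; exact PGr.lin hK
    exact ⟨K, fun j => GrW_of_Gr (hK j)⟩
  obtain ⟨K, hK⟩ := hgr
  have hst : ∀ j, ∃ P : R[X], ∀ z : ℂ, 0 < z.im → h j (qq z) = P.eval₂ φ (yy z) := by
    intro j
    obtain ⟨P, _, hP⟩ := struct φ K (D j) _ (h j) (hfz j) (hr j) (by
      intro γ hγ z hz
      show (∏ i, (X - C (f (Mi l i) _))).coeff j = _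
      rw [hf.prod_inv hp h7 (fun x => X - C x) hγ hz]) (hK j)
    exact ⟨P, fun z hz => by rw [← hP z hz, hfz j z hz]⟩
  choose P hP using hst
  have hPD : ∀ j, evY R (P j) = D j := by
    intro j
    apply PowerSeries.map_injective φ hφ
    have hy : Rep (PowerSeries.map φ (YR R)) yf := by rw [map_YR]; exact yf_rep
    refine (hy.evalPoly (P j)).unique' (hr j) fun q hq hq0 => ?_
    obtain ⟨z, hz, rfl⟩ := qq_surj hq0 hq
    rw [hP j z hz, yy_eq hz]
  have hdQ : Q.natDegree ≤ l + 1 := by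
    rw [hQ]
    refine natDegree_mul_le.trans ?_
    have h1 := natDegree_prod_le (s := Finset.univ) (fun k : Fin l => X - C (PowerSeries.rescale (ζ ^ (k : ℕ)) G))
    simp only [natDegree_X_sub_C, Finset.sum_const, Finset.card_univ, Fintype.card_fin, smul_eq_mul, mul_one] at h1 ⊢
    rw [add_comm]
    exact Nat.add_le_add_right h1 1
  have hdz : ∀ z : ℂ, (∏ i, (X - C (f (Mi l i) z))).natDegree ≤ l + 1 := by
    intro z
    refine (natDegree_prod_le _ _).trans ?_
    simp
  refine ⟨∑ j ∈ Finset.range (l + 2), monomial j (P j), fun z hz => ?_, ?_⟩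
  · ext j
    simp only [coeff_map, finsetSum_coeff, coeff_monomial, Finset.sum_ite_eq', Finset.mem_range]
    split_ifs with hj
    · rw [hfz j z hz, hP j z hz]; rfl
    · rw [coeff_eq_zero_of_natDegree_lt (by have := hdz z; omega)]; simp
  · ext1 j
    simp only [coeff_map, finsetSum_coeff, coeff_monomial, Finset.sum_ite_eq', Finset.mem_range]
    split_ifs with hj
    · rw [← hD j, ← hPD j]; rfl
    · rw [coeff_eq_zero_of_natDegree_lt (by omega)]; simp

end HK

namespace HK
open PowerSeries (coeff)
open UpperHalfPlane hiding I
open ModularForm Complex Filter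
open scoped MatrixGroups Real Topology Manifold

/-- level one modular form (weight `k`), as function of `q` -/
def L1 (k : ℤ) (F : PowerSeries ℂ) (g : ℂ → ℂ) : Prop :=
  Rep F g ∧ ∀ z : ℂ, 0 < z.im → g (qq (-1 / z)) = z ^ k * g (qq z)

lemma im_ne {z : ℂ} (hz : 0 < z.im) : z ≠ 0 := by
  rintro rfl; simp at hz

lemma S_im {z : ℂ} (hz : 0 < z.im) : 0 < (-1 / z).im := by
  have h := im_ne hz
  have : (-1 / z).im = z.im / normSq z := by
    rw [neg_div, neg_im, one_div, inv_im]; ring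
  rw [this]
  exact div_pos hz (normSq_pos.2 h)

lemma L1.mul {k m : ℤ} {F G f g} (hf : L1 k F f) (hg : L1 m G g) :
    L1 (k + m) (F * G) (fun q => f q * g q) :=
  ⟨hf.1.mul hg.1, fun z hz => by
    beta_reduce
    rw [hf.2 z hz, hg.2 z hz, zpow_add₀ (im_ne hz)]; ring⟩

lemma L1.add {k : ℤ} {F G f g} (hf : L1 k F f) (hg : L1 k G g) :
    L1 k (F + G) (fun q => f q + g q) :=
  ⟨hf.1.add hg.1, fun z hz => by
    beta_reduce
    rw [hf.2 z hz, hg.2 z hz]; ring⟩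

lemma L1.const (c : ℂ) : L1 0 (PowerSeries.C c) (fun _ => c) :=
  ⟨Rep.const c, fun z hz => by simp⟩

lemma L1.smul {k : ℤ} {F f} (c : ℂ) (hf : L1 k F f) :
    L1 k (PowerSeries.C c * F) (fun q => c * f q) := by
  simpa using (L1.const c).mul hf

lemma L1.pow {k : ℤ} {F f} (hf : L1 k F f) (n : ℕ) :
    L1 (n * k) (F ^ n) (fun q => f q ^ n) :=
  ⟨hf.1.pow n, fun z hz => by
    beta_reduce
    rw [hf.2 z hz, mul_pow, ← zpow_natCast, ← zpow_mul, mul_comm k]⟩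

lemma L1.toMF {k : ℤ} {F f} (hf : L1 k F f) :
    ∃ M : ModularForm 𝒮ℒ k, ∀ τ : ℍ, M τ = f (qq τ) := by
  have hS : (fun τ : ℍ => f (qq τ)) ∣[k] ModularGroup.S = fun τ : ℍ => f (qq τ) := by
    ext τ
    rw [ModularForm.SL_slash_apply, smul_coe]
    have h := hf.2 τ τ.2
    have e : p1 ModularGroup.S.1 (τ : ℂ) 1 / p2 ModularGroup.S.1 τ 1 = -1 / τ := by
      simp [p1, p2, ModularGroup.S]
    rw [e, h]
    have e2 : denom ModularGroup.S τ = (τ : ℂ) := by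
      simp [ModularGroup.denom_S]
    rw [e2, mul_right_comm, ← zpow_add₀ (im_ne τ.2)]; simp
  have hT : (fun τ : ℍ => f (qq τ)) ∣[k] ModularGroup.T = fun τ : ℍ => f (qq τ) := by
    ext τ
    rw [ModularForm.SL_slash_apply, smul_coe]
    have e : p1 ModularGroup.T.1 (τ : ℂ) 1 / p2 ModularGroup.T.1 τ 1 = τ + (1:ℤ) := by
      simp [p1, p2, ModularGroup.T]
    rw [e, qq_add, qq_int]
    have e2 : denom ModularGroup.T τ = 1 := by
      rw [ModularGroup.denom_apply]; simp [ModularGroup.T]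
    rw [e2]; simp
  have hA := SlashInvariantForm.slash_action_generators_SL2Z hS hT
  refine ⟨{ toFun := fun τ => f (qq τ)
            slash_action_eq' := by
              rintro _ ⟨g, rfl⟩
              exact hA g
            holo' := by
              rw [UpperHalfPlane.mdifferentiable_iff]
              refine hf.1.holo.congr fun z hz => ?_
              simp [ofComplex_apply_of_im_pos hz]
            bdd_at_cusps' := by
              intro c hc
              rw [Subgroup.IsArithmetic.isCusp_iff_isCusp_SL2Z] at hc
              rw [OnePoint.isBoundedAt_iff_forall_SL2Z hc]
              intro γ _
              rw [isBoundedAtImInfty_iff]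
              show ∃ M A, ∀ z : ℍ, A ≤ z.im → ‖((fun τ : ℍ => f (qq τ)) ∣[k] γ) z‖ ≤ M
              rw [hA γ]
              obtain ⟨C, _, h⟩ := hf.1.bdd
              exact ⟨C, 1, fun z hz => h z hz⟩ }, fun τ => rfl⟩

lemma L1.neg_zero {k : ℤ} {F f} (hf : L1 k F f) (hk : k < 0) : F = 0 := by
  obtain ⟨M, hM⟩ := hf.toMF
  have h0 := ModularFormClass.levelOne_neg_weight_eq_zero hk M
  have h1 : Rep (0 : PowerSeries ℂ) (fun _ => 0) := by simpa using Rep.const 0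
  refine hf.1.unique' h1 fun q hq hq0 => ?_
  obtain ⟨z, hz, rfl⟩ := qq_surj hq0 hq
  have := hM ⟨z, hz⟩
  rw [← show f (qq ((⟨z, hz⟩ : ℍ) : ℂ)) = f (qq z) from rfl, ← this, h0]; rfl

lemma L1.ofMF {k : ℤ} (M : ModularForm 𝒮ℒ k) :
    L1 k (qExpansion 1 M) (cuspFunction 1 M) ∧ ∀ τ : ℍ, cuspFunction 1 M (qq τ) = M τ := by
  have hq : ∀ τ : ℍ, cuspFunction 1 M (qq τ) = M τ := fun τ => by
    have := SlashInvariantFormClass.eq_cuspFunction M τ one_mem_strictPeriods_SL one_ne_zero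
    rw [← this, Function.Periodic.qParam, qq]; simp
  refine ⟨⟨fun q hq => ?_, fun z hz => ?_⟩, hq⟩
  · have hi : Fact (IsCusp OnePoint.infty 𝒮ℒ) :=
      ⟨Subgroup.isCusp_of_mem_strictPeriods one_pos one_mem_strictPeriods_SL⟩
    have := UpperHalfPlane.hasSum_qExpansion_of_norm_lt one_pos
      (SlashInvariantFormClass.periodic_comp_ofComplex M one_mem_strictPeriods_SL)
      (ModularFormClass.holo M) (ModularFormClass.bdd_at_infty M) hq
    simpa using this
  · have h1 := hq ⟨z, hz⟩
    have h2 := hq ⟨-1 / z, S_im hz⟩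
    change cuspFunction 1 M (qq z) = _ at h1
    change cuspFunction 1 M (qq (-1/z)) = _ at h2
    rw [h1, h2]
    have h3 := SlashInvariantFormClass.slash_action_eq M ((ModularGroup.S : SL(2,ℤ)) : GL (Fin 2) ℝ) ⟨_, rfl⟩
    have h4 := congrFun h3 ⟨z, hz⟩
    have h5 : ((M : ℍ → ℂ) ∣[k] ModularGroup.S) ⟨z, hz⟩ = M ⟨z, hz⟩ := h4
    rw [ModularForm.SL_slash_apply, ModularGroup.denom_S] at h5
    have e : ModularGroup.S • (⟨z, hz⟩ : ℍ) = ⟨-1 / z, S_im hz⟩ := by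
      apply UpperHalfPlane.ext
      rw [smul_coe]
      simp [p1, p2, ModularGroup.S]
    rw [e] at h5
    change _ * z ^ (-k) = _ at h5
    rw [← h5, mul_left_comm, ← zpow_add₀ (im_ne hz)]; simp

/-- `q d/dq` -/
noncomputable def th {R : Type*} [CommRing R] (F : PowerSeries R) : PowerSeries R :=
  PowerSeries.X * PowerSeries.derivative R F

lemma th_coeff {R : Type*} [CommRing R] (F : PowerSeries R) (n : ℕ) :
    coeff n (th F) = n * coeff n F := by
  cases n with
  | zero => simp [th]
  | succ n => rw [th, PowerSeries.coeff_succ_X_mul, PowerSeries.coeff_derivative]; push_cast; ring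

lemma th_mul {R : Type*} [CommRing R] (F G : PowerSeries R) : th (F * G) = th F * G + F * th G := by
  simp only [th, Derivation.leibniz, smul_eq_mul]; ring

lemma th_add {R : Type*} [CommRing R] (F G : PowerSeries R) : th (F + G) = th F + th G := by
  simp only [th, map_add]; ring

lemma th_C {R : Type*} [CommRing R] (c : R) : th (PowerSeries.C c) = 0 := by
  ext n; rw [th_coeff, PowerSeries.coeff_C]; split_ifs with h <;> simp [h]

lemma th_map {R S : Type*} [CommRing R] [CommRing S] (φ : R →+* S) (F : PowerSeries R) :
    PowerSeries.map φ (th F) = th (PowerSeries.map φ F) := by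
  ext n; rw [PowerSeries.coeff_map, th_coeff, th_coeff, PowerSeries.coeff_map]; simp

lemma Rep.th {F : PowerSeries ℂ} {f : ℂ → ℂ} (h : Rep F f) :
    Rep (th F) (fun q => q * deriv f q) := by
  have hd : DifferentiableOn ℂ (deriv f) (Metric.ball 0 1) :=
    h.differentiableOn.deriv Metric.isOpen_ball
  obtain ⟨G, hG⟩ := exists_rep hd
  have : G = PowerSeries.derivative ℂ F := by
    ext n
    rw [hG.coeff_eq, PowerSeries.coeff_derivative, h.coeff_eq, iteratedDeriv_succ', Nat.factorial_succ]
    have : ((n : ℂ) + 1) ≠ 0 := by exact_mod_cast n.succ_ne_zero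
    have : ((n.factorial : ℕ) : ℂ) ≠ 0 := by exact_mod_cast n.factorial_ne_zero
    push_cast
    field_simp
  rw [HK.th, ← this]
  exact Rep.X.mul hG

lemma Rep.hasDeriv {F : PowerSeries ℂ} {f : ℂ → ℂ} (h : Rep F f) {z : ℂ} (hz : 0 < z.im) :
    HasDerivAt (fun z => f (qq z)) (2 * π * I * (qq z * deriv f (qq z))) z := by
  have h1 : HasDerivAt f (deriv f (qq z)) (qq z) :=
    (h.differentiableOn.differentiableAt
      (Metric.isOpen_ball.mem_nhds (by simpa using qq_norm_lt hz))).hasDerivAt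
  have h2 : HasDerivAt qq (qq z * (2 * π * I)) z := by
    have := ((hasDerivAt_id z).const_mul (2 * π * I)).cexp
    exact this.congr_deriv (by simp [qq])
  exact (h1.comp z h2).congr_deriv (by ring)

lemma S_deriv {z : ℂ} (hz : z ≠ 0) : HasDerivAt (fun z : ℂ => -1 / z) (1 / z ^ 2) z := by
  have := (hasDerivAt_inv hz).neg.congr_deriv (show - -(z ^ 2)⁻¹ = 1 / z ^ 2 by simp)
  refine this.congr_of_eventuallyEq (Eventually.of_forall fun x => ?_)
  simp [neg_div]

lemma L1.th_S {k : ℤ} {F f} (hf : L1 k F f) {z : ℂ} (hz : 0 < z.im) :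
    qq (-1 / z) * deriv f (qq (-1 / z)) = z ^ (k + 2) * (qq z * deriv f (qq z)) +
      k / (2 * π * I) * z ^ (k + 1) * f (qq z) := by
  have h0 := im_ne hz
  have hpi : (2 * π * I : ℂ) ≠ 0 := by simp [Real.pi_ne_zero]
  have h1 := (hf.1.hasDeriv (S_im hz)).comp z (S_deriv h0)
  have h2 := (hasDerivAt_zpow k z (Or.inl h0)).mul (hf.1.hasDeriv hz)
  have h3 := h1.unique (h2.congr_of_eventuallyEq (by
    filter_upwards [(isOpen_lt continuous_const Complex.continuous_im).mem_nhds hz] with w hw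
    exact hf.2 w hw))
  rw [zpow_sub_one₀ h0] at h3
  have h4 : qq (-1 / z) * deriv f (qq (-1 / z)) = z ^ 2 / (2 * π * I) *
      (2 * π * I * (qq (-1 / z) * deriv f (qq (-1 / z))) * (1 / z ^ 2)) := by
    field_simp
  rw [h4, h3, zpow_add₀ h0, zpow_add₀ h0, zpow_ofNat, zpow_one]
  generalize z ^ k = w
  field_simp
  ring

end HK

namespace HK
open PowerSeries (coeff)
open UpperHalfPlane hiding I
open ModularForm Complex Filter
open scoped MatrixGroups Real Topology Manifold ArithmeticFunction.sigma

noncomputable def Ps : PowerSeries ℤ := PowerSeries.mk fun n => if n = 0 then 1 else -24 * (σ 1 n : ℤ)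
noncomputable def Qs : PowerSeries ℤ := PowerSeries.mk fun n => if n = 0 then 1 else 240 * (σ 3 n : ℤ)
noncomputable def Rs : PowerSeries ℤ := PowerSeries.mk fun n => if n = 0 then 1 else -504 * (σ 5 n : ℤ)
noncomputable def Ds : PowerSeries ℤ := PowerSeries.X * E0 ^ 24

lemma Ps_zero : coeff 0 Ps = 1 := by simp [Ps]
lemma Qs_zero : coeff 0 Qs = 1 := by simp [Qs]
lemma Rs_zero : coeff 0 Rs = 1 := by simp [Rs]
lemma Ds_zero : coeff 0 Ds = 0 := by simp [Ds]

lemma Ps_cc : PowerSeries.constantCoeff Ps = 1 := by simpa using Ps_zero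
lemma Qs_cc : PowerSeries.constantCoeff Qs = 1 := by simpa using Qs_zero
lemma Rs_cc : PowerSeries.constantCoeff Rs = 1 := by simpa using Rs_zero
lemma Ds_cc : PowerSeries.constantCoeff Ds = 0 := by simpa using Ds_zero
lemma E0_cc : PowerSeries.constantCoeff E0 = 1 := by simpa using E0_zero
lemma th_cc {R : Type*} [CommRing R] (F : PowerSeries R) : PowerSeries.constantCoeff (th F) = 0 := by
  simp [th]
lemma toC_cc (F : PowerSeries ℤ) : PowerSeries.constantCoeff (toC F) = (PowerSeries.constantCoeff F : ℤ) := by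
  rw [← PowerSeries.coeff_zero_eq_constantCoeff_apply, coeff_toC, PowerSeries.coeff_zero_eq_constantCoeff_apply]
lemma C12 : (PowerSeries.C 12 : PowerSeries ℂ) = 12 := map_ofNat _ 12
lemma C1728 : (PowerSeries.C 1728 : PowerSeries ℂ) = 1728 := map_ofNat _ 1728

noncomputable def Pf (q : ℂ) : ℂ := ∑' n, coeff n (toC Ps) * q ^ n
noncomputable def Qf : ℂ → ℂ := cuspFunction 1 E₄
noncomputable def Rf : ℂ → ℂ := cuspFunction 1 E₆
noncomputable def Df (q : ℂ) : ℂ := q * ep q ^ 24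

lemma Pf_val (τ : ℍ) : HasSum (fun n => coeff n (toC Ps) * qq τ ^ n) (EisensteinSeries.E2 τ) := by
  have := EisensteinSeries.hasSum_qExpansion_E2 (z := τ)
  convert this using 2 with n
  rw [coeff_toC, Ps, PowerSeries.coeff_mk]
  simp [qq]

lemma Pf_rep : Rep (toC Ps) Pf := fun q hq => by
  apply Summable.hasSum
  by_cases h0 : q = 0
  · subst h0
    exact summable_of_ne_finset_zero (s := {0}) fun b hb => by
      simp at hb; simp [hb]
  · obtain ⟨z, hz, rfl⟩ := qq_surj h0 hq
    exact (Pf_val ⟨z, hz⟩).summable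

lemma Pf_eq (τ : ℍ) : Pf (qq τ) = EisensteinSeries.E2 τ := (Pf_val τ).tsum_eq

lemma Pf_S {z : ℂ} (hz : 0 < z.im) : Pf (qq (-1 / z)) = z ^ 2 * Pf (qq z) + 12 / (2 * π * I) * z := by
  have h := congrFun (EisensteinSeries.E2_slash_action ModularGroup.S) ⟨z, hz⟩
  rw [ModularForm.SL_slash_apply, ModularGroup.denom_S] at h
  have e : ModularGroup.S • (⟨z, hz⟩ : ℍ) = ⟨-1 / z, S_im hz⟩ := by
    apply UpperHalfPlane.ext
    rw [smul_coe]
    simp [p1, p2, ModularGroup.S]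
  rw [e, ← Pf_eq, Pi.sub_apply, ← Pf_eq, Pi.smul_apply, EisensteinSeries.D2_S, riemannZeta_two] at h
  change Pf (qq (-1 / z)) * z ^ (-2 : ℤ) = Pf (qq z) - (1 / (2 * ((π:ℂ) ^ 2 / 6))) * (2 * π * I / z) at h
  have h0 := im_ne hz
  have hp : (π : ℂ) ≠ 0 := by simp [Real.pi_ne_zero]
  have : Pf (qq (-1 / z)) = z ^ 2 * (Pf (qq (-1 / z)) * z ^ (-2 : ℤ)) := by
    rw [zpow_neg, zpow_ofNat]; field_simp
  rw [this, h]
  field_simp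
  linear_combination (-12) * I_sq

lemma Q_L1 : L1 4 (toC Qs) Qf := by
  have h := (L1.ofMF E₄).1
  have : qExpansion 1 E₄ = toC Qs := by
    ext n
    rw [EisensteinSeries.E_qExpansion_coeff _ ⟨2, rfl⟩, coeff_toC, Qs, PowerSeries.coeff_mk,
      show _root_.bernoulli 4 = -1 / 30 by decide +kernel]
    split_ifs <;> norm_num
  rw [this] at h; exact h

lemma R_L1 : L1 6 (toC Rs) Rf := by
  have h := (L1.ofMF E₆).1
  have : qExpansion 1 E₆ = toC Rs := by
    ext n
    rw [EisensteinSeries.E_qExpansion_coeff _ ⟨3, rfl⟩, coeff_toC, Rs, PowerSeries.coeff_mk,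
      show _root_.bernoulli 6 = 1 / 42 by decide +kernel]
    split_ifs <;> norm_num
  rw [this] at h; exact h

lemma Df_eq (z : ℂ) : Df (qq z) = e4 z ^ 6 := by
  rw [e4_eq, mul_pow, ← exp_nat_mul, Df, qq, ← pow_mul]
  congr 2; push_cast; ring

lemma D_L1 : L1 12 (toC Ds) Df := by
  constructor
  · rw [Ds, map_mul toC, toC_X, map_pow toC]
    exact Rep.X.mul (ep_rep.pow 24)
  · intro z hz
    rw [Df_eq, Df_eq, e4_S hz, zt_three]
    rw [show (12 : ℤ) = ((12 : ℕ) : ℤ) by norm_num, zpow_natCast]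
    ring

lemma Df_ne {q : ℂ} (hq : ‖q‖ < 1) (h0 : q ≠ 0) : Df q ≠ 0 := mul_ne_zero h0 (pow_ne_zero _ (ep_ne hq))

/-- division by the discriminant -/
lemma L1.div {k : ℤ} {F g} (h : L1 k F g) (h0 : coeff 0 F = 0) :
    ∃ G f, F = toC Ds * G ∧ L1 (k - 12) G f := by
  obtain ⟨H, rfl⟩ := PowerSeries.X_dvd_iff.2 (by simpa using h0 : PowerSeries.constantCoeff F = 0)
  have hs := h.1.shift
  have hv := h.1.shift_val
  have h1 := hs.mul (D0s_rep.pow 24)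
  refine ⟨_, _, ?_, h1, ?_⟩
  · have : toC E0 * toC D0s = 1 := by rw [← map_mul toC, E0_D0s, map_one]
    rw [Ds, map_mul toC, toC_X, map_pow toC]
    calc _ = PowerSeries.X * H * (toC E0 * toC D0s) ^ 24 := by rw [this]; ring
      _ = _ := by ring
  · have key : ∀ z : ℂ, 0 < z.im → (∑' n, coeff n H * qq z ^ n) * (ep (qq z))⁻¹ ^ 24 =
        g (qq z) / Df (qq z) := by
      intro z hz
      have e := ep_ne (qq_norm_lt hz)
      rw [← hv _ (qq_norm_lt hz), Df]
      have := qq_ne z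
      field_simp
    intro z hz
    beta_reduce
    rw [key _ (S_im hz), key z hz, h.2 z hz, D_L1.2 z hz, zpow_sub₀ (im_ne hz)]
    have := im_ne hz
    field_simp

lemma L1.zero {k : ℤ} {F g} (h : L1 k F g) (hk : k < 12) (h0 : coeff 0 F = 0) : F = 0 := by
  obtain ⟨G, f, rfl, hG⟩ := h.div h0
  rw [hG.neg_zero (by linarith), mul_zero]

lemma L1.eq {k : ℤ} {F G f g} (h : L1 k F f) (h' : L1 k G g) (hk : k < 12)
    (h0 : coeff 0 F = coeff 0 G) : F = G := by
  have := (h.add (h'.smul (-1))).zero hk (by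
    rw [map_add, PowerSeries.coeff_C_mul, h0]; ring)
  simp only [map_neg, map_one, neg_mul, one_mul] at this
  exact add_neg_eq_zero.1 this

/-- Serre derivative -/
lemma L1.serre {k : ℤ} {F f} (h : L1 k F f) :
    L1 (k + 2) (12 * th F - PowerSeries.C (k : ℂ) * (toC Ps * F))
      (fun q => 12 * (q * deriv f q) - k * (Pf q * f q)) := by
  constructor
  · have := ((Rep.const 12).mul h.1.th).sub ((Rep.const k).mul (Pf_rep.mul h.1))
    rw [C12] at this; exact this
  · intro z hz
    beta_reduce
    rw [h.th_S hz, Pf_S hz, h.2 z hz]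
    have h0 := im_ne hz
    rw [zpow_add₀ h0, zpow_add₀ h0, zpow_ofNat, zpow_one]
    ring

lemma toC_th (F : PowerSeries ℤ) : toC (th F) = th (toC F) := th_map _ _

lemma th_Q : 3 * th Qs = Ps * Qs - Rs := by
  have h := Q_L1.serre
  have h2 := R_L1.smul (-4)
  have := h.eq h2 (by norm_num) (by
    simp [th_cc, toC_cc, Ps_cc, Qs_cc, Rs_cc])
  have h3 : (12 : PowerSeries ℤ) * th Qs - 4 * (Ps * Qs) = - 4 * Rs := toC_inj (by
    simp only [map_sub, map_mul, map_neg, toC_th]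
    simpa [map_ofNat] using this)
  have h4 : (4 : PowerSeries ℤ) * (3 * th Qs) = 4 * (Ps * Qs - Rs) := by linear_combination h3
  exact mul_left_cancel₀ (fun h => by have := congrArg PowerSeries.constantCoeff h; rw [map_ofNat, map_zero] at this; norm_num at this) h4

lemma th_R : 2 * th Rs = Ps * Rs - Qs ^ 2 := by
  have h := R_L1.serre
  have h2 := (Q_L1.pow 2).smul (-6)
  have := h.eq h2 (by norm_num) (by
    simp [th_cc, toC_cc, Ps_cc, Qs_cc, Rs_cc])
  have h3 : (12 : PowerSeries ℤ) * th Rs - 6 * (Ps * Rs) = - 6 * Qs ^ 2 := toC_inj (by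
    simp only [map_sub, map_mul, map_neg, map_pow, toC_th]
    simpa [map_ofNat] using this)
  have h4 : (6 : PowerSeries ℤ) * (2 * th Rs) = 6 * (Ps * Rs - Qs ^ 2) := by linear_combination h3
  exact mul_left_cancel₀ (fun h => by have := congrArg PowerSeries.constantCoeff h; rw [map_ofNat, map_zero] at this; norm_num at this) h4

lemma th_P : 12 * th Ps = Ps ^ 2 - Qs := by
  have h : L1 4 (12 * th (toC Ps) - toC Ps ^ 2) (fun q => 12 * (q * deriv Pf q) - Pf q ^ 2) := by
    constructor
    · have := ((Rep.const 12).mul Pf_rep.th).sub (Pf_rep.pow 2)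
      rw [C12] at this; exact this
    · intro z hz
      have h0 := im_ne hz
      have hpi : (2 * π * I : ℂ) ≠ 0 := by simp [Real.pi_ne_zero]
      have h1 := (Pf_rep.hasDeriv (S_im hz)).comp z (S_deriv h0)
      have h2 := (((hasDerivAt_id z).pow 2).mul (Pf_rep.hasDeriv hz)).add
        ((hasDerivAt_id z).const_mul (12 / (2 * π * I)))
      have h3 := h1.unique (h2.congr_of_eventuallyEq (by
        filter_upwards [(isOpen_lt continuous_const Complex.continuous_im).mem_nhds hz] with w hw
        exact Pf_S hw))
      have h4 : qq (-1 / z) * deriv Pf (qq (-1 / z)) = z ^ 2 / (2 * π * I) *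
          (2 * π * I * (qq (-1 / z) * deriv Pf (qq (-1 / z))) * (1 / z ^ 2)) := by
        field_simp
      beta_reduce
      rw [h4, h3, Pf_S hz]
      simp only [id, Pi.pow_apply]
      rw [show (4 : ℤ) = ((4 : ℕ) : ℤ) by norm_num, zpow_natCast]
      generalize (2 * π * I : ℂ) = w at *
      field_simp
      ring
  have h2 := Q_L1.smul (-1)
  have := h.eq h2 (by norm_num) (by
    simp [th_cc, toC_cc, Ps_cc, Qs_cc, Rs_cc])
  have h3 : (12 : PowerSeries ℤ) * th Ps - Ps ^ 2 = - Qs := toC_inj (by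
    simp only [map_sub, map_mul, map_neg, map_pow, toC_th]
    simpa [map_ofNat] using this)
  linear_combination h3

lemma th_D : th Ds = Ps * Ds := by
  obtain ⟨G, f, hG, hL⟩ := D_L1.serre.div (by
    simp [th_cc, toC_cc, Ps_cc, Ds_cc])
  have h1 : coeff 1 (toC Ds) = 1 := by
    rw [coeff_toC, Ds, show (1:ℕ) = 0 + 1 from rfl, PowerSeries.coeff_succ_X_mul]
    simp [E0_cc]
  have h0 : coeff 0 (toC Ds) = 0 := by rw [coeff_toC, Ds_zero]; simp
  have hp : coeff 0 (toC Ps) = 1 := by rw [coeff_toC, Ps_zero]; simp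
  have hc := congrArg (PowerSeries.coeff 1) hG
  have h12 := C12.symm
  rw [map_sub, h12, PowerSeries.coeff_C_mul, PowerSeries.coeff_C_mul, th_coeff, PowerSeries.coeff_mul,
    PowerSeries.coeff_mul, Finset.Nat.antidiagonal_succ] at hc
  have h1' : coeff 1 Ds = 1 := by rw [coeff_toC] at h1; exact_mod_cast h1
  simp [h1', Ps_cc, Ds_cc] at hc
  have hz := hL.zero (by norm_num) (by simpa using hc.symm)
  rw [hz, mul_zero] at hG
  have h3 : (12 : PowerSeries ℤ) * th Ds - 12 * (Ps * Ds) = 0 := toC_inj (by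
    simp only [map_sub, map_mul, toC_th]
    simpa [map_ofNat] using hG)
  have h4 : (12 : PowerSeries ℤ) * th Ds = 12 * (Ps * Ds) := by linear_combination h3
  exact mul_left_cancel₀ (fun h => by have := congrArg PowerSeries.constantCoeff h; rw [map_ofNat, map_zero] at this; norm_num at this) h4

lemma Df_disc (τ : ℍ) : 1728 * Df (qq τ) = Qf (qq τ) ^ 3 - Rf (qq τ) ^ 2 := by
  have h := discriminant_eq_E₄_cube_sub_E₆_sq τ
  have e1 : Df (qq τ) = ModularForm.discriminant τ := by
    rw [Df_eq, e4, ← pow_mul]; rfl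
  rw [Qf, Rf, (L1.ofMF E₄).2, (L1.ofMF E₆).2, e1, h]; ring

lemma D_eq : 1728 * Ds = Qs ^ 3 - Rs ^ 2 := by
  apply toC_inj
  have h1 := (Rep.const 1728).mul D_L1.1
  have h2 := (Q_L1.1.pow 3).sub (R_L1.1.pow 2)
  have := h1.unique' h2 fun q hq h0 => by
    obtain ⟨z, hz, rfl⟩ := qq_surj h0 hq
    exact Df_disc ⟨z, hz⟩
  simp only [map_sub, map_mul, map_pow]
  simpa [map_ofNat] using this

end HK

namespace HK
open PowerSeries (coeff)
open UpperHalfPlane hiding I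
open ModularForm Complex Filter
open scoped MatrixGroups Real Topology Manifold ArithmeticFunction.sigma

/-- integer series in any ring -/
noncomputable def iR (R : Type*) [CommRing R] : PowerSeries ℤ →+* PowerSeries R :=
  PowerSeries.map (Int.castRingHom R)

lemma map_iR {R S : Type*} [CommRing R] [CommRing S] (φ : R →+* S) (F : PowerSeries ℤ) :
    PowerSeries.map φ (iR R F) = iR S F := by
  ext n; simp [iR]

lemma iR_C (F : PowerSeries ℤ) : iR ℂ F = toC F := rfl

lemma iR_cc {R : Type*} [CommRing R] (F : PowerSeries ℤ) :
    PowerSeries.constantCoeff (iR R F) = (PowerSeries.constantCoeff F : ℤ) := by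
  rw [← PowerSeries.coeff_zero_eq_constantCoeff_apply, iR, PowerSeries.coeff_map,
    PowerSeries.coeff_zero_eq_constantCoeff_apply]; simp

lemma D0s_cc : PowerSeries.constantCoeff D0s = 1 := by simpa using D0s_zero

lemma L1.congr {k m : ℤ} {F G f} (h : L1 k F f) (hk : k = m) (hF : F = G) : L1 m G f := by
  subst hk; subst hF; exact h

theorem lvl1_struct {R : Type*} [CommRing R] (φ : R →+* ℂ) (hφ : Function.Injective φ)
    (r s : ℕ) (hrs : 4 * r + 6 * s < 12) (n : ℕ) :
    ∀ (F : PowerSeries R) (g : ℂ → ℂ), L1 (12 * n + (4 * r + 6 * s)) (PowerSeries.map φ F) g →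
      ∃ c : ℕ → R, F = ∑ i ∈ Finset.range (n + 1),
        PowerSeries.C (c i) * (iR R Qs ^ (3 * i + r) * iR R Rs ^ s * iR R Ds ^ (n - i)) := by
  have hinj := PowerSeries.map_injective φ hφ
  induction n with
  | zero =>
    intro F g h
    refine ⟨fun _ => coeff 0 F, ?_⟩
    apply hinj
    have h2 := ((Q_L1.pow r).mul (R_L1.pow s)).smul (φ (coeff 0 F))
    have := h.eq (h2.congr (m := 12 * (0 : ℕ) + (4 * r + 6 * s)) (by push_cast; ring) rfl)
      (by push_cast; omega) (by simp [toC_cc, Qs_cc, Rs_cc])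
    rw [this]
    simp [map_iR, iR_C]
  | succ n ih =>
    intro F g h
    have h2 := ((Q_L1.pow (3 * (n + 1) + r)).mul (R_L1.pow s)).smul (-φ (coeff 0 F))
    have h3 := h.add (h2.congr (m := 12 * (n + 1 : ℕ) + (4 * r + 6 * s)) (by push_cast; ring) rfl)
    have hc : PowerSeries.constantCoeff (F - PowerSeries.C (coeff 0 F) * (iR R Qs ^ (3 * (n + 1) + r) * iR R Rs ^ s)) = 0 := by
      simp [iR_cc, Qs_cc, Rs_cc]
    have hm : PowerSeries.map φ F + PowerSeries.C (-φ (coeff 0 F)) * (toC Qs ^ (3 * (n + 1) + r) * toC Rs ^ s) =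
        PowerSeries.map φ (F - PowerSeries.C (coeff 0 F) * (iR R Qs ^ (3 * (n + 1) + r) * iR R Rs ^ s)) := by
      simp only [map_sub, map_mul, map_pow, map_iR, iR_C, PowerSeries.map_C, map_neg]
      ring
    rw [hm] at h3
    obtain ⟨H, hH⟩ := PowerSeries.X_dvd_iff.2 hc
    have hed : iR R E0 * iR R D0s = 1 := by rw [← map_mul, E0_D0s, map_one]
    have hH2 : PowerSeries.X * H = iR R Ds * (H * iR R D0s ^ 24) := by
      rw [Ds, map_mul, map_pow]
      have : iR R PowerSeries.X = PowerSeries.X := by simp [iR]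
      rw [this]
      calc _ = PowerSeries.X * H * (iR R E0 * iR R D0s) ^ 24 := by rw [hed]; ring
        _ = _ := by ring
    obtain ⟨G, f, hG, hL⟩ := h3.div (by
      rw [PowerSeries.coeff_map, PowerSeries.coeff_zero_eq_constantCoeff_apply, hc, map_zero])
    have hDne : toC Ds ≠ 0 := by
      intro h0
      have := congrArg (PowerSeries.coeff 1) h0
      rw [coeff_toC, Ds, show (1:ℕ) = 0 + 1 from rfl, PowerSeries.coeff_succ_X_mul] at this
      simp [E0_cc] at this
    have hGe : G = PowerSeries.map φ (H * iR R D0s ^ 24) := by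
      apply mul_left_cancel₀ hDne
      rw [← hG, hH, hH2, map_mul, map_iR, iR_C]
    rw [hGe] at hL
    obtain ⟨c, hcc⟩ := ih _ _ (hL.congr (by push_cast; ring) rfl)
    refine ⟨fun i => if i = n + 1 then coeff 0 F else c i, ?_⟩
    rw [Finset.sum_range_succ]
    simp only [if_true, Nat.sub_self, pow_zero, mul_one]
    have e : F = iR R Ds * (H * iR R D0s ^ 24) + PowerSeries.C (coeff 0 F) * (iR R Qs ^ (3 * (n + 1) + r) * iR R Rs ^ s) := by
      rw [← hH2, ← hH]; ring
    rw [hcc, Finset.mul_sum] at e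
    conv_lhs => rw [e]
    congr 1
    refine Finset.sum_congr rfl fun i hi => ?_
    have hi' := Finset.mem_range.1 hi
    rw [if_neg (by omega), show n + 1 - i = (n - i) + 1 by omega, pow_succ]
    ring

/-- homogeneous version of a level one form -/
noncomputable def lh (k : ℤ) (g : ℂ → ℂ) (u v : ℂ) : ℂ := v ^ (-k) * g (qq (u / v))

lemma L1.trans {k : ℤ} {F g} (h : L1 k F g) {γ : M2} (hγ : γ.det = 1) {u v : ℂ} (hp : Pos u v) :
    lh k g (p1 γ u v) (p2 γ u v) = lh k g u v := by
  obtain ⟨M, hM⟩ := h.toMF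
  let γ' : SL(2, ℤ) := ⟨γ, hγ⟩
  have h3 := SlashInvariantFormClass.slash_action_eq M (γ' : GL (Fin 2) ℝ) ⟨_, rfl⟩
  have h5 : ((M : ℍ → ℂ) ∣[k] γ') ⟨u / v, hp.im⟩ = M ⟨u / v, hp.im⟩ := congrFun h3 _
  rw [ModularForm.SL_slash_apply, hM, hM, smul_coe, ModularGroup.denom_apply] at h5
  have hv := hp.ne
  have e1 : p1 γ u v = v * p1 γ (u / v) 1 := by simp [p1]; field_simp
  have e2 : p2 γ u v = v * p2 γ (u / v) 1 := by simp [p2]; field_simp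
  have hq : p2 γ (u / v) 1 = γ 1 0 * (u / v) + γ 1 1 := by simp [p2]
  rw [lh, lh, e1, e2, mul_div_mul_left _ _ hv, mul_zpow]
  change g (qq (p1 γ (u / v) 1 / p2 γ (u / v) 1)) * (γ 1 0 * (u / v) + γ 1 1) ^ (-k) = g (qq (u / v)) at h5
  rw [← hq] at h5
  rw [← h5]; ring

lemma seven_trans {k : ℤ} {F g} (h : L1 k F g) {γ : M2} (hγ : D7 1 γ) {u v : ℂ} (hp : Pos u v) :
    lh k g (7 * p1 γ u v) (p2 γ u v) = lh k g (7 * u) v := by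
  obtain ⟨c, hc⟩ := hγ.2
  have := h.trans (γ := !![γ 0 0, 7 * γ 0 1; c, γ 1 1]) (by
    have := hγ.1
    rw [Matrix.det_fin_two] at this ⊢
    simp; rw [hc] at this; linear_combination this) hp.seven
  rw [← this]
  congr 1
  · simp [p1]; ring
  · simp [p2, hc]; ring

/-- the structure theorem in weight 12, level 7 -/
theorem wt12 {R : Type*} [CommRing R] (φ : R →+* ℂ) (F : PowerSeries R) (g : ℂ → ℂ)
    (hF : Rep (PowerSeries.map φ F) g)
    (hi : ∀ γ, D7 1 γ → ∀ u v, Pos u v → lh 12 g (p1 γ u v) (p2 γ u v) = lh 12 g u v)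
    (G : PowerSeries ℂ) (g' : ℂ → ℂ) (hG : Rep G g')
    (hw : ∀ z : ℂ, 0 < z.im → g (qq (-1 / (7 * z))) = z ^ 12 * g' (qq z)) :
    ∃ P : R[X], P.natDegree ≤ 8 ∧ ∀ z : ℂ, 0 < z.im → g (qq z) = ww z * P.eval₂ φ (yy z) := by
  have hwne : ∀ z : ℂ, 0 < z.im → ww z ≠ 0 := fun z hz => wh_ne (Pos.of_im hz)
  have hwi : Rep (PowerSeries.map φ (iR R W0i)) (fun q => (wf q)⁻¹) := by
    rw [map_iR]
    exact wf_rep.inv' (fun q hq => wf_ne hq) (by rw [iR_C, ← map_mul toC, W0_inv, map_one])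
  have hFr : ∀ z : ℂ, 0 < z.im → ww (-1 / (7 * z)) = (7 * z) ^ 12 * (49 * ww z * yy z ^ 8) := by
    intro z hz
    have := wh_fricke (Pos.of_im hz)
    rw [wh_eq (Pos.of_im hz).fricke.ne] at this
    have h0 := im_ne hz
    change _ = 49 * ww z * yy z ^ 8 at this
    rw [← this]; field_simp
  obtain ⟨P, hP, hP2⟩ := struct φ 8 (F * iR R W0i) (fun z => g (qq z) / ww z) (fun q => g q * (wf q)⁻¹)
    (fun z hz => by rw [ww_eq hz]; rfl) (by rw [map_mul]; exact hF.mul hwi)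
    (by
      intro γ hγ z hz
      have hp := Pos.of_im hz
      have h1 := hi γ hγ z 1 hp
      have h2 := wh_inv hγ hp
      have hne := (hp.act (N := γ) (by rw [hγ.1]; norm_num)).ne
      rw [wh_eq hne, wh_eq one_ne_zero] at h2
      simp only [lh, div_one, one_zpow, one_mul, one_pow, inv_one] at h1 h2
      beta_reduce
      rw [← h1, ← h2, show (-12 : ℤ) = -((12 : ℕ) : ℤ) by norm_num, zpow_neg, zpow_natCast]
      field_simp)
    (by
      apply GrW_of_Gr
      have h1 : Gr (fun z => g' (qq z)) 0 := by
        obtain ⟨C, h0, hC⟩ := hG.bdd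
        exact ⟨C, 1, h0, fun z hz _ => by simpa using hC z hz⟩
      have h2 : Gr (fun z => (wf (qq z))⁻¹) 0 := by
        obtain ⟨C, h0, hC⟩ := (hwi).bdd
        exact ⟨C, 1, h0, fun z hz _ => by simpa using hC z hz⟩
      have h3 : Gr (fun z => (yy z)⁻¹) 1 := by
        have hr := y1f_rep.inv' (fun q hq => y1f_ne hq) (G := toC Y1i) (by rw [← map_mul toC, Y1_inv, map_one])
        obtain ⟨C, h0, hC⟩ := hr.bdd
        refine ⟨C, 1, h0, fun z hz hz' => ?_⟩
        beta_reduce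
        rw [yy_eq hz', yf, mul_inv, norm_mul, norm_inv, qq_norm, ← Real.exp_neg, neg_neg, pow_one, mul_comm]
        gcongr
        exact hC z hz
      have h4 := ((h1.mul h2).mul (h3.pow 8)).mul (Gr.const ((7 ^ 12 * 49)⁻¹))
      simp only [mul_one, add_zero, zero_add] at h4
      refine h4.congr fun z hz => ?_
      rw [hw z hz, hFr z hz, ← ww_eq hz]
      have h0 := im_ne hz
      have := hwne z hz
      have := yy_ne hz
      field_simp)
  refine ⟨P, hP, fun z hz => ?_⟩
  rw [← hP2 z hz, mul_div_cancel₀ _ (hwne z hz)]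

end HK

namespace HK
open PowerSeries (coeff)
open UpperHalfPlane hiding I
open ModularForm Complex Filter
open scoped MatrixGroups Real Topology Manifold ArithmeticFunction.sigma

theorem wt12' {R : Type*} [CommRing R] (φ : R →+* ℂ) (F1 F2 : PowerSeries R) (f1 f2 : ℂ → ℂ) {k m : ℤ}
    (h1 : L1 k (PowerSeries.map φ F1) f1) (h2 : L1 m (PowerSeries.map φ F2) f2) (hkm : k + m = 12) :
    ∃ P : R[X], P.natDegree ≤ 8 ∧
      ∀ z : ℂ, 0 < z.im → f1 (qq z) * f2 (qq (7 * z)) = ww z * P.eval₂ φ (yy z) := by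
  have q7 : ∀ z, qq z ^ 7 = qq (7 * z) := fun z => by
    have := qq_nat_mul 7 z
    push_cast at this
    rw [this]
  have r1 := h1.1.mul (h2.1.expand 7 (by norm_num))
  have r2 := (((h1.1.expand 7 (by norm_num))).mul h2.1).mul (Rep.const (7 ^ k))
  obtain ⟨P, hP, hP2⟩ := wt12 φ (F1 * PowerSeries.expand 7 (by norm_num) F2) (fun q => f1 q * f2 (q ^ 7))
    (by rw [map_mul, PowerSeries.map_expand]; exact r1)
    (by
      intro γ hγ u v hp
      have a1 := h1.trans hγ.1 hp
      have a2 := seven_trans h2 hγ hp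
      have e : ∀ u v : ℂ, v ≠ 0 → lh 12 (fun q => f1 q * f2 (q ^ 7)) u v = lh k f1 u v * lh m f2 (7 * u) v := by
        intro u v hv
        simp only [lh, q7]
        rw [← hkm, neg_add, zpow_add₀ hv, mul_div_assoc]; ring
      rw [e _ _ hp.ne, e _ _ (hp.act (N := γ) (by rw [hγ.1]; norm_num)).ne, a1, a2])
    _ _ r2 (by
      intro z hz
      have h7 : 0 < (7 * z).im := by simpa using hz
      have a1 := h1.2 _ h7
      have a2 := h2.2 _ hz
      have e : (7 : ℂ) * (-1 / (7 * z)) = -1 / z := by have := im_ne hz; field_simp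
      rw [q7, q7, a1, e, a2, mul_zpow]
      have : z ^ (12 : ℕ) = z ^ k * z ^ m := by rw [← zpow_add₀ (im_ne hz), hkm]; norm_cast
      rw [this]; ring)
  refine ⟨P, hP, fun z hz => ?_⟩
  rw [← hP2 z hz, q7]

/-! truncated computation -/
noncomputable def ser (L : List ℤ) : PowerSeries ℤ := PowerSeries.mk fun n => L.getD n 0
def Tr (F : PowerSeries ℤ) (L : List ℤ) : Prop := ∀ n < 9, coeff n F = L.getD n 0
def tmul (a b : List ℤ) : List ℤ :=
  (List.range 9).map fun n => ((List.range (n + 1)).map fun i => a.getD i 0 * b.getD (n - i) 0).sum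
def tadd (a b : List ℤ) : List ℤ := (List.range 9).map fun n => a.getD n 0 + b.getD n 0

lemma Tr.mul {F G : PowerSeries ℤ} {a b : List ℤ} (hF : Tr F a) (hG : Tr G b) : Tr (F * G) (tmul a b) := by
  intro n hn
  rw [PowerSeries.coeff_mul, Finset.Nat.sum_antidiagonal_eq_sum_range_succ_mk]
  have : (tmul a b).getD n 0 = ((List.range (n + 1)).map fun i => a.getD i 0 * b.getD (n - i) 0).sum := by
    simp [tmul, hn]
  rw [this, ← List.sum_toFinset _ List.nodup_range, List.toFinset_range]
  refine Finset.sum_congr rfl fun i hi => ?_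
  have := Finset.mem_range.1 hi
  simp only
  rw [hF i (by omega), hG (n - i) (by omega)]

lemma Tr.add {F G : PowerSeries ℤ} {a b : List ℤ} (hF : Tr F a) (hG : Tr G b) : Tr (F + G) (tadd a b) := by
  intro n hn
  rw [map_add, hF n hn, hG n hn]
  simp [tadd, hn]

def tpow (a : List ℤ) : ℕ → List ℤ
  | 0 => [1]
  | n + 1 => tmul (tpow a n) a

lemma Tr.pow {F : PowerSeries ℤ} {a : List ℤ} (hF : Tr F a) (n : ℕ) : Tr (F ^ n) (tpow a n) := by
  induction n with
  | zero =>
    intro n hn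
    rw [pow_zero, PowerSeries.coeff_one]
    rcases n with _ | n <;> simp [tpow]
  | succ n ih => rw [pow_succ]; exact ih.mul hF

lemma Tr.const (c : ℤ) : Tr (PowerSeries.C c) [c] := by
  intro n _
  rw [PowerSeries.coeff_C]
  rcases n with _ | n <;> simp

lemma Tr.inv {F G : PowerSeries ℤ} {a b : List ℤ} (hF : Tr F a) (h : F * G = 1) (hab : tmul a b = [1,0,0,0,0,0,0,0,0]) :
    Tr G b := by
  have hs : Tr (ser b) b := fun n _ => by rw [ser, PowerSeries.coeff_mk]
  have h1 := hF.mul hs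
  rw [hab] at h1
  have h2 : (PowerSeries.X : PowerSeries ℤ) ^ 9 ∣ 1 - F * ser b := by
    rw [PowerSeries.X_pow_dvd_iff]
    intro m hm
    rw [map_sub, h1 m hm, PowerSeries.coeff_one]
    interval_cases m <;> simp
  have h3 : (PowerSeries.X : PowerSeries ℤ) ^ 9 ∣ G - ser b := by
    have : G - ser b = G * (1 - F * ser b) := by linear_combination ser b * h
    rw [this]; exact h2.mul_left _
  rw [PowerSeries.X_pow_dvd_iff] at h3
  intro n hn
  have := h3 n hn
  rw [map_sub, hs n hn] at this
  linarith

def lE : List ℤ := [1, -1, -1, 0, 0, 1, 0, 1, 0]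
def lD : List ℤ := [1, 1, 2, 3, 5, 7, 11, 15, 22]
lemma E0_Tr : Tr E0 lE := by
  obtain ⟨R, hR⟩ := E0_trunc
  intro n hn
  rw [hR, map_add, PowerSeries.coeff_X_pow_mul', if_neg (by omega), add_zero]
  simp only [map_add, map_sub, PowerSeries.coeff_one, PowerSeries.coeff_X, PowerSeries.coeff_X_pow]
  interval_cases n <;> simp [lE]
lemma D0s_Tr : Tr D0s lD := E0_Tr.inv E0_D0s (by decide)
lemma E7_Tr : Tr (PowerSeries.expand 7 (by norm_num) E0) [1,0,0,0,0,0,0,-1,0] := by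
  intro n hn
  by_cases h : 7 ∣ n
  · obtain ⟨m, rfl⟩ := h
    rw [mul_comm 7 m, mul_comm m 7, PowerSeries.coeff_expand_mul, E0_Tr m (by omega)]
    have : m < 2 := by omega
    interval_cases m <;> simp [lE]
  · rw [PowerSeries.coeff_expand_of_not_dvd _ _ _ h]
    interval_cases n <;> simp at h ⊢
lemma D7_Tr : Tr (PowerSeries.expand 7 (by norm_num) D0s) [1,0,0,0,0,0,0,1,0] := E7_Tr.inv ED7 (by decide)

def lY : List ℤ := tmul [0,1] (tmul (tpow [1,0,0,0,0,0,0,-1,0] 4) (tpow lD 4))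
def lW : List ℤ := tmul (tpow lE 28) (tpow [1,0,0,0,0,0,0,1,0] 4)
lemma Y0_Tr : Tr Y0 lY := by
  have hX : Tr PowerSeries.X [0, 1] := by
    intro n hn
    rw [PowerSeries.coeff_X]
    rcases n with _ | _ | n <;> simp
  exact hX.mul ((E7_Tr.pow 4).mul (D0s_Tr.pow 4))
lemma W0_Tr : Tr W0 lW := (E0_Tr.pow 28).mul (D7_Tr.pow 4)
def lQ : List ℤ := [1, 240, 2160, 6720, 17520, 30240, 60480, 82560, 140400]
lemma Qs_Tr : Tr Qs lQ := by
  intro n hn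
  rw [Qs, PowerSeries.coeff_mk]
  interval_cases n
  · rfl
  all_goals
    rw [if_neg (by norm_num)]
    rw [ArithmeticFunction.sigma_apply]
    decide +kernel

/-- `aP` as a polynomial -/
noncomputable def aX : ℤ[X] := aP X
lemma evY_aP : evY ℤ aX = aP Y0 := by
  simp only [aX, aP, map_mul, map_add, map_pow, map_one, map_ofNat]
  have : evY ℤ X = Y0 := by
    simp only [evY, coe_eval₂RingHom, eval₂_X, YR]
    ext n; simp
  rw [this]

def laP : List ℤ :=
  tmul (tadd (tadd (tmul [49] (tpow lY 2)) (tmul [13] lY)) [1])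
    (tpow (tadd (tadd (tmul [2401] (tpow lY 2)) (tmul [245] lY)) [1]) 3)
lemma aP_Tr : Tr (aP Y0) laP := by
  have c (n : ℕ) [n.AtLeastTwo] : (OfNat.ofNat n : PowerSeries ℤ) = PowerSeries.C (OfNat.ofNat n) := (map_ofNat _ n).symm
  have c1 : (1 : PowerSeries ℤ) = PowerSeries.C 1 := by simp
  rw [aP, c 49, c 13, c 2401, c 245, c1]
  exact ((((Tr.const 49).mul (Y0_Tr.pow 2)).add ((Tr.const 13).mul Y0_Tr)).add (Tr.const 1)).mul
    (((((Tr.const 2401).mul (Y0_Tr.pow 2)).add ((Tr.const 245).mul Y0_Tr)).add (Tr.const 1)).pow 3)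

lemma comp_check : tpow lQ 3 = tmul lW laP := by decide +kernel

lemma evY_low {D : ℤ[X]} (hD : D.natDegree ≤ 8) (h : (PowerSeries.X : PowerSeries ℤ) ^ 9 ∣ evY ℤ D) : D = 0 := by
  by_contra h0
  obtain ⟨Q, hQ, hQ0⟩ := exists_eq_pow_rootMultiplicity_mul_and_not_dvd D h0 0
  simp only [map_zero, sub_zero] at hQ hQ0
  generalize rootMultiplicity 0 D = m at hQ
  have hQne : Q ≠ 0 := by rintro rfl; simp at hQ0
  have hm : m ≤ 8 := by
    rw [hQ, natDegree_mul (pow_ne_zero _ X_ne_zero) hQne, natDegree_X_pow] at hD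
    omega
  have hYR : YR ℤ = PowerSeries.X * Y1 := by
    rw [YR, Y0]; ext n; simp
  have hX : evY ℤ X = PowerSeries.X * Y1 := by simp [evY, hYR]
  rw [hQ, map_mul, map_pow, hX, mul_pow, mul_assoc, show 9 = m + (8 - m + 1) by omega, pow_add] at h
  have h2 := (mul_dvd_mul_iff_left (pow_ne_zero m PowerSeries.X_ne_zero)).1 h
  have h3 := (dvd_pow_self _ (by omega)).trans h2
  rw [PowerSeries.X_dvd_iff, map_mul, map_pow] at h3
  have h4 : PowerSeries.constantCoeff Y1 = 1 := by simpa using Y1_zero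
  have h5 : PowerSeries.constantCoeff (evY ℤ Q) = Q.coeff 0 := by
    rw [evY, coe_eval₂RingHom, hom_eval₂, hYR, map_mul, PowerSeries.constantCoeff_X, zero_mul, eval₂_at_zero]
    simp
  rw [h4, h5, one_pow, one_mul] at h3
  exact hQ0 (X_dvd_iff.2 h3)

/-- value of an integral polynomial at the hauptmodul -/
lemma eval_yy_rep (P : ℤ[X]) : Rep (toC (evY ℤ P)) (fun q => P.eval₂ (Int.castRingHom ℂ) (yf q)) := by
  have hy : Rep (PowerSeries.map (Int.castRingHom ℂ) (YR ℤ)) yf := by rw [map_YR]; exact yf_rep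
  exact hy.evalPoly P

theorem Q3_eq : Qs ^ 3 = W0 * aP Y0 := by
  obtain ⟨P, hP, hP2⟩ := wt12' (Int.castRingHom ℂ) (Qs ^ 3) 1 (fun q => Qf q ^ 3) (fun q => 1) (k := 12) (m := 0)
    ((Q_L1.pow 3).congr (by norm_num) (by rw [← map_pow]; rfl))
    ⟨by rw [map_one]; exact Rep.one, fun z hz => by simp⟩ (by norm_num)
  have h1 : Qs ^ 3 = W0 * evY ℤ P := by
    apply toC_inj
    rw [map_mul, map_pow]
    refine (Q_L1.1.pow 3).unique' (wf_rep.mul (eval_yy_rep P)) fun q hq hq0 => ?_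
    obtain ⟨z, hz, rfl⟩ := qq_surj hq0 hq
    have := hP2 z hz
    rw [mul_one, ww_eq hz, yy_eq hz] at this
    exact this
  have h2 : P = aX := by
    rw [← sub_eq_zero]
    apply evY_low
    · refine (natDegree_sub_le _ _).trans (max_le hP ?_)
      rw [aX, aP]
      compute_degree
    · have h3 : (PowerSeries.X : PowerSeries ℤ) ^ 9 ∣ Qs ^ 3 - W0 * aP Y0 := by
        rw [PowerSeries.X_pow_dvd_iff]
        intro n hn
        rw [map_sub, Qs_Tr.pow 3 n hn, W0_Tr.mul aP_Tr n hn, comp_check, sub_self]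
      have h4 : evY ℤ (P - aX) = W0i * (Qs ^ 3 - W0 * aP Y0) := by
        rw [map_sub, evY_aP, h1]
        linear_combination (-(evY ℤ P) + aP Y0) * W0_inv
      rw [h4]; exact h3.mul_left _
  rw [h1, h2, evY_aP]

lemma Ds_eq : Ds = W0 * Y0 := by
  rw [Ds, W0, Y0, Y1]
  have h1 := ED7
  have h2 := E0_D0s
  calc _ = PowerSeries.X * E0 ^ 24 * (PowerSeries.expand 7 (by norm_num) E0 * PowerSeries.expand 7 (by norm_num) D0s) ^ 4
      * (E0 * D0s) ^ 4 := by rw [h1, h2]; ring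
    _ = _ := by ring

lemma R2_eq : Rs ^ 2 = W0 * qP Y0 ^ 2 := by
  have h := D_eq
  rw [Q3_eq, Ds_eq] at h
  rw [← aP_sub]
  linear_combination h

lemma Q3_val {z : ℂ} (hz : 0 < z.im) : Qf (qq z) ^ 3 = ww z * aP (yy z) := by
  have h1 := Q_L1.1.pow 3
  rw [← map_pow toC, Q3_eq, ← evY_aP, map_mul toC] at h1
  have h2 := wf_rep.mul (eval_yy_rep aX)
  have := (h1 (qq z) (qq_norm_lt hz)).unique (h2 _ (qq_norm_lt hz))
  beta_reduce at this
  rw [this, ww_eq hz, yy_eq hz]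
  rw [← coe_eval₂RingHom]
  simp only [aX, aP, map_mul, map_add, map_pow, map_one, map_ofNat]
  simp only [coe_eval₂RingHom, eval₂_X]

lemma D_val {z : ℂ} (hz : 0 < z.im) : Df (qq z) = ww z * yy z := by
  have h1 := D_L1.1
  rw [Ds_eq, map_mul toC] at h1
  have h2 := wf_rep.mul yf_rep
  have := (h1 (qq z) (qq_norm_lt hz)).unique (h2 _ (qq_norm_lt hz))
  rw [this, ww_eq hz, yy_eq hz]

lemma R2_val {z : ℂ} (hz : 0 < z.im) : Rf (qq z) ^ 2 = ww z * qP (yy z) ^ 2 := by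
  have h1 := Df_disc ⟨z, hz⟩
  have h2 := Q3_val hz
  have h3 := D_val hz
  simp only at h1
  rw [h2, h3] at h1
  rw [← aP_sub]
  linear_combination h1

end HK

namespace HK
open PowerSeries (coeff)
open UpperHalfPlane hiding I
open ModularForm Complex Filter
open scoped MatrixGroups Real Topology Manifold ArithmeticFunction.sigma

lemma th_pow' {R : Type*} [CommRing R] (F : PowerSeries R) (n : ℕ) : th (F ^ n) = n * F ^ (n - 1) * th F := by
  induction n with
  | zero => rw [pow_zero, show (1 : PowerSeries R) = PowerSeries.C 1 by simp, th_C]; simp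
  | succ n ih =>
    rw [pow_succ, th_mul, ih]
    rcases n with _ | n
    · simp
    · simp only [Nat.add_sub_cancel]; push_cast; ring

lemma th_one {R : Type*} [CommRing R] : th (1 : PowerSeries R) = 0 := by
  rw [show (1 : PowerSeries R) = PowerSeries.C 1 by simp, th_C]

lemma th_natC {R : Type*} [CommRing R] (n : ℕ) (F : PowerSeries R) : th ((n : PowerSeries R) * F) = n * th F := by
  rw [show (n : PowerSeries R) = PowerSeries.C (n : R) by simp, th_mul, th_C]; ring

section
variable {R : Type*} [CommRing R] {q r d p h : PowerSeries R}

lemma th_mono (hq : th q = 4 * h * (p * q - r)) (hr : th r = 6 * h * (p * r - q ^ 2)) (hd : th d = p * d)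
    (h12 : 12 * h = 1) (a b c : ℕ) (w : PowerSeries R) (hw : 4 * a + 6 * b + 12 * c = w) :
    th (q ^ a * r ^ b * d ^ c) = h * w * p * (q ^ a * r ^ b * d ^ c) - 4 * h * a * q ^ (a - 1) * r ^ (b + 1) * d ^ c
      - 6 * h * b * q ^ (a + 2) * r ^ (b - 1) * d ^ c := by
  have hd' : th d = 12 * h * p * d := by rw [hd, h12, one_mul]
  rw [th_mul, th_mul, th_pow', th_pow', th_pow', hq, hr, hd', ← hw]
  rcases a with _ | a <;> rcases b with _ | b <;> rcases c with _ | c <;>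
    (try simp only [Nat.add_sub_cancel]) <;> push_cast <;> ring

/-- second derivative of a monomial of weight `-1` -/
lemma th2_mono (hq : th q = 4 * h * (p * q - r)) (hr : th r = 6 * h * (p * r - q ^ 2)) (hd : th d = p * d)
    (hp : th p = h * (p ^ 2 - q)) (h12 : 12 * h = 1) (hh : th h = 0) (hD : q ^ 3 = r ^ 2 + 1728 * d)
    (e : ℕ) (he : e ≤ 1) (m j : ℕ) (hw : (4 * e + 6 * m + 12 * j : PowerSeries R) = -1) :
    th (th (q ^ e * r ^ m * d ^ j)) = h ^ 2 * q ^ (e + 1) * ((6 * m + 1 + 4 * e) ^ 2 * (r ^ m * d ^ j)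
      + 62208 * m * (m - 1) * (r ^ (m - 2) * d ^ (j + 1))) := by
  have key : ∀ (F G H : PowerSeries R), th F = h * (-1) * p * F + G → th G = h * p * G + H →
      th (th F) = h ^ 2 * q * F + H := by
    intro F G H h1 h2
    rw [h1, th_add, th_mul, th_mul, th_mul, h1, h2, hh, hp, show (-1 : PowerSeries R) = PowerSeries.C (-1) by simp, th_C]
    simp only [map_neg, map_one]
    ring
  have n1 : ∀ n : ℕ, ∀ F : PowerSeries R, th (h * (n : PowerSeries R) * F) = h * (n : PowerSeries R) * th F := by
    intro n F
    rw [th_mul, th_mul, hh, show (n : PowerSeries R) = PowerSeries.C (n : R) by simp, th_C]; ring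
  interval_cases e
  · rcases m with _ | m
    · rw [key _ 0 0 (by rw [th_mono hq hr hd h12 0 0 j _ (by push_cast at hw ⊢; exact hw)]; simp) (by simp [th])]
      simp
    · have h1 := th_mono hq hr hd h12 0 (m + 1) j _ hw
      have h2 := th_mono hq hr hd h12 2 m j 1 (by push_cast at hw ⊢; linear_combination hw)
      rw [key _ (-6 * (h * ((m + 1 : ℕ) : PowerSeries R) * (q ^ 2 * r ^ m * d ^ j)))
        (-6 * (h * ((m + 1 : ℕ) : PowerSeries R) * (- 4 * h * 2 * q * r ^ (m + 1) * d ^ j - 6 * h * m * q ^ 4 * r ^ (m - 1) * d ^ j)))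
        (by rw [h1]; push_cast; simp; ring)
        (by
          rw [show (-6 : PowerSeries R) = PowerSeries.C (-6) by simp [map_ofNat], th_mul, th_C, n1, h2]
          push_cast; simp; ring)]
      rcases m with _ | m
      · simp; ring
      · rw [show q ^ 4 = q * q ^ 3 by ring, hD]
        simp only [Nat.add_sub_cancel, show m + 1 + 1 - 2 = m by omega]
        push_cast; ring
  · have h1 := th_mono hq hr hd h12 1 m j _ hw
    have h1' : th (q ^ 1 * r ^ m * d ^ j) = h * (-1) * p * (q ^ 1 * r ^ m * d ^ j) +
        (-(h * ((6 * m + 4 : ℕ) : PowerSeries R) * (q ^ 0 * r ^ (m + 1) * d ^ j))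
         - (h * ((10368 * m : ℕ) : PowerSeries R) * (q ^ 0 * r ^ (m - 1) * d ^ (j + 1)))) := by
      rw [h1]
      rcases m with _ | m
      · simp; ring
      · rw [show q ^ (1 + 2) = q ^ 3 by rfl, hD]
        simp only [Nat.add_sub_cancel]
        push_cast; simp; ring
    have h2 := th_mono hq hr hd h12 0 (m + 1) j 1 (by push_cast at hw ⊢; linear_combination hw)
    have n2 : ∀ F G : PowerSeries R, th (-F - G) = - th F - th G := by
      intro F G; ext n; simp only [th_coeff, map_sub, map_neg]; ring
    rcases m with _ | m
    · rw [key _ _ (- (h * 4 * (- 6 * h * q ^ 2 * d ^ j))) h1' (by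
        rw [n2, n1, n1, h2]; push_cast; simp; ring)]
      simp; ring
    · have h3 := th_mono hq hr hd h12 0 m (j + 1) 1 (by push_cast at hw ⊢; linear_combination hw)
      rw [key _ _ (- (h * (6 * (m + 1) + 4) * (- 6 * h * (m + 2) * q ^ 2 * r ^ (m + 1) * d ^ j))
           - h * (10368 * (m + 1)) * (- 6 * h * m * q ^ 2 * r ^ (m - 1) * d ^ (j + 1))) h1' (by
        rw [n2, n1, n1, h2]; simp only [Nat.add_sub_cancel]; rw [h3]; push_cast; simp; ring)]
      rcases m with _ | m
      · simp; ring
      · simp only [Nat.add_sub_cancel, show m + 1 + 1 - 2 = m by omega]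
        push_cast; ring
end

lemma sum_inv_primes (l : ℕ) (hl : l.Prime) (s : Finset ℕ) (hs : ∀ p ∈ s, p.Prime ∧ p ≠ l) :
    ∃ M a : ℤ, ¬ (l : ℤ) ∣ M ∧ (M : ℚ) * ∑ p ∈ s, (1 : ℚ) / p = a := by
  induction s using Finset.induction_on with
  | empty => exact ⟨1, 0, fun h => hl.one_lt.ne' (by exact_mod_cast Int.eq_one_of_dvd_one (by positivity) h), by simp⟩
  | insert p s hp ih =>
    obtain ⟨M, a, hM, ha⟩ := ih fun p hp => hs p (Finset.mem_insert_of_mem hp)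
    obtain ⟨h1, h2⟩ := hs p (Finset.mem_insert_self _ _)
    refine ⟨p * M, M + p * a, fun h => ?_, ?_⟩
    · rcases (Nat.prime_iff_prime_int.1 hl).dvd_or_dvd h with h | h
      · exact h2 ((Nat.prime_dvd_prime_iff_eq hl h1).1 (by exact_mod_cast h)).symm
      · exact hM h
    · rw [Finset.sum_insert hp]
      have : (p : ℚ) ≠ 0 := by exact_mod_cast h1.ne_zero
      push_cast
      rw [← ha]; field_simp

lemma bern_den (l : ℕ) (hl : l.Prime) (h3 : 3 < l) :
    ∃ M N : ℤ, _root_.bernoulli (l - 1) * (M * l) = N ∧ ¬ (l : ℤ) ∣ N := by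
  have hodd : l % 2 = 1 := hl.eq_two_or_odd.resolve_left (by omega)
  have e : l - 1 = 2 * ((l - 1) / 2) := by omega
  obtain ⟨t, ht⟩ := Bernoulli.vonStaudt_clausen ((l - 1) / 2)
  rw [← e] at ht
  set S := {p ∈ Finset.range (l - 1 + 2) | p.Prime ∧ (p - 1) ∣ l - 1} with hS
  have hlS : l ∈ S := by
    simp only [hS, Finset.mem_filter, Finset.mem_range]
    exact ⟨by omega, hl, dvd_rfl⟩
  rw [← Finset.add_sum_erase _ _ hlS] at ht
  obtain ⟨M, a, hM, ha⟩ := sum_inv_primes l hl (S.erase l) (fun p hp => by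
    rw [Finset.mem_erase, hS, Finset.mem_filter] at hp
    exact ⟨hp.2.2.1, hp.1⟩)
  refine ⟨M, M * l * t - M - l * a, ?_, fun h => hM ?_⟩
  · have : (l : ℚ) ≠ 0 := by exact_mod_cast hl.ne_zero
    push_cast
    rw [ht, ← ha]; field_simp; ring
  · have : (M : ℤ) = l * (M * t - a) - (M * l * t - M - l * a) := by ring
    rw [this]; exact dvd_sub (dvd_mul_right _ _) h

/-- a multiple of the Eisenstein series of weight `l - 1` -/
lemma eis_int (l : ℕ) (hl : l.Prime) (h3 : 3 < l) : ∃ (N : ℤ) (F : PowerSeries ℤ) (f : ℂ → ℂ),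
    ¬ (l : ℤ) ∣ N ∧ L1 ((l - 1 : ℕ) : ℤ) (toC F) f ∧ iR (ZMod l) F = PowerSeries.C (N : ZMod l) := by
  obtain ⟨M, N, h1, h2⟩ := bern_den l hl h3
  have hodd : l % 2 = 1 := hl.eq_two_or_odd.resolve_left (by omega)
  have hk : 3 ≤ l - 1 := by omega
  have hk2 : Even (l - 1) := ⟨(l - 1) / 2, by omega⟩
  have h := (L1.ofMF (ModularForm.E hk)).1.smul (N : ℂ)
  refine ⟨N, PowerSeries.mk fun n => if n = 0 then N else -(2 * (l - 1 : ℕ) * M * l * (σ (l - 1 - 1) n : ℤ)), _, h2,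
    h.congr rfl ?_, ?_⟩
  · ext n
    rw [PowerSeries.coeff_C_mul, EisensteinSeries.E_qExpansion_coeff hk hk2, coeff_toC, PowerSeries.coeff_mk]
    split_ifs with h0
    · simp
    · have hN : (N : ℂ) = (_root_.bernoulli (l - 1) : ℂ) * (M * l) := by
        have := congrArg (Rat.cast : ℚ → ℂ) h1
        push_cast at this
        rw [this]
      have hB : ((_root_.bernoulli (l - 1) : ℚ) : ℂ) ≠ 0 := by
        intro h0
        rw [h0, zero_mul] at hN
        apply h2
        have : N = 0 := by exact_mod_cast hN
        simp [this]
      rw [hN]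
      push_cast
      field_simp
  · ext n
    rw [iR, PowerSeries.coeff_map, PowerSeries.coeff_mk, PowerSeries.coeff_C]
    split_ifs <;> simp

noncomputable def PZ (l : ℕ) [Fact (Nat.Prime l)] : PowerSeries ℤ :=
  ∑ k ∈ Finset.range (l / 12 + 1), PowerSeries.C (cc l k) * (Qs ^ rr l * Rs ^ (2 * k + sx l) * Ds ^ (l / 12 - k))

lemma cc_rec (l : ℕ) [Fact (Nat.Prime l)] (k : ℕ) (hk : k < l / 12) :
    cc l k * ((l / 12 - k : ℕ) : ℤ) ^ 2 = -432 * (2 * k + sx l + 2 : ℕ) * (2 * k + sx l + 1 : ℕ) * cc l (k + 1) := by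
  obtain ⟨j, hj⟩ : ∃ j, l / 12 = k + j + 1 := ⟨l / 12 - k - 1, by omega⟩
  simp only [cc]
  rw [hj, show k + j + 1 - k = j + 1 by omega, show k + j + 1 - (k + 1) = j by omega,
    show 2 * (k + j + 1) - 2 * k = 2 * (j + 1) by omega, show 2 * (k + j + 1) - 2 * (k + 1) = 2 * j by omega]
  generalize sx l = s
  have e1 := Nat.add_choose_mul_factorial_mul_factorial (2 * k + s) (2 * (j + 1))
  have e2 := Nat.add_choose_mul_factorial_mul_factorial (2 * (k + 1) + s) (2 * j)
  have e3 := Nat.add_choose_mul_factorial_mul_factorial (j + 1) (j + 1)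
  have e4 := Nat.add_choose_mul_factorial_mul_factorial j j
  rw [← Nat.choose_symm_add] at e1 e2
  rw [show 2 * k + s + 2 * (j + 1) = 2 * (k + j + 1) + s by ring] at e1
  rw [show 2 * (k + 1) + s + 2 * j = 2 * (k + j + 1) + s by ring] at e2
  rw [← two_mul] at e3 e4
  have f1 : (2 * (k + 1) + s).factorial = (2 * k + s + 2) * (2 * k + s + 1) * (2 * k + s).factorial := by
    rw [show 2 * (k + 1) + s = 2 * k + s + 1 + 1 by ring, Nat.factorial_succ, Nat.factorial_succ]; ring
  have f2 : (j + 1).factorial = (j + 1) * j.factorial := Nat.factorial_succ _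
  rw [f1] at e2
  rw [f2] at e3
  generalize (2 * (k + j + 1) + s).choose (2 * k + s) = c1 at *
  generalize (2 * (k + j + 1) + s).choose (2 * (k + 1) + s) = c2 at *
  generalize (2 * (j + 1)).choose (j + 1) = c3 at *
  generalize (2 * j).choose j = c4 at *
  have p1 := Nat.factorial_pos (2 * k + s)
  have p2 := Nat.factorial_pos j
  have p3 := Nat.factorial_pos (2 * j)
  have p4 := Nat.factorial_pos (2 * (j + 1))
  generalize (2 * k + s).factorial = a at *
  generalize j.factorial = b at *
  generalize (2 * j).factorial = d at *
  generalize (2 * (j + 1)).factorial = e at *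
  have key : c1 * c3 * (j + 1) ^ 2 = (2 * k + s + 2) * (2 * k + s + 1) * (c2 * c4) := by
    apply Nat.eq_of_mul_eq_mul_right (show 0 < a * b ^ 2 * d * e by positivity)
    have x1 : c1 * c3 * (j + 1) ^ 2 * (a * b ^ 2 * d * e) = (c1 * a * e) * (c3 * ((j + 1) * b) * ((j + 1) * b)) * d := by ring
    have x2 : (2 * k + s + 2) * (2 * k + s + 1) * (c2 * c4) * (a * b ^ 2 * d * e) =
      (c2 * ((2 * k + s + 2) * (2 * k + s + 1) * a) * d) * (c4 * b * b) * e := by ring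
    rw [x1, x2, e1, e2, e3, e4]; ring
  have key' : (c1 : ℤ) * c3 * (j + 1) ^ 2 = (2 * k + s + 2) * (2 * k + s + 1) * (c2 * c4) := by exact_mod_cast key
  push_cast
  rw [pow_succ]
  linear_combination (-432) ^ j * (-432) * key'

end HK

namespace HK
open PowerSeries (coeff)
open UpperHalfPlane hiding I
open ModularForm Complex Filter
open scoped MatrixGroups Real Topology Manifold ArithmeticFunction.sigma

lemma iR_Ds {R : Type*} [CommRing R] : iR R Ds = PowerSeries.X * iR R E0 ^ 24 := by
  rw [Ds, map_mul, map_pow]; congr 1; simp [iR]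

/-- a level one form of high order vanishes -/
lemma low_order {K : Type*} [Field K] (r s n : ℕ) (c : ℕ → K)
    (h : PowerSeries.X ^ (n + 1) ∣ ∑ i ∈ Finset.range (n + 1),
      PowerSeries.C (c i) * (iR K Qs ^ (3 * i + r) * iR K Rs ^ s * iR K Ds ^ (n - i))) :
    ∑ i ∈ Finset.range (n + 1), PowerSeries.C (c i) * (iR K Qs ^ (3 * i + r) * iR K Rs ^ s * iR K Ds ^ (n - i)) = 0 := by
  induction n with
  | zero =>
    simp only [zero_add, Finset.sum_range_one, pow_one, PowerSeries.X_dvd_iff, map_mul, map_pow, iR_cc, Qs_cc, Rs_cc] at h ⊢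
    simp at h
    simp [h]
  | succ n ih =>
    rw [Finset.sum_range_succ] at h ⊢
    have e : ∑ i ∈ Finset.range (n + 1), PowerSeries.C (c i) * (iR K Qs ^ (3 * i + r) * iR K Rs ^ s * iR K Ds ^ (n + 1 - i)) =
        iR K Ds * ∑ i ∈ Finset.range (n + 1), PowerSeries.C (c i) * (iR K Qs ^ (3 * i + r) * iR K Rs ^ s * iR K Ds ^ (n - i)) := by
      rw [Finset.mul_sum]
      refine Finset.sum_congr rfl fun i hi => ?_
      rw [show n + 1 - i = n - i + 1 by have := Finset.mem_range.1 hi; omega]; ring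
    rw [e] at h ⊢
    have h0 : c (n + 1) = 0 := by
      have h1 := (dvd_pow_self (PowerSeries.X : PowerSeries K) (by omega : n + 1 + 1 ≠ 0)).trans h
      rw [PowerSeries.X_dvd_iff] at h1
      simpa [iR_cc, Qs_cc, Rs_cc, Ds_cc] using h1
    rw [h0, map_zero, zero_mul, add_zero] at h ⊢
    rw [ih, mul_zero]
    have hu : iR K E0 ^ 24 * iR K D0s ^ 24 = 1 := by
      rw [← mul_pow, ← map_mul, E0_D0s, map_one, one_pow]
    rw [iR_Ds, mul_assoc, pow_succ' _ (n + 1)] at h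
    have h2 := (mul_dvd_mul_iff_left PowerSeries.X_ne_zero).1 h
    have h3 := h2.mul_left (iR K D0s ^ 24)
    rw [← mul_assoc, mul_comm (iR K D0s ^ 24), hu, one_mul] at h3
    rwa [iR_Ds]

variable (l : ℕ) [Fact (Nat.Prime l)]

lemma l_eq (hl : 3 < l) : 12 * (l / 12) + 6 * sx l + 4 * rr l + 1 = l := by
  obtain ⟨h1, h2, h3⟩ := rs_spec l hl
  have : l % 2 = 1 := (Fact.out : l.Prime).eq_two_or_odd.resolve_left (by omega)
  omega

lemma PZ_th (hl : 3 < l) : th (th (iR (ZMod l) (PZ l))) = 0 := by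
  obtain ⟨_, hr1, hs1⟩ := rs_spec l hl
  have hle := l_eq l hl
  have hlK : ((l : ℕ) : PowerSeries (ZMod l)) = 0 := by
    rw [← map_natCast (PowerSeries.C (R := ZMod l)) l, ZMod.natCast_self, map_zero]
  have h12 : (12 : ZMod l) ≠ 0 := by
    intro h
    have h : ((12 : ℕ) : ZMod l) = 0 := by exact_mod_cast h
    rw [ZMod.natCast_eq_zero_iff] at h
    have := (Nat.Prime.dvd_mul (Fact.out : l.Prime)).1 (show l ∣ 3 * 4 from h)
    rcases this with h | h
    · have := Nat.le_of_dvd (by norm_num) h; omega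
    · have := Nat.le_of_dvd (by norm_num) h
      have : l = 4 := by omega
      have hp : l.Prime := Fact.out
      rw [this] at hp
      norm_num at hp
  set h : PowerSeries (ZMod l) := PowerSeries.C (12⁻¹ : ZMod l) with hh
  have h1 : 12 * h = 1 := by
    rw [hh, show (12 : PowerSeries (ZMod l)) = PowerSeries.C 12 by simp [map_ofNat], ← map_mul, mul_inv_cancel₀ h12, map_one]
  have hiC : ∀ F, th (iR (ZMod l) F) = iR (ZMod l) (th F) := fun F => by rw [iR, ← th_map]
  have m3 := congrArg (iR (ZMod l)) th_Q
  have m2 := congrArg (iR (ZMod l)) th_R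
  have mP := congrArg (iR (ZMod l)) th_P
  have mD := congrArg (iR (ZMod l)) th_D
  have mE := congrArg (iR (ZMod l)) D_eq
  simp only [map_mul, map_sub, map_pow, map_ofNat, ← hiC] at m3 m2 mP mD mE
  have key := fun m j hw => th2_mono (q := iR (ZMod l) Qs) (r := iR (ZMod l) Rs) (d := iR (ZMod l) Ds)
    (p := iR (ZMod l) Ps) (h := h)
    (by linear_combination (4 * h) * m3 - th (iR (ZMod l) Qs) * h1) (by linear_combination (6 * h) * m2 - th (iR (ZMod l) Rs) * h1)
    mD (by linear_combination h * mP - th (iR (ZMod l) Ps) * h1) h1 (th_C _) (by linear_combination -mE) (rr l) hr1 m j hw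
  generalize hn : l / 12 = n at *
  have e1 : iR (ZMod l) (PZ l) = ∑ k ∈ Finset.range (n + 1), PowerSeries.C (cc l k : ZMod l) *
      (iR (ZMod l) Qs ^ rr l * iR (ZMod l) Rs ^ (2 * k + sx l) * iR (ZMod l) Ds ^ (n - k)) := by
    rw [PZ, map_sum, hn]
    refine Finset.sum_congr rfl fun k hk => ?_
    simp only [map_mul, map_pow]
    simp [iR]
  have e2 : ∀ (f : ℕ → PowerSeries (ZMod l)) (N : ℕ), th (∑ k ∈ Finset.range N, f k) = ∑ k ∈ Finset.range N, th (f k) := by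
    intro f N
    induction N with
    | zero => simp [th]
    | succ N ih => rw [Finset.sum_range_succ, th_add, ih, Finset.sum_range_succ]
  rw [e1, e2, e2]
  set A : ℕ → PowerSeries (ZMod l) := fun k => PowerSeries.C (cc l k : ZMod l) * ((6 * ((2 * k + sx l : ℕ) : PowerSeries (ZMod l)) + 1 + 4 * rr l) ^ 2 *
    (iR (ZMod l) Rs ^ (2 * k + sx l) * iR (ZMod l) Ds ^ (n - k))) with hA
  set B : ℕ → PowerSeries (ZMod l) := fun k => PowerSeries.C (cc l k : ZMod l) * (62208 * ((2 * k + sx l : ℕ) : PowerSeries (ZMod l)) * (((2 * k + sx l : ℕ) : PowerSeries (ZMod l)) - 1) *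
    (iR (ZMod l) Rs ^ (2 * k + sx l - 2) * iR (ZMod l) Ds ^ (n - k + 1))) with hB
  have e3 : ∀ k ∈ Finset.range (n + 1), th (th (PowerSeries.C (cc l k : ZMod l) *
      (iR (ZMod l) Qs ^ rr l * iR (ZMod l) Rs ^ (2 * k + sx l) * iR (ZMod l) Ds ^ (n - k)))) =
      h ^ 2 * iR (ZMod l) Qs ^ (rr l + 1) * (A k + B k) := by
    intro k hk
    have hk' := Finset.mem_range.1 hk
    rw [th_mul, th_C, zero_mul, zero_add, th_mul, th_C, zero_mul, zero_add, key (2 * k + sx l) (n - k) (by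
      have : ((4 * rr l + 6 * (2 * k + sx l) + 12 * (n - k) + 1 : ℕ) : PowerSeries (ZMod l)) = 0 := by
        rw [← hlK]; congr 1; omega
      push_cast at this ⊢
      linear_combination this)]
    simp only [hA, hB]; ring
  have cst : ∀ x : ℤ, (x : PowerSeries (ZMod l)) = PowerSeries.C (x : ZMod l) := fun x => by simp
  have e4 : ∀ k < n, B (k + 1) = - A k := by
    intro k hk
    have hrec := congrArg (Int.cast : ℤ → PowerSeries (ZMod l)) (cc_rec l k (by omega))
    rw [hn] at hrec
    simp only [hA, hB, ← cst]
    have x : (6 * ((2 * k + sx l : ℕ) : PowerSeries (ZMod l)) + 1 + 4 * rr l) = - (12 * ((n - k : ℕ) : PowerSeries (ZMod l))) := by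
      have : ((6 * (2 * k + sx l) + 1 + 4 * rr l + 12 * (n - k) : ℕ) : PowerSeries (ZMod l)) = 0 := by
        rw [← hlK]; congr 1; omega
      push_cast at this ⊢
      linear_combination this
    rw [x, show 2 * (k + 1) + sx l - 2 = 2 * k + sx l by omega, show n - (k + 1) + 1 = n - k by omega]
    push_cast at hrec ⊢
    linear_combination 144 * (iR (ZMod l) Rs ^ (2 * k + sx l) * iR (ZMod l) Ds ^ (n - k)) * hrec
  have e5 : A n = 0 := by
    simp only [hA]
    have : (6 * ((2 * n + sx l : ℕ) : PowerSeries (ZMod l)) + 1 + 4 * rr l) = 0 := by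
      have h : ((6 * (2 * n + sx l) + 1 + 4 * rr l : ℕ) : PowerSeries (ZMod l)) = 0 := by
        rw [← hlK]; congr 1; omega
      push_cast at h ⊢
      linear_combination h
    rw [this]; ring
  have e6 : B 0 = 0 := by
    simp only [hB]
    have : sx l = 0 ∨ sx l = 1 := by omega
    rcases this with h | h <;> simp [h]
  rw [Finset.sum_congr rfl e3, ← Finset.mul_sum, Finset.sum_add_distrib, Finset.sum_range_succ A, Finset.sum_range_succ' B,
    Finset.sum_congr rfl (fun k hk => e4 k (Finset.mem_range.1 hk)), e5, e6, Finset.sum_neg_distrib]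
  ring

/-- the Hasse invariant has `q`-expansion `1` -/
theorem hasse_one (hl : 3 < l) : iR (ZMod l) (PZ l) = 1 := by
  have hp : l.Prime := Fact.out
  obtain ⟨_, hr1, hs1⟩ := rs_spec l hl
  have hle := l_eq l hl
  have hco : ∀ m < l, m ≠ 0 → coeff m (iR (ZMod l) (PZ l)) = 0 := by
    intro m hm h0
    have := congrArg (PowerSeries.coeff m) (PZ_th l hl)
    rw [th_coeff, th_coeff, map_zero] at this
    have hm' : ((m : ℕ) : ZMod l) ≠ 0 := by
      rw [Ne, ZMod.natCast_eq_zero_iff]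
      exact fun h => absurd (Nat.le_of_dvd (by omega) h) (by omega)
    exact ((mul_eq_zero.1 this).resolve_left hm' |> mul_eq_zero.1).resolve_left hm'
  have hc0 : PowerSeries.constantCoeff (PZ l) = 1 := by
    rw [PZ, map_sum, Finset.sum_eq_single (l / 12)]
    · simp [Qs_cc, Rs_cc, cc_top]
    · intro k hk hk'
      have : l / 12 - k ≠ 0 := by have := Finset.mem_range.1 hk; omega
      simp [Ds_cc, this]
    · intro h; simp at h
  obtain ⟨N, F, f, hN, hF, hF1⟩ := eis_int l hp hl
  have hP : ∃ g, L1 ((l - 1 : ℕ) : ℤ) (toC (PZ l)) g := by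
    have : ∀ (N : ℕ), N ≤ l / 12 + 1 → ∃ g, L1 ((l - 1 : ℕ) : ℤ) (toC (∑ k ∈ Finset.range N, PowerSeries.C (cc l k) *
      (Qs ^ rr l * Rs ^ (2 * k + sx l) * Ds ^ (l / 12 - k)))) g := by
      intro N
      induction N with
      | zero => exact fun _ => ⟨fun _ => 0, by simpa using Rep.const 0, fun z hz => by simp⟩
      | succ N ih =>
        intro hN
        obtain ⟨g, hg⟩ := ih (by omega)
        have h1 := (((Q_L1.pow (rr l)).mul (R_L1.pow (2 * N + sx l))).mul (D_L1.pow (l / 12 - N))).smul (cc l N : ℂ)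
        rw [Finset.sum_range_succ]
        refine ⟨_, (hg.add (h1.congr (m := ((l - 1 : ℕ) : ℤ)) ?_ rfl)).congr rfl ?_⟩
        · omega
        · simp only [map_add, map_mul, map_pow, toC_C]
    exact this _ le_rfl
  obtain ⟨g, hg⟩ := hP
  have hd := hF.add (hg.smul (-N : ℂ))
  obtain ⟨c, hc⟩ := lvl1_struct (Int.castRingHom ℂ) Int.cast_injective (rr l) (sx l) (by omega) (l / 12)
    (F - PowerSeries.C N * PZ l) _ (hd.congr (by omega) (by
      change _ = toC _
      rw [map_sub toC, map_mul toC, toC_C]; simp [sub_eq_add_neg]))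
  have h2 := congrArg (iR (ZMod l)) hc
  have h3 : iR (ZMod l) (F - PowerSeries.C N * PZ l) = PowerSeries.C (N : ZMod l) * (1 - iR (ZMod l) (PZ l)) := by
    rw [map_sub, map_mul, hF1, show iR (ZMod l) (PowerSeries.C N) = PowerSeries.C (N : ZMod l) by simp [iR]]; ring
  rw [h3] at h2
  have h4 : iR (ZMod l) (∑ i ∈ Finset.range (l / 12 + 1),
      PowerSeries.C (c i) * (iR ℤ Qs ^ (3 * i + rr l) * iR ℤ Rs ^ sx l * iR ℤ Ds ^ (l / 12 - i))) =
      ∑ i ∈ Finset.range (l / 12 + 1),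
      PowerSeries.C (c i : ZMod l) * (iR (ZMod l) Qs ^ (3 * i + rr l) * iR (ZMod l) Rs ^ sx l * iR (ZMod l) Ds ^ (l / 12 - i)) := by
    rw [map_sum]
    have hid : ∀ G, iR ℤ G = G := fun G => by ext n; simp [iR]
    refine Finset.sum_congr rfl fun i _ => ?_
    simp only [map_mul, map_pow, hid]
    congr 1; simp [iR]
  rw [h4] at h2
  have h5 : PowerSeries.X ^ (l / 12 + 1) ∣ PowerSeries.C (N : ZMod l) * (1 - iR (ZMod l) (PZ l)) := by
    refine Dvd.dvd.mul_left ?_ _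
    rw [PowerSeries.X_pow_dvd_iff]
    intro m hm
    by_cases h0 : m = 0
    · subst h0
      rw [PowerSeries.coeff_zero_eq_constantCoeff_apply, map_sub, iR_cc, hc0]; simp
    · rw [map_sub, hco m (by omega) h0, PowerSeries.coeff_one, if_neg h0, sub_zero]
  have h6 := low_order (rr l) (sx l) (l / 12) (fun i => (c i : ZMod l)) (by rw [← h2]; exact h5)
  rw [h6] at h2
  have hN' : PowerSeries.C (N : ZMod l) ≠ 0 := by
    rw [Ne, ← map_zero (PowerSeries.C), PowerSeries.C_injective.eq_iff, ZMod.intCast_zmod_eq_zero_iff_dvd]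
    exact hN
  have := (mul_eq_zero.1 h2).resolve_left hN'
  rw [sub_eq_zero] at this
  exact this.symm

/-- the twelfth power of the Hasse invariant divided by a power of `W`, as a polynomial in `y` -/
noncomputable def RX : ℤ[X] := aP X ^ (4 * rr l) * qP X ^ (12 * sx l) *
  (∑ k ∈ Finset.range (l / 12 + 1), C (cc l k) * (qP X ^ 2) ^ k * X ^ (l / 12 - k)) ^ 12

lemma RX_hom {R : Type*} [CommRing R] (f : ℤ[X] →+* R) : f (RX l) = aP (f X) ^ (4 * rr l) * qP (f X) ^ (12 * sx l) *
    (∑ k ∈ Finset.range (l / 12 + 1), (cc l k : R) * (qP (f X) ^ 2) ^ k * (f X) ^ (l / 12 - k)) ^ 12 := by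
  have ha : f (aP X) = aP (f X) := by
    simp only [aP, map_mul, map_add, map_pow, map_one, map_ofNat]
  have hq : f (qP X) = qP (f X) := by
    simp only [qP, map_mul, map_add, map_sub, map_pow, map_one, map_ofNat]
  have hc : ∀ n : ℤ, f (C n) = (n : R) := fun n => by simp
  simp only [RX, map_mul, map_pow, map_sum, ha, hq, hc]

lemma RX_zero (hl : 3 < l) {F : Type*} [Field F] (y : F) : (RX l).eval₂ (Int.castRingHom F) y = 0 ↔ SSv l y = 0 := by
  obtain ⟨_, hr1, hs1⟩ := rs_spec l hl
  rw [← coe_eval₂RingHom, RX_hom, SSv]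
  simp only [coe_eval₂RingHom, eval₂_X]
  have hr : rr l = 0 ∨ rr l = 1 := by omega
  have hs : sx l = 0 ∨ sx l = 1 := by omega
  rcases hr with hr | hr <;> rcases hs with hs | hs <;> simp [hr, hs]

theorem RX_rel (hl : 3 < l) : iR (ZMod l) (W0 ^ (l - 1) * evY ℤ (RX l)) = 1 := by
  have h12 : W0 ^ (l - 1) * evY ℤ (RX l) = PZ l ^ 12 := by
    have hle := l_eq l hl
    have hX : evY ℤ X = Y0 := by
      simp only [evY, coe_eval₂RingHom, eval₂_X, YR]
      ext n; simp
    rw [RX_hom, hX, PZ]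
    have e1 : ∀ k ∈ Finset.range (l / 12 + 1), PowerSeries.C (cc l k) * (Qs ^ rr l * Rs ^ (2 * k + sx l) * Ds ^ (l / 12 - k)) =
        Qs ^ rr l * Rs ^ sx l * W0 ^ (l / 12) * ((cc l k : PowerSeries ℤ) * (qP Y0 ^ 2) ^ k * Y0 ^ (l / 12 - k)) := by
      intro k hk
      have hk' := Finset.mem_range.1 hk
      have e2 : W0 ^ (l / 12) = W0 ^ k * W0 ^ (l / 12 - k) := by rw [← pow_add]; congr 1; omega
      have e3 : (PowerSeries.C (cc l k) : PowerSeries ℤ) = (cc l k : PowerSeries ℤ) := by simp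
      rw [pow_add, pow_mul, R2_eq, Ds_eq, e2, e3, mul_pow, mul_pow]; ring
    rw [Finset.sum_congr rfl e1, ← Finset.mul_sum, mul_pow, mul_pow, mul_pow]
    have e4 : (Qs ^ rr l) ^ 12 = W0 ^ (4 * rr l) * aP Y0 ^ (4 * rr l) := by
      rw [← mul_pow, ← Q3_eq]; ring
    have e5 : (Rs ^ sx l) ^ 12 = W0 ^ (6 * sx l) * qP Y0 ^ (12 * sx l) := by
      rw [show 12 * sx l = 2 * (6 * sx l) by ring, pow_mul (qP Y0), ← mul_pow, ← R2_eq]; ring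
    have e6 : W0 ^ (l - 1) = W0 ^ (4 * rr l) * W0 ^ (6 * sx l) * (W0 ^ (l / 12)) ^ 12 := by
      rw [← pow_mul, ← pow_add, ← pow_add]; congr 1; omega
    rw [e4, e5, e6]; ring
  rw [h12, map_pow, hasse_one l hl, one_pow]

end HK

namespace HK
open PowerSeries (coeff)
open UpperHalfPlane hiding I
open ModularForm Complex Filter
open scoped MatrixGroups Real Topology Manifold ArithmeticFunction.sigma

lemma ode_zero {d A B : ℂ → ℂ} (hd : AnalyticAt ℂ d 0) (hA : ContinuousAt A 0) (hB : ContinuousAt B 0)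
    (A0 : A 0 = -4) (B0 : B 0 = 12) (h : ∀ᶠ z in 𝓝[≠] 0, z * deriv d z * A z = d z * B z) :
    ∀ᶠ z in 𝓝 0, d z = 0 := by
  by_contra hne
  obtain ⟨m, e, he, he0, hde⟩ := hd.exists_eventuallyEq_pow_smul_nonzero_iff.2 hne
  have h1 : ∀ᶠ z in 𝓝[≠] (0 : ℂ), (m * e z + z * deriv e z) * A z = e z * B z := by
    have h2 : ∀ᶠ z in 𝓝 (0 : ℂ), d =ᶠ[𝓝 z] fun z => (z - 0) ^ m • e z := hde.eventually_nhds
    have h3 := he.eventually_analyticAt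
    filter_upwards [h, h2.filter_mono nhdsWithin_le_nhds, h3.filter_mono nhdsWithin_le_nhds, self_mem_nhdsWithin] with z hz hz2 hz3 hz0
    have hz0 : z ≠ 0 := hz0
    have hd1 : HasDerivAt (fun z => (z - 0) ^ m • e z) (m * z ^ (m - 1) * e z + z ^ m * deriv e z) z := by
      have := ((hasDerivAt_id z).pow m).mul hz3.differentiableAt.hasDerivAt
      refine (this.congr_deriv ?_).congr_of_eventuallyEq ?_
      · simp
      · filter_upwards with w; simp
    have hd2 : deriv d z = m * z ^ (m - 1) * e z + z ^ m * deriv e z := by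
      rw [hz2.deriv_eq, hd1.deriv]
    have hd3 : d z = z ^ m * e z := by rw [hz2.self_of_nhds]; simp
    rw [hd2, hd3] at hz
    have : z * (m * z ^ (m - 1) * e z) = m * z ^ m * e z := by
      rcases m with _ | m
      · simp
      · simp [pow_succ]; ring
    apply mul_left_cancel₀ (pow_ne_zero m hz0)
    linear_combination hz - A z * this
  have c1 : ContinuousAt (fun z => (m * e z + z * deriv e z) * A z) 0 :=
    ((continuousAt_const.mul he.continuousAt).add (continuousAt_id.mul he.deriv.continuousAt)).mul hA
  have c2 : ContinuousAt (fun z => e z * B z) 0 := he.continuousAt.mul hB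
  have h4 := tendsto_nhds_unique_of_eventuallyEq (c1.tendsto.mono_left nhdsWithin_le_nhds) (c2.tendsto.mono_left nhdsWithin_le_nhds) h1
  simp only [A0, B0, zero_mul, add_zero] at h4
  have h5 : e 0 * ((m : ℂ) + 3) = 0 := by linear_combination -h4/4
  rcases mul_eq_zero.1 h5 with h | h
  · exact he0 h
  · have : ((m + 3 : ℕ) : ℂ) = 0 := by push_cast; exact h
    rw [Nat.cast_eq_zero] at this; omega

open PeriodPair in
theorem lattice_le (L M : PeriodPair) (h4 : L.G 4 = M.G 4) (h6 : L.G 6 = M.G 6) (x : ℂ) (hx : x ∈ L.lattice) : x ∈ M.lattice := by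
  have g2 : L.g₂ = M.g₂ := by rw [g₂, g₂, h4]
  have g3 : L.g₃ = M.g₃ := by rw [g₃, g₃, h6]
  have aL := L.analyticAt_weierstrassPExcept 0
  have aM := M.analyticAt_weierstrassPExcept 0
  have bL := L.analyticAt_derivWeierstrassPExcept 0
  have bM := M.analyticAt_derivWeierstrassPExcept 0
  have PL : ∀ z, L.weierstrassP z = L.weierstrassPExcept 0 z + 1 / z ^ 2 := fun z => by
    have := L.weierstrassPExcept_def 0 z
    simp only [ZeroMemClass.coe_zero] at this
    rw [this]; simp
  have PM : ∀ z, M.weierstrassP z = M.weierstrassPExcept 0 z + 1 / z ^ 2 := fun z => by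
    have := M.weierstrassPExcept_def 0 z
    simp only [ZeroMemClass.coe_zero] at this
    rw [this]; simp
  have dL : ∀ z, L.derivWeierstrassP z = L.derivWeierstrassPExcept 0 z - 2 / z ^ 3 := fun z => by
    have := L.derivWeierstrassPExcept_def 0 z
    simp only [ZeroMemClass.coe_zero] at this
    rw [this]; simp
  have dM : ∀ z, M.derivWeierstrassP z = M.derivWeierstrassPExcept 0 z - 2 / z ^ 3 := fun z => by
    have := M.derivWeierstrassPExcept_def 0 z
    simp only [ZeroMemClass.coe_zero] at this
    rw [this]; simp
  have nL := L.compl_lattice_sdiff_singleton_mem_nhds 0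
  have nM := M.compl_lattice_sdiff_singleton_mem_nhds 0
  have key : ∀ᶠ z in 𝓝 0, (fun z => L.weierstrassPExcept 0 z - M.weierstrassPExcept 0 z) z = 0 := by
    apply ode_zero (d := fun z => L.weierstrassPExcept 0 z - M.weierstrassPExcept 0 z) (aL.sub aM)
      (A := fun z => -4 + z ^ 3 * (L.derivWeierstrassPExcept 0 z + M.derivWeierstrassPExcept 0 z))
      (B := fun z => 4 * ((z ^ 2 * L.weierstrassPExcept 0 z + 1) ^ 2 + (z ^ 2 * L.weierstrassPExcept 0 z + 1) * (z ^ 2 * M.weierstrassPExcept 0 z + 1)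
        + (z ^ 2 * M.weierstrassPExcept 0 z + 1) ^ 2) - L.g₂ * z ^ 4)
    · exact continuousAt_const.add ((continuousAt_id.pow 3).mul (bL.continuousAt.add bM.continuousAt))
    · have c1 := (continuousAt_id.pow 2).mul aL.continuousAt |>.add (continuousAt_const (y := (1:ℂ)))
      have c2 := (continuousAt_id.pow 2).mul aM.continuousAt |>.add (continuousAt_const (y := (1:ℂ)))
      exact (continuousAt_const.mul (((c1.pow 2).add (c1.mul c2)).add (c2.pow 2))).sub (continuousAt_const.mul (continuousAt_id.pow 4))
    · simp
    · norm_num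
    · filter_upwards [nhdsWithin_le_nhds nL, nhdsWithin_le_nhds nM, self_mem_nhdsWithin] with z h1 h2 h0
      have h0 : z ≠ 0 := h0
      have zL : z ∉ L.lattice := fun h => h1 ⟨h, h0⟩
      have zM : z ∉ M.lattice := fun h => h2 ⟨h, h0⟩
      have e1 := L.derivWeierstrassP_sq z zL
      have e2 := M.derivWeierstrassP_sq z zM
      have dd : deriv (fun z => L.weierstrassPExcept 0 z - M.weierstrassPExcept 0 z) z =
          L.derivWeierstrassPExcept 0 z - M.derivWeierstrassPExcept 0 z := by
        rw [deriv_fun_sub, L.eqOn_deriv_weierstrassPExcept_derivWeierstrassPExcept 0 h1, M.eqOn_deriv_weierstrassPExcept_derivWeierstrassPExcept 0 h2]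
        · exact (L.analyticOnNhd_weierstrassPExcept 0 z h1).differentiableAt
        · exact (M.analyticOnNhd_weierstrassPExcept 0 z h2).differentiableAt
      rw [dd]
      rw [dL, PL] at e1
      rw [dM, PM, ← g2, ← g3] at e2
      generalize L.weierstrassPExcept 0 z = a at *
      generalize M.weierstrassPExcept 0 z = b at *
      generalize L.derivWeierstrassPExcept 0 z = a' at *
      generalize M.derivWeierstrassPExcept 0 z = b' at *
      have e3 : (a' - b') * (a' + b' - 4 / z ^ 3) = (a - b) * (4 * ((a + 1 / z ^ 2) ^ 2 + (a + 1 / z ^ 2) * (b + 1 / z ^ 2) + (b + 1 / z ^ 2) ^ 2) - L.g₂) := by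
        linear_combination e1 - e2
      field_simp at e3
      linear_combination e3
  have cnt : ∀ N : PeriodPair, (N.lattice : Set ℂ).Countable := fun N => by
    have : Countable N.lattice := N.latticeEquivProd.toEquiv.countable_iff.2 inferInstance
    exact Set.to_countable _
  have hconn : IsPreconnected ((L.lattice : Set ℂ) ∪ M.lattice)ᶜ :=
    (Set.Countable.isConnected_compl_of_one_lt_rank (by simp [rank_real_complex]) ((cnt L).union (cnt M))).isPreconnected
  have evp : ∀ᶠ z in 𝓝[≠] 0, L.weierstrassP z = M.weierstrassP z := by
    filter_upwards [nhdsWithin_le_nhds key] with z hz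
    rw [PL, PM, sub_eq_zero.1 hz]
  have hfin : Set.EqOn L.weierstrassP M.weierstrassP ((L.lattice : Set ℂ) ∪ M.lattice)ᶜ := by
    have : ∃ z0 ∈ ((L.lattice : Set ℂ) ∪ M.lattice)ᶜ, L.weierstrassP =ᶠ[𝓝 z0] M.weierstrassP := by
      have ev2 : ∀ᶠ z in 𝓝[≠] 0, z ∈ ((L.lattice : Set ℂ) ∪ M.lattice)ᶜ := by
        filter_upwards [nhdsWithin_le_nhds nL, nhdsWithin_le_nhds nM, self_mem_nhdsWithin] with z h1 h2 h0
        rintro (h | h)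
        · exact h1 ⟨h, h0⟩
        · exact h2 ⟨h, h0⟩
      obtain ⟨z0, h1, h2, h3⟩ := ((eventually_eventually_nhdsWithin.2 evp).and (ev2.and self_mem_nhdsWithin)).exists
      refine ⟨z0, h2, ?_⟩
      rwa [(isOpen_compl_singleton).nhdsWithin_eq h3] at h1
    obtain ⟨z0, hz0, hev⟩ := this
    exact (L.analyticOnNhd_weierstrassP.mono (Set.compl_subset_compl.2 Set.subset_union_left)).eqOn_of_preconnected_of_eventuallyEq
      (M.analyticOnNhd_weierstrassP.mono (Set.compl_subset_compl.2 Set.subset_union_right)) hconn hz0 hev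
  by_contra hxM
  have o1 := L.order_weierstrassP x hx
  have o2 : 0 ≤ meromorphicOrderAt M.weierstrassP x := (M.analyticOnNhd_weierstrassP x hxM).meromorphicOrderAt_nonneg
  have : L.weierstrassP =ᶠ[𝓝[≠] x] M.weierstrassP := by
    filter_upwards [nhdsWithin_le_nhds (L.compl_lattice_sdiff_singleton_mem_nhds x), nhdsWithin_le_nhds (M.isClosed_lattice.isOpen_compl.mem_nhds hxM), self_mem_nhdsWithin] with z h1 h2 h0
    apply hfin
    rintro (h | h)
    · exact h1 ⟨h, h0⟩
    · exact h2 h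
  rw [← meromorphicOrderAt_congr this, o1] at o2
  exact absurd o2 (by decide)

/-- the lattice `c (ℤ τ + ℤ)` -/
noncomputable def LP (c : ℂ) (hc : c ≠ 0) (τ : ℂ) (hτ : τ.im ≠ 0) : PeriodPair where
  ω₁ := c * τ
  ω₂ := c
  indep := by
    rw [LinearIndependent.pair_iff]
    intro s t h
    have h1 : c * ((s : ℂ) * τ + t) = 0 := by
      simp only [real_smul] at h; linear_combination h
    have h2 := (mul_eq_zero.1 h1).resolve_left hc
    have h3 := congrArg Complex.im h2
    have h4 := congrArg Complex.re h2
    simp at h3 h4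
    have hs : s = 0 := h3.resolve_right hτ
    refine ⟨hs, ?_⟩
    simpa [hs] using h4

lemma LP_mem {c : ℂ} {hc : c ≠ 0} {τ : ℂ} {hτ : τ.im ≠ 0} {x : ℂ} : x ∈ (LP c hc τ hτ).lattice ↔ inL τ (c⁻¹ * x) := by
  rw [PeriodPair.mem_lattice]
  constructor
  · rintro ⟨m, n, rfl⟩
    refine ⟨n, m, ?_⟩
    change c⁻¹ * (m * (c * τ) + n * c) = _
    field_simp; ring
  · rintro ⟨m, n, h⟩
    refine ⟨n, m, ?_⟩
    change n * (c * τ) + m * c = _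
    have : x = c * (c⁻¹ * x) := by field_simp
    rw [this, h]; ring

lemma LP_G {k : ℕ} (hk : 3 ≤ k) {c : ℂ} (hc : c ≠ 0) (τ : ℍ) :
    (LP c hc τ (hne τ)).G k = (c ^ k)⁻¹ * (2 * riemannZeta k * ModularForm.E hk τ) := by
  have h1 := _root_.tsum_eisSummand_eq_riemannZeta_mul_eisensteinSeries hk τ
  have h2 : ModularForm.E hk τ = 1 / 2 * eisensteinSeries (N := 1) 0 k τ := rfl
  rw [h2, show 2 * riemannZeta k * (1 / 2 * eisensteinSeries (N := 1) 0 k τ) = riemannZeta k * eisensteinSeries (N := 1) 0 k τ by ring, ← h1,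
    ← tsum_mul_left, PeriodPair.G, ← (LP c hc τ (hne τ)).latticeEquivProd.symm.toEquiv.tsum_eq, ← (finTwoArrowEquiv ℤ).tsum_eq]
  refine tsum_congr fun v => ?_
  have := (LP c hc τ (hne τ)).latticeEquiv_symm_apply (finTwoArrowEquiv ℤ v)
  change (_ ^ k)⁻¹ = _
  erw [this]
  change ((((v 0 : ℤ) : ℂ) * (c * τ) + (v 1 : ℤ) * c) ^ k)⁻¹ = (c ^ k)⁻¹ * ((v 0 : ℤ) * (τ : ℂ) + (v 1 : ℤ)) ^ (-(k : ℤ))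
  rw [zpow_neg, zpow_natCast, ← mul_inv, ← mul_pow]
  congr 2; ring

/-- equality of lattices from equality of Eisenstein series -/
lemma lat_eq {c : ℂ} (hc : c ≠ 0) (τ τ' : ℍ) (h4 : E₄ τ' = c ^ 4 * E₄ τ) (h6 : E₆ τ' = c ^ 6 * E₆ τ) (x : ℂ) :
    inL τ' x ↔ inL τ (c * x) := by
  have hc' : c⁻¹ ≠ 0 := inv_ne_zero hc
  have e4 : (LP 1 one_ne_zero τ' (hne τ')).G 4 = (LP c⁻¹ hc' τ (hne τ)).G 4 := by
    rw [LP_G (by norm_num : 3 ≤ 4), LP_G (by norm_num : 3 ≤ 4)]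
    have : ModularForm.E (by norm_num : 3 ≤ 4) τ' = c ^ 4 * ModularForm.E (by norm_num : 3 ≤ 4) τ := h4
    rw [this]; simp; ring
  have e6 : (LP 1 one_ne_zero τ' (hne τ')).G 6 = (LP c⁻¹ hc' τ (hne τ)).G 6 := by
    rw [LP_G (by norm_num : 3 ≤ 6), LP_G (by norm_num : 3 ≤ 6)]
    have : ModularForm.E (by norm_num : 3 ≤ 6) τ' = c ^ 6 * ModularForm.E (by norm_num : 3 ≤ 6) τ := h6
    rw [this]; simp; ring
  have h1 := lattice_le _ _ e4 e6 x
  have h2 := lattice_le _ _ e4.symm e6.symm x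
  rw [LP_mem, LP_mem, inv_one, one_mul, inv_inv] at h1 h2
  exact ⟨h1, h2⟩

lemma scale3 {a b a' b' ρ : ℂ} (hρ : ρ ≠ 0) (h1 : a' ^ 3 = ρ * a ^ 3) (h2 : a' ^ 2 * b' = ρ * (a ^ 2 * b)) (h4 : b' ^ 3 = ρ * b ^ 3) :
    ∃ s, s ^ 3 = ρ ∧ a' = s * a ∧ b' = s * b := by
  by_cases ha : a = 0
  · have ha' : a' = 0 := by rw [ha] at h1; simpa using h1
    by_cases hb : b = 0
    · have hb' : b' = 0 := by rw [hb] at h4; simpa using h4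
      obtain ⟨s, hs⟩ := IsAlgClosed.exists_pow_nat_eq ρ (by norm_num : 0 < 3)
      exact ⟨s, hs, by simp [ha, ha'], by simp [hb, hb']⟩
    · refine ⟨b' / b, ?_, by simp [ha, ha'], by field_simp⟩
      rw [div_pow, h4]; field_simp
  · have hs : (a' / a) ^ 3 = ρ := by rw [div_pow, h1]; field_simp
    refine ⟨a' / a, hs, by field_simp, ?_⟩
    have ha' : a' ≠ 0 := by
      rintro rfl; simp at hs; exact hρ hs.symm
    rw [← hs] at h2
    field_simp at h2 ⊢
    linear_combination h2

lemma scale2 {a b a' b' ρ : ℂ} (hρ : ρ ≠ 0) (h1 : a' ^ 2 = ρ * a ^ 2) (h2 : a' * b' = ρ * (a * b)) (h4 : b' ^ 2 = ρ * b ^ 2) :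
    ∃ s, s ^ 2 = ρ ∧ a' = s * a ∧ b' = s * b := by
  by_cases ha : a = 0
  · have ha' : a' = 0 := by rw [ha] at h1; simpa using h1
    by_cases hb : b = 0
    · have hb' : b' = 0 := by rw [hb] at h4; simpa using h4
      obtain ⟨s, hs⟩ := IsAlgClosed.exists_pow_nat_eq ρ (by norm_num : 0 < 2)
      exact ⟨s, hs, by simp [ha, ha'], by simp [hb, hb']⟩
    · refine ⟨b' / b, ?_, by simp [ha, ha'], by field_simp⟩
      rw [div_pow, h4]; field_simp
  · have hs : (a' / a) ^ 2 = ρ := by rw [div_pow, h1]; field_simp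
    refine ⟨a' / a, hs, by field_simp, ?_⟩
    have ha' : a' ≠ 0 := by
      rintro rfl; simp at hs; exact hρ hs.symm
    rw [← hs] at h2
    field_simp at h2 ⊢
    linear_combination h2

lemma seven_im {z : ℂ} (hz : 0 < z.im) : 0 < (7 * z).im := by simpa using hz

theorem yy_inj (τ τ' : ℍ) (h : yy τ = yy τ') : ∃ γ : SL(2, ℤ), 7 ∣ γ 1 0 ∧ γ • τ = τ' := by
  have hid : ∀ F : PowerSeries ℂ, PowerSeries.map (RingHom.id ℂ) F = F := fun F => by simp
  have mk : ∀ {k m : ℤ} {F1 F2 f1 f2}, L1 k F1 f1 → L1 m F2 f2 → k + m = 12 →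
      f1 (qq τ') * f2 (qq (7 * τ')) = ww τ' / ww τ * (f1 (qq τ) * f2 (qq (7 * τ))) := by
    intro k m F1 F2 f1 f2 h1 h2 hkm
    obtain ⟨P, -, hP⟩ := wt12' (RingHom.id ℂ) F1 F2 f1 f2 (by rwa [hid]) (by rwa [hid]) hkm
    have hw : ww τ ≠ 0 := wh_ne (Pos.of_im τ.im_pos)
    rw [hP _ τ.im_pos, hP _ τ'.im_pos, h]; field_simp
  have one_L1 : L1 0 (1 : PowerSeries ℂ) (fun _ => 1) := ⟨Rep.one, fun z hz => by simp⟩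
  have hρ : ww τ' / ww τ ≠ 0 := div_ne_zero (wh_ne (Pos.of_im τ'.im_pos)) (wh_ne (Pos.of_im τ.im_pos))
  generalize ww τ' / ww τ = ρ at mk hρ
  obtain ⟨s, hs, a1, a2⟩ := scale3 (a := Qf (qq τ)) (b := Qf (qq (7 * τ))) (a' := Qf (qq τ')) (b' := Qf (qq (7 * τ'))) hρ
    (by simpa using mk (Q_L1.pow 3) one_L1 (by norm_num)) (mk (Q_L1.pow 2) Q_L1 (by norm_num)) (by simpa using mk one_L1 (Q_L1.pow 3) (by norm_num))
  obtain ⟨t, ht, b1, b2⟩ := scale2 (a := Rf (qq τ)) (b := Rf (qq (7 * τ))) (a' := Rf (qq τ')) (b' := Rf (qq (7 * τ'))) hρ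
    (by simpa using mk (R_L1.pow 2) one_L1 (by norm_num)) (mk R_L1 R_L1 (by norm_num)) (by simpa using mk one_L1 (R_L1.pow 2) (by norm_num))
  have hs0 : s ≠ 0 := by rintro rfl; simp at hs; exact hρ hs.symm
  have ht0 : t ≠ 0 := by rintro rfl; simp at ht; exact hρ ht.symm
  obtain ⟨c, hc⟩ := IsAlgClosed.exists_pow_nat_eq (t / s) (by norm_num : 0 < 2)
  have hst : t ^ 2 = s ^ 3 := by rw [ht, hs]
  have c4 : c ^ 4 = s := by
    rw [show c ^ 4 = (c ^ 2) ^ 2 by ring, hc, div_pow, hst]; field_simp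
  have c6 : c ^ 6 = t := by
    rw [show c ^ 6 = (c ^ 2) ^ 3 by ring, hc, div_pow, ← hst]; field_simp
  have hc0 : c ≠ 0 := by rintro rfl; simp at c4; exact hs0 c4.symm
  rw [← c4] at a1 a2
  rw [← c6] at b1 b2
  let T1 : ℍ := ⟨7 * τ, seven_im τ.im_pos⟩
  let T2 : ℍ := ⟨7 * τ', seven_im τ'.im_pos⟩
  have Q := (L1.ofMF E₄).2
  have R := (L1.ofMF E₆).2
  have l1 := lat_eq hc0 τ τ' (by rw [← Q, ← Q]; exact a1) (by rw [← R, ← R]; exact b1)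
  have l2 := lat_eq hc0 T1 T2 (by rw [← Q, ← Q]; exact a2) (by rw [← R, ← R]; exact b2)
  obtain ⟨γ, hγ, hlam⟩ := homothety (lam := c) hc0 (by simpa using (l1 1).1 (inL_one _)) ((l1 τ').1 (inL_self _))
      ((l1 _).2 (by simpa [hc0] using inL_one _)) ((l1 _).2 (by rw [← mul_assoc, mul_inv_cancel₀ hc0, one_mul]; exact inL_self _))
  refine ⟨γ, ?_, hγ⟩
  obtain ⟨m, n, hmn⟩ := (l2 1).1 (inL_one _)
  rw [mul_one, hlam] at hmn
  have := (lin_indepZ (hne τ) (a := γ 1 1) (b := γ 1 0) (c := m) (d := 7 * n) (by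
    rw [add_comm, hmn]; change (m : ℂ) + n * (7 * τ) = _; push_cast; ring)).2
  exact ⟨n, this⟩

theorem yy_iff (τ τ' : ℍ) : yy τ = yy τ' ↔ ∃ γ : SL(2, ℤ), 7 ∣ γ 1 0 ∧ γ • τ = τ' := by
  refine ⟨yy_inj τ τ', ?_⟩
  rintro ⟨γ, h7, rfl⟩
  rw [smul_coe]
  exact (yy_inv γ.1 ⟨γ.2, h7⟩ τ τ.im_pos).symm

end HK

namespace HK
open PowerSeries (coeff)
open UpperHalfPlane hiding I
open ModularForm Complex Filter
open scoped MatrixGroups Real Topology Manifold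

/-- `y` at the lattice attached to `N` -/
noncomputable def yN (N : M2) (z : ℂ) : ℂ := yh (p1 N z 1) (p2 N z 1)
/-- ratio of the weight 12 forms -/
noncomputable def rN (N : M2) (z : ℂ) : ℂ := wh (p1 N z 1) (p2 N z 1) / wh z 1

lemma pos_act {l : ℕ} (hl : 0 < l) {N : M2} (hN : D7 l N) {z : ℂ} (hz : 0 < z.im) :
    Pos (p1 N z 1) (p2 N z 1) := (Pos.of_im hz).act (by rw [hN.1]; exact_mod_cast hl)

lemma rN_ne {l : ℕ} (hl : 0 < l) {N : M2} (hN : D7 l N) {z : ℂ} (hz : 0 < z.im) : rN N z ≠ 0 :=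
  div_ne_zero (wh_ne (pos_act hl hN hz)) (wh_ne (Pos.of_im hz))

lemma yN_left {l : ℕ} (hl : 0 < l) {γ N : M2} (hγ : D7 1 γ) (hN : D7 l N) {z : ℂ} (hz : 0 < z.im) :
    yN (γ * N) z = yN N z := by
  rw [yN, p1_mul, p2_mul, yh_inv hγ (pos_act hl hN hz), yN]

lemma rN_left {l : ℕ} (hl : 0 < l) {γ N : M2} (hγ : D7 1 γ) (hN : D7 l N) {z : ℂ} (hz : 0 < z.im) :
    rN (γ * N) z = rN N z := by
  rw [rN, p1_mul, p2_mul, wh_inv hγ (pos_act hl hN hz), rN]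

lemma p_div (N : M2) (u v : ℂ) (hv : v ≠ 0) : p1 N (u / v) 1 = v⁻¹ * p1 N u v ∧ p2 N (u / v) 1 = v⁻¹ * p2 N u v := by
  constructor
  · rw [← p1_smul, inv_mul_cancel₀ hv, div_eq_inv_mul]
  · rw [← p2_smul, inv_mul_cancel₀ hv, div_eq_inv_mul]

lemma yN_div (N : M2) (u v : ℂ) (hv : v ≠ 0) : yN N (u / v) = yh (p1 N u v) (p2 N u v) := by
  rw [yN, (p_div N u v hv).1, (p_div N u v hv).2, yh_smul (inv_ne_zero hv)]

lemma rN_div (N : M2) (u v : ℂ) (hv : v ≠ 0) : rN N (u / v) = wh (p1 N u v) (p2 N u v) / wh u v := by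
  rw [rN, (p_div N u v hv).1, (p_div N u v hv).2, wh_smul (inv_ne_zero hv), wh_eq hv (u := u), ← ww]
  have := pow_ne_zero 12 hv
  field_simp

lemma fam_gen {l : ℕ} (hl : 0 < l) (H : ℂ → ℂ → ℂ → ℂ) : Fam l (fun N z => H (yN N z) (yy z) (rN N z)) where
  left γ N hγ hN z hz := by rw [yN_left hl hγ hN hz, rN_left hl hγ hN hz]
  right γ N hγ hN z hz := by
    have hP := (Pos.of_im hz).act (N := γ) (by rw [hγ.1]; norm_num)
    rw [yN_div _ _ _ hP.ne, rN_div _ _ _ hP.ne, yy_inv γ hγ z hz, wh_inv hγ (Pos.of_im hz),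
      ← p1_mul, ← p2_mul, yN, rN]

/-- the Fricke conjugate -/
def fr (N : M2) : M2 := !![N 1 1, -(N 1 0 / 7); -(7 * N 0 1), N 0 0]

lemma fr_D7 {l : ℤ} {N : M2} (h : D7 l N) : D7 l (fr N) := by
  obtain ⟨h1, c, h2⟩ := h
  rw [Matrix.det_fin_two] at h1
  refine ⟨?_, by simp [fr]⟩
  rw [Matrix.det_fin_two]
  simp [fr, h2] at h1 ⊢
  linarith

lemma fr_p {l : ℤ} {N : M2} (h : D7 l N) (z : ℂ) :
    p1 N (-1) (7 * z) = - p2 (fr N) z 1 ∧ p2 N (-1) (7 * z) = 7 * p1 (fr N) z 1 := by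
  obtain ⟨h1, c, h2⟩ := h
  constructor
  · simp [p1, p2, fr]; ring
  · simp [p1, p2, fr, h2]; ring

lemma yN_fr {l : ℕ} (hl : 0 < l) {N : M2} (hN : D7 l N) {z : ℂ} (hz : 0 < z.im) :
    yN N (-1 / (7 * z)) = 1 / (49 * yN (fr N) z) := by
  have h0 : (7 * z) ≠ 0 := mul_ne_zero (by norm_num) (Pos.of_im hz).ne'
  rw [yN_div _ _ _ h0, (fr_p hN z).1, (fr_p hN z).2, yh_fricke (pos_act hl (fr_D7 hN) hz), yN]

lemma rN_fr {l : ℕ} (hl : 0 < l) {N : M2} (hN : D7 l N) {z : ℂ} (hz : 0 < z.im) :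
    rN N (-1 / (7 * z)) = rN (fr N) z * yN (fr N) z ^ 8 * (yy z)⁻¹ ^ 8 := by
  have h0 : (7 * z) ≠ 0 := mul_ne_zero (by norm_num) (Pos.of_im hz).ne'
  have h1 : wh (-1) (7 * z) = 49 * wh z 1 * yy z ^ 8 := wh_fricke (Pos.of_im hz)
  rw [rN_div _ _ _ h0, (fr_p hN z).1, (fr_p hN z).2, wh_fricke (pos_act hl (fr_D7 hN) hz), h1, yN, rN]
  have := wh_ne (Pos.of_im hz)
  have := yy_ne hz
  field_simp

/-- some growth -/
def AG (f : ℂ → ℂ) : Prop := ∃ K, Gr f K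

lemma AG.congr {f g : ℂ → ℂ} (h : AG f) (e : ∀ z : ℂ, 0 < z.im → f z = g z) : AG g :=
  ⟨_, h.choose_spec.congr e⟩
lemma AG.mul {f g : ℂ → ℂ} (h : AG f) (h' : AG g) : AG (fun z => f z * g z) :=
  ⟨_, h.choose_spec.mul h'.choose_spec⟩
lemma AG.sub {f g : ℂ → ℂ} (h : AG f) (h' : AG g) : AG (fun z => f z - g z) := by
  obtain ⟨K, h⟩ := h
  obtain ⟨L, h'⟩ := h'
  exact ⟨_, (h.mono (le_max_left K L)).sub (h'.mono (le_max_right K L))⟩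
lemma AG.pow {f : ℂ → ℂ} (h : AG f) (n : ℕ) : AG (fun z => f z ^ n) := ⟨_, h.choose_spec.pow n⟩
lemma AG.const (c : ℂ) : AG (fun _ => c) := ⟨_, Gr.const c⟩

lemma AG.rep {G : PowerSeries ℂ} {g : ℂ → ℂ} (h : Rep G g) {c : ℝ} (hc : 0 < c) (b : ℝ) :
    AG (fun z => g (qq (c * z + b))) := by
  obtain ⟨C, hC, hb⟩ := h.bdd
  refine ⟨0, C, 1 / c, hC, fun z hz _ => ?_⟩
  rw [pow_zero, mul_one]
  apply hb
  rw [div_le_iff₀ hc] at hz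
  simp
  linarith

lemma AG.q_inv {c : ℝ} (hc : 0 < c) (b : ℝ) : AG (fun z => (qq (c * z + b))⁻¹) := by
  refine ⟨⌈c⌉₊, 1, 0, zero_le_one, fun z _ hz => ?_⟩
  rw [norm_inv, qq_norm, ← Real.exp_neg, neg_neg, one_mul, ← Real.exp_nat_mul, Real.exp_le_exp]
  have : c * z.im ≤ ⌈c⌉₊ * z.im := mul_le_mul_of_nonneg_right (Nat.le_ceil c) hz.le
  simp
  nlinarith [Real.pi_pos]

lemma lin_im {c : ℝ} (hc : 0 < c) (b : ℝ) {z : ℂ} (hz : 0 < z.im) : 0 < (c * z + b : ℂ).im := by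
  simp; positivity

lemma AG.yf {c : ℝ} (hc : 0 < c) (b : ℝ) : AG (fun z => HK.yf (qq (c * z + b))) := AG.rep yf_rep hc b
lemma AG.wf {c : ℝ} (hc : 0 < c) (b : ℝ) : AG (fun z => HK.wf (qq (c * z + b))) := AG.rep wf_rep hc b
lemma AG.yfi {c : ℝ} (hc : 0 < c) (b : ℝ) : AG (fun z => (HK.yf (qq (c * z + b)))⁻¹) := by
  have h : toC Y1 * toC Y1i = 1 := by rw [← map_mul, Y1_inv, map_one]
  refine ((AG.q_inv hc b).mul (AG.rep (y1f_rep.inv' (fun q hq => y1f_ne hq) h) hc b)).congr fun z hz => ?_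
  rw [HK.yf, mul_inv]
lemma wfi_rep : Rep (toC W0i) (fun q => (HK.wf q)⁻¹) := by
  have h : toC W0 * toC W0i = 1 := by rw [← map_mul, W0_inv, map_one]
  exact wf_rep.inv' (fun q hq => wf_ne hq) h
lemma AG.wfi {c : ℝ} (hc : 0 < c) (b : ℝ) : AG (fun z => (HK.wf (qq (c * z + b)))⁻¹) :=
  AG.rep wfi_rep hc b

lemma yN_none (l : ℕ) (hl : 0 < l) {z : ℂ} (hz : 0 < z.im) : yN (Mi l none) z = yf (qq z ^ l) := by
  have h : 0 < ((l : ℂ) * z).im := by simp; positivity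
  rw [yN, ← qq_nat_mul, ← yy_eq h, yy]
  simp [p1, p2, Mi]

lemma rN_none (l : ℕ) (hl : 0 < l) {z : ℂ} (hz : 0 < z.im) :
    rN (Mi l none) z = wf (qq z ^ l) * (wf (qq z))⁻¹ := by
  have h : 0 < ((l : ℂ) * z).im := by simp; positivity
  rw [rN, ← qq_nat_mul, ← ww_eq h, ← ww_eq hz, ww, ww, div_eq_mul_inv]
  simp [p1, p2, Mi]

lemma some_im (l : ℕ) (hl : 0 < l) (k : ℕ) {z : ℂ} (hz : 0 < z.im) : 0 < ((z + k) / l : ℂ).im := by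
  rw [← ofReal_natCast l, div_ofReal_im]; simp; positivity

lemma qq_some (l : ℕ) (hl : 0 < l) (k : ℕ) (z : ℂ) : qq ((z + k) / l) ^ l = qq z := by
  have : (l : ℂ) ≠ 0 := by exact_mod_cast hl.ne'
  rw [← qq_nat_mul, mul_div_cancel₀ _ this, qq_add, show (k : ℂ) = ((k : ℤ) : ℂ) by simp, qq_int, mul_one]

lemma yN_some (l : ℕ) (hl : 0 < l) (k : Fin l) {z : ℂ} (hz : 0 < z.im) :
    yN (Mi l (some k)) z = yf (qq ((z + (k : ℕ)) / l)) := by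
  have h0 : (l : ℂ) ≠ 0 := by exact_mod_cast hl.ne'
  rw [yN, ← yy_eq (some_im l hl k hz), ← yh_eq h0]
  simp [p1, p2, Mi]

lemma rN_some (l : ℕ) (hl : 0 < l) (k : Fin l) {z : ℂ} (hz : 0 < z.im) :
    rN (Mi l (some k)) z = ((l : ℂ) ^ 12)⁻¹ * (wf (qq ((z + (k : ℕ)) / l)) * (wf (qq z))⁻¹) := by
  have h0 : (l : ℂ) ≠ 0 := by exact_mod_cast hl.ne'
  rw [rN, ← ww_eq (some_im l hl k hz), ← ww_eq hz, ← mul_assoc, ← wh_eq h0, ww, div_eq_mul_inv]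
  simp [p1, p2, Mi]

lemma form_some (l : ℕ) (k : ℕ) (z : ℂ) : (z + k) / l = ((1 / l : ℝ) : ℂ) * z + ((k / l : ℝ) : ℂ) := by
  push_cast; ring

lemma AG.base (l : ℕ) (hl : 0 < l) (i : Option (Fin l)) : AG (yN (Mi l i)) ∧ AG (fun z => (yN (Mi l i) z)⁻¹) ∧
    AG (rN (Mi l i)) ∧ AG (fun z => (rN (Mi l i) z)⁻¹) := by
  have hl' : (0 : ℝ) < l := by exact_mod_cast hl
  have hl'' : (0 : ℝ) < 1 / l := by positivity
  have e1 : ∀ z : ℂ, qq z = qq ((1 : ℝ) * z + (0 : ℝ)) := fun z => by simp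
  have w := AG.wf one_pos 0
  have wi := AG.wfi one_pos 0
  simp only [← e1] at w wi
  rcases i with _ | k
  · have e2 : ∀ z : ℂ, qq ((l : ℝ) * z + (0 : ℝ)) = qq z ^ l := fun z => by
      rw [← qq_nat_mul]; simp
    have a1 := AG.yf hl' 0
    have a2 := AG.yfi hl' 0
    have a3 := AG.wf hl' 0
    have a4 := AG.wfi hl' 0
    simp only [e2] at a1 a2 a3 a4
    refine ⟨a1.congr fun z hz => (yN_none l hl hz).symm, a2.congr fun z hz => by rw [yN_none l hl hz],
      (a3.mul wi).congr fun z hz => (rN_none l hl hz).symm, (a4.mul w).congr fun z hz => ?_⟩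
    rw [rN_none l hl hz, mul_inv, inv_inv]
  · have a1 := AG.yf hl'' (k / l)
    have a2 := AG.yfi hl'' (k / l)
    have a3 := AG.wf hl'' (k / l)
    have a4 := AG.wfi hl'' (k / l)
    simp only [← form_some] at a1 a2 a3 a4
    refine ⟨a1.congr fun z hz => (yN_some l hl k hz).symm, a2.congr fun z hz => by rw [yN_some l hl k hz],
      ((AG.const _).mul (a3.mul wi)).congr fun z hz => (rN_some l hl k hz).symm,
      ((AG.const ((l : ℂ) ^ 12)).mul (a4.mul w)).congr fun z hz => ?_⟩
    rw [rN_some l hl k hz, mul_inv, inv_inv, mul_inv, inv_inv]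

/-- growth of the building blocks at the cusp `0` -/
lemma AG.fricke (l : ℕ) (hp : l.Prime) (h7 : l ≠ 7) (i : Option (Fin l)) :
    AG (fun z => yN (Mi l i) (-1 / (7 * z))) ∧ AG (fun z => yy (-1 / (7 * z))) ∧
    AG (fun z => rN (Mi l i) (-1 / (7 * z))) ∧ AG (fun z => (rN (Mi l i) (-1 / (7 * z)))⁻¹) := by
  have hl := hp.pos
  obtain ⟨j, γ, hγ, hj⟩ := hecke_ex l hp h7 (fr_D7 (Mi_D7 l i))
  obtain ⟨b1, b2, b3, b4⟩ := AG.base l hl j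
  have hy : AG yy := (AG.yf one_pos 0).congr fun z hz => by rw [yy_eq hz]; simp
  have hyi : AG (fun z => (yy z)⁻¹) := (AG.yfi one_pos 0).congr fun z hz => by rw [yy_eq hz]; simp
  have e1 : ∀ z : ℂ, 0 < z.im → yN (fr (Mi l i)) z = yN (Mi l j) z := fun z hz => by
    rw [hj, yN_left hl hγ (Mi_D7 l j) hz]
  have e2 : ∀ z : ℂ, 0 < z.im → rN (fr (Mi l i)) z = rN (Mi l j) z := fun z hz => by
    rw [hj, rN_left hl hγ (Mi_D7 l j) hz]
  refine ⟨((AG.const (1 / 49)).mul b2).congr fun z hz => ?_, ((AG.const (1 / 49)).mul hyi).congr fun z hz => ?_,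
    ((b3.mul (b1.pow 8)).mul (hyi.pow 8)).congr fun z hz => ?_,
    ((b4.mul (b2.pow 8)).mul (hy.pow 8)).congr fun z hz => ?_⟩
  · rw [yN_fr hl (Mi_D7 l i) hz, e1 z hz]; field_simp
  · rw [yy_fricke hz]; field_simp
  · rw [rN_fr hl (Mi_D7 l i) hz, e1 z hz, e2 z hz]
  · rw [rN_fr hl (Mi_D7 l i) hz, e1 z hz, e2 z hz]; simp; ring


/-- a valuation ring of `ℂ` above `l` -/
lemma exists_O (l : ℕ) (hp : l.Prime) : ∃ O : ValuationSubring ℂ, IsLocalRing.residue O (l : O) = 0 := by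
  have : (Ideal.span {(l : ℤ)}).IsPrime :=
    (Ideal.span_singleton_prime (by exact_mod_cast hp.ne_zero)).2 (Nat.prime_iff_prime_int.1 hp)
  let S := Localization.AtPrime (Ideal.span {(l : ℤ)})
  have hinj : Function.Injective (Int.castRingHom ℂ) := Int.cast_injective
  have hu : ∀ y : (Ideal.span {(l : ℤ)}).primeCompl, IsUnit (Int.castRingHom ℂ y) := by
    intro y
    refine isUnit_iff_ne_zero.2 fun h => y.2 ?_
    rw [hinj (h.trans (map_zero _).symm)]
    exact Ideal.zero_mem _
  let f : S →+* ℂ := IsLocalization.lift hu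
  obtain ⟨A, h, hl⟩ := IsLocalRing.exists_factor_valuationRing f
  refine ⟨A, ?_⟩
  rw [IsLocalRing.residue_eq_zero_iff, IsLocalRing.mem_maximalIdeal, mem_nonunits_iff]
  intro hun
  have e : (f.codRestrict A.toSubring h) (l : S) = (l : A) := by
    apply Subtype.ext; simp
  have h2 : IsUnit (l : S) := hl.map_nonunit _ (by rw [e]; exact hun)
  have h3 : IsUnit (algebraMap ℤ S (l : ℤ)) := by simpa using h2
  rw [IsLocalization.AtPrime.isUnit_to_map_iff S (Ideal.span {(l : ℤ)})] at h3
  exact h3 (Ideal.mem_span_singleton_self _)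

section
variable (O : ValuationSubring ℂ)

/-- residue field -/
abbrev kO := IsLocalRing.ResidueField O
/-- reduction -/
noncomputable abbrev res : O →+* kO O := IsLocalRing.residue O

lemma root_mem {P : O[X]} (hP : P.Monic) {x : ℂ} (hx : P.eval₂ O.subtype x = 0) : ∃ a : O, (a : ℂ) = x := by
  have : IsIntegral O x := ⟨P, hP, hx⟩
  obtain ⟨a, ha⟩ := IsIntegrallyClosed.isIntegral_iff.1 this
  exact ⟨a, ha⟩

lemma mem_or_inv (x : ℂ) (hx : ¬ ∃ a : O, (a : ℂ) = x) : ∃ a : O, (a : ℂ) = x⁻¹ ∧ res O a = 0 := by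
  have hx' : x ∉ O := fun h => hx ⟨⟨x, h⟩, rfl⟩
  have hi := (O.mem_or_inv_mem x).resolve_left hx'
  refine ⟨⟨x⁻¹, hi⟩, rfl, ?_⟩
  rw [IsLocalRing.residue_eq_zero_iff, IsLocalRing.mem_maximalIdeal, mem_nonunits_iff]
  rintro ⟨u, hu⟩
  apply hx'
  have h1 := congrArg (Subtype.val) u.inv_mul
  have h2 : ((u : O) : ℂ) = x⁻¹ := by rw [hu]
  simp only [MulMemClass.coe_mul, h2, OneMemClass.coe_one] at h1
  have hx0 : x ≠ 0 := by rintro rfl; simp at h1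
  have : x = ((u⁻¹ : Oˣ) : O) := by field_simp at h1; exact h1.symm
  rw [this]; exact Subtype.property _

lemma charP_k {l : ℕ} (hp : l.Prime) (hO : res O (l : O) = 0) : CharP (kO O) l := by
  rw [map_natCast] at hO
  have h1 := CharP.exists (kO O)
  obtain ⟨p, hp'⟩ := h1
  have h2 := (CharP.cast_eq_zero_iff (kO O) p l).1 hO
  rcases (Nat.dvd_prime hp).1 h2 with h | h
  · subst h
    exact absurd ((Nat.cast_one (R := kO O)).symm.trans (CharP.cast_eq_zero (kO O) 1)) one_ne_zero
  · rwa [← h]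

lemma roots_red_aux (s : Multiset ℂ) : ∃ S : Multiset O, (∀ r : O, S.count r = s.count (r : ℂ)) ∧
    ∃ (A : O[X]) (c : ℂ), c ≠ 0 ∧ (s.map fun a => X - C a).prod = C c * A.map O.subtype ∧
      A.map (res O) = (S.map fun r => X - C (res O r)).prod := by
  classical
  induction s using Multiset.induction_on with
  | empty => exact ⟨0, by simp, 1, 1, one_ne_zero, by simp, by simp⟩
  | cons x s ih =>
    obtain ⟨S, hS, A, c, hc, h1, h2⟩ := ih
    by_cases hx : ∃ a : O, (a : ℂ) = x
    · obtain ⟨a, rfl⟩ := hx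
      refine ⟨a ::ₘ S, fun r => ?_, (X - C a) * A, c, hc, ?_, ?_⟩
      · simp only [Multiset.count_cons, hS, Subtype.ext_iff]
      · rw [Multiset.map_cons, Multiset.prod_cons, h1]
        simp; ring
      · rw [Multiset.map_cons, Multiset.prod_cons, ← h2]; simp
    · obtain ⟨b, hb, hb'⟩ := mem_or_inv O x hx
      have hx0 : x ≠ 0 := by
        rintro rfl; exact hx ⟨0, rfl⟩
      refine ⟨S, fun r => ?_, (1 - C b * X) * A, c * (-x), mul_ne_zero hc (neg_ne_zero.2 hx0), ?_, ?_⟩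
      · rw [Multiset.count_cons_of_ne (fun h => hx ⟨r, h⟩), hS]
      · rw [Multiset.map_cons, Multiset.prod_cons, h1]
        have e : (X - C x : ℂ[X]) = C (-x) * (1 - C x⁻¹ * X) := by
          rw [mul_sub, ← mul_assoc, ← C_mul, show -x * x⁻¹ = -1 by field_simp]
          simp; ring
        rw [e, C_mul]
        simp [hb]; ring
      · rw [Polynomial.map_mul, h2]; simp [hb']

/-- Root counting over a valuation ring -/
lemma roots_red (P : O[X]) (hP : P.map (res O) ≠ 0) : ∃ S : Multiset O, ∃ u : kO O, u ≠ 0 ∧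
    P.map (res O) = C u * (S.map fun r => X - C (res O r)).prod ∧
    ∀ r : O, S.count r = (P.map O.subtype).rootMultiplicity (r : ℂ) := by
  classical
  have hinj : Function.Injective O.subtype := Subtype.val_injective
  obtain ⟨S, hS, A, c, hc, h1, h2⟩ := roots_red_aux O (P.map O.subtype).roots
  have hP0 : P.map O.subtype ≠ 0 := by
    rw [Ne, Polynomial.map_eq_zero_iff hinj]
    rintro rfl; simp at hP
  have hsp := (IsAlgClosed.splits (P.map O.subtype)).eq_prod_roots
  rw [h1, ← mul_assoc, ← C_mul] at hsp
  set d := (P.map O.subtype).leadingCoeff * c with hd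
  have hd0 : d ≠ 0 := mul_ne_zero (leadingCoeff_ne_zero.2 hP0) hc
  have hA : A.map (res O) ≠ 0 := by
    rw [h2]
    exact (monic_multiset_prod_of_monic _ _ fun r _ => monic_X_sub_C _).ne_zero
  obtain ⟨e, he⟩ : ∃ a : O, (a : ℂ) = d := by
    by_contra hcon
    obtain ⟨b, hb, hb'⟩ := mem_or_inv O d hcon
    have : A = C b * P := by
      apply Polynomial.map_injective _ hinj
      rw [Polynomial.map_mul, hsp, map_C, ← mul_assoc, ← C_mul]
      change _ = C ((b : ℂ) * d) * _
      rw [hb, inv_mul_cancel₀ hd0]; simp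
    apply hA
    rw [this]; simp [hb']
  have hPA : P = C e * A := by
    apply Polynomial.map_injective _ hinj
    rw [Polynomial.map_mul, hsp, map_C]
    change _ = C (e : ℂ) * _
    rw [he]
  refine ⟨S, res O e, ?_, ?_, fun r => ?_⟩
  · intro h
    apply hP
    rw [hPA]; simp [h]
  · rw [← h2, ← map_C, ← Polynomial.map_mul, ← hPA]
  · rw [hS, count_roots]
end

lemma iR_frob {k : Type*} [Field k] {l : ℕ} (hp : l.Prime) [CharP k l] (F : PowerSeries ℤ) :
    iR k F ^ l = iR k (PowerSeries.expand l hp.ne_zero F) := by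
  have : Fact l.Prime := ⟨hp⟩
  have h := MvPowerSeries.map_frobenius_expand l hp.ne_zero (f := iR k F)
  rw [← h]
  change PowerSeries.map (frobenius k l) (PowerSeries.expand l hp.ne_zero (iR k F)) = _
  rw [PowerSeries.map_expand, map_iR, iR, PowerSeries.map_expand]

lemma iR_evY {k : Type*} [CommRing k] (A : ℤ[X]) : iR k (evY ℤ A) = evY k (A.map (Int.castRingHom k)) := by
  rw [iR, evY_map]

lemma expand_inj {k : Type*} [CommRing k] {l : ℕ} (hl : l ≠ 0) :
    Function.Injective (PowerSeries.expand l hl : PowerSeries k → PowerSeries k) := by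
  intro F G h
  ext n
  have := congrArg (PowerSeries.coeff (l * n)) h
  simpa using this

theorem famO (O : ValuationSubring ℂ) (l : ℕ) (hp : l.Prime) (h7 : l ≠ 7) (hO : res O (l : O) = 0)
    (H : ℂ → ℂ → ℂ → ℂ)
    (hH : ∀ i, AG (fun z => H (yN (Mi l i) (-1 / (7 * z))) (yy (-1 / (7 * z))) (rN (Mi l i) (-1 / (7 * z)))))
    (G0 G : PowerSeries ℤ) (g0 g : ℂ → ℂ) (hG0 : Rep (toC G0) g0) (hG : Rep (toC G) g)
    (f0 : ∀ z : ℂ, 0 < z.im → H (yN (Mi l none) z) (yy z) (rN (Mi l none) z) = g0 (qq z))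
    (f1 : ∀ k : Fin l, ∀ z : ℂ, 0 < z.im →
      H (yN (Mi l (some k)) z) (yy z) (rN (Mi l (some k)) z) = g (qq ((z + (k : ℕ)) / l))) :
    ∃ P : O[X][X], (∀ z : ℂ, 0 < z.im → P.map (eval₂RingHom O.subtype (yy z)) =
        ∏ i, (X - C (H (yN (Mi l i) z) (yy z) (rN (Mi l i) z)))) ∧
      ∀ A B : ℤ[X], iR (ZMod l) G0 = iR (ZMod l) (evY ℤ A) → iR (ZMod l) G = iR (ZMod l) (evY ℤ B) →
        P.map (mapRingHom (res O)) = (X - C (A.map (Int.castRingHom (kO O)))) *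
          (X ^ l - C (B.map (Int.castRingHom (kO O)))) := by
  have hinj : Function.Injective O.subtype := Subtype.val_injective
  have : Fact l.Prime := ⟨hp⟩
  have hch := charP_k O hp hO
  have hroot : (qq (1 / l)) ^ l = 1 := by
    rw [← qq_nat_mul, mul_one_div_cancel (by exact_mod_cast hp.ne_zero)]
    simpa using qq_int 1
  obtain ⟨ζ, hζ⟩ : ∃ ζ : O, (ζ : ℂ) = qq (1 / l) := by
    refine root_mem O (P := X ^ l - C 1) (monic_X_pow_sub_C _ hp.ne_zero) ?_
    rw [eval₂_sub, eval₂_X_pow, hroot]; simp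
  have hζ1 : res O ζ = 1 := by
    have h1 : ζ ^ l = 1 := by
      apply hinj
      rw [map_pow, map_one]
      change (ζ : ℂ) ^ l = 1
      rw [hζ, hroot]
    have h2 : (res O ζ - 1) ^ l = 0 := by
      rw [sub_pow_char, ← map_pow, h1]; simp
    exact sub_eq_zero.1 (eq_zero_of_pow_eq_zero h2)
  have e : PowerSeries.map O.subtype (iR O G0) = toC G0 := by rw [map_iR, iR_C]
  have e' : PowerSeries.map O.subtype (iR O G) = toC G := by rw [map_iR, iR_C]
  obtain ⟨P, hP, hP2⟩ := family O.subtype hinj l hp h7 ζ hζ _ (fam_gen hp.pos H) hH (iR O G0) (iR O G) g0 g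
    (by rw [e]; exact hG0) (by rw [e']; exact hG) f0 f1
  refine ⟨P, hP, fun A B hA hB => ?_⟩
  have toK : ∀ F F' : PowerSeries ℤ, iR (ZMod l) F = iR (ZMod l) F' → iR (kO O) F = iR (kO O) F' := by
    intro F F' h
    have := congrArg (PowerSeries.map (ZMod.castHom dvd_rfl (kO O))) h
    rwa [map_iR, map_iR] at this
  have h1 := congrArg (Polynomial.map (PowerSeries.map (res O))) hP2
  have hexp : ∀ F : PowerSeries O, PowerSeries.map (res O) (PowerSeries.expand l hp.ne_zero F) =
      PowerSeries.expand l hp.ne_zero (PowerSeries.map (res O) F) := fun F => PowerSeries.map_expand _ _ _ _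
  have hres : ∀ k : ℕ, PowerSeries.map (res O) (PowerSeries.rescale (ζ ^ k) (iR O G)) = iR (kO O) G := by
    intro k
    ext n
    simp only [PowerSeries.coeff_map, PowerSeries.coeff_rescale, map_mul, map_pow, hζ1, one_pow, one_mul]
    rw [← PowerSeries.coeff_map, map_iR]
  rw [Polynomial.map_map] at h1
  set ψ : (kO O)[X] →+* PowerSeries (kO O) :=
    ((PowerSeries.expand l hp.ne_zero : PowerSeries (kO O) →ₐ[kO O] PowerSeries (kO O)) : PowerSeries (kO O) →+* PowerSeries (kO O)).comp (evY (kO O)) with hψ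
  have hcomp : (PowerSeries.map (res O)).comp (((PowerSeries.expand l hp.ne_zero : PowerSeries O →ₐ[O] PowerSeries O) : PowerSeries O →+* PowerSeries O).comp (evY O)) = ψ.comp (mapRingHom (res O)) := by
    refine RingHom.ext fun Q => ?_
    change PowerSeries.map (res O) (PowerSeries.expand l hp.ne_zero (evY O Q)) = PowerSeries.expand l hp.ne_zero (evY _ (Q.map (res O)))
    rw [hexp, evY_map]
  rw [hcomp, ← Polynomial.map_map] at h1
  have hψi : Function.Injective ψ := (expand_inj hp.ne_zero).comp (evY_inj _)
  apply Polynomial.map_injective ψ hψi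
  rw [h1]
  simp only [Polynomial.map_mul, Polynomial.map_sub, Polynomial.map_prod, Polynomial.map_X, Polynomial.map_C,
    Polynomial.map_pow, hres, hexp, map_iR]
  rw [Finset.prod_const, Finset.card_univ, Fintype.card_fin, toK _ _ hA, iR_evY]
  have : CharP (PowerSeries (kO O)) l := by
    refine charP_of_injective_ringHom (f := PowerSeries.C (R := kO O)) ?_ l
    intro a b h
    simpa using congrArg (PowerSeries.constantCoeff) h
  rw [sub_pow_char, ← C_pow, iR_frob hp]
  have e3 : iR (kO O) (PowerSeries.expand l hp.ne_zero G) = PowerSeries.expand l hp.ne_zero (iR (kO O) G) := by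
    rw [iR, PowerSeries.map_expand]
  rw [e3, toK _ _ hB, iR_evY]
  rfl

lemma valO (O : ValuationSubring ℂ) {ι : Type*} [Fintype ι] (P : O[X][X]) (f : ι → ℂ) (a : O)
    (h : P.map (eval₂RingHom O.subtype (a : ℂ)) = ∏ i, (X - C (f i))) :
    ∃ g : ι → O, (∀ i, (g i : ℂ) = f i) ∧ P.map (evalRingHom a) = ∏ i, (X - C (g i)) := by
  have hinj : Function.Injective O.subtype := Subtype.val_injective
  have hc : eval₂RingHom O.subtype (a : ℂ) = O.subtype.comp (evalRingHom a) := by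
    apply Polynomial.ringHom_ext
    · intro b; simp
    · simp
  rw [hc, ← Polynomial.map_map] at h
  have hm : (P.map (evalRingHom a)).Monic := by
    apply monic_of_injective hinj
    rw [h]
    exact monic_prod_of_monic _ _ fun i _ => monic_X_sub_C _
  have hr : ∀ i, ∃ b : O, (b : ℂ) = f i := by
    intro i
    refine root_mem O hm ?_
    rw [← eval_map, h, eval_prod]
    exact Finset.prod_eq_zero (Finset.mem_univ i) (by simp)
  choose g hg using hr
  refine ⟨g, hg, Polynomial.map_injective _ hinj ?_⟩
  rw [h, Polynomial.map_prod]
  refine Finset.prod_congr rfl fun i _ => ?_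
  simp [hg]

lemma valO_res (O : ValuationSubring ℂ) {ι : Type*} [Fintype ι] (P : O[X][X]) (a : O) (g : ι → O)
    (h : P.map (evalRingHom a) = ∏ i, (X - C (g i))) (A B : ℤ[X]) (l : ℕ)
    (hP : P.map (mapRingHom (res O)) = (X - C (A.map (Int.castRingHom (kO O)))) *
          (X ^ l - C (B.map (Int.castRingHom (kO O))))) :
    ∏ i, (X - C (res O (g i))) = (X - C (A.eval₂ (Int.castRingHom (kO O)) (res O a))) *
      (X ^ l - C (B.eval₂ (Int.castRingHom (kO O)) (res O a))) := by
  have h1 := congrArg (Polynomial.map (res O)) h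
  have hc : (res O).comp (evalRingHom a) = (evalRingHom (res O a)).comp (mapRingHom (res O)) := by
    apply Polynomial.ringHom_ext
    · intro b; simp
    · simp
  rw [Polynomial.map_map, hc, ← Polynomial.map_map, hP] at h1
  simpa [eval_map, Polynomial.map_prod] using h1.symm


section
variable (O : ValuationSubring ℂ) (l : ℕ) [hF : Fact l.Prime]

lemma evYZ_X : evY ℤ X = Y0 := by
  simp [evY, YR]

lemma fam1 (h7 : l ≠ 7) (hO : res O (l : O) = 0) :
    ∃ P : O[X][X], (∀ z : ℂ, 0 < z.im → P.map (eval₂RingHom O.subtype (yy z)) =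
        ∏ i, (X - C (yN (Mi l i) z))) ∧
      P.map (mapRingHom (res O)) = (X - C (X ^ l)) * (X ^ l - C X) := by
  have hp := hF.out
  obtain ⟨P, h1, h2⟩ := famO O l hp h7 hO (fun a _ _ => a) (fun i => (AG.fricke l hp h7 i).1)
    (PowerSeries.expand l hp.ne_zero Y0) Y0 (fun q => yf (q ^ l)) yf
    (by rw [toC_expand]; exact yf_rep.expand l hp.ne_zero) yf_rep
    (fun z hz => yN_none l hp.pos hz) (fun k z hz => yN_some l hp.pos k hz)
  refine ⟨P, h1, ?_⟩
  rw [h2 (X ^ l) X (by rw [map_pow, evYZ_X, map_pow, iR_frob hp]) (by rw [evYZ_X])]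
  simp

lemma hasse_ratio (hl : 3 < l) : iR (ZMod l) (W0 * PowerSeries.expand l hF.out.ne_zero W0i) = iR (ZMod l) (evY ℤ (RX l)) := by
  have hp := hF.out
  have h := RX_rel l hl
  rw [map_mul, map_pow] at h
  rw [map_mul, ← iR_frob hp]
  have hw : iR (ZMod l) W0 * iR (ZMod l) W0i = 1 := by rw [← map_mul, W0_inv, map_one]
  have e : l = l - 1 + 1 := by omega
  calc iR (ZMod l) W0 * iR (ZMod l) W0i ^ l
      = iR (ZMod l) W0 * iR (ZMod l) W0i ^ l * (iR (ZMod l) W0 ^ (l - 1) * iR (ZMod l) (evY ℤ (RX l))) := by rw [h, mul_one]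
    _ = (iR (ZMod l) W0 ^ (l - 1 + 1) * iR (ZMod l) W0i ^ l) * iR (ZMod l) (evY ℤ (RX l)) := by ring
    _ = iR (ZMod l) (evY ℤ (RX l)) := by rw [← e, ← mul_pow, hw, one_pow, one_mul]

lemma ratio_rep (hl : l ≠ 0) : Rep (toC (W0 * PowerSeries.expand l hl W0i)) (fun q => wf q * (wf (q ^ l))⁻¹) := by
  rw [map_mul toC, toC_expand]
  exact wf_rep.mul (wfi_rep.expand l hl)

lemma ratio_rep' (hl : l ≠ 0) : Rep (toC (W0i * PowerSeries.expand l hl W0)) (fun q => (wf q)⁻¹ * wf (q ^ l)) := by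
  rw [map_mul toC, toC_expand]
  exact wfi_rep.mul (wf_rep.expand l hl)

lemma lC_rep (n : ℕ) {F : PowerSeries ℤ} {f : ℂ → ℂ} (h : Rep (toC F) f) :
    Rep (toC (PowerSeries.C ((l : ℤ) ^ n) * F)) (fun q => (l : ℂ) ^ n * f q) := by
  rw [map_mul toC, toC_C]
  have := (Rep.const ((l : ℂ) ^ n)).mul h
  simpa using this

lemma lC_zero (n : ℕ) (hn : n ≠ 0) (F : PowerSeries ℤ) : iR (ZMod l) (PowerSeries.C ((l : ℤ) ^ n) * F) = iR (ZMod l) (evY ℤ 0) := by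
  rw [map_zero, map_zero, map_mul]
  have : iR (ZMod l) (PowerSeries.C ((l : ℤ) ^ n)) = 0 := by
    rw [iR, PowerSeries.map_C]; simp [hn]
  rw [this, zero_mul]

lemma fam2 (hl : 3 < l) (h7 : l ≠ 7) (hO : res O (l : O) = 0) :
    ∃ P : O[X][X], (∀ z : ℂ, 0 < z.im → P.map (eval₂RingHom O.subtype (yy z)) =
        ∏ i, (X - C ((l : ℂ) ^ 12 * rN (Mi l i) z))) ∧
      P.map (mapRingHom (res O)) = (X - C ((0 : ℤ[X]).map (Int.castRingHom (kO O)))) *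
          (X ^ l - C ((RX l).map (Int.castRingHom (kO O)))) := by
  have hp := hF.out
  have hl0 : (l : ℂ) ^ 12 ≠ 0 := pow_ne_zero _ (by exact_mod_cast hp.ne_zero)
  obtain ⟨P, h1, h2⟩ := famO O l hp h7 hO (fun _ _ c => (l : ℂ) ^ 12 * c)
    (fun i => (AG.const _).mul (AG.fricke l hp h7 i).2.2.1)
    (PowerSeries.C ((l : ℤ) ^ 12) * (W0i * PowerSeries.expand l hp.ne_zero W0)) (W0 * PowerSeries.expand l hp.ne_zero W0i) _ _
    (lC_rep l 12 (ratio_rep' l hp.ne_zero)) (ratio_rep l hp.ne_zero)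
    (fun z hz => by rw [rN_none l hp.pos hz]; ring) (fun k z hz => by
      rw [rN_some l hp.pos k hz, qq_some l hp.pos, mul_inv_cancel_left₀ hl0])
  exact ⟨P, h1, h2 0 (RX l) (lC_zero l 12 (by norm_num) _) (hasse_ratio l hl)⟩

lemma fam4 (hl : 3 < l) (h7 : l ≠ 7) (hO : res O (l : O) = 0) :
    ∃ P : O[X][X], (∀ z : ℂ, 0 < z.im → P.map (eval₂RingHom O.subtype (yy z)) =
        ∏ i, (X - C ((rN (Mi l i) z)⁻¹))) ∧
      P.map (mapRingHom (res O)) = (X - C ((RX l).map (Int.castRingHom (kO O)))) *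
          (X ^ l - C ((0 : ℤ[X]).map (Int.castRingHom (kO O)))) := by
  have hp := hF.out
  obtain ⟨P, h1, h2⟩ := famO O l hp h7 hO (fun _ _ c => c⁻¹)
    (fun i => (AG.fricke l hp h7 i).2.2.2)
    (W0 * PowerSeries.expand l hp.ne_zero W0i) (PowerSeries.C ((l : ℤ) ^ 12) * (W0i * PowerSeries.expand l hp.ne_zero W0)) _ _
    (ratio_rep l hp.ne_zero) (lC_rep l 12 (ratio_rep' l hp.ne_zero))
    (fun z hz => by rw [rN_none l hp.pos hz, mul_inv, inv_inv, mul_comm]) (fun k z hz => by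
      rw [rN_some l hp.pos k hz, qq_some l hp.pos, mul_inv, inv_inv, mul_inv, inv_inv])
  exact ⟨P, h1, h2 (RX l) 0 (hasse_ratio l hl) (lC_zero l 12 (by norm_num) _)⟩

lemma frob_div : ∃ D : PowerSeries ℤ, PowerSeries.expand l hF.out.ne_zero Y0 - Y0 ^ l = PowerSeries.C (l : ℤ) * D := by
  have h : iR (ZMod l) (PowerSeries.expand l hF.out.ne_zero Y0 - Y0 ^ l) = 0 := by
    rw [map_sub, map_pow, iR_frob hF.out, sub_self]
  have h2 : ∀ n, (l : ℤ) ∣ PowerSeries.coeff n (PowerSeries.expand l hF.out.ne_zero Y0 - Y0 ^ l) := by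
    intro n
    rw [← ZMod.intCast_zmod_eq_zero_iff_dvd]
    have := congrArg (PowerSeries.coeff n) h
    rwa [iR, PowerSeries.coeff_map] at this
  choose d hd using h2
  refine ⟨PowerSeries.mk d, ?_⟩
  ext n
  rw [hd, PowerSeries.coeff_C_mul, PowerSeries.coeff_mk]

lemma fam3 (h7 : l ≠ 7) (hO : res O (l : O) = 0) :
    ∃ P : O[X][X], (∀ z : ℂ, 0 < z.im → P.map (eval₂RingHom O.subtype (yy z)) =
        ∏ i, (X - C ((yN (Mi l i) z - yy z ^ l) ^ 12 * (rN (Mi l i) z)⁻¹ * ((l : ℂ) ^ 12)⁻¹))) := by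
  have hp := hF.out
  have hl0 : (l : ℂ) ≠ 0 := by exact_mod_cast hp.ne_zero
  obtain ⟨D, hD⟩ := frob_div l
  have hDr : ∃ d : ℂ → ℂ, Rep (toC D) d ∧ ∀ q : ℂ, ‖q‖ < 1 → l * d q = yf (q ^ l) - yf q ^ l := by
    refine ⟨fun q => (l : ℂ)⁻¹ * (yf (q ^ l) - yf q ^ l), ?_, fun q _ => by field_simp⟩
    have h1 := (Rep.const (l : ℂ)⁻¹).mul ((yf_rep.expand l hp.ne_zero).sub (yf_rep.pow l))
    have h2 := congrArg toC hD
    rw [map_sub toC, toC_expand, map_pow toC, map_mul toC, toC_C] at h2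
    rw [h2, ← mul_assoc, ← map_mul PowerSeries.C] at h1
    simpa [hl0] using h1
  obtain ⟨d, hd, hd'⟩ := hDr
  have hb : ∀ i, AG (fun z => (yN (Mi l i) (-1 / (7 * z)) - yy (-1 / (7 * z)) ^ l) ^ 12 *
      (rN (Mi l i) (-1 / (7 * z)))⁻¹ * ((l : ℂ) ^ 12)⁻¹) := by
    intro i
    obtain ⟨b1, b2, b3, b4⟩ := AG.fricke l hp h7 i
    exact (((b1.sub (b2.pow l)).pow 12).mul b4).mul (AG.const _)
  have r0 : Rep (toC (D ^ 12 * (W0 * PowerSeries.expand l hp.ne_zero W0i)))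
      (fun q => d q ^ 12 * (wf q * (wf (q ^ l))⁻¹)) := by
    rw [map_mul toC, map_pow toC]
    exact (hd.pow 12).mul (ratio_rep l hp.ne_zero)
  have r1 : Rep (toC ((Y0 - PowerSeries.expand l hp.ne_zero Y0 ^ l) ^ 12 * (W0i * PowerSeries.expand l hp.ne_zero W0)))
      (fun q => (yf q - yf (q ^ l) ^ l) ^ 12 * ((wf q)⁻¹ * wf (q ^ l))) := by
    rw [map_mul toC, map_pow toC, map_sub toC, map_pow toC, toC_expand]
    exact ((yf_rep.sub ((yf_rep.expand l hp.ne_zero).pow l)).pow 12).mul (ratio_rep' l hp.ne_zero)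
  obtain ⟨P, h1, -⟩ := famO O l hp h7 hO (fun a b c => (a - b ^ l) ^ 12 * c⁻¹ * ((l : ℂ) ^ 12)⁻¹) hb
    _ _ _ _ r0 r1
    (fun z hz => by
      beta_reduce
      rw [rN_none l hp.pos hz, yN_none l hp.pos hz, yy_eq hz, ← hd' _ (qq_norm_lt hz), mul_inv, inv_inv]
      field_simp)
    (fun k z hz => by
      beta_reduce
      rw [rN_some l hp.pos k hz, yN_some l hp.pos k hz, yy_eq hz, qq_some l hp.pos, mul_inv, inv_inv, mul_inv, inv_inv]
      field_simp)
  exact ⟨P, h1⟩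

/-- the reduction of all Hecke data at a point -/
theorem hecke_pt (hl : 3 < l) (h7 : l ≠ 7) (hO : res O (l : O) = 0) (a : O) {z : ℂ} (hz : 0 < z.im)
    (ha : yy z = a) : ∃ y u v w : Option (Fin l) → O,
    (∀ i, (y i : ℂ) = yN (Mi l i) z) ∧ (∀ i, (u i : ℂ) = (l : ℂ) ^ 12 * rN (Mi l i) z) ∧
    (∀ i, (v i : ℂ) = (rN (Mi l i) z)⁻¹) ∧ (∀ i, (y i - a ^ l) ^ 12 = w i * u i) ∧
    (∀ i, u i * v i = (l : O) ^ 12) ∧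
    ∏ i, (X - C (res O (y i))) = (X - C (res O a ^ l)) * (X ^ l - C (res O a)) ∧
    ∏ i, (X - C (res O (u i))) = X * (X ^ l - C ((RX l).eval₂ (Int.castRingHom (kO O)) (res O a))) ∧
    ∏ i, (X - C (res O (v i))) = (X - C ((RX l).eval₂ (Int.castRingHom (kO O)) (res O a))) * X ^ l := by
  have hp := hF.out
  have hl0 : (l : ℂ) ^ 12 ≠ 0 := pow_ne_zero _ (by exact_mod_cast hp.ne_zero)
  obtain ⟨P1, h1, r1⟩ := fam1 O l h7 hO
  obtain ⟨P2, h2, r2⟩ := fam2 O l hl h7 hO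
  obtain ⟨P3, h3⟩ := fam3 O l h7 hO
  obtain ⟨P4, h4, r4⟩ := fam4 O l hl h7 hO
  have h1 := h1 z hz
  have h2 := h2 z hz
  have h3 := h3 z hz
  have h4 := h4 z hz
  rw [ha] at h1 h2 h3 h4
  obtain ⟨y, y1, y2⟩ := valO O P1 _ a h1
  obtain ⟨u, u1, u2⟩ := valO O P2 _ a h2
  obtain ⟨w, w1, w2⟩ := valO O P3 _ a h3
  obtain ⟨v, v1, v2⟩ := valO O P4 _ a h4
  have hr : ∀ i, rN (Mi l i) z ≠ 0 := fun i => rN_ne hp.pos (Mi_D7 l i) hz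
  refine ⟨y, u, v, w, y1, u1, v1, fun i => ?_, fun i => ?_, ?_, ?_, ?_⟩
  · apply Subtype.ext
    push_cast
    rw [y1, w1, u1]
    have h9 := mul_inv_cancel₀ (hr i)
    have h8 := mul_inv_cancel₀ hl0
    calc _ = (yN (Mi l i) z - (a : ℂ) ^ l) ^ 12 * (rN (Mi l i) z * (rN (Mi l i) z)⁻¹) * ((l : ℂ) ^ 12 * ((l : ℂ) ^ 12)⁻¹) := by
          rw [h9, h8, mul_one, mul_one]
      _ = _ := by ring
  · apply Subtype.ext
    push_cast
    rw [u1, v1, mul_assoc, mul_inv_cancel₀ (hr i), mul_one]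
  · have := valO_res O P1 a y y2 (X ^ l) X l (by rw [r1]; simp)
    simpa using this
  · have := valO_res O P2 a u u2 _ _ l r2
    simpa using this
  · have := valO_res O P4 a v v2 _ _ l r4
    simpa using this

lemma IIaO (hl : 3 < l) (h7 : l ≠ 7) (hO : res O (l : O) = 0) (a : O) (h : SSv l (res O a) = 0) :
    res O a ^ (l ^ 2) = res O a := by
  have ha0 : (a : ℂ) ≠ 0 := by
    intro h0
    have : a = 0 := Subtype.ext h0
    rw [this, map_zero] at h
    have hch := charP_k O hF.out hO
    let _ : Algebra (ZMod l) (kO O) := (ZMod.castHom dvd_rfl (kO O)).toAlgebra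
    exact SSv_zero l h
  obtain ⟨z, hz, hza⟩ := yy_surj ha0
  obtain ⟨y, u, v, w, -, -, -, hw, -, py, pu, -⟩ := hecke_pt O l hl h7 hO a hz hza
  rw [(RX_zero l hl (res O a)).2 h] at pu
  have hu : ∀ i, res O (u i) = 0 := by
    intro i
    have := congrArg (Polynomial.eval (res O (u i))) pu
    rw [eval_prod, Finset.prod_eq_zero (Finset.mem_univ i) (by simp)] at this
    rw [eval_mul, eval_X, C_0, sub_zero, eval_pow, eval_X] at this
    rcases mul_eq_zero.1 this.symm with h | h
    · exact h
    · exact eq_zero_of_pow_eq_zero h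
  have hy : ∀ i, res O (y i) = res O a ^ l := by
    intro i
    have := congrArg (res O) (hw i)
    rw [map_mul, hu, mul_zero, map_pow, map_sub, map_pow] at this
    exact sub_eq_zero.1 (eq_zero_of_pow_eq_zero this)
  simp only [hy] at py
  rw [Finset.prod_const, Finset.card_univ, Fintype.card_option, Fintype.card_fin, pow_succ'] at py
  have := congrArg (Polynomial.eval (res O a ^ l)) (mul_left_cancel₀ (X_sub_C_ne_zero _) py)
  simp [hF.out.ne_zero] at this
  rw [pow_two, pow_mul]
  exact (sub_eq_zero.1 this.symm)

end

theorem IIa (l : ℕ) [hF : Fact l.Prime] (hl : 3 < l) (h7 : l ≠ 7) (F : Type) [Field F] [Algebra (ZMod l) F] (y : F)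
    (h : SSv l y = 0) : y ^ (l ^ 2) = y := by
  obtain ⟨O, hO⟩ := exists_O l hF.out
  have hch := charP_k O hF.out hO
  let _ : Algebra (ZMod l) (kO O) := (ZMod.castHom dvd_rfl (kO O)).toAlgebra
  set T : (ZMod l)[X] := (RX l).map (Int.castRingHom (ZMod l)) with hT
  have key : ∀ (E : Type) [Field E] [Algebra (ZMod l) E] (x : E), aeval x T = (RX l).eval₂ (Int.castRingHom E) x := by
    intro E _ _ x
    rw [aeval_def, hT, eval₂_map]
    congr 1
    exact RingHom.ext_int _ _
  have hT0 : T ≠ 0 := by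
    intro h0
    have h1 := key (ZMod l) 0
    rw [h0, map_zero] at h1
    exact SSv_zero l ((RX_zero l hl (0 : ZMod l)).1 h1.symm)
  have hTy : aeval y T = 0 := by rw [key, RX_zero l hl]; exact h
  have hint : IsIntegral (ZMod l) y := isAlgebraic_iff_isIntegral.1 ⟨T, hT0, hTy⟩
  set m := minpoly (ZMod l) y with hm
  have hmm : m.Monic := minpoly.monic hint
  obtain ⟨M, hM1, hM2, hM3⟩ := lifts_and_natDegree_eq_and_monic (f := Int.castRingHom (ZMod l)) (p := m)
    ((mem_lifts _).2 (Polynomial.map_surjective _ (ZMod.intCast_surjective) m)) hmm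
  have hdeg : (M.map (Int.castRingHom ℂ)).degree ≠ 0 := by
    rw [hM3.degree_map, degree_eq_natDegree hM3.ne_zero, hM2]
    exact_mod_cast (minpoly.natDegree_pos hint).ne'
  obtain ⟨x, hx⟩ := IsAlgClosed.exists_root _ hdeg
  obtain ⟨a, ha⟩ := root_mem O (P := M.map (Int.castRingHom O)) (hM3.map _) (x := x) (by
    rw [eval₂_map, RingHom.ext_int (O.subtype.comp (Int.castRingHom O)) (Int.castRingHom ℂ), ← eval_map]; exact hx)
  have hMa : M.eval₂ (Int.castRingHom O) a = 0 := by
    have hinj : Function.Injective O.subtype := Subtype.val_injective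
    apply hinj
    rw [hom_eval₂, RingHom.ext_int (O.subtype.comp (Int.castRingHom O)) (Int.castRingHom ℂ), map_zero, ← eval_map]
    change eval (a : ℂ) _ = 0
    rw [ha]; exact hx
  have hma : aeval (res O a) m = 0 := by
    have := congrArg (res O) hMa
    rw [hom_eval₂, map_zero] at this
    rw [← hM1, aeval_def, eval₂_map, ← this]
    congr 1
    exact RingHom.ext_int _ _
  have hma' : m = minpoly (ZMod l) (res O a) := minpoly.eq_of_irreducible_of_monic (minpoly.irreducible hint) hma hmm
  have hTa : aeval (res O a) T = 0 := by
    obtain ⟨q, hq⟩ := minpoly.dvd _ _ hTy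
    rw [hq, map_mul, ← hm, hma, zero_mul]
  rw [key, RX_zero l hl] at hTa
  have h1 := IIaO O l hl h7 hO a hTa
  have h2 : m ∣ X ^ (l ^ 2) - X := by
    rw [hma']
    apply minpoly.dvd
    simp [h1]
  obtain ⟨q, hq⟩ := h2
  have := congrArg (aeval y) hq
  rw [map_mul, hm, minpoly.aeval, zero_mul] at this
  simpa [sub_eq_zero] using this

/-- `α` fixes the point `z`. -/
def Fx (α : M2) (z : ℂ) : Prop := p1 α z 1 = z * p2 α z 1

lemma fix_of_eq {l : ℕ} (hl : 0 < l) {N : M2} (hN : D7 l N) {z : ℂ} (hz : 0 < z.im) (h : yN N z = yy z) :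
    ∃ γ, D7 1 γ ∧ Fx (γ * N) z := by
  have P := pos_act hl hN hz
  rw [yN, yh_eq P.ne] at h
  obtain ⟨γ, h7, hγ⟩ := (yy_iff ⟨_, P.im⟩ ⟨z, hz⟩).1 h
  refine ⟨γ.1, ⟨γ.2, h7⟩, ?_⟩
  have h1 := congrArg (fun τ : ℍ => (τ : ℂ)) hγ
  simp only [smul_coe] at h1
  change p1 γ.1 (p1 N z 1 / p2 N z 1) 1 / p2 γ.1 (p1 N z 1 / p2 N z 1) 1 = z at h1
  rw [(p_div _ _ _ P.ne).1, (p_div _ _ _ P.ne).2] at h1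
  have P2 : Pos (p1 γ.1 (p1 N z 1) (p2 N z 1)) (p2 γ.1 (p1 N z 1) (p2 N z 1)) := P.act (by rw [γ.2]; norm_num)
  have e1 := P.ne
  have e2 := P2.ne
  rw [Fx, p1_mul, p2_mul]
  field_simp at h1
  linear_combination h1

lemma Fx.adj {α : M2} {z : ℂ} (h : Fx α z) : Fx α.adjugate z := by
  unfold Fx p1 p2 at *
  simp [Matrix.adjugate_fin_two] at *
  linear_combination -h

lemma adj_p2 (α : M2) (z : ℂ) : p2 α.adjugate z 1 = (α 0 0 + α 1 1 : ℤ) - p2 α z 1 := by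
  unfold p2
  simp [Matrix.adjugate_fin_two]
  ring

lemma adj_D7l {l : ℕ} {α : M2} (h : D7 l α) : D7 l α.adjugate := by
  refine ⟨by rw [← h.1]; simp [Matrix.det_fin_two, Matrix.adjugate_fin_two]; ring, ?_⟩
  simpa [Matrix.adjugate_fin_two] using h.2

lemma Fx.eqn {l : ℕ} {α : M2} (hα : D7 l α) {z : ℂ} (h : Fx α z) :
    p2 α z 1 ^ 2 - (α 0 0 + α 1 1 : ℤ) * p2 α z 1 + l = 0 := by
  have hd := hα.1
  rw [Matrix.det_fin_two] at hd
  have hd : (α 0 0 : ℂ) * α 1 1 - α 0 1 * α 1 0 = l := by exact_mod_cast hd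
  unfold Fx p1 p2 at *
  push_cast
  linear_combination -(α 1 0 : ℂ) * h - hd

lemma Fx.ne {l : ℕ} (hp : l.Prime) {α : M2} (hα : D7 l α) {z : ℂ} (hz : 0 < z.im) (h : Fx α z) : α 1 0 ≠ 0 := by
  intro h0
  unfold Fx p1 p2 at h
  rw [h0] at h
  obtain ⟨e1, e2⟩ := lin_indepZ (t := z) hz.ne' (a := α 0 1) (b := α 0 0) (c := 0) (d := α 1 1) (by
    push_cast; push_cast at h; linear_combination h)
  have hd := hα.1
  rw [Matrix.det_fin_two, h0, e2, mul_zero, sub_zero] at hd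
  have : (α 1 1).natAbs * (α 1 1).natAbs = l := by
    rw [← Int.natAbs_mul, hd]; rfl
  have h2 := Nat.Prime.eq_one_or_self_of_dvd hp _ ⟨_, this.symm⟩
  have h3 := hp.two_le
  rcases h2 with h2 | h2 <;> rw [h2] at this <;> nlinarith

lemma Fx.tr {l : ℕ} (hp : l.Prime) {α : M2} (hα : D7 l α) {z : ℂ} (hz : 0 < z.im) (h : Fx α z) :
    (α 0 0 + α 1 1) ^ 2 < 4 * (l : ℤ) := by
  have e := h.eqn hα
  have him : (p2 α z 1).im ≠ 0 := by
    simp [p2, h.ne hp hα hz, hz.ne']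
  generalize p2 α z 1 = w at e him
  generalize α 0 0 + α 1 1 = t at e
  have e1 := congrArg Complex.re e
  have e2 := congrArg Complex.im e
  simp [pow_two] at e1 e2
  have e3 : w.im * (2 * w.re - t) = 0 := by linear_combination e2
  have e4 := (mul_eq_zero.1 e3).resolve_left him
  have e5 : (0 : ℝ) < w.im ^ 2 := by positivity
  have : (t : ℝ) ^ 2 < 4 * l := by
    have : w.re = t / 2 := by linarith
    rw [this] at e1
    nlinarith
  exact_mod_cast this

lemma Fx.rN {l : ℕ} (hl : 0 < l) {α : M2} (hα : D7 l α) {z : ℂ} (hz : 0 < z.im) (h : Fx α z) :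
    (rN α z)⁻¹ = p2 α z 1 ^ 12 := by
  have P := pos_act hl hα hz
  have h1 : wh (p1 α z 1) (p2 α z 1) = (p2 α z 1 ^ 12)⁻¹ * wh z 1 := by
    rw [← wh_smul P.ne, mul_one, mul_comm _ z, ← h]
  rw [HK.rN, h1, mul_div_assoc, div_self (wh_ne (Pos.of_im hz)), mul_one, inv_inv]

lemma Fx.mul {γ N α : M2} {z : ℂ} (h : Fx α z) (e : α = γ * N) : Fx (γ * N) z := e ▸ h

/-- The value of the family at the Hecke representative attached to a fixing matrix. -/
lemma Fx.idx {l : ℕ} (hp : l.Prime) (h7 : l ≠ 7) {α : M2} (hα : D7 l α) {z : ℂ} (hz : 0 < z.im) (h : Fx α z) :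
    ∃ i, ∃ γ, D7 1 γ ∧ α = γ * Mi l i ∧ (HK.rN (Mi l i) z)⁻¹ = p2 α z 1 ^ 12 := by
  obtain ⟨i, γ, hγ, e⟩ := hecke_ex l hp h7 hα
  refine ⟨i, γ, hγ, e, ?_⟩
  rw [← rN_left hp.pos hγ (Mi_D7 l i) hz, ← e]
  exact h.rN hp.pos hα hz

section
variable (O : ValuationSubring ℂ) (l : ℕ) [hF : Fact l.Prime]

lemma tr_zero (hl : 3 < l) (h7 : l ≠ 7) (hO : res O (l : O) = 0) (a : O) {z : ℂ} (hz : 0 < z.im) (ha : yy z = a)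
    (hs : SSv l (res O a) = 0) {α : M2} (hα : D7 l α) (h : Fx α z) : α 0 0 + α 1 1 = 0 := by
  obtain ⟨y, u, v, w, -, -, hv, -, -, -, -, pv⟩ := hecke_pt O l hl h7 hO a hz ha
  rw [(RX_zero l hl (res O a)).2 hs, C_0, sub_zero] at pv
  have hv0 : ∀ i, res O (v i) = 0 := by
    intro i
    have := congrArg (Polynomial.eval (res O (v i))) pv
    rw [eval_prod, Finset.prod_eq_zero (Finset.mem_univ i) (by simp), eval_mul, eval_X, eval_pow, eval_X] at this
    rcases mul_eq_zero.1 this.symm with h | h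
    · exact h
    · exact eq_zero_of_pow_eq_zero h
  have key : ∀ β : M2, D7 l β → Fx β z → ∃ b : O, (b : ℂ) = p2 β z 1 ∧ res O b = 0 := by
    intro β hβ hf
    obtain ⟨i, γ, hγ, e, hr⟩ := hf.idx hF.out h7 hβ hz
    obtain ⟨b, hb⟩ := root_mem O (P := X ^ 12 - C (v i)) (x := p2 β z 1) (monic_X_pow_sub_C _ (by norm_num)) (by
      rw [eval₂_sub, eval₂_X_pow, eval₂_C, ← hr, ← hv i]; exact sub_self _)
    refine ⟨b, hb, ?_⟩
    have : b ^ 12 = v i := Subtype.ext (by push_cast; rw [hb, hv, hr])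
    have := congrArg (res O) this
    rw [hv0, map_pow] at this
    exact eq_zero_of_pow_eq_zero this
  obtain ⟨b, hb, hb0⟩ := key α hα h
  obtain ⟨c, hc, hc0⟩ := key _ (adj_D7l hα) h.adj
  have hbc : b + c = ((α 0 0 + α 1 1 : ℤ) : O) := Subtype.ext (by
    push_cast; rw [hb, hc, adj_p2]; push_cast; ring)
  have h0 := congrArg (res O) hbc
  rw [map_add, hb0, hc0, add_zero, map_intCast] at h0
  have hch := charP_k O hF.out hO
  have hd : (l : ℤ) ∣ α 0 0 + α 1 1 := (CharP.intCast_eq_zero_iff (kO O) l _).1 h0.symm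
  obtain ⟨k, hk⟩ := hd
  have ht := h.tr hF.out hα hz
  rw [hk] at ht ⊢
  by_contra hne
  have hk0 : k ≠ 0 := by rintro rfl; simp at hne
  have : 1 ≤ k ^ 2 := by have := sq_nonneg k; have : k ^ 2 ≠ 0 := pow_ne_zero _ hk0; omega
  have h4 : (4 : ℤ) ≤ l := by exact_mod_cast hl
  have h5 : 4 * (l : ℤ) ≤ l * l := by nlinarith
  have h6 : (l : ℤ) * l * 1 ≤ l * l * k ^ 2 := by gcongr
  nlinarith

lemma ss_of_tr (hl : 3 < l) (h7 : l ≠ 7) (hO : res O (l : O) = 0) (a : O) {z : ℂ} (hz : 0 < z.im) (ha : yy z = a)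
    {α : M2} (hα : D7 l α) (h : Fx α z) (ht : α 0 0 + α 1 1 = 0) : SSv l (res O a) = 0 := by
  obtain ⟨y, u, v, w, -, -, hv, -, huv, -, pu, pv⟩ := hecke_pt O l hl h7 hO a hz ha
  rw [← RX_zero l hl (res O a)]
  generalize (RX l).eval₂ (Int.castRingHom (kO O)) (res O a) = ρ at pu pv
  obtain ⟨i, γ, hγ, e, hr⟩ := h.idx hF.out h7 hα hz
  have e1 := h.eqn hα
  rw [ht] at e1
  have hl0 : (l : ℂ) ≠ 0 := by exact_mod_cast hF.out.ne_zero
  have hvi : v i = (l : O) ^ 6 := Subtype.ext (by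
    rw [hv, hr]; push_cast
    have : p2 α z 1 ^ 2 = - l := by push_cast at e1; linear_combination e1
    rw [show p2 α z 1 ^ 12 = (p2 α z 1 ^ 2) ^ 6 by ring, this]; ring)
  have hui : u i = (l : O) ^ 6 := by
    have h1 := huv i
    rw [hvi] at h1
    have hne : (l : O) ^ 6 ≠ 0 := pow_ne_zero _ (fun h => hl0 (by simpa using congrArg Subtype.val h))
    exact mul_right_cancel₀ hne (by rw [h1]; ring)
  have hui0 : res O (u i) = 0 := by rw [hui, map_pow, hO]; norm_num
  have hvi0 : res O (v i) = 0 := by rw [hvi, map_pow, hO]; norm_num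
  by_contra hρ
  have h1 := congrArg (Polynomial.eval ρ) pv
  rw [eval_prod, eval_mul, eval_sub, eval_X, eval_C, sub_self, zero_mul] at h1
  obtain ⟨j, -, hj⟩ := Finset.prod_eq_zero_iff.1 h1
  rw [eval_sub, eval_X, eval_C, sub_eq_zero] at hj
  have huj0 : res O (u j) = 0 := by
    have h2 := congrArg (res O) (huv j)
    rw [map_mul, map_pow, hO, ← hj] at h2
    rcases mul_eq_zero.1 (h2.trans (by norm_num)) with h | h
    · exact h
    · exact absurd h hρ
  have hij : j ≠ i := by rintro rfl; exact hρ (hj.trans hvi0)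
  rw [← Finset.mul_prod_erase _ _ (Finset.mem_univ i), hui0, C_0, sub_zero] at pu
  have h3 := congrArg (Polynomial.eval 0) (mul_left_cancel₀ X_ne_zero pu)
  rw [eval_prod, Finset.prod_eq_zero (Finset.mem_erase.2 ⟨hij, Finset.mem_univ j⟩) (by simp [huj0])] at h3
  simp [hF.out.ne_zero] at h3
  exact hρ h3

lemma S7_fx {τ : ℍ} (h : τ ∈ S7 l) : ∃ α, D7 l α ∧ Fx α τ ∧ α 0 0 + α 1 1 = 0 := by
  obtain ⟨A, B, C, -, h7, hd, he⟩ := h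
  refine ⟨!![-B, -C; A, B], ⟨?_, by simpa using h7⟩, ?_, by simp⟩
  · rw [Matrix.det_fin_two]; simp; linear_combination hd
  · unfold Fx p1 p2; simp; linear_combination -he

lemma fx_S7 {τ : ℍ} {α : M2} (hα : D7 l α) (h : Fx α τ) (ht : α 0 0 + α 1 1 = 0) : τ ∈ S7 l := by
  have hn := h.ne hF.out hα τ.im_pos
  have hd := hα.1
  rw [Matrix.det_fin_two] at hd
  have h0 : α 0 0 = - α 1 1 := by omega
  unfold Fx p1 p2 at h
  rw [h0] at h hd
  push_cast at h
  rcases lt_or_gt_of_ne hn with hn | hn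
  · refine ⟨-α 1 0, -α 1 1, α 0 1, by omega, by simpa using hα.2, by linear_combination hd, ?_⟩
    push_cast; linear_combination h
  · refine ⟨α 1 0, α 1 1, -α 0 1, hn, hα.2, by linear_combination hd, ?_⟩
    push_cast; linear_combination -h

/-- values at the points of `S7` are integral with supersingular reduction. -/
lemma S7_int (hl : 3 < l) (h7 : l ≠ 7) (hO : res O (l : O) = 0) {τ : ℍ} (h : τ ∈ S7 l) :
    ∃ a : O, (a : ℂ) = yy τ ∧ SSv l (res O a) = 0 := by
  by_cases hx : ∃ a : O, (a : ℂ) = yy τ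
  · obtain ⟨a, ha⟩ := hx
    obtain ⟨α, h1, h2, h3⟩ := S7_fx l h
    exact ⟨a, ha, ss_of_tr O l hl h7 hO a τ.im_pos ha.symm h1 h2 h3⟩
  · exfalso
    obtain ⟨b, hb, hb0⟩ := mem_or_inv O _ hx
    have hch := charP_k O hF.out hO
    have h49 : ∃ c : O, (c : ℂ) = (49 : ℂ)⁻¹ := by
      by_contra hc
      obtain ⟨d, hd, hd0⟩ := mem_or_inv O _ hc
      have : d = ((49 : ℕ) : O) := Subtype.ext (by rw [hd, inv_inv]; push_cast; rfl)
      rw [this, map_natCast, CharP.cast_eq_zero_iff (kO O) l] at hd0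
      have h9 := hF.out.dvd_of_dvd_pow (show l ∣ 7 ^ 2 from hd0)
      exact h7 ((Nat.prime_dvd_prime_iff_eq hF.out (by norm_num)).1 h9)
    obtain ⟨c, hc⟩ := h49
    obtain ⟨A, B, C, hA, ⟨A', rfl⟩, hd, he⟩ := h
    have hτ : (τ : ℂ) ≠ 0 := fun h0 => by have := τ.im_pos; have h1 := congrArg Complex.im h0; simp at h1; exact this.ne' h1
    let σ : ℍ := ⟨-1 / (7 * τ), neg_inv_im τ.im_pos⟩
    have hC : 0 < C := by
      have := hF.out.pos
      by_contra hC
      have : (7 * A') * C ≤ 0 := mul_nonpos_of_nonneg_of_nonpos hA.le (by omega)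
      nlinarith [sq_nonneg B]
    have hσ : σ ∈ S7 l := by
      refine ⟨7 * C, -B, A', by omega, ⟨C, rfl⟩, by linear_combination hd, ?_⟩
      change ((7 * C : ℤ) : ℂ) * (-1 / (7 * τ)) ^ 2 + 2 * ((-B : ℤ) : ℂ) * (-1 / (7 * τ)) + A' = 0
      push_cast at he ⊢
      field_simp
      linear_combination he
    obtain ⟨α, h1, h2, h3⟩ := S7_fx l hσ
    have h4 := ss_of_tr O l hl h7 hO (c * b) σ.im_pos (by
      change yy (-1 / (7 * τ)) = _
      rw [yy_fricke τ.im_pos]; push_cast; rw [hb, hc, one_div, mul_inv]) h1 h2 h3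
    rw [map_mul, hb0, mul_zero] at h4
    let _ : Algebra (ZMod l) (kO O) := (ZMod.castHom dvd_rfl (kO O)).toAlgebra
    exact SSv_zero l h4
end

lemma no_sq {l : ℕ} (hp : l.Prime) (hl : 3 < l) {m : ℤ} (hm : m = 1 ∨ m = 3) {p n : ℤ} (hn : n ≠ 0)
    (h : p ^ 2 = m * l * n ^ 2) : False := by
  have h1 : n ∣ p := (Int.pow_dvd_pow_iff two_ne_zero).1 ⟨m * l, by rw [h]; ring⟩
  obtain ⟨k, rfl⟩ := h1
  have h2 : k ^ 2 = m * l := by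
    have : n ^ 2 ≠ 0 := pow_ne_zero _ hn
    exact mul_left_cancel₀ this (by linear_combination h)
  have hpi := Nat.prime_iff_prime_int.1 hp
  obtain ⟨r, rfl⟩ := hpi.dvd_of_dvd_pow (Dvd.intro_left m h2.symm)
  have hl0 : (l : ℤ) ≠ 0 := hpi.ne_zero
  have h3 : l * r ^ 2 = m := mul_left_cancel₀ hl0 (by linear_combination h2)
  have h4 : (l : ℤ) ≤ m := Int.le_of_dvd (by omega) ⟨_, h3.symm⟩
  omega

/-- the derivative of the Hauptmodul vanishes only where `E₄` or `E₆` does. -/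
lemma dyy_zero {z : ℂ} (hz : 0 < z.im) (h : HasDerivAt yy 0 z) : Qf (qq z) = 0 ∨ Rf (qq z) = 0 := by
  have hq := qq_norm_lt hz
  have hQ := Q_L1.1.hasDeriv hz
  have hD := D_L1.1.hasDeriv hz
  have e1 : 3 * (qq z * deriv Qf (qq z)) = Pf (qq z) * Qf (qq z) - Rf (qq z) := by
    have a1 := ((Rep.const 3).mul Q_L1.1.th)
    have a2 := (Pf_rep.mul Q_L1.1).sub R_L1.1
    have : PowerSeries.C (3 : ℂ) * th (toC Qs) = toC Ps * toC Qs - toC Rs := by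
      have := congrArg toC th_Q
      rw [map_sub, map_mul, map_mul, toC_th] at this
      rw [← this]; congr 1
      exact (map_ofNat _ 3).trans (map_ofNat toC 3).symm
    rw [this] at a1
    exact (a1 _ hq).unique (a2 _ hq)
  have e2 : qq z * deriv Df (qq z) = Pf (qq z) * Df (qq z) := by
    have a1 := D_L1.1.th
    have a2 := Pf_rep.mul D_L1.1
    rw [← toC_th, th_D, map_mul] at a1
    exact (a1 _ hq).unique (a2 _ hq)
  have hA : HasDerivAt (fun w => aP (yy w)) 0 z := by
    have h1 : HasDerivAt (fun y : ℂ => (aX.map (Int.castRingHom ℂ)).eval y) _ (yy z) := Polynomial.hasDerivAt _ _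
    have h2 := h1.comp z h
    rw [mul_zero] at h2
    refine h2.congr_of_eventuallyEq (Eventually.of_forall fun w => ?_)
    simp [aX, aP]
  have hL := (hQ.pow 3).mul h
  have hR := hD.mul hA
  have heq : (fun w => Df (qq w)) * (fun w => aP (yy w)) =ᶠ[𝓝 z] (fun w => Qf (qq w)) ^ 3 * yy := by
    filter_upwards [(isOpen_lt continuous_const Complex.continuous_im).mem_nhds hz] with w hw
    change Df (qq w) * aP (yy w) = Qf (qq w) ^ 3 * yy w
    rw [Q3_val hw, D_val hw]; ring
  have hE := (hL.congr_of_eventuallyEq heq).unique hR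
  have hpi : (2 * π * I : ℂ) ≠ 0 := Complex.two_pi_I_ne_zero
  have hv : Df (qq z) * aP (yy z) = Qf (qq z) ^ 3 * yy z := by rw [Q3_val hz, D_val hz]; ring
  simp only [Pi.pow_apply, mul_zero, add_zero] at hE
  have h0 : (2 * π * I) * (Qf (qq z) ^ 2 * Rf (qq z) * yy z) = 0 := by
    push_cast at hE
    linear_combination -hE + (2 * π * I) * Qf (qq z) ^ 2 * yy z * e1 - (2 * π * I) * aP (yy z) * e2 - (2 * π * I) * Pf (qq z) * hv
  have h1 := (mul_eq_zero.1 h0).resolve_left hpi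
  have h2 := (mul_eq_zero.1 h1).resolve_right (yy_ne hz)
  rcases mul_eq_zero.1 h2 with h3 | h3
  · exact Or.inl (eq_zero_of_pow_eq_zero h3)
  · exact Or.inr h3

lemma inL_c {l : ℕ} (hp : l.Prime) (hl : 3 < l) {τ : ℍ} (hS : τ ∈ S7 l) {c : ℂ} (h : inL τ c)
    (hc : c ^ 2 = -1 ∨ c ^ 2 = c - 1) : False := by
  obtain ⟨A, B, C, hA, -, hd, he⟩ := hS
  obtain ⟨m, n, rfl⟩ := h
  have hd' : (A : ℂ) * C - B ^ 2 = l := by exact_mod_cast hd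
  have hτ := τ.im_pos
  -- linear independence of `1, τ` over the integers
  have li := fun a b c d => lin_indepZ (t := (τ : ℂ)) τ.im_ne_zero (a := a) (b := b) (c := c) (d := d)
  rcases hc with hc | hc
  · obtain ⟨e1, e2⟩ := li (A * m ^ 2 - n ^ 2 * C + A) (2 * A * m * n - 2 * B * n ^ 2) 0 0 (by
      push_cast; linear_combination A * hc - n ^ 2 * he)
    have hn : n ≠ 0 := by
      rintro rfl
      nlinarith [sq_nonneg m]
    have e3 : A * m = B * n := by
      have : (2 * n) * (A * m - B * n) = 0 := by linear_combination e2
      have := (mul_eq_zero.1 this).resolve_left (by omega)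
      omega
    exact no_sq hp hl (Or.inl rfl) hn (p := A) (by
      linear_combination A * e1 - (A * m + B * n) * e3 + n ^ 2 * hd)
  · obtain ⟨e1, e2⟩ := li (A * m ^ 2 - n ^ 2 * C + A - A * m) (2 * A * m * n - 2 * B * n ^ 2 - A * n) 0 0 (by
      push_cast; linear_combination A * hc - n ^ 2 * he)
    have hn : n ≠ 0 := by
      rintro rfl
      have : A * (m ^ 2 - m + 1) = 0 := by linear_combination e1
      have := (mul_eq_zero.1 this).resolve_left (by omega)
      nlinarith [sq_nonneg (2 * m - 1)]
    have e3 : 2 * (A * m - B * n) = A := by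
      have : n * (2 * (A * m - B * n) - A) = 0 := by linear_combination e2
      have := (mul_eq_zero.1 this).resolve_left hn
      omega
    exact no_sq hp hl (Or.inr rfl) (n := 2 * n) (by omega) (p := 3 * A) (by
      linear_combination 12 * A * e1 + 12 * n ^ 2 * hd - 3 * (2 * (A * m) - A + 2 * (B * n)) * e3)

lemma dyy_ne {l : ℕ} (hp : l.Prime) (hl : 3 < l) {τ : ℍ} (hS : τ ∈ S7 l) {d : ℂ} (h : HasDerivAt yy d τ) : d ≠ 0 := by
  rintro rfl
  have Q := (L1.ofMF E₄).2
  have R := (L1.ofMF E₆).2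
  rcases dyy_zero τ.im_pos h with h | h
  · have h : E₄ τ = 0 := by rw [← Q]; exact h
    obtain ⟨c, hc⟩ := IsAlgClosed.exists_root (X ^ 2 - X + 1 : ℂ[X]) (by
      rw [show (X ^ 2 - X + 1 : ℂ[X]) = C 1 * X ^ 2 + C (-1) * X + C 1 by simp; ring, degree_quadratic one_ne_zero]; norm_num)
    have hc : c ^ 2 - c + 1 = 0 := by simpa [IsRoot] using hc
    have hc0 : c ≠ 0 := by rintro rfl; simp at hc
    have := (lat_eq hc0 τ τ (by rw [h]; ring) (by
      have : c ^ 6 = 1 := by linear_combination (c ^ 4 + c ^ 3 - c - 1) * hc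
      rw [this, one_mul]) 1).1 (inL_one _)
    rw [mul_one] at this
    exact inL_c hp hl hS this (Or.inr (by linear_combination hc))
  · have h : E₆ τ = 0 := by rw [← R]; exact h
    have := (lat_eq I_ne_zero τ τ (by rw [I_pow_four, one_mul]) (by rw [h]; ring) 1).1 (inL_one _)
    rw [mul_one] at this
    exact inL_c hp hl hS this (Or.inl I_sq)

lemma fx_uni {l : ℕ} {α β : M2} (hα : D7 l α) (hβ : D7 l β) {z : ℂ} (hz : 0 < z.im) (h : Fx α z) (h' : Fx β z)
    (ht : α 0 0 + α 1 1 = 0) (ht' : β 0 0 + β 1 1 = 0) : β = α ∨ β = -α := by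
  have e1 := h.eqn hα
  have e2 := h'.eqn hβ
  rw [ht] at e1
  rw [ht'] at e2
  have e3 : (p2 β z 1 - p2 α z 1) * (p2 β z 1 + p2 α z 1) = 0 := by push_cast at *; linear_combination e2 - e1
  have key : ∀ s : ℤ, p2 β z 1 = s * p2 α z 1 → β = s • α := by
    intro s hs
    have hs1 : p1 β z 1 = s * p1 α z 1 := by rw [h, h', hs]; ring
    unfold p2 at hs
    unfold p1 at hs1
    obtain ⟨a1, a2⟩ := lin_indepZ (t := z) hz.ne' (a := β 1 1) (b := β 1 0) (c := s * α 1 1) (d := s * α 1 0) (by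
      push_cast; linear_combination hs)
    obtain ⟨a3, a4⟩ := lin_indepZ (t := z) hz.ne' (a := β 0 1) (b := β 0 0) (c := s * α 0 1) (d := s * α 0 0) (by
      push_cast; linear_combination hs1)
    ext i j
    fin_cases i <;> fin_cases j <;> simp [a1, a2, a3, a4]
  rcases mul_eq_zero.1 e3 with e | e
  · left; simpa using key 1 (by push_cast; linear_combination e)
  · right; simpa using key (-1) (by push_cast; linear_combination e)

lemma yN_diff {l : ℕ} (hl : 0 < l) {N : M2} (hN : D7 l N) {z : ℂ} (hz : 0 < z.im) {d : ℂ}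
    (hd : HasDerivAt yy d (p1 N z 1 / p2 N z 1)) : HasDerivAt (yN N) (d * (l / p2 N z 1 ^ 2)) z := by
  have P := pos_act hl hN hz
  have hm : HasDerivAt (fun w : ℂ => p1 N w 1 / p2 N w 1) (l / p2 N z 1 ^ 2) z := by
    have h1 : HasDerivAt (fun w : ℂ => p1 N w 1) (N 0 0 : ℂ) z := by
      simpa [p1] using ((hasDerivAt_id z).const_mul (N 0 0 : ℂ)).add_const (N 0 1 * 1 : ℂ)
    have h2 : HasDerivAt (fun w : ℂ => p2 N w 1) (N 1 0 : ℂ) z := by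
      simpa [p2] using ((hasDerivAt_id z).const_mul (N 1 0 : ℂ)).add_const (N 1 1 * 1 : ℂ)
    refine (h1.div h2 P.ne).congr_deriv ?_
    congr 1
    have hd := hN.1
    rw [Matrix.det_fin_two] at hd
    have hd : (N 0 0 : ℂ) * N 1 1 - N 0 1 * N 1 0 = l := by exact_mod_cast hd
    unfold p1 p2
    linear_combination hd
  refine (HasDerivAt.comp z hd hm).congr_of_eventuallyEq ?_
  filter_upwards [(isOpen_lt continuous_const Complex.continuous_im).mem_nhds hz] with w hw
  exact yh_eq (pos_act hl hN hw).ne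

lemma yy_has {z : ℂ} (hz : 0 < z.im) : HasDerivAt yy (deriv yy z) z :=
  ((yy_holo z hz).differentiableAt ((isOpen_lt continuous_const Complex.continuous_im).mem_nhds hz)).hasDerivAt

section
variable (O : ValuationSubring ℂ) (l : ℕ) [hF : Fact l.Prime]

lemma simple_root (hl : 3 < l) (h7 : l ≠ 7) (hO : res O (l : O) = 0) {Ψ : ℂ[X]}
    (hΨ : ∀ w : ℂ, 0 < w.im → Ψ.eval (yy w) = ∏ i, (yy w - yN (Mi l i) w)) {τ : ℍ} (h : τ ∈ S7 l) :
    Ψ.rootMultiplicity (yy τ) = 1 := by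
  have hp := hF.out
  obtain ⟨a, ha, hs⟩ := S7_int O l hl h7 hO h
  obtain ⟨α, h1, h2, h3⟩ := S7_fx l h
  obtain ⟨i, γ, hγ, e⟩ := hecke_ex l hp h7 h1
  have hz := τ.im_pos
  have hyα : ∀ w : ℂ, 0 < w.im → yN (Mi l i) w = yN α w := fun w hw => by
    rw [e, yN_left hp.pos hγ (Mi_D7 l i) hw]
  have hne : ∀ j, j ≠ i → yy τ - yN (Mi l j) τ ≠ 0 := by
    intro j hj h0
    obtain ⟨γ', hγ', hfx⟩ := fix_of_eq hp.pos (Mi_D7 l j) hz (sub_eq_zero.1 h0).symm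
    have hD : D7 l (γ' * Mi l j) := by simpa using hγ'.mul (Mi_D7 l j)
    have ht := tr_zero O l hl h7 hO a hz ha.symm hs hD hfx
    have hadj : γ.adjugate * α = Mi l i := by
      rw [e, ← mul_assoc, Matrix.adjugate_mul, hγ.1, one_smul, one_mul]
    have hdd : (γ.adjugate * γ').det = 1 := by rw [Matrix.det_mul, hγ'.1, (adj_D7 hγ).1, one_mul]
    rcases fx_uni h1 hD hz h2 hfx h3 ht with h | h
    · exact hj (hecke_uni l hp (γ := γ.adjugate * γ') hdd (by rw [mul_assoc, h, hadj]))
    · refine hj (hecke_uni l hp (γ := -(γ.adjugate * γ')) ?_ (by rw [neg_mul, mul_assoc, h, mul_neg, neg_neg, hadj]))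
      rw [Matrix.det_neg, hdd]; simp
  have P := pos_act hp.pos h1 hz
  have hfix : p1 α τ 1 / p2 α τ 1 = τ := by rw [h2, mul_div_assoc, div_self P.ne, mul_one]
  set d := deriv yy τ with hd
  have hyd : HasDerivAt yy d τ := yy_has hz
  have hd0 := dyy_ne hp hl h hyd
  have hlam : p2 α τ 1 ^ 2 = -l := by
    have := h2.eqn h1
    rw [h3] at this; push_cast at this; linear_combination this
  have hl0 : (l : ℂ) ≠ 0 := by exact_mod_cast hp.ne_zero
  have hyN : HasDerivAt (yN (Mi l i)) (-d) τ := by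
    have h4 := yN_diff hp.pos h1 hz (d := d) (by rw [hfix]; exact hyd)
    rw [hlam, div_neg, div_self hl0, mul_neg, mul_one] at h4
    refine h4.congr_of_eventuallyEq ?_
    filter_upwards [(isOpen_lt continuous_const Complex.continuous_im).mem_nhds hz] with w hw
    exact hyα w hw
  have hval : yy τ - yN (Mi l i) τ = 0 := by
    rw [hyα _ hz, yN, yh_eq P.ne, hfix, sub_self]
  set H : ℂ → ℂ := fun w => ∏ j ∈ Finset.univ.erase i, (yy w - yN (Mi l j) w) with hH
  have hHd : DifferentiableAt ℂ H τ := by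
    rw [hH]
    apply DifferentiableAt.fun_finsetProd
    intro j _
    exact (yy_has hz).differentiableAt.sub
      (yN_diff hp.pos (Mi_D7 l j) hz (yy_has (pos_act hp.pos (Mi_D7 l j) hz).im)).differentiableAt
  have hH0 : H τ ≠ 0 := Finset.prod_ne_zero_iff.2 fun j hj => hne j (Finset.ne_of_mem_erase hj)
  have hG := (hyd.sub hyN).mul hHd.hasDerivAt
  have hG' : HasDerivAt (fun w => Ψ.eval (yy w)) (Ψ.derivative.eval (yy τ) * d) τ := (Ψ.hasDerivAt _).comp _ hyd
  have hG2 := hG.congr_of_eventuallyEq (f₁ := fun w => Ψ.eval (yy w)) (by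
    filter_upwards [(isOpen_lt continuous_const Complex.continuous_im).mem_nhds hz] with w hw
    rw [hΨ w hw, ← Finset.mul_prod_erase _ _ (Finset.mem_univ i)]
    rfl)
  have hE := hG'.unique hG2
  simp only [Pi.sub_apply, hval, zero_mul, add_zero] at hE
  have hder : Ψ.derivative.eval (yy τ) ≠ 0 := by
    intro h0
    rw [h0, zero_mul] at hE
    have : d * H τ * 2 = 0 := by linear_combination -hE
    simp [hd0, hH0] at this
  have hΨ0 : Ψ ≠ 0 := by rintro rfl; simp at hder
  have hroot : Ψ.IsRoot (yy τ) := by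
    rw [IsRoot, hΨ _ hz, ← Finset.mul_prod_erase _ _ (Finset.mem_univ i), hval, zero_mul]
  have g1 := (rootMultiplicity_pos hΨ0).2 hroot
  have g2 : ¬ 1 < Ψ.rootMultiplicity (yy τ) := fun h => hder ((one_lt_rootMultiplicity_iff_isRoot hΨ0).1 h).2
  omega
end

lemma SSv_map {l : ℕ} [Fact l.Prime] (hl : 3 < l) {E : Type*} [Field E] (ι : ZMod l →+* E) (c : ZMod l) :
    SSv l (ι c) = 0 ↔ SSv l c = 0 := by
  rw [← RX_zero l hl, ← RX_zero l hl, ← RingHom.ext_int (ι.comp (Int.castRingHom (ZMod l))) (Int.castRingHom E),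
    ← hom_eval₂, map_eq_zero_iff _ ι.injective]

lemma roots_frob {l : ℕ} [hF : Fact l.Prime] {E : Type*} [Field E] (ι : ZMod l →+* E) :
    (X ^ l - X : E[X]).roots = (Finset.univ : Finset (ZMod l)).val.map ι := by
  have h1 : (X ^ l - X : (ZMod l)[X]).roots = (Finset.univ : Finset (ZMod l)).val := by
    have := FiniteField.roots_X_pow_card_sub_X (ZMod l)
    rwa [ZMod.card] at this
  have h2 : (X ^ l - X : E[X]) = (X ^ l - X : (ZMod l)[X]).map ι := by simp
  rw [h2, ← h1]
  refine (Polynomial.roots_map_of_injective_of_card_eq_natDegree ι.injective ?_).symm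
  rw [h1, FiniteField.X_pow_card_sub_X_natDegree_eq _ hF.out.one_lt]
  simp [ZMod.card]

theorem IIb (l : ℕ) [hF : Fact l.Prime] (hl : 3 < l) (h7 : l ≠ 7) :
    ((fun τ : ℍ => yy τ) '' S7 l).ncard = 2 * {y : ZMod l | SSv l y = 0}.ncard := by
  classical
  have hp := hF.out
  obtain ⟨O, hO⟩ := exists_O l hp
  have hch := charP_k O hp hO
  let ι : ZMod l →+* kO O := ZMod.castHom dvd_rfl (kO O)
  obtain ⟨P, hP, hPr⟩ := fam1 O l h7 hO
  set Ψ : O[X] := P.eval X with hΨd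
  have hΨr : Ψ.map (res O) = - (X ^ l - X) ^ 2 := by
    have := eval₂_at_apply (p := P) (mapRingHom (res O)) X
    rw [← eval_map, hPr, coe_mapRingHom, map_X] at this
    rw [hΨd, ← this]
    simp; ring
  have hΨ : ∀ w : ℂ, 0 < w.im → (Ψ.map O.subtype).eval (yy w) = ∏ i, (yy w - yN (Mi l i) w) := by
    intro w hw
    have := eval₂_at_apply (p := P) (eval₂RingHom O.subtype (yy w)) X
    rw [← eval_map, hP w hw, coe_eval₂RingHom, eval₂_X] at this
    rw [eval_map, hΨd, ← this, eval_prod]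
    simp
  have hfr0 : (X ^ l - X : (kO O)[X]) ≠ 0 := FiniteField.X_pow_card_sub_X_ne_zero _ hp.one_lt
  obtain ⟨S, u, hu, hS1, hS2⟩ := roots_red O Ψ (by rw [hΨr]; exact neg_ne_zero.2 (pow_ne_zero _ hfr0))
  have hroots : S.map (res O) = 2 • ((Finset.univ : Finset (ZMod l)).val.map ι) := by
    have h1 := congrArg Polynomial.roots hS1
    rw [hΨr, roots_neg, roots_pow, roots_frob ι, roots_C_mul _ hu] at h1
    rw [h1]
    have := roots_multiset_prod_X_sub_C (S.map (res O))
    rw [Multiset.map_map] at this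
    exact this.symm
  set p : kO O → Prop := fun x => SSv l x = 0 with hpd
  set S' := S.filter (fun r => p (res O r)) with hS'
  have hcard : Multiset.card S' = 2 * {y : ZMod l | SSv l y = 0}.ncard := by
    have h1 := congrArg (fun s => Multiset.card (s.filter p)) hroots
    simp only [Multiset.filter_map, Multiset.filter_nsmul, Multiset.card_map, Multiset.card_nsmul] at h1
    rw [hS']
    refine h1.trans ?_
    congr 1
    have h2 : {y : ZMod l | SSv l y = 0} = ((Finset.univ.filter (p ∘ ι) : Finset (ZMod l)) : Set (ZMod l)) := by
      ext y
      rw [Finset.mem_coe, Finset.mem_filter]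
      simpa [hpd] using (SSv_map hl ι y).symm
    rw [h2, Set.ncard_coe_finset]
    rfl
  have hmem : ∀ r ∈ S', ∃ τ : ℍ, τ ∈ S7 l ∧ yy τ = r := by
    intro r hr
    obtain ⟨hr1, hr2⟩ := Multiset.mem_filter.1 hr
    have hr2 : SSv l (res O r) = 0 := hr2
    have hr0 : (r : ℂ) ≠ 0 := by
      intro h0
      rw [show r = 0 from Subtype.ext h0, map_zero] at hr2
      let _ : Algebra (ZMod l) (kO O) := ι.toAlgebra
      exact SSv_zero l hr2
    obtain ⟨z, hz, hzr⟩ := yy_surj hr0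
    have hrt : (Ψ.map O.subtype).IsRoot (yy z) := by
      have : 0 < S.count r := Multiset.count_pos.2 hr1
      rw [hS2, ← hzr] at this
      exact (rootMultiplicity_pos'.1 this).2
    rw [IsRoot, hΨ z hz, Finset.prod_eq_zero_iff] at hrt
    obtain ⟨i, -, hi⟩ := hrt
    obtain ⟨γ, hγ, hfx⟩ := fix_of_eq hp.pos (Mi_D7 l i) hz (sub_eq_zero.1 hi).symm
    have hD : D7 l (γ * Mi l i) := by simpa using hγ.mul (Mi_D7 l i)
    have ht := tr_zero O l hl h7 hO r hz hzr hr2 hD hfx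
    exact ⟨⟨z, hz⟩, fx_S7 l (τ := ⟨z, hz⟩) hD hfx ht, hzr⟩
  have hnd : S'.Nodup := by
    rw [Multiset.nodup_iff_count_le_one]
    intro r
    by_cases hr : r ∈ S'
    · obtain ⟨τ, h1, h2⟩ := hmem r hr
      refine (Multiset.count_le_of_le r (Multiset.filter_le _ S)).trans ?_
      have := simple_root O l hl h7 hO hΨ h1
      rw [h2] at this
      exact ((hS2 r).trans this).le
    · rw [Multiset.count_eq_zero_of_notMem hr]; norm_num
  have hset : (fun τ : ℍ => yy τ) '' S7 l = (fun r : O => (r : ℂ)) '' (S'.toFinset : Set O) := by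
    ext x
    constructor
    · rintro ⟨τ, hτ, rfl⟩
      obtain ⟨a, ha, hs⟩ := S7_int O l hl h7 hO hτ
      refine ⟨a, ?_, ha⟩
      rw [Finset.mem_coe, Multiset.mem_toFinset, hS', Multiset.mem_filter]
      refine ⟨?_, hs⟩
      rw [← Multiset.count_pos]
      have := simple_root O l hl h7 hO hΨ hτ
      rw [← ha] at this
      exact ((hS2 a).trans this).symm ▸ Nat.one_pos
    · rintro ⟨r, hr, rfl⟩
      rw [Finset.mem_coe, Multiset.mem_toFinset] at hr
      obtain ⟨τ, h1, h2⟩ := hmem r hr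
      exact ⟨τ, h1, h2⟩
  rw [hset, Set.ncard_image_of_injective _ Subtype.val_injective, Set.ncard_coe_finset, Multiset.toFinset_card_of_nodup hnd, hcard]

theorem final (l : ℕ) [Fact (Nat.Prime l)]
    (hl3 : 3 < l) (hmod7 : l % 7 = 3 ∨ l % 7 = 5)
    (K : Type) [Field K] [NumberField K]
    (hdeg : Module.finrank ℚ K = 2) (α : K) (hα : α ^ 2 = -(l : K)) :
    ({p : Polynomial (ZMod l) | p.Monic ∧ Irreducible p ∧ p.natDegree = 3 ∧
        p ∣ hasseH7 l}.ncard : ℤ) =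
      if l % 4 = 1 then (NumberField.classNumber K : ℤ)
      else (3 - legendreSym l 2) * (NumberField.classNumber K : ℤ) := by
  have hp : l.Prime := Fact.out
  have h7 : l ≠ 7 := by rintro rfl; omega
  have h1 := partI l hl3 hmod7 (fun F _ _ y h => IIa l hl3 h7 F y h)
  have h2 := IIb l hl3 h7
  have h3 := card_S7 l hp hmod7 (fun τ => yy τ) yy_iff
  have h4 := card_Hl l hp hl3 _ (NumberField.classNumber_ne_zero K).bot_lt (card_Hom l hp hl3 K hdeg α hα)
  have h5 : {y : ZMod l | SSv l y = 0}.ncard = hcount l (NumberField.classNumber K) := by omega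
  rw [h1, h5, hcount]
  have hodd : l % 2 = 1 := (hp.eq_two_or_odd).resolve_left (by omega)
  rw [legendreSym.at_two (by omega), ZMod.χ₈_nat_eq_if_mod_eight]
  split_ifs with a b c d e <;> omega
end HK

/-- Theorem A(b): for a prime `l > 3` with `l ≡ 3, 5 (mod 7)`, the number of distinct
monic irreducible cubic polynomials over `𝔽_l` dividing `Ĥ_{7,l}` is `h(-l)` if
`l ≡ 1 (mod 4)` and `(3 - (2|l))·h(-l)` if `l ≡ 3 (mod 4)`, where `h(-l)` is the
class number of `ℚ(√-l)`. -/
theorem hasseH7_cubic_factor_count (l : ℕ) [Fact (Nat.Prime l)]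
    (hl3 : 3 < l) (hmod7 : l % 7 = 3 ∨ l % 7 = 5)
    (K : Type) [Field K] [NumberField K]
    (hdeg : Module.finrank ℚ K = 2) (α : K) (hα : α ^ 2 = -(l : K)) :
    ({p : Polynomial (ZMod l) | p.Monic ∧ Irreducible p ∧ p.natDegree = 3 ∧
        p ∣ hasseH7 l}.ncard : ℤ) =
      if l % 4 = 1 then (NumberField.classNumber K : ℤ)
      else (3 - legendreSym l 2) * (NumberField.classNumber K : ℤ) := by
  exact HK.final l hl3 hmod7 K hdeg α hα
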